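/- There exist real constants c_4(C_8) > 0, c_6(C_8), c_7(C_8) such that #F_ℚ(C_8; X) = c_4(C_8) X^{1/4} + c_6(C_8) X^{1/6} + c_7(C_8) X^{1/7} + O(X^{1/8} (log X)^8) as X → ∞. -/

import Mathlib

open scoped Classical

/-- The absolute value of the discriminant of a finite intermediate field of
`AlgebraicClosure ℚ / ℚ` (junk value `0` if the field is not finite over `ℚ`). -/
noncomputable def absDisc (L : IntermediateField ℚ (AlgebraicClosure ℚ)) : ℕ :=
  if h : FiniteDimensional ℚ L then
    letI := h
    letI : NumberField L := ⟨⟩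
    (NumberField.discr L).natAbs
  else 0

/-- `#F_ℚ(G; X)`: the number of field extensions `L/ℚ` inside a fixed algebraic
closure of `ℚ` that are Galois over `ℚ` with `Gal(L/ℚ) ≅ G` and `|disc(L/ℚ)| ≤ X`. -/
noncomputable def galoisCount (G : Type) [Group G] (X : ℝ) : ℕ :=
  Nat.card {L : IntermediateField ℚ (AlgebraicClosure ℚ) //
    FiniteDimensional ℚ L ∧ IsGalois ℚ L ∧ Nonempty ((L ≃ₐ[ℚ] L) ≃* G) ∧ (absDisc L : ℝ) ≤ X}

section LFunctionMoments

open Finset hiding ext exists_between tsum_subtype pi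
open Real hiding norm_ofNat
open Complex hiding exp log sin cos sqrt exp_add exp_sum exp_zero sin_sub log_mul sin_pi_sub ext cos_sq_add_sin_sq
open MeasureTheory hiding integral_const_mul integral_finsetSum integral_const integral_add integral_sub integral_congr_ae norm_integral_le_integral_norm
open intervalIntegral
open Filter hiding pi prod_le_prod mem_map
open DirichletCharacter (norm_le_one differentiableAt_LFunction LFunction_eq_LSeries LFunctionTrivChar₁)

variable (χ : DirichletCharacter ℂ 8) {s : ℂ} {r κ M N J : ℕ} {σ t x : ℝ} {G : ℂ → ℂ}

/-! ### Exponential sums: Kusmin–Landau and the second derivative test -/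

/-- The additive character `x ↦ exp (2πix)`. -/
noncomputable def expc (x : ℝ) : ℂ := Complex.exp (2 * π * x * I)

lemma norm_expc (x : ℝ) : ‖expc x‖ = 1 := by
  have : (2 * π * x * I : ℂ) = ((2 * π * x : ℝ) : ℂ) * I := by push_cast; ring
  rw [expc, this, norm_exp_ofReal_mul_I]

lemma expc_add (x y : ℝ) : expc (x + y) = expc x * expc y := by
  rw [expc, expc, expc, ← Complex.exp_add]; congr 1; push_cast; ring

lemma expc_int_mul (k : ℤ) (m : ℕ) (x : ℝ) : expc (x - k * m) = expc x := by
  have h : expc (-(k * m : ℝ)) = 1 := by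
    rw [expc, Complex.exp_eq_one_iff]
    exact ⟨-(k * m), by push_cast; ring⟩
  rw [sub_eq_add_neg, expc_add, h, mul_one]

lemma expc_sub_one (x : ℝ) : expc x - 1 = 2 * I * sin (π * x) * expc (x / 2) := by
  have h1 : expc x = (expc (x / 2)) ^ 2 := by rw [sq, ← expc_add]; congr 1; ring
  have h2 : expc (x / 2) = cos (π * x) + sin (π * x) * I := by
    rw [expc, ofReal_cos, ofReal_sin, ← exp_mul_I]
    congr 1; push_cast; ring
  have h3 : (cos (π * x) : ℂ) ^ 2 = 1 - (sin (π * x) : ℂ) ^ 2 := by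
    rw [eq_sub_iff_add_eq]
    exact_mod_cast cos_sq_add_sin_sq (π * x)
  rw [h1, h2]
  have hI : I ^ 2 = -1 := I_sq
  linear_combination h3 - (sin (π * x) : ℂ) ^ 2 * hI

lemma inv_expc_sub_one (hx : sin (π * x) ≠ 0) : (expc x - 1)⁻¹ =
      -1 / 2 - I / 2 * ((cos (π * x) / sin (π * x) : ℝ) : ℂ) := by
  have h2 : expc (x / 2) = cos (π * x) + sin (π * x) * I := by
    rw [expc, ofReal_cos, ofReal_sin, ← exp_mul_I]
    congr 1; push_cast; ring
  have hs : (sin (π * x) : ℂ) ≠ 0 := mod_cast hx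
  have h3 : (cos (π * x) : ℂ) ^ 2 = 1 - (sin (π * x) : ℂ) ^ 2 := by
    rw [eq_sub_iff_add_eq]
    exact_mod_cast cos_sq_add_sin_sq (π * x)
  have hI : I ^ 2 = -1 := I_sq
  apply inv_eq_of_mul_eq_one_left
  rw [expc_sub_one, h2]
  push_cast at *
  field_simp
  linear_combination (-I ^ 2) * h3 - (1 + I * Complex.sin (π * x) * Complex.cos (π * x)) * hI

lemma sin_pi_mul_ge {x l : ℝ} (hl : 0 ≤ l) (h1 : l ≤ x) (h2 : x ≤ 1 - l) : 2 * l ≤ sin (π * x) := by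
  have hpi := pi_pos
  have hx0 : 0 ≤ x := hl.trans h1
  rcases le_total x (1 / 2) with h | h
  · have := mul_le_sin (x := π * x) (by positivity) (by nlinarith)
    have e : 2 / π * (π * x) = 2 * x := by field_simp
    linarith
  · have := mul_le_sin (x := π * (1 - x)) (by nlinarith) (by nlinarith)
    have e : 2 / π * (π * (1 - x)) = 2 * (1 - x) := by field_simp
    have e2 : sin (π * (1 - x)) = sin (π * x) := by rw [mul_sub, mul_one, sin_pi_sub]
    linarith

lemma cot_sub_nonneg {x y : ℝ} (hx : 0 < sin x) (hy : 0 < sin y) (hxy : x ≤ y)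
    (hyx : y - x ≤ π) : cos y / sin y ≤ cos x / sin x := by
  rw [div_le_div_iff₀ hy hx]
  have := sin_nonneg_of_nonneg_of_le_pi (sub_nonneg.2 hxy) hyx
  rw [sin_sub] at this
  linarith

/-- The Kusmin–Landau inequality. -/
lemma kusmin_landau_aux (f : ℕ → ℝ) (a n : ℕ) (l : ℝ) (hl : 0 < l)
    (hanti : ∀ m, a ≤ m → m + 1 ≤ a + n → f (m + 2) - f (m + 1) ≤ f (m + 1) - f m)
    (hlb : ∀ m, a ≤ m → m ≤ a + n → l ≤ f (m + 1) - f m)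
    (hub : ∀ m, a ≤ m → m ≤ a + n → f (m + 1) - f m ≤ 1 - l) :
    ‖∑ m ∈ Ico a (a + n + 1), expc (f m)‖ ≤ 1 / l := by
  set d : ℕ → ℝ := fun m => f (m + 1) - f m with hd
  set c : ℕ → ℝ := fun m => cos (π * d m) / sin (π * d m) with hc
  have hsin : ∀ m, a ≤ m → m ≤ a + n → 2 * l ≤ sin (π * d m) := fun m h1 h2 =>
    sin_pi_mul_ge hl.le (hlb m h1 h2) (hub m h1 h2)
  have hne : ∀ m, a ≤ m → m ≤ a + n → sin (π * d m) ≠ 0 := fun m h1 h2 =>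
    (lt_of_lt_of_le (by linarith) (hsin m h1 h2)).ne'
  have hg : ∀ m, a ≤ m → m ≤ a + n → (expc (d m) - 1)⁻¹ = -1 / 2 - I / 2 * (c m : ℂ) :=
    fun m h1 h2 => inv_expc_sub_one (hne m h1 h2)
  have hgn : ∀ m, a ≤ m → m ≤ a + n → ‖(expc (d m) - 1)⁻¹‖ ≤ 1 / (4 * l) := by
    intro m h1 h2
    rw [norm_inv, expc_sub_one, norm_mul, norm_mul, norm_mul, norm_expc, norm_I, norm_real, one_div]
    apply inv_anti₀ (by linarith)
    have := hsin m h1 h2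
    rw [norm_of_nonneg (by linarith)]
    simp; linarith
  have hmul : ∀ m, a ≤ m → m ≤ a + n →
      expc (f m) = (expc (f (m + 1)) - expc (f m)) * (expc (d m) - 1)⁻¹ := by
    intro m h1 h2
    have e : expc (f (m + 1)) = expc (f m) * expc (d m) := by rw [← expc_add]; congr 1; simp [hd]
    have h0 : expc (d m) - 1 ≠ 0 := by
      rw [expc_sub_one]
      have h3 : expc (d m / 2) ≠ 0 := by rw [← norm_pos_iff, norm_expc]; norm_num
      have h4 : (sin (π * d m) : ℂ) ≠ 0 := mod_cast hne m h1 h2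
      exact mul_ne_zero (mul_ne_zero (mul_ne_zero two_ne_zero I_ne_zero) h4) h3
    rw [e, eq_mul_inv_iff_mul_eq₀ h0]; ring
  have hcmono : ∀ m, a ≤ m → m + 1 ≤ a + n → c m ≤ c (m + 1) := by
    intro m h1 h2
    have p1 := hsin m h1 (by omega)
    have p2 := hsin (m + 1) (by omega) h2
    have q1 := hlb (m + 1) (by omega) h2
    have q2 := hub m h1 (by omega)
    have q3 : d (m + 1) ≤ d m := hanti m h1 h2
    change l ≤ d (m + 1) at q1
    change d m ≤ 1 - l at q2
    have hpi := pi_pos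
    refine cot_sub_nonneg (by linarith) (by linarith) (by nlinarith) (by nlinarith)
  have key : ∀ k, k ≤ n → ‖∑ m ∈ Ico a (a + k + 1), expc (f m) -
      expc (f (a + k + 1)) * (expc (d (a + k)) - 1)⁻¹‖ ≤ 1 / (4 * l) + (c (a + k) - c a) / 2 := by
    intro k
    induction k with
    | zero =>
      intro _
      rw [add_zero, sum_Ico_succ_top le_rfl, Ico_self, sum_empty, zero_add,
        hmul a le_rfl (by omega)]
      have : (expc (f (a + 1)) - expc (f a)) * (expc (d a) - 1)⁻¹ -
          expc (f (a + 1)) * (expc (d a) - 1)⁻¹ = - (expc (f a) * (expc (d a) - 1)⁻¹) := by ring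
      rw [this, norm_neg, norm_mul, norm_expc]
      have := hgn a le_rfl (by omega)
      simpa using this
    | succ k ih =>
      intro hk
      have ih := ih (by omega)
      rw [← add_assoc, sum_Ico_succ_top (by omega), hmul (a + k + 1) (by omega) (by omega)]
      have e : ∑ m ∈ Ico a (a + k + 1), expc (f m) + (expc (f (a + k + 1 + 1)) -
          expc (f (a + k + 1))) * (expc (d (a + k + 1)) - 1)⁻¹ -
          expc (f (a + k + 1 + 1)) * (expc (d (a + k + 1)) - 1)⁻¹ =
          (∑ m ∈ Ico a (a + k + 1), expc (f m) - expc (f (a + k + 1)) * (expc (d (a + k)) - 1)⁻¹) +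
          expc (f (a + k + 1)) * ((expc (d (a + k)) - 1)⁻¹ - (expc (d (a + k + 1)) - 1)⁻¹) := by
        ring
      rw [e]
      refine (norm_add_le _ _).trans ?_
      rw [norm_mul, norm_expc, one_mul, hg (a + k) (by omega) (by omega),
        hg (a + k + 1) (by omega) (by omega)]
      have e2 : (-1 / 2 - I / 2 * (c (a + k) : ℂ)) - (-1 / 2 - I / 2 * (c (a + k + 1) : ℂ)) =
          I * (((c (a + k + 1) - c (a + k)) / 2 : ℝ) : ℂ) := by push_cast; ring
      have hm := hcmono (a + k) (by omega) (by omega)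
      rw [e2, norm_mul, norm_I, one_mul, norm_real, norm_of_nonneg (by linarith)]
      rw [hg (a + k) (by omega) (by omega)] at ih
      linarith
  have hcb : ∀ m, a ≤ m → m ≤ a + n → |c m| / 2 ≤ 1 / (4 * l) := by
    intro m h1 h2
    have hs := hsin m h1 h2
    have : |c m| ≤ 1 / (2 * l) := by
      rw [hc]; simp only
      rw [abs_div, abs_of_pos (show (0:ℝ) < sin (π * d m) by linarith)]
      exact div_le_div₀ zero_le_one (abs_cos_le_one _) (by linarith) hs
    calc |c m| / 2 ≤ (1 / (2 * l)) / 2 := by linarith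
      _ = 1 / (4 * l) := by field_simp; norm_num
  have k1 := key n le_rfl
  have k2 := hgn (a + n) (by omega) le_rfl
  have k3 := hcb a le_rfl (by omega)
  have k4 := hcb (a + n) (by omega) le_rfl
  have k5 : ‖∑ m ∈ Ico a (a + n + 1), expc (f m)‖ ≤ ‖∑ m ∈ Ico a (a + n + 1), expc (f m) -
      expc (f (a + n + 1)) * (expc (d (a + n)) - 1)⁻¹‖ + 1 / (4 * l) := by
    refine (norm_le_norm_sub_add _ (expc (f (a + n + 1)) * (expc (d (a + n)) - 1)⁻¹)).trans ?_
    gcongr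
    rw [norm_mul, norm_expc, one_mul]; exact k2
  have e4 : 1 / l = 1 / (4 * l) + 1 / (4 * l) + 1 / (4 * l) + 1 / (4 * l) := by field_simp; norm_num
  have := neg_abs_le (c a)
  have := le_abs_self (c (a + n))
  linarith

lemma kusmin_landau (f : ℕ → ℝ) (a b : ℕ) (k : ℤ) (l : ℝ) (hl : 0 < l)
    (hanti : ∀ m, a ≤ m → m + 1 < b → f (m + 2) - f (m + 1) ≤ f (m + 1) - f m)
    (hlb : ∀ m, a ≤ m → m < b → k + l ≤ f (m + 1) - f m)
    (hub : ∀ m, a ≤ m → m < b → f (m + 1) - f m ≤ k + 1 - l) :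
    ‖∑ m ∈ Ico a b, expc (f m)‖ ≤ 1 / l := by
  rcases le_or_gt b a with h | h
  · rw [Ico_eq_empty_of_le h]; simp; positivity
  obtain ⟨n, rfl⟩ : ∃ n, b = a + n + 1 := ⟨b - a - 1, by omega⟩
  have := kusmin_landau_aux (fun m => f m - k * m) a n l hl
    (fun m h1 h2 => by have := hanti m h1 (by omega); push_cast; linarith)
    (fun m h1 h2 => by have := hlb m h1 (by omega); push_cast; linarith)
    (fun m h1 h2 => by have := hub m h1 (by omega); push_cast; linarith)
  simpa only [expc_int_mul] using this

lemma exists_eq_Ico_of_ordConnected (s : Finset ℕ)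
    (h : ∀ x ∈ s, ∀ z ∈ s, ∀ y, x ≤ y → y ≤ z → y ∈ s) : ∃ a b, s = Ico a b := by
  rcases s.eq_empty_or_nonempty with rfl | hne
  · exact ⟨0, 0, by simp⟩
  refine ⟨s.min' hne, s.max' hne + 1, ?_⟩
  ext y
  rw [mem_Ico, Nat.lt_succ_iff]
  exact ⟨fun hy => ⟨s.min'_le y hy, s.le_max' y hy⟩,
    fun hy => h _ (s.min'_mem hne) _ (s.max'_mem hne) y hy.1 hy.2⟩

section secondDerivative

variable {f : ℕ → ℝ} {a b : ℕ} {μ : ℝ}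

lemma mul_le_of_second_diff
    (hdec : ∀ m, a ≤ m → m + 1 < b → μ ≤ (f (m + 1) - f m) - (f (m + 2) - f (m + 1)))
    {x y : ℕ} (hx : a ≤ x) (hxy : x ≤ y) (hy : y < b) :
    (y - x) * μ ≤ (f (x + 1) - f x) - (f (y + 1) - f y) := by
  induction y, hxy using Nat.le_induction with
  | base => simp
  | succ y hxy ih =>
    have h1 := ih (by omega)
    have h2 := hdec y (by omega) hy
    push_cast
    linarith

lemma norm_sum_expc_near_le (hμ : 0 < μ)
    (hdec : ∀ m, a ≤ m → m + 1 < b → μ ≤ (f (m + 1) - f m) - (f (m + 2) - f (m + 1)))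
    (s : Finset ℕ) (hs : s ⊆ Ico a b) (u l : ℝ) (hl : 0 ≤ l)
    (hsu : ∀ m ∈ s, u ≤ f (m + 1) - f m ∧ f (m + 1) - f m ≤ u + l) :
    ‖∑ m ∈ s, expc (f m)‖ ≤ l / μ + 1 := by
  have h1 : ‖∑ m ∈ s, expc (f m)‖ ≤ s.card := by
    refine (norm_sum_le _ _).trans ?_
    simp [norm_expc]
  refine h1.trans ?_
  rcases s.eq_empty_or_nonempty with rfl | hne
  · simp; positivity
  have hmin := s.min'_mem hne
  have hmax := s.max'_mem hne
  have hle : s.min' hne ≤ s.max' hne := s.min'_le _ hmax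
  have hsub : s ⊆ Icc (s.min' hne) (s.max' hne) := fun y hy =>
    mem_Icc.2 ⟨s.min'_le y hy, s.le_max' y hy⟩
  have hcard := card_le_card hsub
  rw [Nat.card_Icc] at hcard
  have h2 := mul_le_of_second_diff hdec (mem_Ico.1 (hs hmin)).1 hle (mem_Ico.1 (hs hmax)).2
  have h3 := hsu _ hmin
  have h4 := hsu _ hmax
  have h5 : ((s.max' hne : ℝ) - s.min' hne) ≤ l / μ := by rw [le_div_iff₀ hμ]; linarith
  have h6 : (s.card : ℝ) ≤ s.max' hne + 1 - s.min' hne := by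
    have : s.card + s.min' hne ≤ s.max' hne + 1 := by omega
    have : (s.card : ℝ) + s.min' hne ≤ s.max' hne + 1 := mod_cast this
    linarith
  linarith

lemma antitone_diff (hμ : 0 < μ)
    (hdec : ∀ m, a ≤ m → m + 1 < b → μ ≤ (f (m + 1) - f m) - (f (m + 2) - f (m + 1)))
    {x y : ℕ} (hx : a ≤ x) (hxy : x ≤ y) (hy : y < b) :
    f (y + 1) - f y ≤ f (x + 1) - f x := by
  have := mul_le_of_second_diff hdec hx hxy hy
  have h2 : (0:ℝ) ≤ (y - x) * μ := mul_nonneg (sub_nonneg.2 (mod_cast hxy)) hμ.le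
  linarith

lemma norm_sum_expc_fibre_le (hμ : 0 < μ) (hμ1 : μ ≤ 1)
    (hdec : ∀ m, a ≤ m → m + 1 < b → μ ≤ (f (m + 1) - f m) - (f (m + 2) - f (m + 1))) (k : ℤ) :
    ‖∑ m ∈ (Ico a b).filter (fun m => ⌊f (m + 1) - f m⌋ = k), expc (f m)‖ ≤ 5 / √μ := by
  set l : ℝ := √μ / 2 with hl
  have hsq : 0 < √μ := sqrt_pos.2 hμ
  have hsq1 : √μ ≤ 1 := sqrt_le_one.2 hμ1
  have hss : √μ * √μ = μ := mul_self_sqrt hμ.le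
  have hlpos : 0 < l := by positivity
  set s := (Ico a b).filter (fun m => ⌊f (m + 1) - f m⌋ = k) with hs
  have hfl : ∀ m ∈ s, (k : ℝ) ≤ f (m + 1) - f m ∧ f (m + 1) - f m < k + 1 := fun m hm =>
    Int.floor_eq_iff.1 (mem_filter.1 hm).2
  have hsub : s ⊆ Ico a b := filter_subset _ _
  rw [← sum_filter_add_sum_filter_not s (fun m => f (m + 1) - f m < k + l),
    ← sum_filter_add_sum_filter_not (s.filter fun m => ¬ (f (m + 1) - f m < k + l))
      (fun m => f (m + 1) - f m ≤ k + 1 - l)]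
  have h1 := norm_sum_expc_near_le hμ hdec (s.filter (fun m => f (m + 1) - f m < k + l))
    ((filter_subset _ _).trans hsub) k l hlpos.le (fun m hm => by
      have h := mem_filter.1 hm
      exact ⟨(hfl m h.1).1, h.2.le⟩)
  have h2 := norm_sum_expc_near_le hμ hdec ((s.filter fun m => ¬ (f (m + 1) - f m < k + l)).filter
    (fun m => ¬ (f (m + 1) - f m ≤ k + 1 - l)))
    ((filter_subset _ _).trans ((filter_subset _ _).trans hsub)) (k + 1 - l) l hlpos.le
    (fun m hm => by
      have h := mem_filter.1 hm
      have h' := mem_filter.1 h.1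
      exact ⟨(not_le.1 h.2).le, by have := (hfl m h'.1).2; linarith⟩)
  have h3 : ‖∑ m ∈ (s.filter fun m => ¬ (f (m + 1) - f m < k + l)).filter
      (fun m => f (m + 1) - f m ≤ k + 1 - l), expc (f m)‖ ≤ 1 / l := by
    set S := (s.filter fun m => ¬ (f (m + 1) - f m < k + l)).filter
      (fun m => f (m + 1) - f m ≤ k + 1 - l) with hS
    have hmem : ∀ m, m ∈ S ↔ (a ≤ m ∧ m < b) ∧ k + l ≤ f (m + 1) - f m ∧
        f (m + 1) - f m ≤ k + 1 - l := by
      intro m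
      simp only [hS, hs, mem_filter, mem_Ico, not_lt, Int.floor_eq_iff]
      constructor
      · rintro ⟨⟨⟨h1, h2⟩, h3⟩, h4⟩; exact ⟨h1, h3, h4⟩
      · rintro ⟨h1, h3, h4⟩; exact ⟨⟨⟨h1, by linarith, by linarith⟩, h3⟩, h4⟩
    obtain ⟨a', b', hab⟩ := exists_eq_Ico_of_ordConnected S (by
      intro x hx z hz y hxy hyz
      rw [hmem] at hx hz ⊢
      have u1 := antitone_diff hμ hdec hx.1.1 hxy (by omega)
      have u2 := antitone_diff hμ hdec (hx.1.1.trans hxy) hyz hz.1.2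
      exact ⟨⟨by omega, by omega⟩, by linarith [hz.2.1], by linarith [hx.2.2]⟩)
    rw [hab]
    have hm' : ∀ m, a' ≤ m → m < b' → _ := fun m h1 h2 => (hmem m).1 (hab ▸ mem_Ico.2 ⟨h1, h2⟩)
    refine kusmin_landau f a' b' k l hlpos ?_ (fun m h1 h2 => (hm' m h1 h2).2.1)
      (fun m h1 h2 => (hm' m h1 h2).2.2)
    intro m h1 h2
    have v1 := (hm' m h1 (by omega)).1
    have v2 := (hm' (m + 1) (by omega) h2).1
    have := hdec m v1.1 v2.2
    linarith
  refine (norm_add_le _ _).trans ?_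
  refine (add_le_add h1 ((norm_add_le _ _).trans (add_le_add h3 h2))).trans ?_
  have e1 : l / μ = 1 / (2 * √μ) := by
    rw [hl, div_div, div_eq_div_iff (by positivity) (by positivity)]
    linear_combination 2 * hss
  have e2 : 1 / l = 2 / √μ := by rw [hl]; field_simp
  have e3 : 1 / (2 * √μ) = (1 / √μ) / 2 := by field_simp
  have e4 : 1 ≤ 1 / √μ := by rw [le_div_iff₀ hsq]; linarith
  have e5 : 2 / √μ = 2 * (1 / √μ) := by ring
  have e6 : 5 / √μ = 5 * (1 / √μ) := by ring
  rw [e1, e2, e3, e5, e6]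
  linarith

/-- Van der Corput's second derivative test. -/
lemma norm_sum_expc_le_of_second_diff (hμ : 0 < μ) (hμ1 : μ ≤ 1)
    (hdec : ∀ m, a ≤ m → m + 1 < b → μ ≤ (f (m + 1) - f m) - (f (m + 2) - f (m + 1)))
    {D : ℝ} (h0 : ∀ m, a ≤ m → m < b → 0 ≤ f (m + 1) - f m)
    (hD : ∀ m, a ≤ m → m < b → f (m + 1) - f m ≤ D) (hD0 : 0 ≤ D) :
    ‖∑ m ∈ Ico a b, expc (f m)‖ ≤ 5 * (D + 1) / √μ := by
  have hmaps : ∀ m ∈ Ico a b, ⌊f (m + 1) - f m⌋ ∈ Icc 0 ⌊D⌋ := by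
    intro m hm
    rw [mem_Ico] at hm
    rw [mem_Icc]
    exact ⟨Int.floor_nonneg.2 (h0 m hm.1 hm.2), Int.floor_le_floor (hD m hm.1 hm.2)⟩
  rw [← sum_fiberwise_of_maps_to hmaps]
  refine (norm_sum_le _ _).trans ?_
  refine (sum_le_card_nsmul _ _ (5 / √μ) (fun k _ => norm_sum_expc_fibre_le hμ hμ1 hdec k)).trans ?_
  rw [nsmul_eq_mul, mul_comm 5, mul_div_assoc]
  gcongr
  rw [Int.card_Icc]
  have h1 : 0 ≤ ⌊D⌋ := Int.floor_nonneg.2 hD0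
  have : ((⌊D⌋ + 1 - 0).toNat : ℝ) = ((⌊D⌋ : ℤ) : ℝ) + 1 := by
    have h2 : ((⌊D⌋ + 1 - 0).toNat : ℤ) = ⌊D⌋ + 1 := by rw [Int.toNat_of_nonneg (by omega)]; ring
    exact_mod_cast h2
  rw [this]
  linarith [Int.floor_le D]

end secondDerivative

/-! ### Exponential sums over residue classes and twisted by characters -/

lemma natCast_cpow_mul_I {n : ℕ} (hn : n ≠ 0) (t : ℝ) :
    (n : ℂ) ^ (t * I) = expc (t / (2 * π) * log n) := by
  have hn' : (n : ℂ) ≠ 0 := mod_cast hn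
  rw [cpow_def_of_ne_zero hn', expc, ← natCast_log]
  congr 1
  have : (π : ℂ) ≠ 0 := mod_cast pi_ne_zero
  push_cast
  field_simp

/-- The phase function along an arithmetic progression modulo `8`. -/
noncomputable def apPhase (t : ℝ) (r m : ℕ) : ℝ := t / (2 * π) * log ((8 * m + r : ℕ) : ℝ)

section apPhase

variable {t : ℝ} {r m : ℕ}

lemma apPhase_succ_sub (hm : 0 < 8 * m + r) : apPhase t r (m + 1) - apPhase t r m =
      t / (2 * π) * log (1 + 8 / ((8 * m + r : ℕ) : ℝ)) := by
  have hx : (0:ℝ) < ((8 * m + r : ℕ) : ℝ) := mod_cast hm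
  rw [apPhase, apPhase, ← mul_sub, ← log_div _ hx.ne']
  · congr 2
    push_cast at *
    field_simp
    ring
  · have : 8 * (m + 1) + r ≠ 0 := by omega
    exact_mod_cast this

lemma apPhase_succ_sub_le (ht : 0 < t) (hN : 0 < N) (hm : N ≤ 8 * m + r) :
    apPhase t r (m + 1) - apPhase t r m ≤ 2 * t / N := by
  have hN' : (0:ℝ) < N := mod_cast hN
  have hx : (N:ℝ) ≤ ((8 * m + r : ℕ) : ℝ) := mod_cast hm
  rw [apPhase_succ_sub (by omega)]
  have hpi := pi_gt_three
  have h1 : log (1 + 8 / ((8 * m + r : ℕ) : ℝ)) ≤ 8 / N := by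
    have := log_le_sub_one_of_pos (x := 1 + 8 / ((8 * m + r : ℕ) : ℝ)) (by positivity)
    have h2 : 8 / ((8 * m + r : ℕ) : ℝ) ≤ 8 / N := by gcongr
    linarith
  have h0 : 0 ≤ log (1 + 8 / ((8 * m + r : ℕ) : ℝ)) := log_nonneg (by
    have : (0:ℝ) ≤ 8 / ((8 * m + r : ℕ) : ℝ) := by positivity
    linarith)
  calc t / (2 * π) * log (1 + 8 / ((8 * m + r : ℕ) : ℝ))
      ≤ t / (2 * 2) * (8 / N) := by gcongr; linarith
    _ = 2 * t / N := by ring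

lemma le_apPhase_succ_sub (ht : 0 < t) (hN : 4 ≤ N) (hm0 : 0 < 8 * m + r) (hm : 8 * m + r < 2 * N) :
    t / (4 * N) ≤ apPhase t r (m + 1) - apPhase t r m := by
  have hN' : (4:ℝ) ≤ N := mod_cast hN
  have hx : ((8 * m + r : ℕ) : ℝ) ≤ 2 * N := mod_cast hm.le
  have hx0 : (0:ℝ) < ((8 * m + r : ℕ) : ℝ) := mod_cast hm0
  rw [apPhase_succ_sub hm0]
  set x := ((8 * m + r : ℕ) : ℝ)
  have hpi := pi_lt_four
  have hpi0 := pi_pos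
  have h1 : 2 / N ≤ log (1 + 8 / x) := by
    have := one_sub_inv_le_log_of_pos (x := 1 + 8 / x) (by positivity)
    refine le_trans ?_ this
    have e : 1 - (1 + 8 / x)⁻¹ = 8 / (x + 8) := by field_simp; ring
    rw [e, div_le_div_iff₀ (by linarith) (by positivity)]
    linarith
  calc t / (4 * N) = t / (2 * 4) * (2 / N) := by ring
    _ ≤ t / (2 * π) * log (1 + 8 / x) := by gcongr

lemma le_apPhase_second_diff (ht : 0 < t) (hN : 0 < N) (hm0 : 0 < 8 * m + r)
    (hm : 8 * (m + 1) + r < 2 * N) :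
    2 * t / N ^ 2 ≤ (apPhase t r (m + 1) - apPhase t r m) -
      (apPhase t r (m + 2) - apPhase t r (m + 1)) := by
  have hN' : (0:ℝ) < N := mod_cast hN
  rw [apPhase_succ_sub hm0, apPhase_succ_sub (m := m + 1) (by omega)]
  have hx0 : (0:ℝ) < ((8 * m + r : ℕ) : ℝ) := mod_cast hm0
  have e : ((8 * (m + 1) + r : ℕ) : ℝ) = ((8 * m + r : ℕ) : ℝ) + 8 := by push_cast; ring
  have hx : ((8 * (m + 1) + r : ℕ) : ℝ) ≤ 2 * N := mod_cast hm.le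
  rw [e] at hx ⊢
  set x := ((8 * m + r : ℕ) : ℝ)
  have hpi := pi_lt_four
  have hpi0 := pi_pos
  rw [← mul_sub, ← log_div (by positivity) (by positivity)]
  have h1 : 16 / (N:ℝ) ^ 2 ≤ log ((1 + 8 / x) / (1 + 8 / (x + 8))) := by
    have := one_sub_inv_le_log_of_pos (x := (1 + 8 / x) / (1 + 8 / (x + 8))) (by positivity)
    refine le_trans ?_ this
    have e : 1 - ((1 + 8 / x) / (1 + 8 / (x + 8)))⁻¹ = 64 / (x + 8) ^ 2 := by field_simp; ring
    rw [e, div_le_div_iff₀ (by positivity) (by positivity)]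
    nlinarith
  calc 2 * t / (N:ℝ) ^ 2 = t / (2 * 4) * (16 / N ^ 2) := by ring
    _ ≤ t / (2 * π) * log ((1 + 8 / x) / (1 + 8 / (x + 8))) := by gcongr

end apPhase

lemma filter_mod_eq_image (a b r : ℕ) (hr : r < 8) : (Ico a b).filter (fun n => n % 8 = r) =
      (Ico ((a + 7 - r) / 8) ((b + 7 - r) / 8)).image (fun m => 8 * m + r) := by
  ext n
  simp only [mem_filter, mem_Ico, mem_image]
  constructor
  · rintro ⟨⟨h1, h2⟩, h3⟩
    exact ⟨n / 8, by omega, by omega⟩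
  · rintro ⟨m, ⟨h1, h2⟩, rfl⟩
    omega

lemma sum_ap_eq {a : ℕ} (b r : ℕ) (t : ℝ) (ha : 0 < a) (hr : r < 8) :
    ∑ n ∈ (Ico a b).filter (fun n => n % 8 = r), (n : ℂ) ^ (t * I) =
      ∑ m ∈ Ico ((a + 7 - r) / 8) ((b + 7 - r) / 8), expc (apPhase t r m) := by
  rw [filter_mod_eq_image a b r hr, sum_image (fun x _ y _ h => by simpa using h)]
  refine sum_congr rfl fun m hm => ?_
  rw [mem_Ico] at hm
  rw [natCast_cpow_mul_I (by omega), apPhase]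

lemma norm_sum_ap_le_of_pos {N a b r : ℕ} (hN : 0 < N) (ha : N ≤ a) (hb : b ≤ 2 * N) (hr : r < 8) (ht : 0 < t) :
    ‖∑ n ∈ (Ico a b).filter (fun n => n % 8 = r), (n : ℂ) ^ (t * I)‖ ≤ 8 * (√t + N / √t) := by
  have hN' : (0:ℝ) < N := mod_cast hN
  have hst : 0 < √t := sqrt_pos.2 ht
  have hss : √t * √t = t := mul_self_sqrt ht.le
  rcases le_or_gt (2 * t / (N:ℝ) ^ 2) 1 with h1 | h1
  · rw [sum_ap_eq b r t (by omega) hr]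
    have h2 := norm_sum_expc_le_of_second_diff (f := apPhase t r) (a := (a + 7 - r) / 8)
      (b := (b + 7 - r) / 8) (μ := 2 * t / (N:ℝ) ^ 2) (by positivity) h1
      (fun m h1 h2 => le_apPhase_second_diff ht hN (by omega) (by omega)) (D := 2 * t / N)
      (fun m h1 h2 => by
        rw [apPhase_succ_sub (by omega)]
        have : 0 ≤ log (1 + 8 / ((8 * m + r : ℕ) : ℝ)) := log_nonneg (by
          have : (0:ℝ) ≤ 8 / ((8 * m + r : ℕ) : ℝ) := by positivity
          linarith)
        have := pi_pos
        positivity)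
      (fun m h1 h2 => apPhase_succ_sub_le ht hN (by omega)) (by positivity)
    refine h2.trans ?_
    have e : √(2 * t / (N:ℝ) ^ 2) = √2 * √t / N := by
      rw [sqrt_div (by positivity), sqrt_mul (by norm_num), sqrt_sq hN'.le]
    have hs2 : (5:ℝ) / 4 ≤ √2 := le_sqrt_of_sq_le (by norm_num)
    rw [e, div_le_iff₀ (by positivity)]
    have e2 : 8 * (√t + N / √t) * (√2 * √t / N) = √2 * (8 * (t / N + 1)) := by
      field_simp
      linear_combination hss
    rw [e2]
    have e3 : 2 * t / N = 2 * (t / N) := by ring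
    rw [e3]
    have : 0 ≤ t / N := by positivity
    nlinarith
  · have h2 : (N:ℝ) ≤ 2 * √t := by
      rw [lt_div_iff₀ (by positivity)] at h1
      by_contra h
      push Not at h
      nlinarith
    refine (norm_sum_le _ _).trans ?_
    have h3 : ∀ n ∈ (Ico a b).filter (fun n => n % 8 = r), ‖(n : ℂ) ^ (t * I)‖ ≤ 1 := by
      intro n hn
      have := mem_Ico.1 (mem_filter.1 hn).1
      rw [natCast_cpow_mul_I (by omega), norm_expc]
    refine (sum_le_card_nsmul _ _ 1 h3).trans ?_
    rw [nsmul_eq_mul, mul_one]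
    have h4 : ((Ico a b).filter (fun n => n % 8 = r)).card ≤ N := by
      refine (card_filter_le _ _).trans ?_
      rw [Nat.card_Ico]; omega
    have h5 : ((((Ico a b).filter (fun n => n % 8 = r)).card : ℕ) : ℝ) ≤ N := by exact_mod_cast h4
    have : 0 ≤ (N:ℝ) / √t := by positivity
    linarith

lemma norm_sum_ap_le_of_pos' {N a b r : ℕ} (hN : 4 ≤ N) (ha : N ≤ a) (hb : b ≤ 2 * N) (hr : r < 8) (ht : 0 < t) (hNt : 4 * t ≤ N) :
    ‖∑ n ∈ (Ico a b).filter (fun n => n % 8 = r), (n : ℂ) ^ (t * I)‖ ≤ 4 * N / t := by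
  have hN' : (4:ℝ) ≤ N := mod_cast hN
  rw [sum_ap_eq b r t (by omega) hr]
  have h := kusmin_landau (apPhase t r) ((a + 7 - r) / 8) ((b + 7 - r) / 8) 0 (t / (4 * N))
    (by positivity)
    (fun m h1 h2 => by
      have := le_apPhase_second_diff (m := m) (r := r) ht (show 0 < N by omega) (by omega) (by omega)
      have h3 : 0 ≤ 2 * t / (N:ℝ) ^ 2 := by positivity
      linarith)
    (fun m h1 h2 => by
      have := le_apPhase_succ_sub (m := m) (r := r) ht hN (by omega) (by omega)
      simpa using this)
    (fun m h1 h2 => by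
      have := apPhase_succ_sub_le (m := m) (r := r) ht (show 0 < N by omega) (by omega)
      have h3 : 2 * t / (N:ℝ) ≤ 1 / 2 := by rw [div_le_iff₀ (by linarith)]; linarith
      have h4 : t / (4 * N) ≤ 1 / 16 := by rw [div_le_iff₀ (by linarith)]; linarith
      simp only [Int.cast_zero]
      linarith)
  rwa [one_div_div] at h

lemma norm_sum_ap_neg (s : Finset ℕ) (t : ℝ) :
    ‖∑ n ∈ s, (n : ℂ) ^ (((-t : ℝ) : ℂ) * I)‖ = ‖∑ n ∈ s, (n : ℂ) ^ (t * I)‖ := by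
  rw [← norm_conj, map_sum]
  congr 1
  refine sum_congr rfl fun n _ => ?_
  have h := cpow_conj (n : ℂ) (((-t : ℝ) : ℂ) * I) (by rw [natCast_arg]; exact pi_pos.ne)
  rw [conj_natCast] at h
  rw [← h]
  simp

lemma norm_sum_char_le_of_ap (a b : ℕ) (t : ℝ) {B : ℝ}
    (h : ∀ r < 8, ‖∑ n ∈ (Ico a b).filter (fun n => n % 8 = r), (n : ℂ) ^ (|t| * I)‖ ≤ B) :
    ‖∑ n ∈ Ico a b, χ n * (n : ℂ) ^ (t * I)‖ ≤ 8 * B := by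
  rw [← sum_fiberwise_of_maps_to (t := range 8) (g := fun n => n % 8)
    (fun n _ => mem_range.2 (Nat.mod_lt _ (by norm_num)))]
  refine (norm_sum_le _ _).trans ?_
  refine (sum_le_card_nsmul _ _ B fun r hr => ?_).trans (by simp)
  have e : ∑ n ∈ (Ico a b).filter (fun n => n % 8 = r), χ n * (n : ℂ) ^ (t * I) =
      χ (r : ZMod 8) * ∑ n ∈ (Ico a b).filter (fun n => n % 8 = r), (n : ℂ) ^ (t * I) := by
    rw [mul_sum]
    refine sum_congr rfl fun n hn => ?_
    have h1 : ((n : ZMod 8)) = (r : ZMod 8) := by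
      rw [ZMod.natCast_eq_natCast_iff']
      have := (mem_filter.1 hn).2
      rw [this]; have := mem_range.1 hr; omega
    rw [h1]
  rw [e, norm_mul]
  refine (mul_le_of_le_one_left (norm_nonneg _) (norm_le_one χ _)).trans ?_
  have h2 := h r (mem_range.1 hr)
  rcases abs_choice t with ht | ht <;> rw [ht] at h2
  · exact h2
  · rwa [norm_sum_ap_neg] at h2

/-- Partial summation against a decreasing weight. -/
lemma norm_sum_mul_antitone_le (g : ℕ → ℝ) (u : ℕ → ℂ) (a b : ℕ) (B : ℝ)
    (hg : ∀ n, a ≤ n → n < b → g (n + 1) ≤ g n) (hg0 : 0 ≤ g b)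
    (hu : ∀ c, a ≤ c → c ≤ b → ‖∑ n ∈ Ico a c, u n‖ ≤ B) (hab : a ≤ b) :
    ‖∑ n ∈ Ico a b, (g n : ℂ) * u n‖ ≤ g a * B := by
  have key : ∀ c, a ≤ c → c ≤ b → ‖∑ n ∈ Ico a c, (g n : ℂ) * u n -
      g c * ∑ n ∈ Ico a c, u n‖ ≤ (g a - g c) * B := by
    intro c hc
    induction c, hc using Nat.le_induction with
    | base => simp
    | succ c hc ih =>
      intro hcb
      have ih := ih (by omega)
      have hgc := hg c hc (by omega)
      have e : ∑ n ∈ Ico a (c + 1), (g n : ℂ) * u n - g (c + 1) * ∑ n ∈ Ico a (c + 1), u n =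
          (∑ n ∈ Ico a c, (g n : ℂ) * u n - g c * ∑ n ∈ Ico a c, u n) +
          ((g c - g (c + 1) : ℝ) : ℂ) * ∑ n ∈ Ico a (c + 1), u n := by
        rw [sum_Ico_succ_top hc, sum_Ico_succ_top hc]; push_cast; ring
      rw [e]
      refine (norm_add_le _ _).trans ?_
      rw [norm_mul, norm_real, norm_of_nonneg (by linarith)]
      have := mul_le_mul_of_nonneg_left (hu (c + 1) (by omega) hcb)
        (show 0 ≤ g c - g (c + 1) by linarith)
      linarith
  have h1 := key b hab le_rfl
  have h2 := hu b hab le_rfl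
  refine (norm_le_norm_sub_add _ ((g b : ℂ) * ∑ n ∈ Ico a b, u n)).trans ?_
  rw [norm_mul, norm_real, norm_of_nonneg hg0]
  have := mul_le_mul_of_nonneg_left h2 hg0
  linarith

lemma char_mul_cpow_eq {n : ℕ} (hn : n ≠ 0) (s : ℂ) : χ n * (n : ℂ) ^ (-s) =
      (((n : ℝ) ^ (-s.re) : ℝ) : ℂ) * (χ n * (n : ℂ) ^ (((-s.im : ℝ) : ℂ) * I)) := by
  have hn' : (n : ℂ) ≠ 0 := mod_cast hn
  have e : -s = ((-s.re : ℝ) : ℂ) + ((-s.im : ℝ) : ℂ) * I := by apply Complex.ext <;> simp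
  rw [ofReal_cpow (by positivity), e, cpow_add _ _ hn']
  push_cast
  ring

lemma norm_dirichletPoly_le_of_ap (hN : 0 < N) (s : ℂ) (hs : 0 ≤ s.re) {B : ℝ}
    (h : ∀ c ≤ 2 * N, ∀ r < 8,
      ‖∑ n ∈ (Ico N c).filter (fun n => n % 8 = r), (n : ℂ) ^ (|s.im| * I)‖ ≤ B) :
    ‖∑ n ∈ Ico N (2 * N), χ n * (n : ℂ) ^ (-s)‖ ≤ (N : ℝ) ^ (-s.re) * (8 * B) := by
  rw [sum_congr rfl (fun n hn => char_mul_cpow_eq χ (by have := mem_Ico.1 hn; omega) s)]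
  refine norm_sum_mul_antitone_le (fun n => (n : ℝ) ^ (-s.re)) _ N (2 * N) _
    (fun n h1 _ => rpow_le_rpow_of_nonpos (mod_cast hN.trans_le h1) (mod_cast n.le_succ)
      (by linarith)) (by positivity) (fun c _ hc => ?_) (by omega)
  exact norm_sum_char_le_of_ap χ N c _ (by rw [abs_neg]; exact h c hc)

lemma norm_dirichletPoly_le (hN : 0 < N) (s : ℂ) (hs : 0 ≤ s.re) (ht : s.im ≠ 0) :
    ‖∑ n ∈ Ico N (2 * N), χ n * (n : ℂ) ^ (-s)‖ ≤
      (N : ℝ) ^ (-s.re) * (64 * (√|s.im| + N / √|s.im|)) :=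
  (norm_dirichletPoly_le_of_ap χ hN s hs fun _ hc _ hr =>
    norm_sum_ap_le_of_pos hN le_rfl hc hr (abs_pos.2 ht)).trans_eq (by ring)

lemma norm_dirichletPoly_le' (hN : 4 ≤ N) (s : ℂ) (hs : 0 ≤ s.re) (ht : s.im ≠ 0)
    (hNt : 4 * |s.im| ≤ N) :
    ‖∑ n ∈ Ico N (2 * N), χ n * (n : ℂ) ^ (-s)‖ ≤ (N : ℝ) ^ (-s.re) * (8 * (4 * N / |s.im|)) :=
  norm_dirichletPoly_le_of_ap χ (by omega) s hs fun _ hc _ hr =>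
    norm_sum_ap_le_of_pos' hN le_rfl hc hr (abs_pos.2 ht) hNt

/-! ### Approximating Dirichlet `L`-functions modulo `8` by Dirichlet polynomials -/

lemma norm_cpow_sub_cpow_le {a x y : ℝ} (ha : 0 < a) (hs : 0 ≤ s.re)
    (hx : x ∈ Set.Icc a (a + 8)) (hy : y ∈ Set.Icc a (a + 8)) :
    ‖(y : ℂ) ^ (-s) - (x : ℂ) ^ (-s)‖ ≤ ‖s‖ * a ^ (-s.re - 1) * 8 := by
  by_cases h0 : s = 0
  · simp [h0]
  have h1 : ∀ z ∈ Set.Icc a (a + 8), HasDerivWithinAt (fun y : ℝ => (y : ℂ) ^ (-s))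
      (-s * (z : ℂ) ^ (-s - 1)) (Set.Icc a (a + 8)) z := fun z hz =>
    (hasDerivAt_ofReal_cpow_const (by linarith [hz.1]) (neg_ne_zero.2 h0)).hasDerivWithinAt
  have h2 : ∀ z ∈ Set.Icc a (a + 8), ‖-s * (z : ℂ) ^ (-s - 1)‖ ≤ ‖s‖ * a ^ (-s.re - 1) := by
    intro z hz
    have hz0 : 0 < z := lt_of_lt_of_le ha hz.1
    rw [norm_mul, norm_neg, norm_cpow_eq_rpow_re_of_pos hz0]
    gcongr
    simp only [sub_re, neg_re, one_re]
    exact rpow_le_rpow_of_nonpos ha hz.1 (by linarith)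
  refine ((convex_Icc a (a + 8)).norm_image_sub_le_of_norm_hasDerivWithin_le h1 h2 hx hy).trans ?_
  gcongr
  rw [norm_eq_abs, abs_le]
  constructor <;> linarith [hx.1, hx.2, hy.1, hy.2]

lemma norm_cpow_sub_mean_le {a x : ℝ} (ha : 0 < a) (hs : 0 ≤ s.re) (hs1 : s ≠ 1)
    (hx : x ∈ Set.Icc a (a + 8)) :
    ‖(x : ℂ) ^ (-s) - ((a : ℂ) ^ (1 - s) - ((a + 8 : ℝ) : ℂ) ^ (1 - s)) / (8 * (s - 1))‖ ≤
      8 * ‖s‖ * a ^ (-s.re - 1) := by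
  have hs1' : s - 1 ≠ 0 := sub_ne_zero.2 hs1
  have hs1'' : -s + 1 ≠ 0 := by intro h; apply hs1'; linear_combination -h
  have h1 : ∀ z ∈ Set.Icc a (a + 8), HasDerivWithinAt
      (fun y : ℝ => (x : ℂ) ^ (-s) * y - (y : ℂ) ^ (-s + 1) / (-s + 1))
      ((x : ℂ) ^ (-s) - (z : ℂ) ^ (-s)) (Set.Icc a (a + 8)) z := by
    intro z hz
    have e1 := hasDerivAt_ofReal_cpow_const' (x := z) (r := -s) (by linarith [hz.1])
      (by intro h; apply hs1; linear_combination -h)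
    have e2 : HasDerivAt (fun y : ℝ => (x : ℂ) ^ (-s) * (y : ℂ)) ((x : ℂ) ^ (-s) * 1) z :=
      (HasDerivAt.ofReal_comp (hasDerivAt_id z)).const_mul _
    rw [mul_one] at e2
    exact (e2.sub e1).hasDerivWithinAt
  have h := (convex_Icc a (a + 8)).norm_image_sub_le_of_norm_hasDerivWithin_le h1
    (fun z hz => norm_cpow_sub_cpow_le ha hs hz hx) (Set.left_mem_Icc.2 (by linarith))
    (Set.right_mem_Icc.2 (by linarith))
  have e : (x : ℂ) ^ (-s) * ((a + 8 : ℝ) : ℂ) - ((a + 8 : ℝ) : ℂ) ^ (-s + 1) / (-s + 1) -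
      ((x : ℂ) ^ (-s) * (a : ℂ) - (a : ℂ) ^ (-s + 1) / (-s + 1)) =
      8 * ((x : ℂ) ^ (-s) - ((a : ℂ) ^ (1 - s) - ((a + 8 : ℝ) : ℂ) ^ (1 - s)) / (8 * (s - 1))) := by
    rw [show (1:ℂ) - s = -s + 1 by ring]
    have : (8:ℂ) * (s - 1) = -8 * (-s + 1) := by ring
    rw [this]
    field_simp
    push_cast
    ring
  rw [e, norm_mul, add_sub_cancel_left] at h
  simp only [norm_ofNat, Real.norm_ofNat] at h
  linarith

/-- The difference between a block of eight terms of the `L`-series and its mean value. -/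
noncomputable def lBlock (s : ℂ) (m : ℕ) : ℂ := ∑ r ∈ range 8, χ r * (((8 * m + r : ℕ) : ℂ) ^ (-s) -
    (((8 * m : ℕ) : ℂ) ^ (1 - s) - ((8 * (m + 1) : ℕ) : ℂ) ^ (1 - s)) / (8 * (s - 1)))

lemma norm_lBlock_le {m : ℕ} (hm : 1 ≤ m) (hs : 0 ≤ s.re)
    (hs1 : s ≠ 1) : ‖lBlock χ s m‖ ≤ 64 * ‖s‖ * (m : ℝ) ^ (-s.re - 1) := by
  have hm' : (1:ℝ) ≤ m := mod_cast hm
  have hr : ∀ r ∈ range 8, ‖χ r * (((8 * m + r : ℕ) : ℂ) ^ (-s) -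
    (((8 * m : ℕ) : ℂ) ^ (1 - s) - ((8 * (m + 1) : ℕ) : ℂ) ^ (1 - s)) / (8 * (s - 1)))‖ ≤
      8 * ‖s‖ * (m : ℝ) ^ (-s.re - 1) := by
    intro r hr
    have hr8 : (r : ℝ) < 8 := mod_cast mem_range.1 hr
    have h := norm_cpow_sub_mean_le (s := s) (a := 8 * m) (x := 8 * m + r) (by positivity) hs hs1
      ⟨by linarith [Nat.cast_nonneg (α := ℝ) r], by linarith⟩
    have h1 : ‖χ (r : ZMod 8)‖ ≤ 1 := norm_le_one χ _
    have h3 : (8 * (m : ℝ)) ^ (-s.re - 1) ≤ (m : ℝ) ^ (-s.re - 1) :=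
      rpow_le_rpow_of_nonpos (by positivity) (by linarith) (by linarith)
    rw [norm_mul]
    have e : (8 * m + 8 : ℝ) = 8 * (m + 1) := by ring
    rw [e] at h
    push_cast at h ⊢
    calc _ ≤ 1 * (8 * ‖s‖ * (8 * (m : ℝ)) ^ (-s.re - 1)) := by gcongr
      _ ≤ 8 * ‖s‖ * (m : ℝ) ^ (-s.re - 1) := by rw [one_mul]; gcongr
  refine (norm_sum_le _ _).trans ((sum_le_card_nsmul _ _ _ hr).trans (le_of_eq ?_))
  simp; ring

lemma sum_lBlock_eq (M K : ℕ) : ∑ m ∈ range K, lBlock χ s (m + M) =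
      ∑ n ∈ range (8 * (K + M)), χ n * (n : ℂ) ^ (-s) -
      ∑ n ∈ range (8 * M), χ n * (n : ℂ) ^ (-s) -
      (∑ r ∈ range 8, χ r) * (((8 * M : ℕ) : ℂ) ^ (1 - s) -
        ((8 * (K + M) : ℕ) : ℂ) ^ (1 - s)) / (8 * (s - 1)) := by
  induction K with
  | zero => simp
  | succ K ih =>
    rw [sum_range_succ, ih]
    have e1 : 8 * (K + 1 + M) = 8 * (K + M) + 8 := by ring
    rw [e1, sum_range_add (n := 8 * (K + M)) (m := 8)]
    have e2 : ∀ r : ℕ, χ ((8 * (K + M) + r : ℕ) : ZMod 8) = χ (r : ZMod 8) := by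
      intro r
      congr 1
      have : ((8 : ℕ) : ZMod 8) = 0 := ZMod.natCast_self 8
      push_cast at this ⊢
      rw [this]; ring
    simp only [e2]
    rw [lBlock, show 8 * (K + M + 1) = 8 * (K + M) + 8 by ring]
    simp only [mul_sub, sum_sub_distrib, ← sum_mul]
    ring

lemma rpow_neg_sub_one_le_telescope (h1 : 1 / 2 ≤ σ) {m : ℕ} (hm : 1 ≤ m) :
    (m : ℝ) ^ (-σ - 1) ≤ 8 * ((m : ℝ) ^ (-σ) - ((m + 1 : ℕ) : ℝ) ^ (-σ)) := by
  have hm' : (1:ℝ) ≤ m := mod_cast hm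
  have hm0 : (0:ℝ) < m := by linarith
  have e1 : ((m + 1 : ℕ) : ℝ) = m * (1 + 1 / m) := by push_cast; field_simp
  rw [e1, mul_rpow hm0.le (by positivity), rpow_sub_one hm0.ne']
  have h3 : (1 + 1 / (m:ℝ)) ^ (-σ) ≤ 1 - 1 / (8 * m) := by
    have h4 : 1 + 1 / (4 * (m:ℝ)) ≤ (1 + 1 / (m:ℝ)) ^ σ := by
      have h5 : 1 + 1 / (4 * (m:ℝ)) ≤ (1 + 1 / (m:ℝ)) ^ (1 / 2 : ℝ) := by
        rw [← sqrt_eq_rpow]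
        apply le_sqrt_of_sq_le
        have e : 1 / (4 * (m:ℝ)) = (1 / m) / 4 := by field_simp
        have hx : 1 / (m:ℝ) ≤ 1 := by rw [div_le_one hm0]; exact hm'
        have hx0 : 0 < 1 / (m:ℝ) := by positivity
        rw [e]; nlinarith
      refine h5.trans (rpow_le_rpow_of_exponent_le ?_ h1)
      have : 0 < 1 / (m:ℝ) := by positivity
      linarith
    rw [rpow_neg (by positivity)]
    have h6 : ((1 + 1 / (m:ℝ)) ^ σ)⁻¹ ≤ (1 + 1 / (4 * (m:ℝ)))⁻¹ := inv_anti₀ (by positivity) h4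
    refine h6.trans ?_
    rw [inv_le_iff_one_le_mul₀ (by positivity)]
    have e : 1 / (4 * (m:ℝ)) = (1 / m) / 4 := by field_simp
    have e' : 1 / (8 * (m:ℝ)) = (1 / m) / 8 := by field_simp
    have hx : 1 / (m:ℝ) ≤ 1 := by rw [div_le_one hm0]; exact hm'
    have hx0 : 0 < 1 / (m:ℝ) := by positivity
    rw [e, e']; nlinarith
  have h7 : 0 < (m:ℝ) ^ (-σ) := by positivity
  have h8 : (m:ℝ) ^ (-σ) * (1 + 1 / (m:ℝ)) ^ (-σ) ≤ (m:ℝ) ^ (-σ) * (1 - 1 / (8 * m)) := by gcongr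
  calc (m:ℝ) ^ (-σ) / m = 8 * ((m:ℝ) ^ (-σ) - (m:ℝ) ^ (-σ) * (1 - 1 / (8 * m))) := by
        field_simp; ring
    _ ≤ _ := by linarith

lemma summable_rpow_shift {c : ℝ} (hc : c < -1) (M : ℕ) :
    Summable fun m : ℕ => ((m + M : ℕ) : ℝ) ^ c :=
  (summable_nat_add_iff M).2 (summable_nat_rpow.2 hc)

lemma summable_lBlock (hs : 0 < s.re) (hs1 : s ≠ 1)
    (hM : 1 ≤ M) : Summable fun m => ‖lBlock χ s (m + M)‖ :=
  Summable.of_nonneg_of_le (fun _ => norm_nonneg _) (fun m => norm_lBlock_le χ (by omega) hs.le hs1)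
    ((summable_rpow_shift (by linarith) M).mul_left _)

lemma norm_tsum_lBlock_le (h1 : 1 / 2 ≤ s.re) (hs1 : s ≠ 1) (hM : 1 ≤ M) :
    ‖∑' m, lBlock χ s (m + M)‖ ≤ 512 * ‖s‖ * (M : ℝ) ^ (-s.re) := by
  refine (norm_tsum_le_tsum_norm (summable_lBlock χ (by linarith) hs1 hM)).trans ?_
  refine tsum_le_of_sum_range_le (fun _ => norm_nonneg _) fun K => ?_
  have : ∑ m ∈ range K, ‖lBlock χ s (m + M)‖ ≤
      512 * ‖s‖ * ((M : ℝ) ^ (-s.re) - ((K + M : ℕ) : ℝ) ^ (-s.re)) := by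
    induction K with
    | zero => simp
    | succ K ih =>
      rw [sum_range_succ]
      have h3 := norm_lBlock_le χ (s := s) (m := K + M) (by omega) (by linarith) hs1
      have h4 := rpow_neg_sub_one_le_telescope h1 (m := K + M) (by omega)
      have h5 := mul_le_mul_of_nonneg_left h4 (show 0 ≤ 64 * ‖s‖ by positivity)
      rw [show K + 1 + M = K + M + 1 by ring]
      linarith
  refine this.trans ?_
  gcongr
  have : 0 ≤ ((K + M : ℕ) : ℝ) ^ (-s.re) := by positivity
  linarith

lemma lBlock_tail_of_one_lt_re (hs : 1 < s.re) (hM : 1 ≤ M) :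
    ∑' m, lBlock χ s (m + M) = χ.LFunction s - ∑ n ∈ range (8 * M), χ n * (n : ℂ) ^ (-s) -
      (∑ r ∈ range 8, χ r) * ((8 * M : ℕ) : ℂ) ^ (1 - s) / (8 * (s - 1)) := by
  have hs1 : s ≠ 1 := by rintro rfl; simp at hs
  have h1 := ((summable_lBlock χ (by linarith) hs1 hM).of_norm).hasSum.tendsto_sum_nat
  refine tendsto_nhds_unique h1 ?_
  simp only [sum_lBlock_eq]
  have hK : Tendsto (fun K : ℕ => 8 * (K + M)) atTop atTop :=
    tendsto_atTop_mono (fun K => by simp only [id]; omega) tendsto_id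
  have h2 : Tendsto (fun K : ℕ => ∑ n ∈ range (8 * (K + M)), χ n * (n : ℂ) ^ (-s))
      atTop (nhds (χ.LFunction s)) := by
    have := (DirichletCharacter.LSeriesSummable_of_one_lt_re χ hs).hasSum.tendsto_sum_nat
    rw [LFunction_eq_LSeries χ hs]
    refine (this.comp hK).congr fun K => sum_congr rfl fun n _ => ?_
    rw [LSeries.term_def]
    split_ifs with h
    · subst h
      have : χ ((0:ℕ) : ZMod 8) = 0 := by
        rw [Nat.cast_zero]; exact χ.map_nonunit (by rw [isUnit_zero_iff]; decide)
      rw [this, zero_mul]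
    · rw [cpow_neg, div_eq_mul_inv]
  have h3 : Tendsto (fun K : ℕ => ((8 * (K + M) : ℕ) : ℂ) ^ (1 - s)) atTop (nhds 0) := by
    rw [tendsto_zero_iff_norm_tendsto_zero]
    have h4 : Tendsto (fun n : ℕ => (n : ℝ) ^ (-(s.re - 1))) atTop (nhds 0) :=
      (tendsto_rpow_neg_atTop (by linarith)).comp tendsto_natCast_atTop_atTop
    refine (h4.comp hK).congr fun K => ?_
    simp only [Function.comp]
    rw [norm_natCast_cpow_of_pos (by omega)]
    congr 1
    simp
  have := (h2.sub_const (∑ n ∈ range (8 * M), χ n * (n : ℂ) ^ (-s))).sub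
    (((h3.const_sub (((8 * M : ℕ) : ℂ) ^ (1 - s))).const_mul
      (∑ r ∈ range 8, χ r)).div_const (8 * (s - 1)))
  simpa using this

lemma differentiableAt_lBlock {m : ℕ} (hm : 1 ≤ m)
    (hs1 : s ≠ 1) : DifferentiableAt ℂ (fun s => lBlock χ s m) s := by
  have h0 : ∀ k : ℕ, 8 * m ≤ k → (k : ℂ) ≠ 0 := fun k hk => by exact_mod_cast (by omega : k ≠ 0)
  unfold lBlock
  refine DifferentiableAt.fun_sum fun r _ => ?_
  refine DifferentiableAt.const_mul ?_ _
  refine DifferentiableAt.sub ?_ (DifferentiableAt.div (DifferentiableAt.sub ?_ ?_) ?_ ?_)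
  · exact (differentiableAt_id.neg).const_cpow (Or.inl (h0 _ (by omega)))
  · exact (differentiableAt_id.const_sub 1).const_cpow (Or.inl (h0 _ (by omega)))
  · exact (differentiableAt_id.const_sub 1).const_cpow (Or.inl (h0 _ (by omega)))
  · exact (differentiableAt_id.sub_const 1).const_mul 8
  · exact mul_ne_zero (by norm_num) (sub_ne_zero.2 hs1)

lemma lBlock_tail_on_convex {U : Set ℂ} (hU : IsOpen U)
    (hconv : Convex ℝ U) (R : ℝ) (hR : ∀ s ∈ U, ‖s‖ ≤ R) (hre : ∀ s ∈ U, 1 / 4 ≤ s.re)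
    (h1 : (1 : ℂ) ∉ U) (hex : ∃ z ∈ U, 1 < z.re) (hM : 1 ≤ M) :
    Set.EqOn (fun s => ∑' m, lBlock χ s (m + M)) (fun s => χ.LFunction s -
      ∑ n ∈ range (8 * M), χ n * (n : ℂ) ^ (-s) -
      (∑ r ∈ range 8, χ r) * ((8 * M : ℕ) : ℂ) ^ (1 - s) / (8 * (s - 1))) U := by
  have hne : ∀ s ∈ U, s ≠ 1 := fun s hs h => h1 (h ▸ hs)
  obtain ⟨z, hz, hz1⟩ := hex
  refine AnalyticOnNhd.eqOn_of_preconnected_of_eventuallyEq (𝕜 := ℂ) (E := ℂ) (F := ℂ) (z₀ := z) ?_ ?_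
    hconv.isPreconnected hz ?_
  · refine DifferentiableOn.analyticOnNhd ?_ hU
    refine differentiableOn_tsum_of_summable_norm
      (u := fun m => 64 * R * ((m + M : ℕ) : ℝ) ^ (-(5 / 4) : ℝ))
      ((summable_rpow_shift (by norm_num) M).mul_left _) ?_ hU ?_
    · exact fun m s hs => (differentiableAt_lBlock χ (by omega) (hne s hs)).differentiableWithinAt
    · intro m s hs
      have h2 := hre s hs
      refine (norm_lBlock_le χ (by omega) (by linarith) (hne s hs)).trans ?_
      have h3 : (1:ℝ) ≤ ((m + M : ℕ) : ℝ) := mod_cast (by omega : 1 ≤ m + M)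
      have h4 := hR s hs
      have h5 : 0 ≤ R := (norm_nonneg s).trans h4
      gcongr
      linarith
  · refine DifferentiableOn.analyticOnNhd (fun s hs => DifferentiableAt.differentiableWithinAt ?_) hU
    have h0 : ((8 * M : ℕ) : ℂ) ≠ 0 := mod_cast (by omega : 8 * M ≠ 0)
    refine DifferentiableAt.sub (DifferentiableAt.sub
      (differentiableAt_LFunction χ s (Or.inl (hne s hs))) ?_) ?_
    · refine DifferentiableAt.fun_sum fun n _ => ?_
      rcases eq_or_ne n 0 with rfl | hn
      · have : χ ((0:ℕ) : ZMod 8) = 0 := by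
          rw [Nat.cast_zero]; exact χ.map_nonunit (by rw [isUnit_zero_iff]; decide)
        simp only [this, zero_mul]
        exact differentiableAt_const _
      · exact ((differentiableAt_id.neg).const_cpow (Or.inl (mod_cast hn))).const_mul _
    · refine DifferentiableAt.div (((differentiableAt_id.const_sub 1).const_cpow
        (Or.inl h0)).const_mul _) ((differentiableAt_id.sub_const 1).const_mul 8)
        (mul_ne_zero (by norm_num) (sub_ne_zero.2 (hne s hs)))
  · have : {s : ℂ | 1 < s.re} ∈ nhds z := (isOpen_lt continuous_const continuous_re).mem_nhds hz1
    filter_upwards [this] with s hs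
    exact lBlock_tail_of_one_lt_re χ hs hM

lemma lBlock_tail (hs : 1 / 2 ≤ s.re) (ht : s.im ≠ 0) (hM : 1 ≤ M) :
    ∑' m, lBlock χ s (m + M) = χ.LFunction s - ∑ n ∈ range (8 * M), χ n * (n : ℂ) ^ (-s) -
      (∑ r ∈ range 8, χ r) * ((8 * M : ℕ) : ℂ) ^ (1 - s) / (8 * (s - 1)) := by
  set R : ℝ := ‖s‖ + 4
  have hball : Convex ℝ (Metric.ball (0:ℂ) R) := convex_ball _ _
  have hre : Convex ℝ {z : ℂ | 1 / 4 < z.re} := convex_halfSpace_re_gt _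
  have hreo : IsOpen {z : ℂ | 1 / 4 < z.re} := isOpen_lt continuous_const continuous_re
  have hnorm : ∀ t : ℝ, |t| = 1 → ‖(⟨2, t⟩ : ℂ)‖ < R := by
    intro t ht
    have := norm_le_abs_re_add_abs_im (⟨2, t⟩ : ℂ)
    simp only [ht, abs_two] at this
    have := norm_nonneg s
    simp only [R]; linarith
  have hsR : ‖s‖ < R := by simp [R]
  rcases lt_or_gt_of_ne ht with h | h
  · refine lBlock_tail_on_convex χ (U := (Metric.ball 0 R ∩ {z : ℂ | 1 / 4 < z.re}) ∩
      {z : ℂ | z.im < 0}) ((Metric.isOpen_ball.inter hreo).inter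
        (isOpen_lt continuous_im continuous_const))
      ((hball.inter hre).inter (convex_halfSpace_im_lt _)) R ?_ ?_ ?_ ?_ hM ?_
    · exact fun z hz => (mem_ball_zero_iff.1 hz.1.1).le
    · exact fun z hz => le_of_lt hz.1.2
    · exact fun hz => by simpa using hz.2
    · exact ⟨⟨2, -1⟩, ⟨⟨mem_ball_zero_iff.2 (hnorm _ (by simp)), by norm_num [Set.mem_ofPred_eq]⟩,
        by norm_num [Set.mem_ofPred_eq]⟩, by norm_num⟩
    · exact ⟨⟨mem_ball_zero_iff.2 hsR, by simp only [Set.mem_ofPred_eq]; linarith⟩, h⟩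
  · refine lBlock_tail_on_convex χ (U := (Metric.ball 0 R ∩ {z : ℂ | 1 / 4 < z.re}) ∩
      {z : ℂ | 0 < z.im}) ((Metric.isOpen_ball.inter hreo).inter
        (isOpen_lt continuous_const continuous_im))
      ((hball.inter hre).inter (convex_halfSpace_im_gt _)) R ?_ ?_ ?_ ?_ hM ?_
    · exact fun z hz => (mem_ball_zero_iff.1 hz.1.1).le
    · exact fun z hz => le_of_lt hz.1.2
    · exact fun hz => by simpa using hz.2
    · exact ⟨⟨2, 1⟩, ⟨⟨mem_ball_zero_iff.2 (hnorm _ (by simp)), by norm_num [Set.mem_ofPred_eq]⟩,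
        by norm_num [Set.mem_ofPred_eq]⟩, by norm_num⟩
    · exact ⟨⟨mem_ball_zero_iff.2 hsR, by simp only [Set.mem_ofPred_eq]; linarith⟩, h⟩

lemma norm_sum_Ico_mul_two_pow_le (h1 : 0 ≤ s.re)
    (h2 : s.re ≤ 15 / 16) (ht : s.im ≠ 0) (hN : 4 ≤ N) (hNt : 4 * |s.im| ≤ N) (J : ℕ) :
    ‖∑ n ∈ Ico N (N * 2 ^ J), χ n * (n : ℂ) ^ (-s)‖ ≤
      1024 / |s.im| * ((N * 2 ^ J : ℕ) : ℝ) ^ (1 - s.re) := by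
  have ht0 : 0 < |s.im| := abs_pos.2 ht
  induction J with
  | zero => simp; positivity
  | succ J ih =>
    have hle : N ≤ N * 2 ^ J := Nat.le_mul_of_pos_right _ (by positivity)
    have hle' : N * 2 ^ J ≤ N * 2 ^ (J + 1) := by gcongr <;> omega
    set Q := N * 2 ^ J with hQ
    have hQ0 : (0:ℝ) < (Q : ℝ) := mod_cast (by omega : 0 < Q)
    have e : N * 2 ^ (J + 1) = 2 * Q := by rw [hQ]; ring
    rw [← sum_Ico_consecutive _ hle hle', e]
    refine (norm_add_le _ _).trans ?_
    have hb := norm_dirichletPoly_le' χ (N := Q) (by omega) s h1 ht (hNt.trans (mod_cast hle))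
    have e3 : (Q : ℝ) ^ (-s.re) * (8 * (4 * Q / |s.im|)) = 32 / |s.im| * (Q : ℝ) ^ (1 - s.re) := by
      rw [show (1 - s.re) = -s.re + 1 by ring, rpow_add_one hQ0.ne']; ring
    rw [e3] at hb
    have h3 : (33 / 32 : ℝ) ≤ 2 ^ (1 - s.re) := by
      have : (33 / 32 : ℝ) ≤ 2 ^ (1 / 16 : ℝ) := by
        refine le_of_pow_le_pow_left₀ (n := 16) (by norm_num) (by positivity) ?_
        rw [← rpow_mul_natCast (by norm_num)]
        norm_num
      exact this.trans (rpow_le_rpow_of_exponent_le (by norm_num) (by linarith))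
    push_cast
    rw [mul_rpow (by norm_num) hQ0.le]
    have h4 : 33 / 32 * (Q : ℝ) ^ (1 - s.re) ≤ 2 ^ (1 - s.re) * (Q : ℝ) ^ (1 - s.re) := by gcongr
    have h5 := mul_le_mul_of_nonneg_left h4 (show 0 ≤ 1024 / |s.im| by positivity)
    have e4 : 1024 / |s.im| * (33 / 32 * (Q : ℝ) ^ (1 - s.re)) =
      1024 / |s.im| * (Q : ℝ) ^ (1 - s.re) + 32 / |s.im| * (Q : ℝ) ^ (1 - s.re) := by ring
    linarith

lemma exists_two_pow_mul_mem_Icc (hM : 1 ≤ M) (ht : (M : ℝ) ≤ 2 * t) :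
    ∃ J : ℕ, t ≤ ((M * 2 ^ J : ℕ) : ℝ) ∧ ((M * 2 ^ J : ℕ) : ℝ) ≤ 2 * t := by
  have hex : ∃ J : ℕ, t ≤ ((M * 2 ^ J : ℕ) : ℝ) := by
    obtain ⟨n, hn⟩ := exists_nat_ge t
    refine ⟨n, hn.trans ?_⟩
    have : n ≤ M * 2 ^ n := (Nat.lt_two_pow_self).le.trans (Nat.le_mul_of_pos_left _ hM)
    exact_mod_cast this
  refine ⟨Nat.find hex, Nat.find_spec hex, ?_⟩
  rcases h : Nat.find hex with _ | k
  · simpa using ht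
  · have h1 := Nat.find_min hex (m := k) (by omega)
    rw [not_le] at h1
    push_cast at h1 ⊢
    rw [pow_succ]
    linarith

/-- Approximation of `L(s, χ)` by a Dirichlet polynomial of length comparable to `|Im s|`. -/
lemma norm_LFunction_sub_le (h1 : 1 / 2 ≤ s.re)
    (h2 : s.re ≤ 15 / 16) (ht : 1 ≤ |s.im|) (hM : 4 * |s.im| ≤ 8 * M)
    (hM' : (8 * M : ℝ) ≤ 16 * |s.im|) :
    ‖χ.LFunction s - ∑ n ∈ Ico 1 (8 * M), χ n * (n : ℂ) ^ (-s)‖ ≤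
      20000 * |s.im| ^ (1 - 2 * s.re) := by
  set t := |s.im| with htdef
  have ht0 : 0 < t := by linarith
  have him : s.im ≠ 0 := abs_pos.1 ht0
  have hM1 : 1 ≤ M := by
    rcases Nat.eq_zero_or_pos M with h | h
    · subst h; simp at hM; linarith
    · exact h
  obtain ⟨J, hJ1, hJ2⟩ := exists_two_pow_mul_mem_Icc (t := t ^ 2) hM1 (by nlinarith)
  set Q := M * 2 ^ J with hQ
  have hQ1 : 1 ≤ Q := Nat.mul_pos hM1 (by positivity)
  have hQ0 : (0:ℝ) < Q := mod_cast hQ1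
  have htail := lBlock_tail χ h1 him hQ1
  have hb1 := norm_tsum_lBlock_le χ h1 (by rintro rfl; simp at him) hQ1
  have hb2 := norm_sum_Ico_mul_two_pow_le χ (by linarith) h2 him (N := 8 * M) (by omega)
    (by push_cast; exact hM) J
  have hsplit : ∑ n ∈ range (8 * Q), χ n * (n : ℂ) ^ (-s) =
      ∑ n ∈ Ico 1 (8 * M), χ n * (n : ℂ) ^ (-s) +
      ∑ n ∈ Ico (8 * M) (8 * M * 2 ^ J), χ n * (n : ℂ) ^ (-s) := by
    rw [show 8 * Q = 8 * M * 2 ^ J by rw [hQ]; ring,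
      sum_Ico_consecutive _ (by omega) (Nat.le_mul_of_pos_right _ (by positivity)),
      range_eq_Ico, sum_eq_sum_Ico_succ_bot (by positivity)]
    have : χ ((0:ℕ) : ZMod 8) = 0 := by
      rw [Nat.cast_zero]; exact χ.map_nonunit (by rw [isUnit_zero_iff]; decide)
    simp only [this, zero_mul, zero_add]
  have e : χ.LFunction s - ∑ n ∈ Ico 1 (8 * M), χ n * (n : ℂ) ^ (-s) = ∑' m, lBlock χ s (m + Q) +
      ∑ n ∈ Ico (8 * M) (8 * M * 2 ^ J), χ n * (n : ℂ) ^ (-s) +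
      (∑ r ∈ range 8, χ r) * ((8 * Q : ℕ) : ℂ) ^ (1 - s) / (8 * (s - 1)) := by
    rw [htail, hsplit]; ring
  rw [e]
  have hpow : ((8 * Q : ℕ) : ℝ) ^ (1 - s.re) ≤ 16 * t ^ (2 - 2 * s.re) := by
    have h3 : ((8 * Q : ℕ) : ℝ) ≤ 16 * t ^ 2 := by push_cast; linarith
    calc ((8 * Q : ℕ) : ℝ) ^ (1 - s.re) ≤ (16 * t ^ 2) ^ (1 - s.re) := by
          gcongr; linarith
      _ = 16 ^ (1 - s.re) * t ^ (2 - 2 * s.re) := by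
          rw [mul_rpow (by norm_num) (by positivity), ← rpow_natCast t 2, ← rpow_mul ht0.le]
          congr 2; push_cast; ring
      _ ≤ 16 ^ (1:ℝ) * t ^ (2 - 2 * s.re) := by
          gcongr
          · norm_num
          · linarith
      _ = _ := by rw [rpow_one]
  have hs : ‖s‖ ≤ 2 * t := by
    have := norm_le_abs_re_add_abs_im s
    rw [abs_of_nonneg (by linarith : 0 ≤ s.re)] at this
    linarith
  have hdiv : t ^ (2 - 2 * s.re) / t = t ^ (1 - 2 * s.re) := by
    rw [show 2 - 2 * s.re = (1 - 2 * s.re) + 1 by ring, rpow_add_one ht0.ne']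
    field_simp
  have c1 : ‖∑' m, lBlock χ s (m + Q)‖ ≤ 1024 * t ^ (1 - 2 * s.re) := by
    refine hb1.trans ?_
    have h3 : (Q : ℝ) ^ (-s.re) ≤ t ^ (-2 * s.re) := by
      rw [show -2 * s.re = (2 : ℕ) * (-s.re) by push_cast; ring, rpow_natCast_mul ht0.le]
      exact rpow_le_rpow_of_nonpos (by positivity) hJ1 (by linarith)
    calc 512 * ‖s‖ * (Q : ℝ) ^ (-s.re) ≤ 512 * (2 * t) * t ^ (-2 * s.re) := by gcongr
      _ = 1024 * (t ^ (-2 * s.re) * t) := by ring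
      _ = 1024 * t ^ (1 - 2 * s.re) := by rw [← rpow_add_one ht0.ne']; congr 2; ring
  have c2 : ‖∑ n ∈ Ico (8 * M) (8 * M * 2 ^ J), χ n * (n : ℂ) ^ (-s)‖ ≤
      16384 * t ^ (1 - 2 * s.re) := by
    refine hb2.trans ?_
    rw [show 8 * M * 2 ^ J = 8 * Q by rw [hQ]; ring]
    calc 1024 / t * ((8 * Q : ℕ) : ℝ) ^ (1 - s.re) ≤ 1024 / t * (16 * t ^ (2 - 2 * s.re)) := by
          gcongr
      _ = 16384 * (t ^ (2 - 2 * s.re) / t) := by ring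
      _ = _ := by rw [hdiv]
  have c3 : ‖(∑ r ∈ range 8, χ r) * ((8 * Q : ℕ) : ℂ) ^ (1 - s) / (8 * (s - 1))‖ ≤
      16 * t ^ (1 - 2 * s.re) := by
    rw [norm_div, norm_mul, norm_mul, norm_natCast_cpow_of_pos (by omega)]
    have h3 : ‖∑ r ∈ range 8, χ r‖ ≤ 8 := by
      refine (norm_sum_le _ _).trans ?_
      refine (sum_le_card_nsmul _ _ 1 fun r _ => norm_le_one χ _).trans ?_
      simp
    have h4 : t ≤ ‖s - 1‖ := by
      have := abs_im_le_norm (s - 1)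
      simpa using this
    simp only [sub_re, one_re, norm_ofNat]
    calc _ ≤ 8 * (16 * t ^ (2 - 2 * s.re)) / (8 * t) := by gcongr
      _ = 16 * (t ^ (2 - 2 * s.re) / t) := by field_simp
      _ = _ := by rw [hdiv]
  have c0 : 0 ≤ t ^ (1 - 2 * s.re) := by positivity
  refine (norm_add₃_le).trans ?_
  linarith

/-- Convexity-free growth bound used on horizontal segments. -/
lemma norm_LFunction_le (h1 : 1 / 2 ≤ s.re) (h2 : s.re ≤ 3) (ht : 1 ≤ |s.im|) :
    ‖χ.LFunction s‖ ≤ 5000 * |s.im| ^ (max (1 - s.re) 0) * (1 + log |s.im|) := by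
  set t := |s.im| with htdef
  have ht0 : 0 < t := by linarith
  have him : s.im ≠ 0 := abs_pos.1 ht0
  set e := max (1 - s.re) 0 with he
  have he0 : 0 ≤ e := le_max_right _ _
  have he1 : 1 - s.re ≤ e := le_max_left _ _
  have he2 : e ≤ 1 / 2 := max_le (by linarith) (by norm_num)
  set M := ⌈t⌉₊ with hMdef
  have hM : 1 ≤ M := Nat.ceil_pos.2 ht0
  have hMt : t ≤ M := Nat.le_ceil t
  have hMt' : (M : ℝ) ≤ 2 * t := by
    have := Nat.ceil_lt_add_one ht0.le
    linarith
  have hM0 : (0:ℝ) < M := by linarith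
  have htail := lBlock_tail χ h1 him hM
  have hb1 := norm_tsum_lBlock_le χ h1 (by rintro rfl; simp at him) hM
  have hlog : 0 ≤ log t := log_nonneg ht
  have htp : 1 ≤ t ^ e := one_le_rpow ht he0
  have hs : ‖s‖ ≤ 4 * t := by
    have := norm_le_abs_re_add_abs_im s
    rw [abs_of_nonneg (by linarith : 0 ≤ s.re)] at this
    linarith
  have e0 : χ.LFunction s = ∑' m, lBlock χ s (m + M) + ∑ n ∈ range (8 * M), χ n * (n : ℂ) ^ (-s) +
      (∑ r ∈ range 8, χ r) * ((8 * M : ℕ) : ℂ) ^ (1 - s) / (8 * (s - 1)) := by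
    rw [htail]; ring
  have hpow : ((8 * M : ℕ) : ℝ) ^ (1 - s.re) ≤ 4 * t ^ e := by
    have h3 : ((8 * M : ℕ) : ℝ) ≤ 16 * t := by push_cast; linarith
    have h3' : (1:ℝ) ≤ ((8 * M : ℕ) : ℝ) := mod_cast (by omega : 1 ≤ 8 * M)
    calc ((8 * M : ℕ) : ℝ) ^ (1 - s.re) ≤ ((8 * M : ℕ) : ℝ) ^ e :=
          rpow_le_rpow_of_exponent_le h3' he1
      _ ≤ (16 * t) ^ e := by gcongr
      _ = 16 ^ e * t ^ e := mul_rpow (by norm_num) ht0.le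
      _ ≤ 16 ^ (1 / 2 : ℝ) * t ^ e := by gcongr; norm_num
      _ = 4 * t ^ e := by
          rw [show (16:ℝ) = 4 ^ (2:ℝ) by norm_num, ← rpow_mul (by norm_num)]; norm_num
  have c1 : ‖∑' m, lBlock χ s (m + M)‖ ≤ 2048 * t ^ e := by
    refine hb1.trans ?_
    have h3 : (M : ℝ) ^ (-s.re) ≤ t ^ (-s.re) := rpow_le_rpow_of_nonpos ht0 hMt (by linarith)
    calc 512 * ‖s‖ * (M : ℝ) ^ (-s.re) ≤ 512 * (4 * t) * t ^ (-s.re) := by gcongr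
      _ = 2048 * (t ^ (-s.re) * t) := by ring
      _ = 2048 * t ^ (1 - s.re) := by rw [← rpow_add_one ht0.ne']; congr 2; ring
      _ ≤ 2048 * t ^ e := by gcongr
  have c2 : ‖∑ n ∈ range (8 * M), χ n * (n : ℂ) ^ (-s)‖ ≤ 20 * t ^ e * (1 + log t) := by
    have h3 : ∀ n ∈ range (8 * M), ‖χ n * (n : ℂ) ^ (-s)‖ ≤ 4 * t ^ e * (n : ℝ)⁻¹ := by
      intro n hn
      rcases Nat.eq_zero_or_pos n with rfl | hn0
      · have : χ ((0:ℕ) : ZMod 8) = 0 := by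
          rw [Nat.cast_zero]; exact χ.map_nonunit (by rw [isUnit_zero_iff]; decide)
        simp only [this, zero_mul, norm_zero]; positivity
      · have hn1 : (0:ℝ) < n := mod_cast hn0
        have hn2 : (n : ℝ) ≤ ((8 * M : ℕ) : ℝ) := mod_cast (mem_range.1 hn).le
        rw [norm_mul, norm_natCast_cpow_of_pos hn0]
        have h4 : (n : ℝ) ^ (1 - s.re) ≤ 4 * t ^ e := by
          have h5 : (n : ℝ) ^ (1 - s.re) ≤ (n : ℝ) ^ e :=
            rpow_le_rpow_of_exponent_le (mod_cast hn0) he1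
          have h6 : (n : ℝ) ^ e ≤ (16 * t) ^ e := by
            gcongr
            push_cast at hn2; linarith
          refine h5.trans (h6.trans ?_)
          rw [mul_rpow (by norm_num) ht0.le]
          have h7 : (16:ℝ) ^ e ≤ 16 ^ (1 / 2 : ℝ) := by gcongr; norm_num
          have h8 : (16:ℝ) ^ (1 / 2 : ℝ) = 4 := by
            rw [show (16:ℝ) = 4 ^ (2:ℝ) by norm_num, ← rpow_mul (by norm_num)]; norm_num
          rw [h8] at h7
          gcongr
        calc ‖χ n‖ * (n : ℝ) ^ ((-s).re) ≤ 1 * (n : ℝ) ^ (-s.re) := by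
              rw [neg_re]
              gcongr
              exact norm_le_one χ _
          _ = (n : ℝ) ^ (1 - s.re) * (n : ℝ)⁻¹ := by
              rw [one_mul, ← rpow_neg_one, ← rpow_add hn1]; congr 1; ring
          _ ≤ _ := by gcongr
    refine (norm_sum_le _ _).trans ((sum_le_sum h3).trans ?_)
    rw [← mul_sum]
    have h9 : ∑ n ∈ range (8 * M), (n : ℝ)⁻¹ ≤ 1 + log (8 * M) := by
      have h10 := harmonic_le_one_add_log (8 * M)
      rw [harmonic] at h10
      push_cast at h10
      refine le_trans ?_ h10
      have := sum_range_succ' (fun n : ℕ => (n : ℝ)⁻¹) (8 * M)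
      have h12 := sum_range_succ (fun n : ℕ => (n : ℝ)⁻¹) (8 * M)
      have h11 : (0:ℝ) ≤ ((8 * M : ℕ) : ℝ)⁻¹ := by positivity
      push_cast at this h12 h11 ⊢
      simp only [inv_zero, add_zero] at this
      linarith
    have h13 : log (8 * M) ≤ 4 + log t := by
      have : log (8 * M) ≤ log (16 * t) := log_le_log (by positivity) (by linarith)
      rw [log_mul (by norm_num) ht0.ne'] at this
      have h14 : log 16 ≤ 4 := by
        rw [show (16:ℝ) = 2 ^ 4 by norm_num, log_pow]
        have := log_two_lt_d9
        push_cast; linarith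
      linarith
    calc 4 * t ^ e * ∑ n ∈ range (8 * M), (n : ℝ)⁻¹ ≤ 4 * t ^ e * (5 * (1 + log t)) := by
          gcongr
          linarith
      _ = _ := by ring
  have c3 : ‖(∑ r ∈ range 8, χ r) * ((8 * M : ℕ) : ℂ) ^ (1 - s) / (8 * (s - 1))‖ ≤ 4 * t ^ e := by
    rw [norm_div, norm_mul, norm_mul, norm_natCast_cpow_of_pos (by omega)]
    have h3 : ‖∑ r ∈ range 8, χ r‖ ≤ 8 := by
      refine (norm_sum_le _ _).trans ?_
      refine (sum_le_card_nsmul _ _ 1 fun r _ => norm_le_one χ _).trans ?_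
      simp
    have h4 : 1 ≤ ‖s - 1‖ := by
      have := abs_im_le_norm (s - 1)
      simp only [sub_im, one_im, sub_zero] at this
      exact ht.trans this
    simp only [sub_re, one_re, norm_ofNat]
    calc _ ≤ 8 * (4 * t ^ e) / (8 * 1) := by gcongr
      _ = _ := by ring
  rw [e0]
  refine (norm_add₃_le).trans ?_
  have : t ^ e ≤ t ^ e * (1 + log t) := le_mul_of_one_le_right (by linarith) (by linarith)
  linarith

/-! ### The divisor bound and the mean value theorem for Dirichlet polynomials -/

lemma succ_le_mul_two_rpow {ε : ℝ} (hε : 0 < ε) (a : ℕ) {p : ℝ} (hp : 2 ≤ p) :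
    (a + 1 : ℝ) ≤ (1 + 1 / (ε * log 2)) * (p ^ ε) ^ a := by
  have hl : 0 < log 2 := log_pos (by norm_num)
  have h1 : (2:ℝ) ^ ε ≤ p ^ ε := rpow_le_rpow (by norm_num) hp hε.le
  have h2 : 1 + ε * log 2 ≤ (2:ℝ) ^ ε := by
    rw [rpow_def_of_pos (by norm_num), mul_comm]
    linarith [add_one_le_exp (log 2 * ε)]
  have h3 : 1 + (a : ℝ) * (ε * log 2) ≤ (p ^ ε) ^ a := by
    have := one_add_mul_le_pow (a := ε * log 2) (by nlinarith [mul_pos hε hl]) a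
    refine this.trans ?_
    gcongr
    linarith
  have h4 : 0 < ε * log 2 := mul_pos hε hl
  calc (a + 1 : ℝ) ≤ (1 + 1 / (ε * log 2)) * (1 + (a : ℝ) * (ε * log 2)) := by
        have h5 : 1 / (ε * log 2) * ((a : ℝ) * (ε * log 2)) = a := by field_simp
        have h6 : 0 ≤ 1 / (ε * log 2) := by positivity
        have h7 : 0 ≤ (a : ℝ) * (ε * log 2) := by positivity
        nlinarith
    _ ≤ _ := by gcongr

/-- The divisor bound. -/
lemma exists_card_divisors_le {ε : ℝ} (hε : 0 < ε) :
    ∃ C : ℝ, 1 ≤ C ∧ ∀ n : ℕ, n ≠ 0 → (n.divisors.card : ℝ) ≤ C * (n : ℝ) ^ ε := by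
  have hl : 0 < log 2 := log_pos (by norm_num)
  set K : ℝ := 1 + 1 / (ε * log 2) with hK
  have hK1 : 1 ≤ K := by
    have : 0 ≤ 1 / (ε * log 2) := by positivity
    linarith
  obtain ⟨P, hP⟩ := exists_nat_ge ((2:ℝ) ^ (1 / ε))
  refine ⟨K ^ P, one_le_pow₀ hK1, fun n hn => ?_⟩
  rw [Nat.card_divisors hn]
  have hn' : (n : ℝ) ^ ε = ∏ p ∈ n.primeFactors, ((p : ℝ) ^ ε) ^ (n.factorization p) := by
    conv_lhs => rw [← Nat.prod_factorization_pow_eq_self hn]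
    rw [Finsupp.prod, Nat.support_factorization]
    push_cast
    rw [← finsetProd_rpow _ _ (fun i _ => by positivity)]
    refine prod_congr rfl fun p _ => ?_
    rw [← rpow_natCast, ← rpow_natCast, ← rpow_mul (by positivity),
      ← rpow_mul (by positivity), mul_comm]
  have h1 : ∀ p ∈ n.primeFactors, ((n.factorization p + 1 : ℕ) : ℝ) ≤
      (if p < P then K else 1) * ((p : ℝ) ^ ε) ^ (n.factorization p) := by
    intro p hp
    have hp2 : (2:ℝ) ≤ p := mod_cast (Nat.prime_of_mem_primeFactors hp).two_le
    push_cast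
    split_ifs with h
    · exact succ_le_mul_two_rpow hε _ hp2
    · rw [one_mul]
      have h2 : (2:ℝ) ≤ (p : ℝ) ^ ε := by
        have h3 : (2:ℝ) ^ (1 / ε) ≤ p := hP.trans (mod_cast not_lt.1 h)
        have h4 := rpow_le_rpow (by positivity) h3 hε.le
        rwa [← rpow_mul (by norm_num), one_div_mul_cancel hε.ne', rpow_one] at h4
      have h5 : ((n.factorization p + 1 : ℕ) : ℝ) ≤ ((2 ^ n.factorization p : ℕ) : ℝ) := by
        exact_mod_cast Nat.lt_two_pow_self
      push_cast at h5
      exact h5.trans (by gcongr)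
  push_cast at h1 ⊢
  refine (prod_le_prod (fun p _ => by positivity) h1).trans ?_
  rw [prod_mul_distrib, ← hn']
  gcongr
  rw [prod_ite, prod_const, prod_const_one, mul_one]
  refine pow_le_pow_right₀ hK1 ?_
  refine (card_le_card (t := range P) fun p hp => ?_).trans (by simp)
  exact mem_range.2 (mem_filter.1 hp).2

lemma norm_integral_exp_mul_I_le {c : ℝ} (hc : c ≠ 0) (a b : ℝ) :
    ‖∫ t in a..b, Complex.exp ((c : ℂ) * I * t)‖ ≤ 2 / |c| := by
  have hc' : (c : ℂ) * I ≠ 0 := mul_ne_zero (mod_cast hc) I_ne_zero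
  rw [integral_exp_mul_complex hc', norm_div, norm_mul, norm_I, mul_one, norm_real, norm_eq_abs]
  gcongr
  refine (norm_sub_le _ _).trans ?_
  have h : ∀ x : ℝ, ‖Complex.exp ((c : ℂ) * I * x)‖ = 1 := by
    intro x
    rw [show (c : ℂ) * I * x = ((c * x : ℝ) : ℂ) * I by push_cast; ring, norm_exp_ofReal_mul_I]
  rw [h, h]; norm_num

lemma integral_norm_sq_sum_exp_le (U : Finset ℕ) (a : ℕ → ℂ) (c : ℕ → ℝ) {τ₁ τ₂ : ℝ}
    (hτ : τ₁ ≤ τ₂) (B : ℕ → ℕ → ℝ) (hB : ∀ m ∈ U, ∀ n ∈ U, m ≠ n → c m ≠ c n ∧ 2 / |c m - c n| ≤ B m n) :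
    ∫ t in τ₁..τ₂, ‖∑ n ∈ U, a n * Complex.exp ((c n : ℂ) * I * t)‖ ^ 2 ≤
      ∑ m ∈ U, ∑ n ∈ U, ‖a m‖ * ‖a n‖ * (if m = n then τ₂ - τ₁ else B m n) := by
  have key : ∀ t : ℝ, ((‖∑ n ∈ U, a n * Complex.exp ((c n : ℂ) * I * t)‖ ^ 2 : ℝ) : ℂ) =
      ∑ m ∈ U, ∑ n ∈ U, a m * (starRingEnd ℂ) (a n) *
        Complex.exp (((c m - c n : ℝ) : ℂ) * I * t) := by
    intro t
    push_cast
    rw [← mul_conj', map_sum, sum_mul_sum]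
    refine sum_congr rfl fun m _ => sum_congr rfl fun n _ => ?_
    rw [map_mul, ← exp_conj]
    have : (starRingEnd ℂ) ((c n : ℂ) * I * t) = -((c n : ℂ) * I * t) := by simp
    rw [this, mul_mul_mul_comm, ← Complex.exp_add]
    congr 2
    ring
  have hitg : ((∫ t in τ₁..τ₂, ‖∑ n ∈ U, a n * Complex.exp ((c n : ℂ) * I * t)‖ ^ 2 : ℝ) : ℂ)
      = ∑ m ∈ U, ∑ n ∈ U, a m * (starRingEnd ℂ) (a n) *
        ∫ t in τ₁..τ₂, Complex.exp (((c m - c n : ℝ) : ℂ) * I * t) := by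
    rw [← intervalIntegral.integral_ofReal]
    simp only [key]
    have hi : ∀ m n : ℕ, IntervalIntegrable (fun t : ℝ => a m * (starRingEnd ℂ) (a n) *
        Complex.exp (((c m - c n : ℝ) : ℂ) * I * t)) MeasureTheory.volume τ₁ τ₂ :=
      fun m n => Continuous.intervalIntegrable (by fun_prop) _ _
    rw [integral_finsetSum fun m _ => Continuous.intervalIntegrable (by fun_prop) _ _]
    refine sum_congr rfl fun m _ => ?_
    rw [integral_finsetSum fun n _ => hi m n]
    exact sum_congr rfl fun n _ => integral_const_mul _ _
  refine (le_abs_self _).trans ?_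
  rw [← norm_eq_abs, ← norm_real, hitg]
  refine (norm_sum_le _ _).trans (sum_le_sum fun m hm => (norm_sum_le _ _).trans
    (sum_le_sum fun n hn => ?_))
  rw [norm_mul, norm_mul, RCLike.norm_conj]
  gcongr
  split_ifs with h
  · subst h
    simp only [sub_self, ofReal_zero, zero_mul, Complex.exp_zero,
      integral_const, norm_smul, norm_one, mul_one, norm_eq_abs]
    rw [abs_of_nonneg (sub_nonneg.2 hτ)]
  · obtain ⟨h1, h2⟩ := hB m hm n hn h
    exact (norm_integral_exp_mul_I_le (sub_ne_zero.2 h1) _ _).trans h2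

lemma sum_inv_abs_sub_le {N m : ℕ} (hm : m ∈ Icc 1 N) :
    ∑ n ∈ Icc 1 N, (if m = n then 0 else 1 / |(m : ℝ) - n|) ≤ 2 * (1 + log N) := by
  have hH : ∑ k ∈ Icc 1 N, (1 / (k : ℝ)) ≤ 1 + log N := by
    have := harmonic_le_one_add_log N
    rw [harmonic_eq_sum_Icc] at this
    push_cast at this
    simpa [one_div] using this
  rw [mem_Icc] at hm
  have h1 : ∑ n ∈ Icc 1 N, (if m = n then 0 else 1 / |(m : ℝ) - n|) =
      ∑ n ∈ Ico 1 m, 1 / |(m : ℝ) - n| + ∑ n ∈ Ico (m + 1) (N + 1), 1 / |(m : ℝ) - n| := by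
    have e : Icc 1 N = Ico 1 (N + 1) := rfl
    rw [e, ← sum_Ico_consecutive _ hm.1 (by omega : m ≤ N + 1),
      sum_eq_sum_Ico_succ_bot (by omega : m < N + 1)]
    simp only [if_true, zero_add]
    congr 1
    · exact sum_congr rfl fun n hn => if_neg (by have := mem_Ico.1 hn; omega)
    · exact sum_congr rfl fun n hn => if_neg (by have := mem_Ico.1 hn; omega)
  have h2 : ∑ n ∈ Ico 1 m, 1 / |(m : ℝ) - n| ≤ ∑ k ∈ Icc 1 N, (1 / (k : ℝ)) := by
    have : ∑ n ∈ Ico 1 m, 1 / |(m : ℝ) - n| = ∑ k ∈ Ico 1 m, (1 / (k : ℝ)) := by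
      refine sum_nbij' (fun n => m - n) (fun n => m - n) ?_ ?_ ?_ ?_ ?_ <;> intro n hn <;>
        rw [mem_Ico] at hn
      · exact mem_Ico.2 (by omega)
      · exact mem_Ico.2 (by omega)
      · omega
      · omega
      · have : (n : ℝ) ≤ m := mod_cast hn.2.le
        rw [Nat.cast_sub hn.2.le, abs_of_nonneg (by linarith)]
    rw [this]
    refine sum_le_sum_of_subset_of_nonneg (fun n hn => ?_) fun _ _ _ => by positivity
    rw [mem_Ico] at hn
    exact mem_Icc.2 (by omega)
  have h3 : ∑ n ∈ Ico (m + 1) (N + 1), 1 / |(m : ℝ) - n| ≤ ∑ k ∈ Icc 1 N, (1 / (k : ℝ)) := by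
    have : ∑ n ∈ Ico (m + 1) (N + 1), 1 / |(m : ℝ) - n| =
        ∑ k ∈ Ico 1 (N + 1 - m), (1 / (k : ℝ)) := by
      refine sum_nbij' (fun n => n - m) (fun n => n + m) ?_ ?_ ?_ ?_ ?_ <;> intro n hn <;>
        rw [mem_Ico] at hn
      · exact mem_Ico.2 (by omega)
      · exact mem_Ico.2 (by omega)
      · omega
      · omega
      · have : (m : ℝ) ≤ n := mod_cast (by omega : m ≤ n)
        rw [Nat.cast_sub (by omega), abs_sub_comm, abs_of_nonneg (by linarith)]
    rw [this]
    refine sum_le_sum_of_subset_of_nonneg (fun n hn => ?_) fun _ _ _ => by positivity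
    rw [mem_Ico] at hn
    exact mem_Icc.2 (by omega)
  linarith

/-- Mean value theorem for Dirichlet polynomials. -/
lemma integral_norm_sq_dirichletPoly_le {U : Finset ℕ} (hU : ∀ n ∈ U, 1 ≤ n ∧ n ≤ N)
    (a : ℕ → ℂ) {κ : ℝ} (hκ : 1 ≤ κ) {τ₁ τ₂ : ℝ} (hτ : τ₁ ≤ τ₂) :
    ∫ t in τ₁..τ₂, ‖∑ n ∈ U, a n * (n : ℂ) ^ (-((κ * t : ℝ) : ℂ) * I)‖ ^ 2 ≤
      ((τ₂ - τ₁) + 4 * N * (1 + log N)) * ∑ n ∈ U, ‖a n‖ ^ 2 := by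
  have hc : ∀ t : ℝ, ∑ n ∈ U, a n * (n : ℂ) ^ (-((κ * t : ℝ) : ℂ) * I) =
      ∑ n ∈ U, a n * Complex.exp (((-κ * log n : ℝ) : ℂ) * I * t) := by
    intro t
    refine sum_congr rfl fun n hn => ?_
    have hn0 : (n : ℂ) ≠ 0 := mod_cast (by have := hU n hn; omega : n ≠ 0)
    rw [cpow_def_of_ne_zero hn0, ← natCast_log]
    congr 2
    push_cast; ring
  simp only [hc]
  refine (integral_norm_sq_sum_exp_le U a _ hτ (fun m n => 2 * N * (1 / |(m : ℝ) - n|)) ?_).trans ?_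
  · intro m hm n hn hmn
    have hm1 : (1:ℝ) ≤ m := mod_cast (hU m hm).1
    have hn1 : (1:ℝ) ≤ n := mod_cast (hU n hn).1
    have hmN : (m:ℝ) ≤ N := mod_cast (hU m hm).2
    have hnN : (n:ℝ) ≤ N := mod_cast (hU n hn).2
    have hmn' : (m:ℝ) ≠ n := mod_cast hmn
    have aux : ∀ x y : ℝ, 1 ≤ x → x < y → y ≤ N → |x - y| / N ≤ log y - log x := by
      intro x y hx hxy hyN
      have hx0 : 0 < x := by linarith
      have hy0 : 0 < y := by linarith
      have := one_sub_inv_le_log_of_pos (show 0 < y / x by positivity)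
      rw [log_div (by linarith) (by linarith), inv_div] at this
      refine le_trans ?_ this
      rw [abs_of_neg (by linarith)]
      have e : 1 - x / y = -(x - y) / y := by field_simp; ring
      rw [e]
      gcongr
      linarith
    have h : |(m:ℝ) - n| / N ≤ |(-κ * log m) - (-κ * log n)| := by
      rw [show (-κ * log m) - (-κ * log n) = κ * (log n - log m) by ring, abs_mul,
        abs_of_nonneg (by linarith : 0 ≤ κ)]
      have h2 : |(m:ℝ) - n| / N ≤ |log n - log m| := by
        rcases lt_or_gt_of_ne hmn' with h | h
        · exact (aux _ _ hm1 h hnN).trans (le_abs_self _)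
        · rw [abs_sub_comm, abs_sub_comm (log n)]
          exact (aux _ _ hn1 h hmN).trans (le_abs_self _)
      refine h2.trans (le_mul_of_one_le_left (abs_nonneg _) hκ)
    have hpos : 0 < |(m:ℝ) - n| / N := div_pos (abs_pos.2 (sub_ne_zero.2 hmn')) (by linarith)
    refine ⟨fun h' => ?_, ?_⟩
    · rw [h', sub_self, abs_zero] at h; linarith
    · calc _ ≤ 2 / (|(m:ℝ) - n| / N) := by gcongr
        _ = _ := by
          have : |(m:ℝ) - n| ≠ 0 := (abs_pos.2 (sub_ne_zero.2 hmn')).ne'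
          field_simp
  · rcases Nat.eq_zero_or_pos N with rfl | hN
    · have : U = ∅ := eq_empty_of_forall_notMem fun n hn => by have := hU n hn; omega
      simp [this]
    have hlog : 0 ≤ log N := log_natCast_nonneg N
    set D : ℕ → ℕ → ℝ := fun m n => if m = n then τ₂ - τ₁ else 2 * N * (1 / |(m : ℝ) - n|) with hD
    have hDs : ∀ m n, D m n = D n m := fun m n => by
      simp only [hD, eq_comm (a := m), abs_sub_comm (m : ℝ)]
    have hD0 : ∀ m n, 0 ≤ D m n := fun m n => by
      simp only [hD]; split_ifs
      · linarith
      · positivity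
    have hrow : ∀ m ∈ U, ∑ n ∈ U, D m n ≤ (τ₂ - τ₁) + 4 * N * (1 + log N) := by
      intro m hm
      have hm' : m ∈ Icc 1 N := mem_Icc.2 (hU m hm)
      calc ∑ n ∈ U, D m n ≤ ∑ n ∈ Icc 1 N, D m n :=
            sum_le_sum_of_subset_of_nonneg (fun n hn => mem_Icc.2 (hU n hn)) fun n _ _ => hD0 m n
        _ = ∑ n ∈ Icc 1 N, ((if m = n then τ₂ - τ₁ else 0) +
              2 * N * (if m = n then 0 else 1 / |(m : ℝ) - n|)) := by
            refine sum_congr rfl fun n _ => ?_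
            simp only [hD]; split_ifs <;> simp
        _ = (τ₂ - τ₁) + 2 * N * ∑ n ∈ Icc 1 N, (if m = n then 0 else 1 / |(m : ℝ) - n|) := by
            rw [sum_add_distrib, ← mul_sum, sum_ite_eq, if_pos hm']
        _ ≤ (τ₂ - τ₁) + 2 * N * (2 * (1 + log N)) := by
            gcongr
            exact sum_inv_abs_sub_le hm'
        _ = _ := by ring
    have h1 : ∑ m ∈ U, ∑ n ∈ U, ‖a m‖ * ‖a n‖ * D m n ≤
        ∑ m ∈ U, ∑ n ∈ U, (‖a m‖ ^ 2 / 2 * D m n + ‖a n‖ ^ 2 / 2 * D m n) := by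
      refine sum_le_sum fun m _ => sum_le_sum fun n _ => ?_
      rw [← add_mul]
      refine mul_le_mul_of_nonneg_right ?_ (hD0 m n)
      nlinarith [sq_nonneg (‖a m‖ - ‖a n‖)]
    refine h1.trans ?_
    simp only [sum_add_distrib]
    have h2 : ∑ m ∈ U, ∑ n ∈ U, ‖a n‖ ^ 2 / 2 * D m n = ∑ m ∈ U, ∑ n ∈ U, ‖a m‖ ^ 2 / 2 * D m n := by
      rw [sum_comm]
      simp only [hDs]
    rw [h2, ← two_mul, mul_sum, mul_sum]
    refine sum_le_sum fun m hm => ?_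
    rw [← mul_sum]
    have := mul_le_mul_of_nonneg_left (hrow m hm) (sq_nonneg ‖a m‖)
    linarith

/-! ### Dyadic pieces of Dirichlet `L`-functions and products of them -/

/-- The dyadic piece `∑_{2^j ≤ n < 2^(j+1)} χ(n) n^(-κ s)`. -/
noncomputable def dpiece (κ : ℕ) (s : ℂ) (j : ℕ) : ℂ :=
  ∑ n ∈ Ico (2 ^ j : ℕ) (2 ^ (j + 1)), χ n * (n : ℂ) ^ (-((κ : ℂ) * s))

lemma re_natCast_mul (κ : ℕ) (s : ℂ) : ((κ : ℂ) * s).re = κ * s.re := by simp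

lemma im_natCast_mul (κ : ℕ) (s : ℂ) : ((κ : ℂ) * s).im = κ * s.im := by simp

lemma natCast_prod_cpow {ι : Type} (S : Finset ι) (x : ι → ℕ) (s : ℂ) :
    ((∏ i ∈ S, x i : ℕ) : ℂ) ^ s = ∏ i ∈ S, (x i : ℂ) ^ s := by
  induction S using Finset.induction_on with
  | empty => simp
  | insert a S ha ih =>
    rw [prod_insert ha, prod_insert ha, Nat.cast_mul, natCast_mul_natCast_cpow, ih]

lemma continuous_dpiece (κ : ℕ) (j : ℕ) : Continuous fun s => dpiece χ κ s j := by
  unfold dpiece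
  refine continuous_finsetSum _ fun n hn => continuous_const.mul ?_
  have hn0 : (n : ℂ) ≠ 0 := by
    have h1 : 0 < 2 ^ j := by positivity
    have := (mem_Ico.1 hn).1
    exact_mod_cast (by omega : n ≠ 0)
  exact Continuous.const_cpow (by fun_prop) (Or.inl hn0)

lemma norm_natCast_cpow_neg_mul {n κ : ℕ} (hn : 0 < n) (s : ℂ) :
    ‖(n : ℂ) ^ (-((κ : ℂ) * s))‖ = (n : ℝ) ^ (-(κ * s.re)) := by
  rw [norm_natCast_cpow_of_pos hn]
  congr 1
  simp

lemma natCast_rpow_neg_mul_le {n κ : ℕ} {j : ℕ} (hσ : 1 / 8 ≤ σ) (hn : 2 ^ j ≤ n) :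
    (n : ℝ) ^ (-(κ * σ)) ≤ (2:ℝ) ^ (-(κ / 8 * j) : ℝ) := by
  have hn' : (2:ℝ) ^ j ≤ n := mod_cast hn
  have h1 : (1:ℝ) ≤ 2 ^ j := one_le_pow₀ (by norm_num)
  calc (n : ℝ) ^ (-(κ * σ)) ≤ (n : ℝ) ^ (-(κ * (1 / 8)) : ℝ) :=
        rpow_le_rpow_of_exponent_le (by linarith) (by gcongr)
    _ ≤ ((2:ℝ) ^ j) ^ (-(κ * (1 / 8)) : ℝ) := rpow_le_rpow_of_nonpos (by positivity) hn' (by simp)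
    _ = _ := by
        rw [← rpow_natCast, ← rpow_mul (by norm_num)]
        congr 1; ring

lemma norm_dpiece_le_trivial (κ : ℕ) (hs : 1 / 8 ≤ s.re)
    (j : ℕ) : ‖dpiece χ κ s j‖ ≤ (2:ℝ) ^ ((1 - κ / 8) * j : ℝ) := by
  have h : ∀ n ∈ Ico (2 ^ j : ℕ) (2 ^ (j + 1)), ‖χ n * (n : ℂ) ^ (-((κ : ℂ) * s))‖ ≤
      (2:ℝ) ^ (-(κ / 8 * j) : ℝ) := by
    intro n hn
    rw [mem_Ico] at hn
    have h1 : 0 < 2 ^ j := by positivity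
    rw [norm_mul, norm_natCast_cpow_neg_mul (by omega)]
    calc _ ≤ 1 * (2:ℝ) ^ (-(κ / 8 * j) : ℝ) := by
          gcongr
          · exact norm_le_one χ _
          · exact natCast_rpow_neg_mul_le hs hn.1
      _ = _ := one_mul _
  refine (norm_sum_le _ _).trans ((sum_le_card_nsmul _ _ _ h).trans (le_of_eq ?_))
  rw [Nat.card_Ico, pow_succ, mul_two, Nat.add_sub_cancel, nsmul_eq_mul]
  push_cast
  rw [← rpow_natCast, ← rpow_add (by norm_num)]
  congr 1; ring

/-- `t` lies in the dyadic range `2^J ≤ |t| ≤ 2^(J+1)`. -/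
def InDyadic (J : ℕ) (t : ℝ) : Prop := (2:ℝ) ^ J ≤ |t| ∧ |t| ≤ 2 * 2 ^ J

lemma norm_dpiece_le_sqrt (hκ : 4 ≤ κ) (hκ' : κ ≤ 7) (hs : 1 / 8 ≤ s.re) {J j : ℕ} (ht : InDyadic J s.im) (hj : j ≤ J + 6) :
    ‖dpiece χ κ s j‖ ≤ 3000 * (2:ℝ) ^ ((J : ℝ) / 2 - κ / 8 * j) := by
  set t := |((κ : ℂ) * s).im| with htdef
  have hκ1 : (4:ℝ) ≤ κ := mod_cast hκ
  have hκ2 : (κ:ℝ) ≤ 7 := mod_cast hκ'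
  have ht' : t = κ * |s.im| := by rw [htdef, im_natCast_mul, abs_mul, abs_of_nonneg (by positivity)]
  have hτ : (0:ℝ) < 2 ^ J := by positivity
  have h1 : 4 * 2 ^ J ≤ t := by rw [ht']; nlinarith [ht.1]
  have h2 : t ≤ 16 * 2 ^ J := by rw [ht']; nlinarith [ht.2, ht.1]
  have ht0 : 0 < t := by linarith
  have h := norm_dirichletPoly_le χ (N := 2 ^ j) (by positivity) ((κ : ℂ) * s)
    (by rw [re_natCast_mul]; exact mul_nonneg (by positivity) (by linarith)) (abs_pos.1 ht0)
  rw [← htdef, ← pow_succ'] at h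
  refine h.trans ?_
  have hr : √((2:ℝ) ^ J) = (2:ℝ) ^ ((J : ℝ) / 2) := by
    rw [sqrt_eq_rpow, ← rpow_natCast, ← rpow_mul (by norm_num)]
    congr 1; ring
  have hr0 : 0 < √((2:ℝ) ^ J) := sqrt_pos.2 hτ
  have h3 : √t ≤ 4 * √((2:ℝ) ^ J) := by
    rw [show (4:ℝ) = √16 by rw [show (16:ℝ) = 4 ^ 2 by norm_num]; simp, ← sqrt_mul (by norm_num)]
    exact sqrt_le_sqrt h2
  have h4 : 2 * √((2:ℝ) ^ J) ≤ √t := by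
    rw [show (2:ℝ) * √((2:ℝ) ^ J) = √4 * √((2:ℝ) ^ J) by
      rw [show (4:ℝ) = 2 ^ 2 by norm_num]; simp, ← sqrt_mul (by norm_num)]
    exact sqrt_le_sqrt h1
  have h5 : ((2 ^ j : ℕ) : ℝ) / √t ≤ 32 * √((2:ℝ) ^ J) := by
    rw [div_le_iff₀ (by linarith)]
    have h6 : (2:ℝ) ^ j ≤ 64 * 2 ^ J := by
      calc (2:ℝ) ^ j ≤ 2 ^ (J + 6) := pow_le_pow_right₀ (by norm_num) hj
        _ = _ := by ring
    have h7 : √((2:ℝ) ^ J) * √((2:ℝ) ^ J) = 2 ^ J := mul_self_sqrt hτ.le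
    push_cast
    nlinarith
  have h8 : ((2 ^ j : ℕ) : ℝ) ^ (-((κ : ℂ) * s).re) ≤ (2:ℝ) ^ (-(κ / 8 * j) : ℝ) := by
    rw [re_natCast_mul]
    exact natCast_rpow_neg_mul_le hs le_rfl
  calc _ ≤ (2:ℝ) ^ (-(κ / 8 * j) : ℝ) * (64 * (4 * √((2:ℝ) ^ J) + 32 * √((2:ℝ) ^ J))) := by gcongr
    _ = 2304 * (√((2:ℝ) ^ J) * (2:ℝ) ^ (-(κ / 8 * j) : ℝ)) := by ring
    _ = 2304 * (2:ℝ) ^ ((J : ℝ) / 2 - κ / 8 * j) := by rw [hr, ← rpow_add (by norm_num)]; rfl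
    _ ≤ _ := by gcongr; norm_num

section Group

variable {ι : Type} [Fintype ι]

lemma norm_prod_dpiece_le_trivial (χ : ι → DirichletCharacter ℂ 8) (κ : ℕ)
    (hs : 1 / 8 ≤ s.re) (k : ι → ℕ) :
    ‖∏ i, dpiece (χ i) κ s (k i)‖ ≤ (2:ℝ) ^ ((1 - κ / 8) * (∑ i, k i : ℕ) : ℝ) := by
  rw [norm_prod]
  refine (prod_le_prod (fun _ _ => norm_nonneg _)
    fun i _ => norm_dpiece_le_trivial (χ i) κ hs (k i)).trans (le_of_eq ?_)
  rw [← rpow_sum_of_pos (by norm_num)]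
  congr 1
  push_cast
  rw [mul_sum]

lemma norm_prod_dpiece_le_sqrt (χ : ι → DirichletCharacter ℂ 8) (hκ : 4 ≤ κ) (hκ' : κ ≤ 7) (hs : 1 / 8 ≤ s.re) (ht : InDyadic J s.im) (k : ι → ℕ) (hk : ∀ i, k i ≤ J + 6) :
    ‖∏ i, dpiece (χ i) κ s (k i)‖ ≤
      3000 ^ Fintype.card ι * (2:ℝ) ^ ((J : ℝ) / 2 * Fintype.card ι - κ / 8 * (∑ i, k i : ℕ)) := by
  rw [norm_prod]
  refine (prod_le_prod (fun _ _ => norm_nonneg _)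
    fun i _ => norm_dpiece_le_sqrt (χ i) hκ hκ' hs ht (hk i)).trans (le_of_eq ?_)
  rw [prod_mul_distrib, prod_const, card_univ,
    ← rpow_sum_of_pos (by norm_num), sum_sub_distrib, ← mul_sum]
  congr 2
  push_cast
  rw [sum_const, card_univ, nsmul_eq_mul, mul_comm ((J : ℝ) / 2)]

/-- Coefficients of a product of dyadic pieces. -/
noncomputable def pieceCoeff (χ : ι → DirichletCharacter ℂ 8) (k : ι → ℕ) (n : ℕ) : ℂ :=
  ∑ x ∈ Fintype.piFinset (fun i => Ico (2 ^ k i) (2 ^ (k i + 1))) with ∏ i, x i = n,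
    ∏ i, χ i (x i : ZMod 8)

lemma prod_dpiece_eq (χ : ι → DirichletCharacter ℂ 8) (κ : ℕ) (s : ℂ) (k : ι → ℕ) :
    ∏ i, dpiece (χ i) κ s (k i) = ∑ n ∈ Icc (2 ^ ∑ i, k i) (2 ^ Fintype.card ι * 2 ^ ∑ i, k i),
        pieceCoeff χ k n * (n : ℂ) ^ (-((κ : ℂ) * s)) := by
  simp only [dpiece]
  rw [prod_univ_sum]
  rw [← sum_fiberwise_of_maps_to (g := fun x : ι → ℕ => ∏ i, x i)
    (t := Icc (2 ^ ∑ i, k i) (2 ^ Fintype.card ι * 2 ^ ∑ i, k i))]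
  · refine sum_congr rfl fun n _ => ?_
    rw [pieceCoeff, sum_mul]
    refine sum_congr rfl fun x hx => ?_
    rw [prod_mul_distrib, ← (mem_filter.1 hx).2]
    rw [natCast_prod_cpow]
  · intro x hx
    rw [Fintype.mem_piFinset] at hx
    rw [mem_Icc]
    constructor
    · rw [← prod_pow_eq_pow_sum]
      exact prod_le_prod' fun i _ => (mem_Ico.1 (hx i)).1
    · calc ∏ i, x i ≤ ∏ i, 2 ^ (k i + 1) :=
            prod_le_prod' fun i _ => (mem_Ico.1 (hx i)).2.le
        _ = _ := by
          rw [prod_pow_eq_pow_sum, sum_add_distrib, pow_add, mul_comm]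
          simp

lemma norm_pieceCoeff_le (χ : ι → DirichletCharacter ℂ 8) (k : ι → ℕ) {n : ℕ} (hn : n ≠ 0) :
    ‖pieceCoeff χ k n‖ ≤ (n.divisors.card : ℝ) ^ Fintype.card ι := by
  rw [pieceCoeff]
  refine (norm_sum_le _ _).trans ((sum_le_card_nsmul _ _ 1 fun x _ => ?_).trans ?_)
  · rw [norm_prod]
    exact prod_le_one (fun _ _ => norm_nonneg _) fun i _ => norm_le_one _ _
  · rw [nsmul_eq_mul, mul_one]
    have h : (filter (fun x : ι → ℕ => ∏ i, x i = n)
        (Fintype.piFinset fun i => Ico (2 ^ k i) (2 ^ (k i + 1)))).card ≤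
        (Fintype.piFinset fun _ : ι => n.divisors).card := by
      refine card_le_card fun x hx => Fintype.mem_piFinset.2 fun i => ?_
      rw [Nat.mem_divisors]
      exact ⟨(mem_filter.1 hx).2 ▸ dvd_prod_of_mem _ (mem_univ i), hn⟩
    rw [Fintype.card_piFinset, prod_const, card_univ] at h
    exact_mod_cast h

end Group

lemma exists_add_natCast_le_mul_two_rpow {ε : ℝ} (hε : 0 < ε) (A : ℝ) :
    ∃ C : ℝ, 0 ≤ C ∧ ∀ b : ℕ, A + b ≤ C * (2:ℝ) ^ (ε * b) := by
  have hl : 0 < log 2 := log_pos (by norm_num)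
  have h0 : 0 < ε * log 2 := mul_pos hε hl
  refine ⟨|A| + 1 / (ε * log 2), by positivity, fun b => ?_⟩
  have h1 : 1 + ε * log 2 * b ≤ (2:ℝ) ^ (ε * b) := by
    rw [rpow_def_of_pos (by norm_num)]
    have := add_one_le_exp (log 2 * (ε * b))
    linarith
  have h2 : 1 / (ε * log 2) * (ε * log 2 * b) = b := by field_simp
  have h3 : 0 ≤ 1 / (ε * log 2) := by positivity
  have h4 : (0:ℝ) ≤ b := Nat.cast_nonneg b
  have h5 : 0 ≤ ε * log 2 * b := by positivity
  calc A + b ≤ |A| * 1 + 1 / (ε * log 2) * (1 + ε * log 2 * b) := by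
        linarith [le_abs_self A]
    _ ≤ |A| * (1 + ε * log 2 * b) + 1 / (ε * log 2) * (1 + ε * log 2 * b) := by
        gcongr
        linarith
    _ = (|A| + 1 / (ε * log 2)) * (1 + ε * log 2 * b) := by ring
    _ ≤ _ := by gcongr

lemma continuous_prod_dpiece {ι : Type} [Fintype ι] (χ : ι → DirichletCharacter ℂ 8) (κ : ℕ)
    (k : ι → ℕ) (σ : ℝ) :
    Continuous fun t : ℝ => ∏ i, dpiece (χ i) κ (σ + t * I) (k i) :=
  continuous_finsetProd _ fun i _ => (continuous_dpiece (χ i) κ (k i)).comp (by fun_prop)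

/-- Mean square of a product of dyadic pieces. -/
lemma exists_integral_norm_sq_prod_dpiece_le (ι : Type) [Fintype ι] {ε : ℝ} (hε : 0 < ε) :
    ∃ C : ℝ, 0 ≤ C ∧ ∀ (χ : ι → DirichletCharacter ℂ 8) (κ : ℕ), 1 ≤ κ → ∀ (k : ι → ℕ)
      (J : ℕ) (σ τ₁ τ₂ : ℝ), 1 / 8 ≤ σ → τ₂ - τ₁ = 2 ^ J →
      ∫ t in τ₁..τ₂, ‖∏ i, dpiece (χ i) κ (σ + t * I) (k i)‖ ^ 2 ≤
        C * (2:ℝ) ^ (max (J : ℝ) (∑ i, k i : ℕ) + (1 - κ / 4) * (∑ i, k i : ℕ) +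
          ε * (∑ i, k i : ℕ)) := by
  set r := Fintype.card ι with hr
  set ε₁ : ℝ := ε / (4 * (r + 1)) with hε₁
  have hε₁0 : 0 < ε₁ := by positivity
  obtain ⟨C₁, hC₁, hdiv⟩ := exists_card_divisors_le hε₁0
  obtain ⟨C₂, hC₂, hlog⟩ := exists_add_natCast_le_mul_two_rpow (half_pos hε) (1 + r)
  refine ⟨(1 + 4 * 2 ^ r) * C₂ * (C₁ ^ (2 * r) * (2:ℝ) ^ (ε / 2 * r) * 2 ^ r), by positivity, ?_⟩
  intro χ κ hκ k J σ τ₁ τ₂ hσ hτ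
  set b := ∑ i, k i with hb
  set U := Icc (2 ^ b) (2 ^ r * 2 ^ b) with hU
  have h2b : 1 ≤ 2 ^ b := Nat.one_le_two_pow
  have hUpos : ∀ n ∈ U, 1 ≤ n ∧ n ≤ 2 ^ r * 2 ^ b := fun n hn => by
    have := mem_Icc.1 hn
    exact ⟨h2b.trans this.1, this.2⟩
  have hform : ∀ t : ℝ, ∏ i, dpiece (χ i) κ (σ + t * I) (k i) =
      ∑ n ∈ U, (pieceCoeff χ k n * (n : ℂ) ^ (-((κ * σ : ℝ) : ℂ))) *
        (n : ℂ) ^ (-((κ * t : ℝ) : ℂ) * I) := by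
    intro t
    rw [prod_dpiece_eq]
    refine sum_congr rfl fun n hn => ?_
    have hn0 : (n : ℂ) ≠ 0 := mod_cast (by have := hUpos n hn; omega : n ≠ 0)
    rw [mul_assoc, ← cpow_add _ _ hn0]
    congr 2
    push_cast; ring
  simp only [hform]
  have hmv := integral_norm_sq_dirichletPoly_le hUpos
    (fun n => pieceCoeff χ k n * (n : ℂ) ^ (-((κ * σ : ℝ) : ℂ))) (κ := κ) (mod_cast hκ)
    (show τ₁ ≤ τ₂ by linarith [pow_pos (two_pos (α := ℝ)) J])
  refine hmv.trans ?_
  have hcoef : ∀ n ∈ U, ‖pieceCoeff χ k n * (n : ℂ) ^ (-((κ * σ : ℝ) : ℂ))‖ ^ 2 ≤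
      C₁ ^ (2 * r) * (2:ℝ) ^ (ε / 2 * r) * (2:ℝ) ^ (ε / 2 * b - κ / 4 * b) := by
    intro n hn
    obtain ⟨hn1, hn2⟩ := hUpos n hn
    have hn2' : (n : ℝ) ≤ (2:ℝ) ^ (r + b) := by rw [pow_add]; exact_mod_cast hn2
    have h1 : ‖pieceCoeff χ k n‖ ≤ C₁ ^ r * (2:ℝ) ^ (ε₁ * r * (r + b)) := by
      refine (norm_pieceCoeff_le χ k (by omega)).trans ?_
      calc ((n.divisors.card : ℝ)) ^ r ≤ (C₁ * (n : ℝ) ^ ε₁) ^ r := by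
            gcongr
            exact hdiv n (by omega)
        _ ≤ (C₁ * ((2:ℝ) ^ (r + b)) ^ ε₁) ^ r := by gcongr
        _ = _ := by
            rw [mul_pow, ← rpow_natCast 2 (r + b), ← rpow_mul (by norm_num),
              ← rpow_mul_natCast (by norm_num)]
            congr 2
            push_cast; ring
    have h2 : ‖(n : ℂ) ^ (-((κ * σ : ℝ) : ℂ))‖ ≤ (2:ℝ) ^ (-(κ / 8 * b) : ℝ) := by
      rw [norm_natCast_cpow_of_pos (by omega)]
      have := natCast_rpow_neg_mul_le (κ := κ) hσ (mem_Icc.1 hn).1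
      simpa using this
    have h3 : ε₁ * r * (r + b) * 2 ≤ ε / 2 * r + ε / 2 * b := by
      have h4 : ε₁ * r * 2 ≤ ε / 2 := by
        rw [hε₁, div_mul_eq_mul_div, div_mul_eq_mul_div, div_le_div_iff₀ (by positivity) (by norm_num)]
        nlinarith
      have h5 : (0:ℝ) ≤ r + b := by positivity
      nlinarith
    calc ‖pieceCoeff χ k n * (n : ℂ) ^ (-((κ * σ : ℝ) : ℂ))‖ ^ 2
        ≤ (C₁ ^ r * (2:ℝ) ^ (ε₁ * r * (r + b)) * (2:ℝ) ^ (-(κ / 8 * b) : ℝ)) ^ 2 := by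
          rw [norm_mul]
          gcongr
      _ = C₁ ^ (2 * r) * (2:ℝ) ^ (ε₁ * r * (r + b) * 2 + (-(κ / 4 * b))) := by
          rw [mul_assoc, ← rpow_add (by norm_num), mul_pow, ← pow_mul, mul_comm r 2,
            ← rpow_mul_natCast (by norm_num)]
          congr 2
          push_cast; ring
      _ ≤ C₁ ^ (2 * r) * (2:ℝ) ^ (ε / 2 * r + (ε / 2 * b - κ / 4 * b)) := by
          exact mul_le_mul_of_nonneg_left
            (rpow_le_rpow_of_exponent_le (by norm_num) (by linarith)) (by positivity)
      _ = _ := by rw [rpow_add (by norm_num)]; ring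
  have hsum := sum_le_card_nsmul _ _ _ hcoef
  have hcard : (U.card : ℝ) ≤ 2 ^ r * (2:ℝ) ^ (b : ℝ) := by
    rw [rpow_natCast]
    have : U.card ≤ 2 ^ r * 2 ^ b := by rw [hU, Nat.card_Icc]; omega
    exact_mod_cast this
  rw [nsmul_eq_mul] at hsum
  have hM0 : (2:ℝ) ^ J ≤ (2:ℝ) ^ (max (J : ℝ) b) := by
    rw [← rpow_natCast]
    exact rpow_le_rpow_of_exponent_le (by norm_num) (le_max_left _ _)
  have hM1 : (2:ℝ) ^ b ≤ (2:ℝ) ^ (max (J : ℝ) b) := by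
    rw [← rpow_natCast]
    exact rpow_le_rpow_of_exponent_le (by norm_num) (le_max_right _ _)
  have hlg : 1 + log ((2 ^ r * 2 ^ b : ℕ) : ℝ) ≤ 1 + r + b := by
    rw [← pow_add]
    push_cast
    rw [log_pow]
    have := log_two_lt_d9
    push_cast
    nlinarith [Nat.cast_nonneg (α := ℝ) r, Nat.cast_nonneg (α := ℝ) b]
  have hlg0 : 0 ≤ log ((2 ^ r * 2 ^ b : ℕ) : ℝ) := log_natCast_nonneg _
  have hfac : (τ₂ - τ₁) + 4 * ((2 ^ r * 2 ^ b : ℕ) : ℝ) * (1 + log ((2 ^ r * 2 ^ b : ℕ) : ℝ)) ≤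
      (1 + 4 * 2 ^ r) * C₂ * (2:ℝ) ^ (max (J : ℝ) b + ε / 2 * b) := by
    have h1 : (1:ℝ) ≤ 1 + r + b := by
      have := Nat.cast_nonneg (α := ℝ) r
      have := Nat.cast_nonneg (α := ℝ) b
      linarith
    calc _ ≤ (2:ℝ) ^ (max (J : ℝ) b) * (1 + r + b) +
          4 * (2 ^ r * (2:ℝ) ^ (max (J : ℝ) b)) * (1 + r + b) := by
          rw [hτ]
          have h2 : (2:ℝ) ^ J ≤ (2:ℝ) ^ (max (J : ℝ) b) * (1 + r + b) :=
            hM0.trans (le_mul_of_one_le_right (by positivity) h1)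
          have h3 : 4 * ((2 ^ r * 2 ^ b : ℕ) : ℝ) * (1 + log ((2 ^ r * 2 ^ b : ℕ) : ℝ)) ≤
              4 * (2 ^ r * (2:ℝ) ^ (max (J : ℝ) b)) * (1 + r + b) := by
            push_cast at hlg hlg0 ⊢
            gcongr
          linarith
      _ = (1 + 4 * 2 ^ r) * ((2:ℝ) ^ (max (J : ℝ) b)) * (1 + r + b) := by ring
      _ ≤ (1 + 4 * 2 ^ r) * ((2:ℝ) ^ (max (J : ℝ) b)) * (C₂ * (2:ℝ) ^ (ε / 2 * b)) := by
          gcongr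
          exact hlog b
      _ = _ := by rw [rpow_add (by norm_num)]; ring
  have hS0 : 0 ≤ ∑ n ∈ U, ‖pieceCoeff χ k n * (n : ℂ) ^ (-((κ * σ : ℝ) : ℂ))‖ ^ 2 :=
    sum_nonneg fun _ _ => by positivity
  calc _ ≤ ((1 + 4 * 2 ^ r) * C₂ * (2:ℝ) ^ (max (J : ℝ) b + ε / 2 * b)) *
        ((2 ^ r * (2:ℝ) ^ (b : ℝ)) *
          (C₁ ^ (2 * r) * (2:ℝ) ^ (ε / 2 * r) * (2:ℝ) ^ (ε / 2 * b - κ / 4 * b))) := by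
        refine mul_le_mul hfac (hsum.trans ?_) hS0 (by positivity)
        gcongr
    _ = (1 + 4 * 2 ^ r) * C₂ * (C₁ ^ (2 * r) * (2:ℝ) ^ (ε / 2 * r) * 2 ^ r) *
        ((2:ℝ) ^ (max (J : ℝ) b + ε / 2 * b) * ((2:ℝ) ^ (b : ℝ) *
          (2:ℝ) ^ (ε / 2 * b - κ / 4 * b))) := by ring
    _ = _ := by
        rw [← rpow_add (by norm_num), ← rpow_add (by norm_num)]
        congr 2; ring

lemma sum_range_dpiece (κ : ℕ) (s : ℂ) (m : ℕ) : ∑ j ∈ range m, dpiece χ κ s j =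
      ∑ n ∈ Ico (1 : ℕ) (2 ^ m), χ n * (n : ℂ) ^ (-((κ : ℂ) * s)) := by
  induction m with
  | zero => simp
  | succ m ih =>
    rw [sum_range_succ, ih, dpiece, sum_Ico_consecutive]
    · exact Nat.one_le_two_pow
    · exact Nat.pow_le_pow_right (by norm_num) (by omega)

lemma norm_LFunction_sub_sum_dpiece_le (hκ : 4 ≤ κ)
    (hκ' : κ ≤ 7) (hs : 1 / 8 ≤ s.re) (hs' : s.re ≤ 1 / 8 + 1 / 200)
    (ht : InDyadic J s.im) :
    ‖χ.LFunction (κ * s) - ∑ j ∈ range (J + 6), dpiece χ κ s j‖ ≤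
      20000 * (2:ℝ) ^ ((1 - κ / 4) * J : ℝ) := by
  have hκ1 : (4:ℝ) ≤ κ := mod_cast hκ
  have hκ2 : (κ:ℝ) ≤ 7 := mod_cast hκ'
  have hτ : (1:ℝ) ≤ 2 ^ J := one_le_pow₀ (by norm_num)
  have him : |((κ : ℂ) * s).im| = κ * |s.im| := by
    rw [im_natCast_mul, abs_mul, abs_of_nonneg (by positivity)]
  obtain ⟨h1, h2⟩ := ht
  have hM : ((8 * (8 * 2 ^ J : ℕ) : ℝ)) = 64 * 2 ^ J := by push_cast; ring
  have hpow : 2 ^ (J + 6) = 8 * (8 * 2 ^ J) := by ring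
  have key := norm_LFunction_sub_le χ (s := κ * s) (M := 8 * 2 ^ J)
    (by rw [re_natCast_mul]; nlinarith) (by rw [re_natCast_mul]; nlinarith)
    (by rw [him]; nlinarith) (by rw [him, hM]; nlinarith) (by rw [him, hM]; nlinarith)
  rw [sum_range_dpiece, hpow]
  refine key.trans (mul_le_mul_of_nonneg_left ?_ (by norm_num))
  rw [him, re_natCast_mul]
  have h3 : (2:ℝ) ^ J ≤ κ * |s.im| := by nlinarith
  calc (κ * |s.im|) ^ (1 - 2 * (κ * s.re)) ≤ ((2:ℝ) ^ J) ^ (1 - 2 * (κ * s.re)) :=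
        rpow_le_rpow_of_nonpos (by positivity) h3 (by nlinarith)
    _ ≤ ((2:ℝ) ^ J) ^ (1 - κ / 4 : ℝ) := rpow_le_rpow_of_exponent_le hτ (by nlinarith)
    _ = _ := by rw [← rpow_natCast, ← rpow_mul (by norm_num), mul_comm]

lemma norm_dpiece_le_interp (hκ : 4 ≤ κ) (hκ' : κ ≤ 7) (hs : 1 / 8 ≤ s.re) {J j : ℕ} (ht : InDyadic J s.im) (hj : j ≤ J + 6) :
    ‖dpiece χ κ s j‖ ≤ 3000 * (2:ℝ) ^ ((1 - κ / 8) * J / 2 : ℝ) := by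
  have hκ2 : (κ:ℝ) ≤ 7 := mod_cast hκ'
  rcases le_total (2 * j) J with h | h
  · have h' : (2:ℝ) * j ≤ J := mod_cast h
    refine (norm_dpiece_le_trivial χ κ hs j).trans ?_
    have : (2:ℝ) ^ ((1 - κ / 8) * j : ℝ) ≤ (2:ℝ) ^ ((1 - κ / 8) * J / 2 : ℝ) :=
      rpow_le_rpow_of_exponent_le (by norm_num) (by nlinarith)
    have h0 : (0:ℝ) < (2:ℝ) ^ ((1 - κ / 8) * J / 2 : ℝ) := by positivity
    linarith
  · have h' : (J:ℝ) ≤ 2 * j := mod_cast h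
    refine (norm_dpiece_le_sqrt χ hκ hκ' hs ht hj).trans (mul_le_mul_of_nonneg_left
        (rpow_le_rpow_of_exponent_le (by norm_num) (by nlinarith)) (by norm_num))

lemma norm_sum_dpiece_le (hκ : 4 ≤ κ) (hκ' : κ ≤ 7) (hs : 1 / 8 ≤ s.re) (ht : InDyadic J s.im) :
    ‖∑ j ∈ range (J + 6), dpiece χ κ s j‖ ≤
      18000 * (J + 1) * (2:ℝ) ^ ((1 - κ / 8) * J / 2 : ℝ) := by
  refine (norm_sum_le _ _).trans ((sum_le_card_nsmul _ _ _ fun j hj =>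
    norm_dpiece_le_interp χ hκ hκ' hs ht (by have := mem_range.1 hj; omega)).trans ?_)
  rw [card_range, nsmul_eq_mul]
  push_cast
  have h0 : (0:ℝ) < (2:ℝ) ^ ((1 - κ / 8) * J / 2 : ℝ) := by positivity
  have hJ : (0:ℝ) ≤ J := by positivity
  nlinarith [mul_nonneg hJ h0.le]

lemma norm_LFunction_natCast_mul_le (hκ : 4 ≤ κ)
    (hκ' : κ ≤ 7) (hs : 1 / 8 ≤ s.re) (hs' : s.re ≤ 1 / 8 + 1 / 200)
    (ht : InDyadic J s.im) :
    ‖χ.LFunction (κ * s)‖ ≤ 38000 * (J + 1) * (2:ℝ) ^ ((1 - κ / 8) * J / 2 : ℝ) := by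
  have h1 := norm_LFunction_sub_sum_dpiece_le χ hκ hκ' hs hs' ht
  have h2 := norm_sum_dpiece_le χ hκ hκ' hs ht
  have hκ1 : (4:ℝ) ≤ κ := mod_cast hκ
  have h3 : (2:ℝ) ^ ((1 - κ / 4) * J : ℝ) ≤ (2:ℝ) ^ ((1 - κ / 8) * J / 2 : ℝ) := by
    have hJ : (0:ℝ) ≤ J := by positivity
    exact rpow_le_rpow_of_exponent_le (by norm_num) (by nlinarith)
  have h0 : (0:ℝ) < (2:ℝ) ^ ((1 - κ / 8) * J / 2 : ℝ) := by positivity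
  have hJ : (0:ℝ) ≤ J := by positivity
  have := norm_le_norm_sub_add (χ.LFunction (κ * s)) (∑ j ∈ range (J + 6), dpiece χ κ s j)
  nlinarith [mul_nonneg hJ h0.le]

lemma norm_prod_sub_prod_le_card_mul {ι : Type*} (S : Finset ι) (f g : ι → ℂ) (U : ι → ℝ) {ρ : ℝ}
    (hf : ∀ i ∈ S, ‖f i‖ ≤ U i) (hg : ∀ i ∈ S, ‖g i‖ ≤ U i)
    (hfg : ∀ i ∈ S, ‖f i - g i‖ ≤ ρ * U i) :
    ‖∏ i ∈ S, f i - ∏ i ∈ S, g i‖ ≤ S.card * ρ * ∏ i ∈ S, U i := by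
  induction S using Finset.induction_on with
  | empty => simp
  | insert a S ha ih =>
    rw [prod_insert ha, prod_insert ha, prod_insert ha, card_insert_of_notMem ha]
    simp only [mem_insert, forall_eq_or_imp] at hf hg hfg
    have ih' := ih hf.2 hg.2 hfg.2
    have hU : ∏ i ∈ S, ‖g i‖ ≤ ∏ i ∈ S, U i := prod_le_prod (fun _ _ => norm_nonneg _) hg.2
    have e : f a * ∏ i ∈ S, f i - g a * ∏ i ∈ S, g i =
        f a * (∏ i ∈ S, f i - ∏ i ∈ S, g i) + (f a - g a) * ∏ i ∈ S, g i := by ring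
    rw [e]
    refine (norm_add_le _ _).trans ?_
    rw [norm_mul, norm_mul, norm_prod]
    have h1 : ‖f a‖ * ‖∏ i ∈ S, f i - ∏ i ∈ S, g i‖ ≤ U a * (S.card * ρ * ∏ i ∈ S, U i) :=
      mul_le_mul hf.1 ih' (norm_nonneg _) ((norm_nonneg _).trans hf.1)
    have h2 : ‖f a - g a‖ * ∏ i ∈ S, ‖g i‖ ≤ (ρ * U a) * ∏ i ∈ S, U i :=
      mul_le_mul hfg.1 hU (prod_nonneg fun _ _ => norm_nonneg _) ((norm_nonneg _).trans hfg.1)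
    push_cast
    linarith

lemma intervalIntegral_mul_le_mul {a b F G : ℝ} {f g : ℝ → ℝ} (hab : a ≤ b)
    (hf : ContinuousOn f (Set.Icc a b)) (hg : ContinuousOn g (Set.Icc a b)) (hF : 0 < F)
    (hG : 0 < G) (hfF : ∫ t in a..b, f t ^ 2 ≤ F ^ 2) (hgG : ∫ t in a..b, g t ^ 2 ≤ G ^ 2) :
    ∫ t in a..b, f t * g t ≤ F * G := by
  rw [← Set.uIcc_of_le hab] at hf hg
  have h1 : ∫ t in a..b, f t * g t ≤
      ∫ t in a..b, (G / (2 * F) * f t ^ 2 + F / (2 * G) * g t ^ 2) := by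
    refine integral_mono_on hab (hf.mul hg).intervalIntegrable
      (((hf.pow 2).const_mul _).add ((hg.pow 2).const_mul _)).intervalIntegrable fun t _ => ?_
    have : G / (2 * F) * f t ^ 2 + F / (2 * G) * g t ^ 2 - f t * g t =
        (G * f t - F * g t) ^ 2 / (2 * F * G) := by field_simp; ring
    have h2 : 0 ≤ (G * f t - F * g t) ^ 2 / (2 * F * G) := by positivity
    linarith
  have hi₁ : IntervalIntegrable (fun t => G / (2 * F) * f t ^ 2) MeasureTheory.volume a b :=
    ((hf.pow 2).const_mul _).intervalIntegrable
  have hi₂ : IntervalIntegrable (fun t => F / (2 * G) * g t ^ 2) MeasureTheory.volume a b :=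
    ((hg.pow 2).const_mul _).intervalIntegrable
  rw [integral_add hi₁ hi₂, integral_const_mul, integral_const_mul] at h1
  have h3 : G / (2 * F) * ∫ t in a..b, f t ^ 2 ≤ G / (2 * F) * F ^ 2 := by gcongr
  have h4 : F / (2 * G) * ∫ t in a..b, g t ^ 2 ≤ F / (2 * G) * G ^ 2 := by gcongr
  have h5 : G / (2 * F) * F ^ 2 + F / (2 * G) * G ^ 2 = F * G := by field_simp; ring
  linarith

/-- The interval `[a, b]` has length `2 ^ J` and lies in the dyadic range of height `2 ^ J`. -/
structure DyadicInterval (J : ℕ) (a b : ℝ) : Prop where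
  length : b - a = 2 ^ J
  inDyadic : ∀ t ∈ Set.Icc a b, InDyadic J t

lemma DyadicInterval.le {a b : ℝ} (h : DyadicInterval J a b) : a ≤ b := by
  have := h.length
  have : (0:ℝ) < 2 ^ J := by positivity
  linarith

lemma InDyadic.ne_zero (h : InDyadic J t) : t ≠ 0 := by
  rintro rfl
  have h1 := h.1
  rw [abs_zero] at h1
  have : (0:ℝ) < 2 ^ J := by positivity
  linarith

lemma add_mul_I_im (σ t : ℝ) : ((σ : ℂ) + t * I).im = t := by simp

lemma add_mul_I_re (σ t : ℝ) : ((σ : ℂ) + t * I).re = σ := by simp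

lemma continuousOn_LFunction_natCast_mul (hκ : κ ≠ 0) (σ : ℝ) {a b : ℝ} (h : DyadicInterval J a b) :
    ContinuousOn (fun t : ℝ => χ.LFunction (κ * (σ + t * I))) (Set.Icc a b) := by
  intro t ht
  have h0 : (κ : ℂ) * (σ + t * I) ≠ 1 := by
    intro h1
    have h2 := congrArg im h1
    rw [im_natCast_mul, add_mul_I_im, one_im] at h2
    rcases mul_eq_zero.1 h2 with h3 | h3
    · exact hκ (mod_cast h3)
    · exact (h.inDyadic t ht).ne_zero h3
  have h1 := (differentiableAt_LFunction χ _ (Or.inl h0)).continuousAt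
  exact (ContinuousAt.comp (f := fun t : ℝ => (κ : ℂ) * (σ + t * I)) h1
    (by fun_prop)).continuousWithinAt

/-- Mean square of `L(4s)`. -/
lemma exists_integral_norm_sq_LFunction_four_le :
    ∃ C : ℝ, 0 < C ∧ ∀ (χ : DirichletCharacter ℂ 8) (J : ℕ) (σ a b : ℝ), 1 / 8 ≤ σ →
      σ ≤ 1 / 8 + 1 / 200 → DyadicInterval J a b →
      ∫ t in a..b, ‖χ.LFunction ((4 : ℕ) * (σ + t * I))‖ ^ 2 ≤
        (C * (2:ℝ) ^ ((J:ℝ) / 2) * (J + 1)) ^ 2 := by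
  refine ⟨40000, by norm_num, fun χ J σ a b hσ hσ' h => ?_⟩
  have hab := h.le
  set P : ℝ → ℂ := fun t => ∑ j ∈ range (J + 6), dpiece χ 4 (σ + t * I) j with hP
  have hPc : Continuous P :=
    continuous_finsetSum _ fun j _ => (continuous_dpiece χ 4 j).comp (by fun_prop)
  have hpt : ∀ t ∈ Set.Icc a b,
      ‖χ.LFunction ((4 : ℕ) * (σ + t * I))‖ ^ 2 ≤ 2 * ‖P t‖ ^ 2 + 2 * 20000 ^ 2 := by
    intro t ht
    have h1 := norm_LFunction_sub_sum_dpiece_le χ (κ := 4) (by norm_num) (by norm_num)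
      (s := σ + t * I) (by simpa using hσ) (by simpa using hσ') (J := J)
      (by rw [add_mul_I_im]; exact h.inDyadic t ht)
    have e : ((1 - (4:ℕ) / 4) * J : ℝ) = 0 := by norm_num
    rw [e, rpow_zero, mul_one] at h1
    have h2 := norm_le_norm_sub_add (χ.LFunction ((4 : ℕ) * (σ + t * I))) (P t)
    have h3 : ‖χ.LFunction ((4 : ℕ) * (σ + t * I))‖ ≤ 20000 + ‖P t‖ := h2.trans (by gcongr)
    have h4 : ‖χ.LFunction ((4 : ℕ) * (σ + t * I))‖ ^ 2 ≤ (20000 + ‖P t‖) ^ 2 := by gcongr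
    nlinarith [sq_nonneg (20000 - ‖P t‖)]
  have hcont := continuousOn_LFunction_natCast_mul χ (κ := 4) (by norm_num) σ h
  rw [← Set.uIcc_of_le hab] at hcont
  have hitg : ∫ t in a..b, ‖χ.LFunction ((4 : ℕ) * (σ + t * I))‖ ^ 2 ≤
      ∫ t in a..b, (2 * ‖P t‖ ^ 2 + 2 * 20000 ^ 2) :=
    integral_mono_on hab (hcont.norm.pow 2).intervalIntegrable
      (Continuous.intervalIntegrable (by fun_prop) _ _) hpt
  rw [integral_add (Continuous.intervalIntegrable (by fun_prop) _ _)
    (by simp), integral_const_mul, integral_const,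
    h.length, smul_eq_mul] at hitg
  have hN : ∀ n ∈ Ico (1 : ℕ) (2 ^ (J + 6)), 1 ≤ n ∧ n ≤ 2 ^ (J + 6) := by
    intro n hn
    rw [mem_Ico] at hn
    omega
  have hmv := integral_norm_sq_dirichletPoly_le hN
    (fun n => χ n * (n : ℂ) ^ (-((4 * σ : ℝ) : ℂ))) (κ := 4) (by norm_num) hab
  have hPeq : ∀ t, ∑ n ∈ Ico (1 : ℕ) (2 ^ (J + 6)),
      χ n * (n : ℂ) ^ (-((4 * σ : ℝ) : ℂ)) * (n : ℂ) ^ (-((4 * t : ℝ) : ℂ) * I) = P t := by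
    intro t
    rw [hP]
    simp only
    rw [sum_range_dpiece]
    refine sum_congr rfl fun n hn => ?_
    have hn0 : (n : ℂ) ≠ 0 := by have := (hN n hn).1; exact_mod_cast (by omega : n ≠ 0)
    rw [mul_assoc, ← cpow_add _ _ hn0]
    congr 2
    push_cast; ring
  simp only [hPeq, h.length] at hmv
  have hlog : log ((2 ^ (J + 6) : ℕ) : ℝ) ≤ J + 6 := by
    push_cast
    rw [log_pow]
    have := log_two_lt_d9
    push_cast
    have hJ : (0:ℝ) ≤ J := by positivity
    nlinarith
  have hsum : ∑ n ∈ Ico (1 : ℕ) (2 ^ (J + 6)),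
      ‖χ n * (n : ℂ) ^ (-((4 * σ : ℝ) : ℂ))‖ ^ 2 ≤ J + 7 := by
    calc _ ≤ ∑ n ∈ Icc (1 : ℕ) (2 ^ (J + 6)), ((n : ℝ))⁻¹ := by
          refine (sum_le_sum (g := fun n : ℕ => ((n : ℝ))⁻¹) fun n hn => ?_).trans
            (sum_le_sum_of_subset_of_nonneg (fun n hn => ?_) fun _ _ _ => by positivity)
          · have hn1 := (hN n hn).1
            have hn1' : (1:ℝ) ≤ n := mod_cast hn1
            have h5 : ‖χ n * (n : ℂ) ^ (-((4 * σ : ℝ) : ℂ))‖ ≤ (n : ℝ) ^ (-(1/2) : ℝ) := by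
              rw [norm_mul, norm_natCast_cpow_of_pos (by omega)]
              calc _ ≤ 1 * (n : ℝ) ^ (-(1/2) : ℝ) := by
                    have h7 : (-((4 * σ : ℝ) : ℂ)).re ≤ -(1 / 2) := by
                      rw [neg_re, ofReal_re]; linarith
                    exact mul_le_mul (norm_le_one _ _)
                      (rpow_le_rpow_of_exponent_le hn1' h7) (by positivity) (by norm_num)
                _ = _ := one_mul _
            calc _ ≤ ((n : ℝ) ^ (-(1/2) : ℝ)) ^ 2 := by gcongr
              _ = _ := by
                rw [← rpow_mul_natCast (by positivity), ← rpow_neg_one]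
                norm_num
          · have := hN n hn
            exact mem_Icc.2 this
      _ ≤ 1 + log ((2 ^ (J + 6) : ℕ) : ℝ) := by
          have h6 := harmonic_le_one_add_log (2 ^ (J + 6))
          rw [harmonic_eq_sum_Icc] at h6
          push_cast at h6 ⊢
          exact h6
      _ ≤ _ := by linarith
  have hτ : (0:ℝ) < 2 ^ J := by positivity
  have hJ : (0:ℝ) ≤ J := by positivity
  have hN' : ((2 ^ (J + 6) : ℕ) : ℝ) = 64 * 2 ^ J := by push_cast; ring
  have hfin : ∫ t in a..b, ‖P t‖ ^ 2 ≤ (2 ^ J + 4 * (64 * 2 ^ J) * (J + 7)) * (J + 7) := by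
    refine hmv.trans ?_
    rw [hN'] at hlog ⊢
    have h9 : 1 + log (64 * 2 ^ J) ≤ (J:ℝ) + 7 := by linarith
    gcongr
  have e2 : ((40000:ℝ) * (2:ℝ) ^ ((J:ℝ) / 2) * (J + 1)) ^ 2 = 40000 ^ 2 * 2 ^ J * (J + 1) ^ 2 := by
    rw [mul_pow, mul_pow, ← rpow_mul_natCast (by norm_num)]
    norm_num
  rw [e2]
  refine hitg.trans ?_
  have h8 : (2 ^ J + 4 * (64 * 2 ^ J) * (J + 7)) * (J + 7) ≤ 2 ^ J * (13000 * ((J:ℝ) + 1) ^ 2) := by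
    have : (2 ^ J + 4 * (64 * 2 ^ J) * (J + 7)) * ((J:ℝ) + 7) =
      2 ^ J * ((1 + 256 * (J + 7)) * (J + 7)) := by ring
    rw [this]
    refine mul_le_mul_of_nonneg_left ?_ hτ.le
    nlinarith
  nlinarith [mul_nonneg hτ.le hJ, mul_nonneg hτ.le (mul_nonneg hJ hJ)]

/-- The replacement of the `L`-functions by their approximating polynomials. -/
lemma exists_norm_prod_LFunction_sub_le (ι ι' : Type) [Fintype ι] [Fintype ι']
    (hι : Fintype.card ι ≤ 2) (hι' : Fintype.card ι' ≤ 4) :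
    ∃ C : ℝ, 0 < C ∧ ∀ (χ : ι → DirichletCharacter ℂ 8) (χ' : ι' → DirichletCharacter ℂ 8)
      (s : ℂ) (J : ℕ), 1 / 8 ≤ s.re → s.re ≤ 1 / 8 + 1 / 200 → InDyadic J s.im →
      ‖(∏ i, (χ i).LFunction ((6 : ℕ) * s)) * (∏ i, (χ' i).LFunction ((7 : ℕ) * s)) -
        (∏ i, ∑ j ∈ range (J + 6), dpiece (χ i) 6 s j) *
        (∏ i, ∑ j ∈ range (J + 6), dpiece (χ' i) 7 s j)‖ ≤ C := by
  obtain ⟨C₁, hC₁, hexp⟩ := exists_add_natCast_le_mul_two_rpow (ε := 1 / 48) (by norm_num) 1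
  refine ⟨6 * (38000 * C₁) ^ 6 + 1, by positivity, fun χ χ' s J hs hs' ht => ?_⟩
  have hJ : (0:ℝ) ≤ J := by positivity
  set D : ℝ := 38000 * (J + 1) with hD
  have hD1 : 1 ≤ D := by rw [hD]; linarith
  set U : ι ⊕ ι' → ℝ := Sum.elim (fun _ => D * (2:ℝ) ^ ((1 - 6 / 8) * J / 2 : ℝ))
    (fun _ => D * (2:ℝ) ^ ((1 - 7 / 8) * J / 2 : ℝ)) with hU
  have key := norm_prod_sub_prod_le_card_mul (univ : Finset (ι ⊕ ι'))
    (Sum.elim (fun i => (χ i).LFunction ((6 : ℕ) * s)) (fun i => (χ' i).LFunction ((7 : ℕ) * s)))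
    (Sum.elim (fun i => ∑ j ∈ range (J + 6), dpiece (χ i) 6 s j)
      (fun i => ∑ j ∈ range (J + 6), dpiece (χ' i) 7 s j)) U
    (ρ := (2:ℝ) ^ (-(5 / 8 * J) : ℝ)) ?_ ?_ ?_
  · rw [Fintype.prod_sum_type, Fintype.prod_sum_type] at key
    simp only [Sum.elim_inl, Sum.elim_inr] at key
    refine key.trans ?_
    rw [Fintype.prod_sum_type]
    simp only [hU, Sum.elim_inl, Sum.elim_inr, prod_const, card_univ, Fintype.card_sum]
    have h6 : (1:ℝ) ≤ D * (2:ℝ) ^ ((1 - 6 / 8) * J / 2 : ℝ) :=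
      one_le_mul_of_one_le_of_one_le hD1 (one_le_rpow (by norm_num) (by nlinarith))
    have h7 : (1:ℝ) ≤ D * (2:ℝ) ^ ((1 - 7 / 8) * J / 2 : ℝ) :=
      one_le_mul_of_one_le_of_one_le hD1 (one_le_rpow (by norm_num) (by nlinarith))
    have hcard : ((Fintype.card ι + Fintype.card ι' : ℕ) : ℝ) ≤ 6 := by
      exact_mod_cast (by omega : Fintype.card ι + Fintype.card ι' ≤ 6)
    have hexpJ : ((J:ℝ) + 1) ^ 6 ≤ C₁ ^ 6 * (2:ℝ) ^ ((J:ℝ) / 8) := by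
      have := hexp J
      calc ((J:ℝ) + 1) ^ 6 ≤ (C₁ * (2:ℝ) ^ (1 / 48 * J : ℝ)) ^ 6 := by gcongr; linarith
        _ = _ := by
          rw [mul_pow, ← rpow_mul_natCast (by norm_num)]
          congr 2; push_cast; ring
    calc ((Fintype.card ι + Fintype.card ι' : ℕ) : ℝ) * (2:ℝ) ^ (-(5 / 8 * J) : ℝ) *
          ((D * (2:ℝ) ^ ((1 - 6 / 8) * J / 2 : ℝ)) ^ Fintype.card ι *
          (D * (2:ℝ) ^ ((1 - 7 / 8) * J / 2 : ℝ)) ^ Fintype.card ι')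
        ≤ 6 * (2:ℝ) ^ (-(5 / 8 * J) : ℝ) * ((D * (2:ℝ) ^ ((1 - 6 / 8) * J / 2 : ℝ)) ^ 2 *
          (D * (2:ℝ) ^ ((1 - 7 / 8) * J / 2 : ℝ)) ^ 4) := by
          have := pow_le_pow_right₀ h6 hι
          have := pow_le_pow_right₀ h7 hι'
          gcongr
      _ = 6 * D ^ 6 * ((2:ℝ) ^ (-(5 / 8 * J) : ℝ) * ((2:ℝ) ^ ((1 - 6 / 8) * J / 2 : ℝ)) ^ 2 *
          ((2:ℝ) ^ ((1 - 7 / 8) * J / 2 : ℝ)) ^ 4) := by ring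
      _ = 6 * D ^ 6 * (2:ℝ) ^ (-((J:ℝ) / 8)) := by
          rw [← rpow_mul_natCast (by norm_num), ← rpow_mul_natCast (by norm_num),
            ← rpow_add (by norm_num), ← rpow_add (by norm_num)]
          congr 2; push_cast; ring
      _ = 6 * 38000 ^ 6 * (((J:ℝ) + 1) ^ 6 * (2:ℝ) ^ (-((J:ℝ) / 8))) := by rw [hD]; ring
      _ ≤ 6 * 38000 ^ 6 * ((C₁ ^ 6 * (2:ℝ) ^ ((J:ℝ) / 8)) * (2:ℝ) ^ (-((J:ℝ) / 8))) := by gcongr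
      _ = 6 * (38000 * C₁) ^ 6 := by
          rw [mul_assoc (C₁ ^ 6), ← rpow_add (by norm_num), add_neg_cancel, rpow_zero]
          ring
      _ ≤ _ := by linarith
  · rintro (i | i) -
    · exact norm_LFunction_natCast_mul_le (χ i) (κ := 6) (by norm_num) (by norm_num) hs hs' ht
    · exact norm_LFunction_natCast_mul_le (χ' i) (κ := 7) (by norm_num) (by norm_num) hs hs' ht
  · have hle : 18000 * ((J:ℝ) + 1) ≤ D := by rw [hD]; linarith
    rintro (i | i) -
    · refine (norm_sum_dpiece_le (χ i) (κ := 6) (by norm_num) (by norm_num) hs ht).trans ?_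
      simp only [hU, Sum.elim_inl]
      push_cast
      gcongr
    · refine (norm_sum_dpiece_le (χ' i) (κ := 7) (by norm_num) (by norm_num) hs ht).trans ?_
      simp only [hU, Sum.elim_inr]
      push_cast
      gcongr
  · have hle : 20000 ≤ D := by rw [hD]; linarith
    have hgen : ∀ x y z : ℝ, x ≤ y + z → 20000 * (2:ℝ) ^ x ≤ (2:ℝ) ^ y * (D * (2:ℝ) ^ z) := by
      intro x y z hxyz
      calc 20000 * (2:ℝ) ^ x ≤ D * (2:ℝ) ^ (y + z) :=
            mul_le_mul hle (rpow_le_rpow_of_exponent_le (by norm_num) hxyz) (by positivity)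
              (by linarith)
        _ = _ := by rw [rpow_add (by norm_num)]; ring
    rintro (i | i) -
    · refine (norm_LFunction_sub_sum_dpiece_le (χ i) (κ := 6) (by norm_num) (by norm_num) hs hs'
        ht).trans (hgen _ _ _ ?_)
      push_cast; linarith
    · refine (norm_LFunction_sub_sum_dpiece_le (χ' i) (κ := 7) (by norm_num) (by norm_num) hs hs'
        ht).trans (hgen _ _ _ ?_)
      push_cast; linarith

lemma cell_exponent {J b c : ℝ} (hb : 0 ≤ b) (hb' : b ≤ 2 * J + 12) :
    J / 4 + max J b / 2 - b / 4 + max J c / 2 - 3 * c / 8 ≤ J - (b + c) / 30 + 100 ∨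
    J / 2 + max J b / 2 - b / 4 + c / 8 ≤ J - (b + c) / 30 + 100 ∨
    J / 2 + max J b / 2 - b / 4 + (2 * J - 7 * c / 8) ≤ J - (b + c) / 30 + 100 ∨
    J / 2 + max J c / 2 - 3 * c / 8 + b / 4 ≤ J - (b + c) / 30 + 100 ∨
    J / 2 + max J c / 2 - 3 * c / 8 + (J - 3 * b / 4) ≤ J - (b + c) / 30 + 100 := by
  by_contra! h
  obtain ⟨h0, h1, h2, h3, h4⟩ := h
  rcases max_cases J b with ⟨e, _⟩ | ⟨e, _⟩ <;> rcases max_cases J c with ⟨e', _⟩ | ⟨e', _⟩ <;>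
    rw [e] at h0 h1 h2 <;> rw [e'] at h0 h3 h4 <;> linarith

lemma exists_sq_integral_prod_dpiece_le (ι : Type) [Fintype ι] :
    ∃ C : ℝ, 1 ≤ C ∧ ∀ (χ : ι → DirichletCharacter ℂ 8) (κ : ℕ), 1 ≤ κ → ∀ (k : ι → ℕ)
      (J : ℕ) (σ τ₁ τ₂ : ℝ), 1 / 8 ≤ σ → τ₂ - τ₁ = 2 ^ J →
      ∫ t in τ₁..τ₂, ‖∏ i, dpiece (χ i) κ (σ + t * I) (k i)‖ ^ 2 ≤
        (C * (2:ℝ) ^ (max (J : ℝ) (∑ i, k i : ℕ) / 2 + (1 - κ / 4) / 2 * (∑ i, k i : ℕ) +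
          (∑ i, k i : ℕ) / 200)) ^ 2 := by
  obtain ⟨C, hC, h⟩ := exists_integral_norm_sq_prod_dpiece_le ι (ε := 1 / 100) (by norm_num)
  refine ⟨C + 1, by linarith, fun χ κ hκ k J σ τ₁ τ₂ hσ hτ => (h χ κ hκ k J σ τ₁ τ₂ hσ hτ).trans ?_⟩
  rw [mul_pow, ← rpow_mul_natCast (by norm_num)]
  have h1 : C ≤ (C + 1) ^ 2 := by nlinarith
  have e : max (J : ℝ) (∑ i, k i : ℕ) + (1 - κ / 4) * (∑ i, k i : ℕ) + 1 / 100 * (∑ i, k i : ℕ) =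
    (max (J : ℝ) (∑ i, k i : ℕ) / 2 + (1 - κ / 4) / 2 * (∑ i, k i : ℕ) +
          (∑ i, k i : ℕ) / 200) * (2 : ℕ) := by push_cast; ring
  rw [e]
  gcongr

set_option maxHeartbeats 1000000 in
/-- Mean value of `L(4s)` times products of dyadic pieces. -/
lemma exists_integral_cell_le (ι ι' : Type) [Fintype ι] [Fintype ι']
    (hι : Fintype.card ι ≤ 2) (hι' : Fintype.card ι' ≤ 4) :
    ∃ C : ℝ, 0 < C ∧ ∀ (χ₀ : DirichletCharacter ℂ 8) (χ : ι → DirichletCharacter ℂ 8)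
      (χ' : ι' → DirichletCharacter ℂ 8) (J : ℕ) (σ τ₁ τ₂ : ℝ), 1 / 8 ≤ σ →
      σ ≤ 1 / 8 + 1 / 200 → DyadicInterval J τ₁ τ₂ →
      ∀ (k : ι → ℕ) (l : ι' → ℕ), (∀ i, k i ≤ J + 6) → (∀ i, l i ≤ J + 6) →
      ∫ t in τ₁..τ₂, ‖χ₀.LFunction ((4 : ℕ) * (σ + t * I))‖ *
        (‖∏ i, dpiece (χ i) 6 (σ + t * I) (k i)‖ * ‖∏ i, dpiece (χ' i) 7 (σ + t * I) (l i)‖) ≤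
        C * (J + 1) * 2 ^ J * (2:ℝ) ^ (-(((∑ i, k i : ℕ) + (∑ i, l i : ℕ) : ℝ) / 40)) := by
  obtain ⟨CA, hCA, hA⟩ := exists_integral_norm_sq_LFunction_four_le
  obtain ⟨CB, hCB, hB⟩ := exists_sq_integral_prod_dpiece_le ι
  obtain ⟨CC, hCC, hC⟩ := exists_sq_integral_prod_dpiece_le ι'
  refine ⟨(38000 + CA) * CB * CC * 3000 ^ 4 * (2:ℝ) ^ (100:ℝ), by positivity, ?_⟩
  intro χ₀ χ χ' J σ τ₁ τ₂ hσ hσ' h k l hk hl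
  set b := ∑ i, k i with hb
  set c := ∑ i, l i with hc
  have hab := h.le
  have hJ : (0:ℝ) ≤ J := by positivity
  set f : ℝ → ℝ := fun t => ‖χ₀.LFunction ((4 : ℕ) * (σ + t * I))‖ with hf
  set g : ℝ → ℝ := fun t => ‖∏ i, dpiece (χ i) 6 (σ + t * I) (k i)‖ with hg
  set w : ℝ → ℝ := fun t => ‖∏ i, dpiece (χ' i) 7 (σ + t * I) (l i)‖ with hw
  have hfc : ContinuousOn f (Set.Icc τ₁ τ₂) :=
    (continuousOn_LFunction_natCast_mul χ₀ (by norm_num) σ h).norm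
  have hgc : Continuous g := (continuous_prod_dpiece χ 6 k σ).norm
  have hwc : Continuous w := (continuous_prod_dpiece χ' 7 l σ).norm
  have hre : ∀ t : ℝ, 1 / 8 ≤ ((σ : ℂ) + t * I).re := fun t => by rw [add_mul_I_re]; exact hσ
  have hdy : ∀ t ∈ Set.Icc τ₁ τ₂, InDyadic J ((σ : ℂ) + t * I).im :=
    fun t ht => by rw [add_mul_I_im]; exact h.inDyadic t ht
  have hb' : (b:ℝ) ≤ 2 * J + 12 := by
    have h1 : b ≤ Fintype.card ι * (J + 6) := by
      rw [hb]
      exact (sum_le_card_nsmul _ _ _ fun i _ => hk i).trans (by simp)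
    have h2 : Fintype.card ι * (J + 6) ≤ 2 * (J + 6) := Nat.mul_le_mul_right _ hι
    have : b ≤ 2 * J + 12 := by omega
    exact_mod_cast this
  have hb0 : (0:ℝ) ≤ b := by positivity
  have hc0 : (0:ℝ) ≤ c := by positivity
  have hf2 := hA χ₀ J σ τ₁ τ₂ hσ hσ' h
  have hg2 := hB χ 6 (by norm_num) k J σ τ₁ τ₂ hσ h.length
  have hw2 := hC χ' 7 (by norm_num) l J σ τ₁ τ₂ hσ h.length
  rw [← hb] at hg2
  rw [← hc] at hw2
  have hgw := intervalIntegral_mul_le_mul hab hgc.continuousOn hwc.continuousOn (by positivity)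
    (by positivity) hg2 hw2
  have hfg := intervalIntegral_mul_le_mul hab hfc hgc.continuousOn (by positivity)
    (by positivity) hf2 hg2
  have hfw := intervalIntegral_mul_le_mul hab hfc hwc.continuousOn (by positivity)
    (by positivity) hf2 hw2
  have hfc' : ContinuousOn f (Set.uIcc τ₁ τ₂) := by rwa [Set.uIcc_of_le hab]
  have hgu := hgc.continuousOn (s := Set.uIcc τ₁ τ₂)
  have hwu := hwc.continuousOn (s := Set.uIcc τ₁ τ₂)
  have hf0 : ∀ t, 0 ≤ f t := fun _ => norm_nonneg _
  have hg0 : ∀ t, 0 ≤ g t := fun _ => norm_nonneg _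
  have hw0 : ∀ t, 0 ≤ w t := fun _ => norm_nonneg _
  have sup₁ : ∀ M : ℝ, (∀ t ∈ Set.Icc τ₁ τ₂, f t ≤ M) →
      ∫ t in τ₁..τ₂, f t * (g t * w t) ≤ M * ∫ t in τ₁..τ₂, g t * w t := by
    intro M hM
    rw [← integral_const_mul]
    exact integral_mono_on hab (hfc'.mul (hgu.mul hwu)).intervalIntegrable
      ((hgu.mul hwu).const_mul _).intervalIntegrable fun t ht =>
      mul_le_mul_of_nonneg_right (hM t ht) (mul_nonneg (hg0 t) (hw0 t))
  have sup₂ : ∀ M : ℝ, (∀ t ∈ Set.Icc τ₁ τ₂, g t ≤ M) →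
      ∫ t in τ₁..τ₂, f t * (g t * w t) ≤ M * ∫ t in τ₁..τ₂, f t * w t := by
    intro M hM
    rw [← integral_const_mul]
    refine integral_mono_on hab (hfc'.mul (hgu.mul hwu)).intervalIntegrable
      ((hfc'.mul hwu).const_mul _).intervalIntegrable fun t ht => ?_
    have := mul_le_mul_of_nonneg_right (hM t ht) (mul_nonneg (hf0 t) (hw0 t))
    linarith
  have sup₃ : ∀ M : ℝ, (∀ t ∈ Set.Icc τ₁ τ₂, w t ≤ M) →
      ∫ t in τ₁..τ₂, f t * (g t * w t) ≤ M * ∫ t in τ₁..τ₂, f t * g t := by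
    intro M hM
    rw [← integral_const_mul]
    refine integral_mono_on hab (hfc'.mul (hgu.mul hwu)).intervalIntegrable
      ((hfc'.mul hgu).const_mul _).intervalIntegrable fun t ht => ?_
    have := mul_le_mul_of_nonneg_right (hM t ht) (mul_nonneg (hf0 t) (hg0 t))
    linarith
  set K := (38000 + CA) * CB * CC * 3000 ^ 4 with hK
  have hfinal : ∀ (D E : ℝ), D ≤ K → E ≤ J - (b + c) / 30 + 100 →
      D * (J + 1) * (2:ℝ) ^ (E + (b + c) / 200) ≤
        K * (2:ℝ) ^ (100:ℝ) * (J + 1) * 2 ^ J * (2:ℝ) ^ (-((b + c : ℝ) / 40)) := by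
    intro D E hD hE
    calc D * (J + 1) * (2:ℝ) ^ (E + (b + c) / 200) ≤
          K * (J + 1) * (2:ℝ) ^ (100 + (J:ℝ) + (-((b + c : ℝ) / 40))) := by
          have h1 : (2:ℝ) ^ (E + (b + c) / 200) ≤ (2:ℝ) ^ (100 + (J:ℝ) + (-((b + c : ℝ) / 40))) :=
            rpow_le_rpow_of_exponent_le (by norm_num) (by linarith)
          gcongr
      _ = _ := by
          rw [rpow_add (by norm_num), rpow_add (by norm_num), rpow_natCast]
          ring
  have hBC : 1 ≤ CB * CC := one_le_mul_of_one_le_of_one_le hCB hCC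
  have hKge : ∀ x y z : ℝ, 0 ≤ x → 0 ≤ y → x ≤ (38000 + CA) → y ≤ CB * CC → z ≤ 3000 ^ 4 → 0 ≤ z →
      x * y * z ≤ K := by
    intro x y z hx hy hx' hy' hz' hz
    rw [hK, mul_assoc (38000 + CA)]
    gcongr
  have htwo : ∀ x y : ℝ, (2:ℝ) ^ x * (2:ℝ) ^ y = (2:ℝ) ^ (x + y) :=
    fun x y => (rpow_add (by norm_num) x y).symm
  have hsimp3 : ∀ n : ℕ, n ≤ 4 → (3000:ℝ) ^ n ≤ 3000 ^ 4 := fun n hn =>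
    pow_le_pow_right₀ (by norm_num) hn
  rcases cell_exponent (c := (c:ℝ)) hb0 hb' with hE | hE | hE | hE | hE
  · refine ((sup₁ (38000 * (J + 1) * (2:ℝ) ^ ((J:ℝ) / 4)) fun t ht => ?_).trans
      (mul_le_mul_of_nonneg_left hgw (by positivity))).trans ?_
    · refine (norm_LFunction_natCast_mul_le χ₀ (κ := 4) (by norm_num) (by norm_num) (hre t)
        (by rw [add_mul_I_re]; exact hσ') (hdy t ht)).trans (le_of_eq ?_)
      congr 2; push_cast; ring
    · refine le_trans (le_of_eq ?_) (hfinal (38000 * (CB * CC) * 1) _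
        (hKge _ _ _ (by norm_num) (by positivity) (by linarith) le_rfl (by norm_num) (by norm_num)) hE)
      have e : (38000 * ((J:ℝ) + 1) * (2:ℝ) ^ ((J:ℝ) / 4)) * ((CB * (2:ℝ) ^ (max (J:ℝ) b / 2 +
        (1 - (6 : ℕ) / 4) / 2 * b + b / 200)) * (CC * (2:ℝ) ^ (max (J:ℝ) c / 2 +
        (1 - (7 : ℕ) / 4) / 2 * c + c / 200))) = 38000 * (CB * CC) * (J + 1) *
        ((2:ℝ) ^ ((J:ℝ) / 4) * (2:ℝ) ^ (max (J:ℝ) b / 2 +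
        (1 - (6 : ℕ) / 4) / 2 * b + b / 200) * (2:ℝ) ^ (max (J:ℝ) c / 2 +
        (1 - (7 : ℕ) / 4) / 2 * c + c / 200)) := by ring
      rw [e, htwo, htwo, mul_one]
      congr 2
      push_cast; ring
  · refine ((sup₃ ((2:ℝ) ^ ((1 - (7:ℕ) / 8) * (c : ℕ) : ℝ)) fun t _ => ?_).trans
      (mul_le_mul_of_nonneg_left hfg (by positivity))).trans ?_
    · exact norm_prod_dpiece_le_trivial χ' 7 (hre t) l
    · have e : (2:ℝ) ^ ((1 - (7:ℕ) / 8) * (c : ℕ) : ℝ) * ((CA * (2:ℝ) ^ ((J:ℝ) / 2) * (J + 1)) *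
        (CB * (2:ℝ) ^ (max (J:ℝ) b / 2 + (1 - (6 : ℕ) / 4) / 2 * b + b / 200))) =
        CA * CB * 1 * (J + 1) * ((2:ℝ) ^ ((1 - (7:ℕ) / 8) * (c : ℕ) : ℝ) * (2:ℝ) ^ ((J:ℝ) / 2) *
        (2:ℝ) ^ (max (J:ℝ) b / 2 + (1 - (6 : ℕ) / 4) / 2 * b + b / 200)) := by ring
      rw [e, htwo, htwo]
      refine le_trans ?_ (hfinal (CA * CB * 1) _ (hKge _ _ _ (by positivity) (by positivity)
        (by linarith) (by nlinarith) (by norm_num) (by norm_num)) hE)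
      refine mul_le_mul_of_nonneg_left
        (rpow_le_rpow_of_exponent_le (by norm_num) ?_) (by positivity)
      push_cast; linarith
  · refine ((sup₃ (3000 ^ Fintype.card ι' * (2:ℝ) ^ ((J:ℝ) / 2 * Fintype.card ι' -
      (7:ℕ) / 8 * (c : ℕ) : ℝ)) fun t ht => ?_).trans
      (mul_le_mul_of_nonneg_left hfg (by positivity))).trans ?_
    · exact norm_prod_dpiece_le_sqrt χ' (by norm_num) (by norm_num) (hre t) (hdy t ht) l hl
    · have e : (3000 ^ Fintype.card ι' * (2:ℝ) ^ ((J:ℝ) / 2 * Fintype.card ι' -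
        (7:ℕ) / 8 * (c : ℕ) : ℝ)) * ((CA * (2:ℝ) ^ ((J:ℝ) / 2) * (J + 1)) *
        (CB * (2:ℝ) ^ (max (J:ℝ) b / 2 + (1 - (6 : ℕ) / 4) / 2 * b + b / 200))) =
        CA * CB * 3000 ^ Fintype.card ι' * (J + 1) * ((2:ℝ) ^ ((J:ℝ) / 2 * Fintype.card ι' -
        (7:ℕ) / 8 * (c : ℕ) : ℝ) * (2:ℝ) ^ ((J:ℝ) / 2) *
        (2:ℝ) ^ (max (J:ℝ) b / 2 + (1 - (6 : ℕ) / 4) / 2 * b + b / 200)) := by ring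
      rw [e, htwo, htwo]
      refine le_trans ?_ (hfinal (CA * CB * 3000 ^ Fintype.card ι') _ (hKge _ _ _ (by positivity)
        (by positivity) (by linarith) (by nlinarith) (hsimp3 _ hι') (by positivity)) hE)
      refine mul_le_mul_of_nonneg_left
        (rpow_le_rpow_of_exponent_le (by norm_num) ?_) (by positivity)
      have : (Fintype.card ι' : ℝ) ≤ 4 := mod_cast hι'
      push_cast; nlinarith
  · refine ((sup₂ ((2:ℝ) ^ ((1 - (6:ℕ) / 8) * (b : ℕ) : ℝ)) fun t _ => ?_).trans
      (mul_le_mul_of_nonneg_left hfw (by positivity))).trans ?_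
    · exact norm_prod_dpiece_le_trivial χ 6 (hre t) k
    · have e : (2:ℝ) ^ ((1 - (6:ℕ) / 8) * (b : ℕ) : ℝ) * ((CA * (2:ℝ) ^ ((J:ℝ) / 2) * (J + 1)) *
        (CC * (2:ℝ) ^ (max (J:ℝ) c / 2 + (1 - (7 : ℕ) / 4) / 2 * c + c / 200))) =
        CA * CC * 1 * (J + 1) * ((2:ℝ) ^ ((1 - (6:ℕ) / 8) * (b : ℕ) : ℝ) * (2:ℝ) ^ ((J:ℝ) / 2) *
        (2:ℝ) ^ (max (J:ℝ) c / 2 + (1 - (7 : ℕ) / 4) / 2 * c + c / 200)) := by ring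
      rw [e, htwo, htwo]
      refine le_trans ?_ (hfinal (CA * CC * 1) _ (hKge _ _ _ (by positivity) (by positivity)
        (by linarith) (by nlinarith) (by norm_num) (by norm_num)) hE)
      refine mul_le_mul_of_nonneg_left
        (rpow_le_rpow_of_exponent_le (by norm_num) ?_) (by positivity)
      push_cast; linarith
  · refine ((sup₂ (3000 ^ Fintype.card ι * (2:ℝ) ^ ((J:ℝ) / 2 * Fintype.card ι -
      (6:ℕ) / 8 * (b : ℕ) : ℝ)) fun t ht => ?_).trans
      (mul_le_mul_of_nonneg_left hfw (by positivity))).trans ?_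
    · exact norm_prod_dpiece_le_sqrt χ (by norm_num) (by norm_num) (hre t) (hdy t ht) k hk
    · have e : (3000 ^ Fintype.card ι * (2:ℝ) ^ ((J:ℝ) / 2 * Fintype.card ι -
        (6:ℕ) / 8 * (b : ℕ) : ℝ)) * ((CA * (2:ℝ) ^ ((J:ℝ) / 2) * (J + 1)) *
        (CC * (2:ℝ) ^ (max (J:ℝ) c / 2 + (1 - (7 : ℕ) / 4) / 2 * c + c / 200))) =
        CA * CC * 3000 ^ Fintype.card ι * (J + 1) * ((2:ℝ) ^ ((J:ℝ) / 2 * Fintype.card ι -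
        (6:ℕ) / 8 * (b : ℕ) : ℝ) * (2:ℝ) ^ ((J:ℝ) / 2) *
        (2:ℝ) ^ (max (J:ℝ) c / 2 + (1 - (7 : ℕ) / 4) / 2 * c + c / 200)) := by ring
      rw [e, htwo, htwo]
      refine le_trans ?_ (hfinal (CA * CC * 3000 ^ Fintype.card ι) _ (hKge _ _ _ (by positivity)
        (by positivity) (by linarith) (by nlinarith) (hsimp3 _ (by omega)) (by positivity)) hE)
      refine mul_le_mul_of_nonneg_left
        (rpow_le_rpow_of_exponent_le (by norm_num) ?_) (by positivity)
      have : (Fintype.card ι : ℝ) ≤ 2 := mod_cast hι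
      push_cast; nlinarith

/-- Mean value of `L(4s) ∏ L(6s) ∏ L(7s)` over a dyadic interval. -/
lemma exists_integral_norm_prod_LFunction_le (ι ι' : Type) [Fintype ι] [Fintype ι']
    (hι : Fintype.card ι ≤ 2) (hι' : Fintype.card ι' ≤ 4) :
    ∃ C : ℝ, 0 < C ∧ ∀ (χ₀ : DirichletCharacter ℂ 8) (χ : ι → DirichletCharacter ℂ 8)
      (χ' : ι' → DirichletCharacter ℂ 8) (J : ℕ) (σ τ₁ τ₂ : ℝ), 1 / 8 ≤ σ →
      σ ≤ 1 / 8 + 1 / 200 → DyadicInterval J τ₁ τ₂ →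
      ∫ t in τ₁..τ₂, ‖χ₀.LFunction ((4 : ℕ) * (σ + t * I)) *
        ((∏ i, (χ i).LFunction ((6 : ℕ) * (σ + t * I))) *
          ∏ i, (χ' i).LFunction ((7 : ℕ) * (σ + t * I)))‖ ≤ C * (J + 1) * 2 ^ J := by
  obtain ⟨CA, hCA, hA⟩ := exists_integral_norm_sq_LFunction_four_le
  obtain ⟨C₀, hC₀, happ⟩ := exists_norm_prod_LFunction_sub_le ι ι' hι hι'
  obtain ⟨C₁, hC₁, hcell⟩ := exists_integral_cell_le ι ι' hι hι'
  set q : ℝ := (2:ℝ) ^ (-(1 / 40) : ℝ) with hq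
  have hq0 : 0 < q := by positivity
  have hq1 : q < 1 := rpow_lt_one_of_one_lt_of_neg (by norm_num) (by norm_num)
  set G : ℝ := (1 - q)⁻¹ with hG
  have hG1 : 1 ≤ G := (one_le_inv₀ (by linarith)).2 (by linarith)
  refine ⟨C₀ * CA + C₁ * (G ^ 2 * G ^ 4), by positivity, fun χ₀ χ χ' J σ τ₁ τ₂ hσ hσ' h => ?_⟩
  have hab := h.le
  have hJ : (0:ℝ) ≤ J := by positivity
  set f : ℝ → ℝ := fun t => ‖χ₀.LFunction ((4 : ℕ) * (σ + t * I))‖ with hf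
  have hfc : ContinuousOn f (Set.uIcc τ₁ τ₂) := by
    rw [Set.uIcc_of_le hab]
    exact (continuousOn_LFunction_natCast_mul χ₀ (by norm_num) σ h).norm
  set g : (ι → ℕ) → ℝ → ℝ := fun k t => ‖∏ i, dpiece (χ i) 6 (σ + t * I) (k i)‖ with hg
  set w : (ι' → ℕ) → ℝ → ℝ := fun l t => ‖∏ i, dpiece (χ' i) 7 (σ + t * I) (l i)‖ with hw
  have hgc : ∀ k, Continuous (g k) := fun k => (continuous_prod_dpiece χ 6 k σ).norm
  have hwc : ∀ l, Continuous (w l) := fun l => (continuous_prod_dpiece χ' 7 l σ).norm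
  set SB : Finset (ι → ℕ) := Fintype.piFinset fun _ => range (J + 6) with hSB
  set SC : Finset (ι' → ℕ) := Fintype.piFinset fun _ => range (J + 6) with hSC
  have hpt : ∀ t ∈ Set.Icc τ₁ τ₂, ‖χ₀.LFunction ((4 : ℕ) * (σ + t * I)) *
        ((∏ i, (χ i).LFunction ((6 : ℕ) * (σ + t * I))) *
          ∏ i, (χ' i).LFunction ((7 : ℕ) * (σ + t * I)))‖ ≤
      f t * C₀ + ∑ k ∈ SB, ∑ l ∈ SC, f t * (g k t * w l t) := by
    intro t ht
    have h1 := happ χ χ' (σ + t * I) J (by simpa using hσ) (by simpa using hσ')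
      (by rw [add_mul_I_im]; exact h.inDyadic t ht)
    set X := (∏ i, (χ i).LFunction ((6 : ℕ) * (σ + t * I))) *
          ∏ i, (χ' i).LFunction ((7 : ℕ) * (σ + t * I))
    rw [prod_univ_sum, prod_univ_sum, sum_mul_sum] at h1
    have h2 := norm_le_norm_sub_add X (∑ k ∈ SB, ∑ l ∈ SC,
      (∏ i, dpiece (χ i) 6 (σ + t * I) (k i)) * (∏ i, dpiece (χ' i) 7 (σ + t * I) (l i)))
    have h3 : ‖∑ k ∈ SB, ∑ l ∈ SC,
      (∏ i, dpiece (χ i) 6 (σ + t * I) (k i)) * (∏ i, dpiece (χ' i) 7 (σ + t * I) (l i))‖ ≤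
        ∑ k ∈ SB, ∑ l ∈ SC, g k t * w l t := by
      refine (norm_sum_le _ _).trans (sum_le_sum fun k _ => (norm_sum_le _ _).trans
        (sum_le_sum fun l _ => ?_))
      rw [norm_mul]
    rw [norm_mul]
    have h4 : ‖X‖ ≤ C₀ + ∑ k ∈ SB, ∑ l ∈ SC, g k t * w l t := by linarith
    calc _ ≤ f t * (C₀ + ∑ k ∈ SB, ∑ l ∈ SC, g k t * w l t) :=
          mul_le_mul_of_nonneg_left h4 (norm_nonneg _)
      _ = _ := by rw [mul_add, mul_sum]; simp only [mul_sum]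
  have hcell' : ∀ k ∈ SB, ∀ l ∈ SC, ∫ t in τ₁..τ₂, f t * (g k t * w l t) ≤
      C₁ * (J + 1) * 2 ^ J * ((∏ i, q ^ k i) * ∏ i, q ^ l i) := by
    intro k hk l hl
    rw [Fintype.mem_piFinset] at hk hl
    refine (hcell χ₀ χ χ' J σ τ₁ τ₂ hσ hσ' h k l (fun i => (mem_range.1 (hk i)).le)
      fun i => (mem_range.1 (hl i)).le).trans (le_of_eq ?_)
    congr 1
    rw [prod_pow_eq_pow_sum, prod_pow_eq_pow_sum, ← pow_add, hq, ← rpow_mul_natCast (by norm_num)]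
    congr 1
    push_cast; ring
  have hiA : IntervalIntegrable (fun t => f t * C₀) MeasureTheory.volume τ₁ τ₂ :=
    (hfc.mul_const _).intervalIntegrable
  have hi : ∀ k l, IntervalIntegrable (fun t => f t * (g k t * w l t)) MeasureTheory.volume τ₁ τ₂ :=
    fun k l => (hfc.mul ((hgc k).mul (hwc l)).continuousOn).intervalIntegrable
  have hi' : ∀ k, IntervalIntegrable (fun t => ∑ l ∈ SC, f t * (g k t * w l t))
      MeasureTheory.volume τ₁ τ₂ := fun k => (continuousOn_finsetSum _ fun l _ =>
    hfc.mul ((hgc k).mul (hwc l)).continuousOn).intervalIntegrable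
  have hi'' : IntervalIntegrable (fun t => ∑ k ∈ SB, ∑ l ∈ SC, f t * (g k t * w l t))
      MeasureTheory.volume τ₁ τ₂ := (continuousOn_finsetSum _ fun k _ => continuousOn_finsetSum _
    fun l _ => hfc.mul ((hgc k).mul (hwc l)).continuousOn).intervalIntegrable
  have hitg := integral_mono_on hab ?_ (hiA.add hi'') hpt
  · refine hitg.trans ?_
    rw [integral_add hiA hi'', intervalIntegral.integral_mul_const,
      integral_finsetSum fun k _ => hi' k]
    have h1 : ∑ k ∈ SB, ∫ t in τ₁..τ₂, ∑ l ∈ SC, f t * (g k t * w l t) ≤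
        C₁ * (J + 1) * 2 ^ J * (G ^ 2 * G ^ 4) := by
      calc _ ≤ ∑ k ∈ SB, ∑ l ∈ SC, C₁ * (J + 1) * 2 ^ J * ((∏ i, q ^ k i) * ∏ i, q ^ l i) := by
            refine sum_le_sum fun k hk => ?_
            rw [integral_finsetSum fun l _ => hi k l]
            exact sum_le_sum fun l hl => hcell' k hk l hl
        _ = C₁ * (J + 1) * 2 ^ J * ((∏ _i : ι, ∑ j ∈ range (J + 6), q ^ j) *
            ∏ _i : ι', ∑ j ∈ range (J + 6), q ^ j) := by
            rw [prod_univ_sum, prod_univ_sum, sum_mul_sum, mul_sum]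
            simp only [mul_sum]
            rfl
        _ ≤ C₁ * (J + 1) * 2 ^ J * (G ^ Fintype.card ι * G ^ Fintype.card ι') := by
            rw [prod_const, prod_const, card_univ, card_univ]
            have h2 : ∑ j ∈ range (J + 6), q ^ j ≤ G := by
              rw [hG, ← tsum_geometric_of_lt_one hq0.le hq1]
              exact (summable_geometric_of_lt_one hq0.le hq1).sum_le_tsum _ fun _ _ => by positivity
            have h3 : 0 ≤ ∑ j ∈ range (J + 6), q ^ j := sum_nonneg fun _ _ => by positivity
            gcongr
        _ ≤ _ := by gcongr
    have h2 := intervalIntegral_mul_le_mul hab (f := f) (g := fun _ => 1)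
      (by rwa [Set.uIcc_of_le hab] at hfc) continuousOn_const
      (F := CA * (2:ℝ) ^ ((J:ℝ) / 2) * (J + 1)) (G := (2:ℝ) ^ ((J:ℝ) / 2)) (by positivity)
      (by positivity) (hA χ₀ J σ τ₁ τ₂ hσ hσ' h) (by
        rw [← rpow_mul_natCast (by norm_num)]
        simp [h.length])
    simp only [mul_one] at h2
    have h3 : CA * (2:ℝ) ^ ((J:ℝ) / 2) * (J + 1) * (2:ℝ) ^ ((J:ℝ) / 2) = CA * (J + 1) * 2 ^ J := by
      have : (2:ℝ) ^ ((J:ℝ) / 2) * (2:ℝ) ^ ((J:ℝ) / 2) = 2 ^ J := by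
        rw [← rpow_add (by norm_num), add_halves, rpow_natCast]
      rw [← this]; ring
    rw [h3] at h2
    have h4 : (∫ t in τ₁..τ₂, f t) * C₀ ≤ CA * (J + 1) * 2 ^ J * C₀ := by gcongr
    linarith
  · refine ContinuousOn.intervalIntegrable ?_
    rw [Set.uIcc_of_le hab]
    exact ((continuousOn_LFunction_natCast_mul χ₀ (by norm_num) σ h).mul
      ((continuousOn_finsetProd _ fun i _ =>
        continuousOn_LFunction_natCast_mul (χ i) (by norm_num) σ h).mul
      (continuousOn_finsetProd _ fun i _ =>
        continuousOn_LFunction_natCast_mul (χ' i) (by norm_num) σ h))).norm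

/-- The four characters modulo `8`, with complex values. -/
noncomputable def charModEight (i : ℕ) : DirichletCharacter ℂ 8 :=
  (if i % 4 = 0 then 1 else if i % 4 = 1 then ZMod.χ₈ * ZMod.χ₈' else
    if i % 4 = 2 then ZMod.χ₈ else ZMod.χ₈').ringHomComp (Int.castRingHom ℂ)

/-- The first `r` terms of the periodic sequence of characters modulo `8`. -/
noncomputable def charFamily (r : ℕ) (i : Fin r) : DirichletCharacter ℂ 8 := charModEight i

/-- For an odd prime `p` and `e > 0`, the number of characters of `(ℤ/p)ˣ` with values in a cyclic
group of order `8` (when `r = 4`), or of order `4` (when `r = 0`), whose order `m` satisfies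
`8 - 8 / m = e`. -/
def localWeight (r p e : ℕ) : ℕ := if e = 0 then 1 else if p = 2 then 0 else if e = 4 then 1 else
    if e = 6 then (if p % 4 = 1 then 2 else 0) else
      if e = 7 then (if p % 8 = 1 then r else 0) else 0

/-- The multiplicative function with values `localWeight r p e` at prime powers. -/
def weight (r n : ℕ) : ℕ := if n = 0 then 0 else n.factorization.prod (localWeight r)

@[simp] lemma localWeight_zero (r p : ℕ) : localWeight r p 0 = 1 := rfl

@[simp] lemma weight_zero (r : ℕ) : weight r 0 = 0 := rfl

@[simp] lemma weight_one (r : ℕ) : weight r 1 = 1 := by simp [weight]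

lemma weight_mul_of_coprime (r : ℕ) {m n : ℕ} (h : m.Coprime n) :
    weight r (m * n) = weight r m * weight r n := by
  rcases eq_or_ne m 0 with rfl | hm
  · simp
  rcases eq_or_ne n 0 with rfl | hn
  · simp
  simp only [weight, hm, hn, mul_ne_zero hm hn, if_false]
  rw [Nat.factorization_mul hm hn]
  exact Finsupp.prod_add_index_of_disjoint (Nat.Coprime.disjoint_primeFactors h) _

lemma weight_prime_pow (r : ℕ) {p : ℕ} (hp : p.Prime) (e : ℕ) :
    weight r (p ^ e) = localWeight r p e := by
  rw [weight, if_neg (pow_ne_zero _ hp.ne_zero), hp.factorization_pow,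
    Finsupp.prod_single_index (by simp)]

lemma norm_charFamily_le (r : ℕ) (i : Fin r) (a : ZMod 8) : ‖charFamily r i a‖ ≤ 1 :=
  norm_le_one _ _

lemma charModEight_zero : charModEight 0 = 1 := by
  ext a
  simp [charModEight]

lemma charFamily_natCast (r : ℕ) (i : Fin r) (n : ℕ) :
    charFamily r i n = (((if i.1 % 4 = 0 then 1 else if i.1 % 4 = 1 then ZMod.χ₈ * ZMod.χ₈' else
    if i.1 % 4 = 2 then ZMod.χ₈ else ZMod.χ₈' : MulChar (ZMod 8) ℤ) ((n % 8 : ℕ) : ZMod 8) : ℤ) :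
      ℂ) := by
  simp [charFamily, charModEight]

lemma mulChar_one_apply_mod_eight {k : ℕ} (h : k = 1 ∨ k = 3 ∨ k = 5 ∨ k = 7) :
    (1 : MulChar (ZMod 8) ℤ) (k : ZMod 8) = 1 := by
  refine MulChar.one_apply ?_
  rw [ZMod.isUnit_iff_coprime]
  rcases h with (rfl | rfl | rfl | rfl) <;> norm_num

lemma sum_charFamily_two {p : ℕ} (hp : p % 2 = 1) :
    ∑ i, charFamily 2 i p = if p % 4 = 1 then 2 else 0 := by
  simp only [charFamily_natCast, Fin.sum_univ_two, ← Int.cast_add]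
  have h : p % 8 = 1 ∨ p % 8 = 3 ∨ p % 8 = 5 ∨ p % 8 = 7 := by omega
  have e : ∀ k : ℕ, k = 1 ∨ k = 3 ∨ k = 5 ∨ k = 7 →
      1 + (ZMod.χ₈ * ZMod.χ₈') (k : ZMod 8) = if k % 4 = 1 then 2 else 0 := by
    rintro k (rfl | rfl | rfl | rfl) <;> decide
  have h1 := e _ h
  rw [show p % 8 % 4 = p % 4 by omega] at h1
  rw [if_pos (by rfl), if_neg (by simp), if_pos (by simp), mulChar_one_apply_mod_eight h, h1]
  split_ifs <;> simp

lemma sum_charFamily_four {p : ℕ} (hp : p % 2 = 1) :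
    ∑ i, charFamily 4 i p = if p % 8 = 1 then 4 else 0 := by
  simp only [charFamily_natCast, Fin.sum_univ_four, ← Int.cast_add]
  have h : p % 8 = 1 ∨ p % 8 = 3 ∨ p % 8 = 5 ∨ p % 8 = 7 := by omega
  have e : ∀ k : ℕ, k = 1 ∨ k = 3 ∨ k = 5 ∨ k = 7 → 1 + (ZMod.χ₈ * ZMod.χ₈') (k : ZMod 8) +
      ZMod.χ₈ (k : ZMod 8) + ZMod.χ₈' (k : ZMod 8) = if k = 1 then 4 else 0 := by
    rintro k (rfl | rfl | rfl | rfl) <;> decide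
  have h1 := e _ h
  rw [if_pos (by rfl), if_neg (by simp), if_pos (by simp), if_neg (by decide), if_neg (by decide),
    if_pos (by decide), if_neg (by decide), if_neg (by decide), if_neg (by decide),
    mulChar_one_apply_mod_eight h, h1]
  split_ifs <;> simp

lemma natCast_localWeight (hr : r = 0 ∨ r = 4) {p : ℕ} (hp : p.Prime) :
    (localWeight r p 4 : ℂ) = charModEight 0 p ∧
    (localWeight r p 6 : ℂ) = ∑ i, charFamily 2 i p ∧
    (localWeight r p 7 : ℂ) = ∑ i, charFamily r i p := by
  rcases hp.eq_two_or_odd with rfl | h2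
  · have h : ∀ χ : DirichletCharacter ℂ 8, χ (2 : ℕ) = 0 := fun χ => χ.map_nonunit (by decide)
    have h' : ∀ χ : DirichletCharacter ℂ 8, χ 2 = 0 := fun χ => by simpa using h χ
    simp [localWeight, h']
  · have hp2 : p ≠ 2 := by rintro rfl; omega
    refine ⟨?_, ?_, ?_⟩
    · rw [charModEight_zero, MulChar.one_apply]
      · simp [localWeight, hp2]
      · rw [ZMod.isUnit_iff_coprime]
        exact (Nat.Coprime.pow_right 3 ((Nat.coprime_primes hp Nat.prime_two).2 hp2) :)
    · rw [sum_charFamily_two h2]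
      simp [localWeight, hp2]
    · rcases hr with rfl | rfl
      · simp [localWeight, hp2]
      · rw [sum_charFamily_four h2]
        simp [localWeight, hp2]

lemma hasSum_localWeight {R : Type*} [CommSemiring R] [TopologicalSpace R] (r p : ℕ) (z : R) :
    HasSum (fun e => (localWeight r p e : R) * z ^ e)
      (1 + localWeight r p 4 * z ^ 4 + localWeight r p 6 * z ^ 6 + localWeight r p 7 * z ^ 7) := by
  have h : ∀ e ∉ range 8, (localWeight r p e : R) * z ^ e = 0 := by
    intro e he
    rw [mem_range, not_lt] at he
    rw [localWeight]
    simp [show e ≠ 0 by omega, show e ≠ 4 by omega, show e ≠ 6 by omega, show e ≠ 7 by omega]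
  convert hasSum_sum_of_ne_finset_zero (L := SummationFilter.unconditional ℕ) h using 1
  simp [sum_range_succ, localWeight]

lemma norm_prod_one_sub_sub_le {n : ℕ} (z : Fin n → ℂ) (hz : ∀ i, ‖z i‖ ≤ 1) {w : ℂ}
    (hw : ‖w‖ ≤ 1) :
    ‖∏ i, (1 - z i * w) - (1 - (∑ i, z i) * w)‖ ≤ 4 ^ n * ‖w‖ ^ 2 := by
  induction n with
  | zero => simp
  | succ n ih =>
    have h1 := ih (fun i => z i.succ) (fun i => hz _)
    rw [Fin.prod_univ_succ, Fin.sum_univ_succ]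
    set P := ∏ i : Fin n, (1 - z i.succ * w)
    set T := ∑ i : Fin n, z i.succ with hS
    have h2 : ‖T‖ ≤ n := by
      refine (norm_sum_le _ _).trans ((sum_le_sum fun i _ => hz _).trans ?_)
      simp
    have h3 : (n:ℝ) ≤ 2 ^ n := mod_cast Nat.lt_two_pow_self.le
    have h4 : (2:ℝ) ^ n ≤ 4 ^ n := by gcongr; norm_num
    have e : (1 - z 0 * w) * P - (1 - (z 0 + T) * w) =
        (1 - z 0 * w) * (P - (1 - T * w)) + z 0 * T * w ^ 2 := by ring
    rw [e]
    have h5 : ‖1 - z 0 * w‖ ≤ 2 := by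
      refine (norm_sub_le _ _).trans ?_
      rw [norm_one, norm_mul]
      have := mul_le_one₀ (hz 0) (norm_nonneg w) hw
      linarith
    calc _ ≤ ‖1 - z 0 * w‖ * ‖P - (1 - T * w)‖ + ‖z 0‖ * ‖T‖ * ‖w‖ ^ 2 := by
          refine (norm_add_le _ _).trans ?_
          simp only [norm_mul, norm_pow]; exact le_rfl
      _ ≤ 2 * (4 ^ n * ‖w‖ ^ 2) + 1 * 4 ^ n * ‖w‖ ^ 2 := by
          gcongr
          · exact hz 0
          · linarith
      _ ≤ _ := by
          rw [pow_succ (4:ℝ)]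
          have : 0 ≤ (4:ℝ) ^ n * ‖w‖ ^ 2 := by positivity
          linarith

/-- The local factor at `p` of the Dirichlet series of `weight r` after division by the local
factors of `L(4s) L(6s)² L(7s)ʳ`, as a function of `z = p⁻ˢ`. -/
noncomputable def localFactor (r p : ℕ) (z : ℂ) : ℂ :=
  (1 + localWeight r p 4 * z ^ 4 + localWeight r p 6 * z ^ 6 + localWeight r p 7 * z ^ 7) *
    ((1 - charModEight 0 p * z ^ 4) * ((∏ i, (1 - charFamily 2 i p * z ^ 6)) *
      ∏ i, (1 - charFamily r i p * z ^ 7)))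

/-- If the parameters satisfy natural bounds, the product of the local factors is close to one. -/
lemma norm_local_product_le {q : ℝ} (hq : q ≤ 1) {u V A B a b : ℂ}
    (hu : ‖u‖ ≤ q ^ 4) (ha : ‖a‖ ≤ 2 * q ^ 6) (hb : ‖b‖ ≤ 4 * q ^ 7) (hV : V = a + b)
    (hA : ‖A - (1 - a)‖ ≤ 4 ^ 4 * q ^ 12) (hB : ‖B - (1 - b)‖ ≤ 4 ^ 4 * q ^ 14) (hq0 : 0 ≤ q) :
    ‖(1 + u + V) * ((1 - u) * (A * B)) - 1‖ ≤ q ^ 8 + 1000000 * q ^ 10 := by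
  set α := A - (1 - a) with hα
  set β := B - (1 - b) with hβ
  have eA : A = 1 - a + α := by rw [hα]; ring
  have eB : B = 1 - b + β := by rw [hβ]; ring
  have hp : ∀ m : ℕ, q ^ (10 + m) ≤ q ^ 10 := fun m => by
    rw [pow_add]
    exact mul_le_of_le_one_right (by positivity) (pow_le_one₀ hq0 hq)
  have hV' : ‖V‖ ≤ 6 * q ^ 6 := by
    rw [hV]
    refine (norm_add_le _ _).trans ?_
    have : q ^ 7 ≤ q ^ 6 := pow_le_pow_of_le_one hq0 hq (by norm_num)
    linarith
  have h1 : ∀ m : ℕ, q ^ m ≤ 1 := fun m => pow_le_one₀ hq0 hq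
  -- the product of `A` and `B` is `1 - V + ρ`
  set ρ := a * b + (1 - a) * β + (1 - b) * α + α * β with hρ
  have eAB : A * B = 1 - V + ρ := by rw [hρ, eA, eB, hV]; ring
  have h1a : ‖1 - a‖ ≤ 3 := by
    refine (norm_sub_le _ _).trans ?_
    rw [norm_one]; linarith [h1 6]
  have h1b : ‖1 - b‖ ≤ 5 := by
    refine (norm_sub_le _ _).trans ?_
    rw [norm_one]; linarith [h1 7]
  have hρ' : ‖ρ‖ ≤ 70000 * q ^ 10 := by
    calc ‖ρ‖ ≤ ‖a‖ * ‖b‖ + ‖1 - a‖ * ‖β‖ + ‖1 - b‖ * ‖α‖ + ‖α‖ * ‖β‖ := by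
          rw [hρ]
          refine (norm_add_le _ _).trans (add_le_add ((norm_add_le _ _).trans
            (add_le_add ((norm_add_le _ _).trans (add_le_add ?_ ?_)) ?_)) ?_) <;> rw [norm_mul]
      _ ≤ (2 * q ^ 6) * (4 * q ^ 7) + 3 * (4 ^ 4 * q ^ 14) + 5 * (4 ^ 4 * q ^ 12) +
          (4 ^ 4 * q ^ 12) * (4 ^ 4 * q ^ 14) := by gcongr
      _ = 8 * q ^ (10 + 3) + 768 * q ^ (10 + 4) + 1280 * q ^ (10 + 2) + 65536 * q ^ (10 + 16) := by
          ring
      _ ≤ _ := by linarith [hp 3, hp 4, hp 2, hp 16, pow_nonneg hq0 10]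
  have e : (1 + u + V) * ((1 - u) * (A * B)) - 1 =
      -u ^ 2 + (-(u * V) + u ^ 2 * V - V ^ 2 + u * V ^ 2 + (1 - u ^ 2 + V - u * V) * ρ) := by
    rw [eAB]; ring
  have hu1 : ‖u‖ ≤ 1 := hu.trans (h1 4)
  have h9 : ‖1 - u ^ 2 + V - u * V‖ ≤ 14 := by
    calc _ ≤ 1 + ‖u‖ ^ 2 + ‖V‖ + ‖u‖ * ‖V‖ := by
          refine (norm_sub_le _ _).trans (add_le_add ((norm_add_le _ _).trans
            (add_le_add ((norm_sub_le _ _).trans (add_le_add ?_ ?_)) le_rfl)) ?_)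
          · simp
          · simp
          · simp
      _ ≤ 1 + 1 ^ 2 + 6 * 1 + 1 * (6 * 1) := by
          have : ‖V‖ ≤ 6 * 1 := hV'.trans (by gcongr; exact h1 6)
          gcongr
      _ = 14 := by norm_num
  rw [e]
  have h10 : ‖V‖ ^ 2 ≤ (6 * q ^ 6) ^ 2 := by gcongr
  calc _ ≤ ‖u‖ ^ 2 + (‖u‖ * ‖V‖ + ‖u‖ ^ 2 * ‖V‖ + ‖V‖ ^ 2 + ‖u‖ * ‖V‖ ^ 2 +
        ‖1 - u ^ 2 + V - u * V‖ * ‖ρ‖) := by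
        refine (norm_add_le _ _).trans (add_le_add (by simp) ((norm_add_le _ _).trans
          (add_le_add ((norm_add_le _ _).trans (add_le_add ((norm_sub_le _ _).trans
          (add_le_add ((norm_add_le _ _).trans (add_le_add ?_ ?_)) ?_)) ?_)) ?_))) <;> simp
    _ ≤ (q ^ 4) ^ 2 + (q ^ 4 * (6 * q ^ 6) + (q ^ 4) ^ 2 * (6 * q ^ 6) + (6 * q ^ 6) ^ 2 +
        1 * (6 * q ^ 6) ^ 2 + 14 * (70000 * q ^ 10)) := by gcongr
    _ = q ^ 8 + (6 * q ^ 10 + 6 * q ^ (10 + 4) + 72 * q ^ (10 + 2) + 980000 * q ^ 10) := by ring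
    _ ≤ _ := by linarith [hp 4, hp 2, pow_nonneg hq0 10]

lemma norm_localFactor_sub_one_le (hr : r = 0 ∨ r = 4) {p : ℕ} (hp : p.Prime) {z : ℂ}
    (hz : ‖z‖ ≤ 1) : ‖localFactor r p z - 1‖ ≤ ‖z‖ ^ 8 + 1000000 * ‖z‖ ^ 10 := by
  obtain ⟨h4, h6, h7⟩ := natCast_localWeight hr hp
  rw [localFactor, add_assoc, h4, h6, h7]
  have hr4 : r ≤ 4 := by omega
  have hsum : ∀ k : ℕ, ‖∑ i, charFamily k i p‖ ≤ k := fun k => by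
    refine (norm_sum_le _ _).trans ((sum_le_sum fun i _ => norm_charFamily_le k i _).trans ?_)
    simp
  have hpow : ∀ m : ℕ, ‖z ^ m‖ ≤ 1 := fun m => by
    rw [norm_pow]; exact pow_le_one₀ (norm_nonneg _) hz
  have h44 : ∀ k : ℕ, k ≤ 4 → (4:ℝ) ^ k ≤ 4 ^ 4 := fun k hk => pow_le_pow_right₀ (by norm_num) hk
  refine norm_local_product_le hz ?_ (a := (∑ i, charFamily 2 i p) * z ^ 6)
    (b := (∑ i, charFamily r i p) * z ^ 7) ?_ ?_ rfl ?_ ?_ (norm_nonneg _)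
  · rw [norm_mul, norm_pow]
    exact mul_le_of_le_one_left (by positivity) (norm_le_one _ _)
  · rw [norm_mul, norm_pow]
    gcongr
    exact_mod_cast hsum 2
  · rw [norm_mul, norm_pow]
    gcongr
    refine (hsum r).trans ?_
    exact_mod_cast hr4
  · refine (norm_prod_one_sub_sub_le _ (fun i => norm_charFamily_le 2 i _) (hpow 6)).trans ?_
    rw [norm_pow, ← pow_mul]
    gcongr <;> norm_num
  · refine (norm_prod_one_sub_sub_le _ (fun i => norm_charFamily_le r i _) (hpow 7)).trans ?_
    rw [norm_pow, ← pow_mul]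
    gcongr
    norm_num

lemma norm_primes_cpow (p : Nat.Primes) (s : ℂ) : ‖((p : ℕ) : ℂ) ^ (-s)‖ = ((p : ℕ) : ℝ) ^ (-s.re) := by
  rw [norm_natCast_cpow_of_pos p.2.pos, neg_re]

lemma primes_rpow_neg_le {p : Nat.Primes} {σ τ : ℝ} (h : σ ≤ τ) :
    ((p : ℕ) : ℝ) ^ (-τ) ≤ ((p : ℕ) : ℝ) ^ (-σ) :=
  rpow_le_rpow_of_exponent_le (mod_cast p.2.one_le) (by linarith)

lemma primes_rpow_neg_le_one {p : Nat.Primes} (h : 0 ≤ σ) : ((p : ℕ) : ℝ) ^ (-σ) ≤ 1 :=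
  rpow_le_one_of_one_le_of_nonpos (mod_cast p.2.one_le) (by linarith)

lemma primes_rpow_neg_pow (p : Nat.Primes) (σ : ℝ) (m : ℕ) :
    (((p : ℕ) : ℝ) ^ (-σ)) ^ m = ((p : ℕ) : ℝ) ^ (-(m * σ)) := by
  rw [← rpow_mul_natCast (by positivity)]
  congr 1; ring

lemma summable_primes_rpow_neg_pow {m : ℕ} (h : 1 < m * σ) :
    Summable fun p : Nat.Primes => (((p : ℕ) : ℝ) ^ (-σ)) ^ m := by
  simp_rw [primes_rpow_neg_pow]
  exact Nat.Primes.summable_rpow.2 (by linarith)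

/-- The Euler product remaining after dividing the Dirichlet series of `weight r` by
`L(4s) L(6s)² L(7s)ʳ`. -/
noncomputable def correctionFactor (r : ℕ) (s : ℂ) : ℂ :=
  ∏' p : Nat.Primes, localFactor r p (((p : ℕ) : ℂ) ^ (-s))

lemma norm_localFactor_primes_sub_one_le (hr : r = 0 ∨ r = 4) (p : Nat.Primes)
    (hσ : 0 ≤ σ) (hs : σ ≤ s.re) :
    ‖localFactor r p (((p : ℕ) : ℂ) ^ (-s)) - 1‖ ≤
      (((p : ℕ) : ℝ) ^ (-σ)) ^ 8 + 1000000 * (((p : ℕ) : ℝ) ^ (-σ)) ^ 10 := by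
  have h1 : ‖((p : ℕ) : ℂ) ^ (-s)‖ ≤ ((p : ℕ) : ℝ) ^ (-σ) := by
    rw [norm_primes_cpow]; exact primes_rpow_neg_le hs
  refine (norm_localFactor_sub_one_le hr p.2 (h1.trans (primes_rpow_neg_le_one hσ))).trans ?_
  gcongr

lemma summable_primes_bound (hσ : 1 / 8 < σ) : Summable fun p : Nat.Primes =>
      (((p : ℕ) : ℝ) ^ (-σ)) ^ 8 + 1000000 * (((p : ℕ) : ℝ) ^ (-σ)) ^ 10 :=
  (summable_primes_rpow_neg_pow (by push_cast; linarith)).add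
    ((summable_primes_rpow_neg_pow (by push_cast; linarith)).mul_left _)

lemma multipliable_localFactor (hr : r = 0 ∨ r = 4) (hs : 1 / 8 < s.re) :
    Multipliable fun p : Nat.Primes => localFactor r p (((p : ℕ) : ℂ) ^ (-s)) := by
  have h : Summable fun p : Nat.Primes => localFactor r p (((p : ℕ) : ℂ) ^ (-s)) - 1 :=
    Summable.of_norm_bounded (summable_primes_bound hs)
      fun p => norm_localFactor_primes_sub_one_le hr p (by linarith) le_rfl
  simpa using Complex.multipliable_one_add_of_summable h

lemma differentiable_localFactor (r : ℕ) (p : ℕ) : Differentiable ℂ (localFactor r p) := by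
  unfold localFactor
  fun_prop

lemma differentiableOn_correctionFactor (hr : r = 0 ∨ r = 4) :
    DifferentiableOn ℂ (correctionFactor r) {s | 1 / 8 < s.re} := by
  intro s hs
  obtain ⟨σ, h1, h2⟩ := exists_between (show 1 / 8 < s.re from hs)
  have hopen : IsOpen {z : ℂ | σ < z.re} := isOpen_lt continuous_const continuous_re
  have hd : ∀ p : Nat.Primes, Differentiable ℂ
      fun z : ℂ => localFactor r p (((p : ℕ) : ℂ) ^ (-z)) - 1 := fun p =>
    ((differentiable_localFactor r p).comp
      (differentiable_neg.const_cpow (Or.inl (mod_cast p.2.ne_zero)))).sub_const 1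
  have h3 := Summable.hasProdLocallyUniformlyOn_one_add hopen (summable_primes_bound h1)
    (f := fun (p : Nat.Primes) (z : ℂ) => localFactor r p (((p : ℕ) : ℂ) ^ (-z)) - 1)
    (.of_forall fun p z hz => norm_localFactor_primes_sub_one_le hr p (by linarith) (le_of_lt hz))
    fun p => (hd p).continuous.continuousOn
  have h4 : DifferentiableOn ℂ (fun z => ∏' p : Nat.Primes,
      (1 + (localFactor r p (((p : ℕ) : ℂ) ^ (-z)) - 1))) {z : ℂ | σ < z.re} :=
    h3.differentiableOn (.of_forall fun S => by
      simpa [prod_fn] using DifferentiableOn.finsetProd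
        (fun p _ => ((hd p).const_add 1).differentiableOn)) hopen
  simp only [add_sub_cancel] at h4
  exact (h4.differentiableAt (hopen.mem_nhds h2)).differentiableWithinAt

lemma prod_primes_le_tsum (hσ : 1 < σ) (S : Finset Nat.Primes) :
    ∏ p ∈ S, (1 + ((p : ℕ) : ℝ) ^ (-σ)) ≤ ∑' n : ℕ, 1 / (n : ℝ) ^ σ := by
  let f : ℕ →* ℝ := ⟨⟨fun n => (n : ℝ) ^ (-σ), by simp⟩, fun m n => by
    push_cast
    exact mul_rpow (by positivity) (by positivity)⟩
  have hf : ∀ n, f n = (n : ℝ) ^ (-σ) := fun _ => rfl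
  have hsum : Summable fun n : ℕ => f n := summable_nat_rpow.2 (by linarith)
  let ι : Nat.Primes ↪ ℕ := ⟨fun p => (p : ℕ), Nat.Primes.coe_nat_injective⟩
  have h1 := EulerProduct.prod_filter_prime_geometric_eq_tsum_factoredNumbers hsum (S.map ι)
  have h2 : ∏ p ∈ S.map ι with p.Prime, (1 - f p)⁻¹ = ∏ p ∈ S, (1 - ((p : ℕ) : ℝ) ^ (-σ))⁻¹ := by
    rw [filter_true_of_mem, prod_map]
    · rfl
    · intro p hp
      obtain ⟨q, -, rfl⟩ := mem_map.1 hp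
      exact q.2
  have h0 : ∀ n, 0 ≤ f n := fun n => by rw [hf]; positivity
  calc _ ≤ ∏ p ∈ S, (1 - ((p : ℕ) : ℝ) ^ (-σ))⁻¹ := by
        refine prod_le_prod (fun p _ => by positivity) fun p _ => ?_
        have h3 : ((p : ℕ) : ℝ) ^ (-σ) < 1 :=
          rpow_lt_one_of_one_lt_of_neg (mod_cast p.2.one_lt) (by linarith)
        have h4 : 0 ≤ ((p : ℕ) : ℝ) ^ (-σ) := by positivity
        rw [le_inv_comm₀ (by positivity) (by linarith), inv_eq_one_div, le_div_iff₀ (by positivity)]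
        nlinarith
    _ = ∑' m : Nat.factoredNumbers (S.map ι), f m := by rw [← h1, h2]
    _ ≤ ∑' n, f n := Summable.tsum_subtype_le (f := fun n => f n) _ h0 hsum
    _ = _ := by
        congr 1; ext n
        rw [hf, rpow_neg (by positivity), one_div]

/-- The correction factor is bounded by a constant times `ζ(8σ)` to the right of
`Re s = σ > 1/8`. -/
theorem exists_norm_correctionFactor_le : ∃ C : ℝ, 0 < C ∧ ∀ r : ℕ, r = 0 ∨ r = 4 →
    ∀ σ : ℝ, 1 / 8 < σ → ∀ s : ℂ, σ ≤ s.re →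
    ‖correctionFactor r s‖ ≤ C * ∑' n : ℕ, 1 / (n : ℝ) ^ (8 * σ) := by
  have hsum : Summable fun p : Nat.Primes => (((p : ℕ) : ℝ) ^ (-(1 / 8 : ℝ))) ^ 10 :=
    summable_primes_rpow_neg_pow (by norm_num)
  refine ⟨exp (1000000 * ∑' p : Nat.Primes, (((p : ℕ) : ℝ) ^ (-(1 / 8 : ℝ))) ^ 10),
    exp_pos _, fun r hr σ hσ s hs => ?_⟩
  have hm := multipliable_localFactor hr (hσ.trans_le hs)
  rw [correctionFactor]
  have h2 := (hm.hasProd.norm : HasProd _ _)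
  refine le_of_tendsto h2 (.of_forall fun S => ?_)
  calc ∏ p ∈ S, ‖localFactor r p (((p : ℕ) : ℂ) ^ (-s))‖
      ≤ ∏ p ∈ S, (exp (1000000 * (((p : ℕ) : ℝ) ^ (-(1 / 8 : ℝ))) ^ 10) *
          (1 + ((p : ℕ) : ℝ) ^ (-(8 * σ)))) := by
        refine prod_le_prod (fun _ _ => norm_nonneg _) fun p _ => ?_
        have h3 := norm_localFactor_primes_sub_one_le hr p (by linarith) hs
        have h4 : ‖localFactor r p (((p : ℕ) : ℂ) ^ (-s))‖ ≤
            1 + ((((p : ℕ) : ℝ) ^ (-σ)) ^ 8 + 1000000 * (((p : ℕ) : ℝ) ^ (-σ)) ^ 10) := by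
          have := norm_add_le (1 : ℂ) (localFactor r p (((p : ℕ) : ℂ) ^ (-s)) - 1)
          rw [add_sub_cancel, norm_one] at this
          linarith
        have h5 : (((p : ℕ) : ℝ) ^ (-σ)) ^ 10 ≤ (((p : ℕ) : ℝ) ^ (-(1 / 8 : ℝ))) ^ 10 := by
          have := primes_rpow_neg_le (p := p) hσ.le
          gcongr
        have h6 := add_one_le_exp (1000000 * (((p : ℕ) : ℝ) ^ (-(1 / 8 : ℝ))) ^ 10)
        have h7 : (((p : ℕ) : ℝ) ^ (-σ)) ^ 8 = ((p : ℕ) : ℝ) ^ (-(8 * σ)) := by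
          rw [primes_rpow_neg_pow]; norm_num
        rw [h7] at h4
        have h8 : 0 ≤ ((p : ℕ) : ℝ) ^ (-(8 * σ)) := by positivity
        have h9 : 0 ≤ (((p : ℕ) : ℝ) ^ (-(1 / 8 : ℝ))) ^ 10 := by positivity
        nlinarith
    _ = exp (1000000 * ∑ p ∈ S, (((p : ℕ) : ℝ) ^ (-(1 / 8 : ℝ))) ^ 10) *
        ∏ p ∈ S, (1 + ((p : ℕ) : ℝ) ^ (-(8 * σ))) := by
        rw [prod_mul_distrib, ← exp_sum, mul_sum]
    _ ≤ _ := by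
        gcongr
        · exact hsum.sum_le_tsum _ fun _ _ => by positivity
        · exact prod_primes_le_tsum (by linarith) S

lemma localWeight_le (hr : r = 0 ∨ r = 4) (p e : ℕ) : localWeight r p e ≤ 4 := by
  rw [localWeight]
  split_ifs <;> omega

lemma natCast_pow_cpow (p e : ℕ) (s : ℂ) : ((p ^ e : ℕ) : ℂ) ^ s = ((p : ℂ) ^ s) ^ e := by
  induction e with
  | zero => simp
  | succ e ih => rw [pow_succ, Nat.cast_mul, natCast_mul_natCast_cpow, ih, pow_succ]

/-- The Dirichlet series of `weight r` converges absolutely for `Re s > 1/4`. -/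
lemma summable_weight_mul_rpow (hr : r = 0 ∨ r = 4) (hσ : 1 / 4 < σ) :
    Summable fun n : ℕ => (weight r n : ℝ) * (n : ℝ) ^ (-σ) := by
  set f : ℕ → ℝ := fun n => (weight r n : ℝ) * (n : ℝ) ^ (-σ) with hf
  have hf0 : ∀ n, 0 ≤ f n := fun n => by positivity
  have hmul : ∀ {m n : ℕ}, m.Coprime n → f (m * n) = f m * f n := fun {m n} h => by
    simp only [hf, weight_mul_of_coprime r h, Nat.cast_mul]
    rw [mul_rpow (by positivity) (by positivity)]; ring
  have hpe : ∀ {p : ℕ}, p.Prime → HasSum (fun e => f (p ^ e))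
      (1 + localWeight r p 4 * ((p : ℝ) ^ (-σ)) ^ 4 + localWeight r p 6 * ((p : ℝ) ^ (-σ)) ^ 6 +
        localWeight r p 7 * ((p : ℝ) ^ (-σ)) ^ 7) := fun {p} hp => by
    have h : (fun e => f (p ^ e)) = fun e => (localWeight r p e : ℝ) * ((p : ℝ) ^ (-σ)) ^ e := by
      ext e
      simp only [hf, weight_prime_pow r hp, Nat.cast_pow]
      rw [← rpow_natCast_mul (by positivity), mul_comm (e : ℝ), rpow_mul_natCast (by positivity)]
    rw [h]
    exact hasSum_localWeight r p _
  have hps : Summable fun p : Nat.Primes => (((p : ℕ) : ℝ) ^ (-σ)) ^ 4 :=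
    summable_primes_rpow_neg_pow (by push_cast; linarith)
  refine summable_of_sum_le (c := exp (12 * ∑' p : Nat.Primes, (((p : ℕ) : ℝ) ^ (-σ)) ^ 4))
    hf0 fun u => ?_
  obtain ⟨N, hN⟩ : ∃ N : ℕ, ∀ n ∈ u, n < N := ⟨u.sup id + 1, fun n hn =>
    Nat.lt_succ_of_le (le_sup (f := id) hn)⟩
  have hE := EulerProduct.summable_and_hasSum_smoothNumbers_prod_primesBelow_tsum (f := f)
    (by simp [hf]) hmul (fun {p} hp => by simpa using (hpe hp).summable.norm) N
  have h1 : ∑ n ∈ u, f n ≤ ∑' m : N.smoothNumbers, f m := by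
    have h2 : ∑ n ∈ u, f n = ∑ n ∈ u, N.smoothNumbers.indicator f n := by
      refine sum_congr rfl fun n hn => ?_
      rcases eq_or_ne n 0 with rfl | h0
      · simp [hf, Set.indicator_apply]
      · rw [Set.indicator_of_mem]
        exact Nat.mem_smoothNumbers_of_lt (Nat.pos_of_ne_zero h0) (hN n hn)
    rw [h2, tsum_subtype]
    refine Summable.sum_le_tsum _ (fun n _ => Set.indicator_nonneg (fun n _ => hf0 n) n) ?_
    exact summable_subtype_iff_indicator.1 hE.2.summable
  refine h1.trans ?_
  rw [hE.2.tsum_eq]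
  have h3 : ∀ p ∈ N.primesBelow, ∑' e, f (p ^ e) ≤ exp (12 * ((p : ℝ) ^ (-σ)) ^ 4) := by
    intro p hp
    have hp' := Nat.prime_of_mem_primesBelow hp
    rw [(hpe hp').tsum_eq]
    have hx1 : (p : ℝ) ^ (-σ) ≤ 1 := primes_rpow_neg_le_one (p := ⟨p, hp'⟩) (by linarith)
    have hx0 : 0 ≤ (p : ℝ) ^ (-σ) := by positivity
    have h6 : ((p : ℝ) ^ (-σ)) ^ 6 ≤ ((p : ℝ) ^ (-σ)) ^ 4 :=
      pow_le_pow_of_le_one hx0 hx1 (by norm_num)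
    have h7 : ((p : ℝ) ^ (-σ)) ^ 7 ≤ ((p : ℝ) ^ (-σ)) ^ 4 :=
      pow_le_pow_of_le_one hx0 hx1 (by norm_num)
    have hw : ∀ e, (localWeight r p e : ℝ) ≤ 4 := fun e => by exact_mod_cast localWeight_le hr p e
    have g4 : (localWeight r p 4 : ℝ) * ((p : ℝ) ^ (-σ)) ^ 4 ≤ 4 * ((p : ℝ) ^ (-σ)) ^ 4 := by
      gcongr; exact hw _
    have g6 : (localWeight r p 6 : ℝ) * ((p : ℝ) ^ (-σ)) ^ 6 ≤ 4 * ((p : ℝ) ^ (-σ)) ^ 4 := by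
      gcongr; exact hw _
    have g7 : (localWeight r p 7 : ℝ) * ((p : ℝ) ^ (-σ)) ^ 7 ≤ 4 * ((p : ℝ) ^ (-σ)) ^ 4 := by
      gcongr; exact hw _
    have := add_one_le_exp (12 * ((p : ℝ) ^ (-σ)) ^ 4)
    linarith
  calc _ ≤ ∏ p ∈ N.primesBelow, exp (12 * ((p : ℝ) ^ (-σ)) ^ 4) :=
        prod_le_prod (fun p _ => tsum_nonneg fun e => hf0 _) h3
    _ = exp (12 * ∑ p ∈ N.primesBelow, ((p : ℝ) ^ (-σ)) ^ 4) := by rw [← exp_sum, mul_sum]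
    _ ≤ _ := by
        gcongr
        let e : {p // p ∈ N.primesBelow} ↪ Nat.Primes :=
          ⟨fun p => ⟨p.1, Nat.prime_of_mem_primesBelow p.2⟩, fun p q h => Subtype.ext (congrArg (fun q : Nat.Primes => (q : ℕ)) h)⟩
        have := hps.sum_le_tsum (N.primesBelow.attach.map e) fun _ _ => by positivity
        rw [sum_map] at this
        rw [← sum_attach]
        exact this

/-- The Dirichlet series of `weight r`. -/
noncomputable def weightSeries (r : ℕ) (s : ℂ) : ℂ := ∑' n : ℕ, (weight r n : ℂ) * (n : ℂ) ^ (-s)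

lemma norm_weight_mul_cpow (r n : ℕ) (s : ℂ) :
    ‖(weight r n : ℂ) * (n : ℂ) ^ (-s)‖ = (weight r n : ℝ) * (n : ℝ) ^ (-s.re) := by
  rcases Nat.eq_zero_or_pos n with rfl | hn
  · simp
  · rw [norm_mul, norm_natCast_cpow_of_pos hn, Complex.norm_natCast, neg_re]

lemma hasProd_weightSeries (hr : r = 0 ∨ r = 4) (hs : 1 / 4 < s.re) :
    HasProd (fun p : Nat.Primes => 1 + localWeight r p 4 * (((p : ℕ) : ℂ) ^ (-s)) ^ 4 +
      localWeight r p 6 * (((p : ℕ) : ℂ) ^ (-s)) ^ 6 +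
        localWeight r p 7 * (((p : ℕ) : ℂ) ^ (-s)) ^ 7) (weightSeries r s) := by
  have h := EulerProduct.eulerProduct_hasProd
    (f := fun n : ℕ => (weight r n : ℂ) * (n : ℂ) ^ (-s)) (by simp)
    (fun {m n} h => by
      rw [weight_mul_of_coprime r h, Nat.cast_mul, Nat.cast_mul, natCast_mul_natCast_cpow]; ring)
    (by simpa only [norm_weight_mul_cpow] using summable_weight_mul_rpow hr hs) (by simp)
  rw [weightSeries]
  convert h using 2 with p
  refine ((hasSum_localWeight r p (((p : ℕ) : ℂ) ^ (-s))).tsum_eq).symm.trans ?_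
  congr 1; ext e
  rw [weight_prime_pow r p.2, natCast_pow_cpow]

lemma hasProd_LFunction_natCast_mul (hs : 1 < κ * s.re) :
    HasProd (fun p : Nat.Primes => (1 - χ p * (((p : ℕ) : ℂ) ^ (-s)) ^ κ)⁻¹)
      (χ.LFunction (κ * s)) := by
  have h1 : 1 < ((κ : ℂ) * s).re := by simpa using hs
  rw [LFunction_eq_LSeries χ h1]
  convert DirichletCharacter.LSeries_eulerProduct_hasProd χ h1 using 2 with p
  have h2 : ((p : ℕ) : ℂ) ^ (-(κ * s)) = (((p : ℕ) : ℂ) ^ (-s)) ^ κ := by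
    rw [← cpow_nat_mul, mul_neg]
  exact congrArg (fun z => (1 - χ p * z)⁻¹) h2.symm

theorem weightSeries_eq (hr : r = 0 ∨ r = 4) (hs : 1 / 4 < s.re) :
    weightSeries r s = (charModEight 0).LFunction ((4 : ℕ) * s) *
      ((∏ i, (charFamily 2 i).LFunction ((6 : ℕ) * s)) *
        ∏ i, (charFamily r i).LFunction ((7 : ℕ) * s)) * correctionFactor r s := by
  have h1 := ((hasProd_LFunction_natCast_mul (charModEight 0) (κ := 4) (s := s)
    (by push_cast; linarith)).mul ((hasProd_prod (s := univ) fun i _ =>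
      hasProd_LFunction_natCast_mul (charFamily 2 i) (κ := 6) (s := s)
      (by push_cast; linarith)).mul (hasProd_prod (s := univ) fun i _ =>
      hasProd_LFunction_natCast_mul (charFamily r i) (κ := 7) (s := s)
      (by push_cast; linarith)))).mul (multipliable_localFactor hr (s := s) (by linarith)).hasProd
  refine (hasProd_weightSeries hr hs).unique ?_
  rw [correctionFactor]
  convert h1 using 2 with p
  have hz : ‖((p : ℕ) : ℂ) ^ (-s)‖ < 1 := by
    rw [norm_primes_cpow]
    exact rpow_lt_one_of_one_lt_of_neg (mod_cast p.2.one_lt) (by linarith)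
  have hne : ∀ (χ : DirichletCharacter ℂ 8) (κ : ℕ), κ ≠ 0 →
      1 - χ p * (((p : ℕ) : ℂ) ^ (-s)) ^ κ ≠ 0 := fun χ κ hκ h => by
    have h2 : ‖χ p * (((p : ℕ) : ℂ) ^ (-s)) ^ κ‖ < 1 := by
      rw [norm_mul, norm_pow]
      exact (mul_le_of_le_one_left (by positivity) (norm_le_one _ _)).trans_lt
        (pow_lt_one₀ (norm_nonneg _) hz hκ)
    rw [← sub_eq_zero.1 h, norm_one] at h2
    exact lt_irrefl _ h2
  rw [localFactor, prod_inv_distrib, prod_inv_distrib]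
  have h4 := hne (charModEight 0) 4 (by norm_num)
  have h6 := prod_ne_zero_iff.2 fun i (_ : i ∈ univ) => hne (charFamily 2 i) 6 (by norm_num)
  have h7 := prod_ne_zero_iff.2 fun i (_ : i ∈ univ) => hne (charFamily r i) 7 (by norm_num)
  rw [show ∀ P A B C : ℂ, A⁻¹ * (B⁻¹ * C⁻¹) * (P * (A * (B * C))) =
    P * ((A⁻¹ * A) * ((B⁻¹ * B) * (C⁻¹ * C))) from fun P A B C => by ring, inv_mul_cancel₀ h4,
    inv_mul_cancel₀ h6, inv_mul_cancel₀ h7, mul_one, mul_one, mul_one]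

lemma ofReal_add_mul_I_ne_zero {a : ℝ} (ha : 0 < a) (y : ℝ) : (a : ℂ) + y * I ≠ 0 := fun h => by
  have := congrArg re h
  simp at this
  linarith

lemma one_add_sq_le_norm_mul {a b : ℝ} (ha : 0 < a) (hb : 0 < b) (y : ℝ) :
    min (min a b ^ 2) 1 * (1 + y ^ 2) ≤ ‖((a : ℂ) + y * I) * (b + y * I)‖ := by
  set m := min a b with hm
  have hm0 : 0 < m := lt_min ha hb
  have key : ∀ c : ℝ, m ≤ c → sqrt (m ^ 2 + y ^ 2) ≤ ‖(c : ℂ) + y * I‖ := fun c hc => by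
    rw [norm_add_mul_I]
    exact sqrt_le_sqrt (by nlinarith)
  rw [norm_mul]
  calc _ ≤ m ^ 2 + y ^ 2 := by
        have h1 := min_le_left (m ^ 2) 1
        have h2 := min_le_right (m ^ 2) 1
        nlinarith [mul_nonneg (sub_nonneg.2 h2) (sq_nonneg y)]
    _ = sqrt (m ^ 2 + y ^ 2) * sqrt (m ^ 2 + y ^ 2) := (mul_self_sqrt (by positivity)).symm
    _ ≤ _ := mul_le_mul (key a (min_le_left _ _)) (key b (min_le_right _ _)) (by positivity)
        (norm_nonneg _)

lemma integrable_inv_mul_add_mul_I {a b : ℝ} (ha : 0 < a) (hb : 0 < b) :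
    Integrable fun y : ℝ => (((a : ℂ) + y * I) * (b + y * I))⁻¹ := by
  set m := min (min a b ^ 2) 1 with hm
  have hm0 : 0 < m := lt_min (by have := lt_min ha hb; positivity) one_pos
  refine (integrable_inv_one_add_sq.const_mul m⁻¹).mono' ?_ (.of_forall fun y => ?_)
  · refine Continuous.aestronglyMeasurable (Continuous.inv₀ (by fun_prop) fun y => ?_)
    exact mul_ne_zero (ofReal_add_mul_I_ne_zero ha y) (ofReal_add_mul_I_ne_zero hb y)
  · rw [norm_inv, ← mul_inv]
    exact inv_anti₀ (by positivity) (one_add_sq_le_norm_mul ha hb y)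

/-- Mellin inversion for `A v ^ (-α) + B + C v` truncated at `1`. -/
lemma mellinInv_truncated {α c A B C v : ℝ} (hα : 0 ≤ α) (hc : α < c) (h0 : A + B + C = 0)
    (hv : 0 < v) :
    ∫ y : ℝ, (v : ℂ) ^ (-((c : ℂ) + y * I)) *
      (A * α * (((c : ℂ) + y * I) * (((c - α : ℝ) : ℂ) + y * I))⁻¹
        - C * (((c : ℂ) + y * I) * (((c + 1 : ℝ) : ℂ) + y * I))⁻¹) =
      ((2 * π * (A * (min v 1) ^ (-α) + B + C * min v 1) : ℝ) : ℂ) := by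
  set f : ℝ → ℂ := fun t => (A : ℂ) • Set.indicator (Set.Ioc 0 1) (fun t : ℝ => (t : ℂ) ^ (-α : ℂ)) t
    + ((B : ℂ) • Set.indicator (Set.Ioc 0 1) (fun _ => (1 : ℂ)) t
    + (C : ℂ) • Set.indicator (Set.Ioc 0 1) (fun t : ℝ => (t : ℂ) ^ (1 : ℂ)) t) with hf
  have hmel : ∀ s : ℂ, s.re = c → HasMellin f s (A * (1 / (s + (-α : ℂ))) +
      (B * (1 / s) + C * (1 / (s + 1)))) := fun s hs => by
    have m1 := hasMellin_cpow_Ioc (-α : ℂ) (s := s) (by simp [hs]; linarith)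
    have m2 := hasMellin_one_Ioc (s := s) (by rw [hs]; linarith)
    have m3 := hasMellin_cpow_Ioc (1 : ℂ) (s := s) (by simp [hs]; linarith)
    have n1 := hasMellin_const_smul m1.1 (A : ℂ)
    have n2 := hasMellin_const_smul m2.1 (B : ℂ)
    have n3 := hasMellin_const_smul m3.1 (C : ℂ)
    have n4 := hasMellin_add n2.1 n3.1
    have n5 := hasMellin_add n1.1 n4.1
    refine ⟨n5.1, n5.2.trans ?_⟩
    rw [n4.2, n1.2, n2.2, n3.2, m1.2, m2.2, m3.2]
    simp only [smul_eq_mul]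
  have hc0 : 0 < c := by linarith
  have hB : B = -A - C := by linarith
  have heq : ∀ y : ℝ, mellin f (c + y * I) =
      A * α * (((c : ℂ) + y * I) * (((c - α : ℝ) : ℂ) + y * I))⁻¹
        - C * (((c : ℂ) + y * I) * (((c + 1 : ℝ) : ℂ) + y * I))⁻¹ := fun y => by
    rw [(hmel (c + y * I) (by simp)).2]
    have e1 := ofReal_add_mul_I_ne_zero hc0 y
    have e2 := ofReal_add_mul_I_ne_zero (sub_pos.2 hc) y
    have e3 := ofReal_add_mul_I_ne_zero (by linarith : 0 < c + 1) y
    rw [show (c : ℂ) + y * I + -α = ((c - α : ℝ) : ℂ) + y * I by push_cast; ring,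
      show (c : ℂ) + y * I + 1 = ((c + 1 : ℝ) : ℂ) + y * I by push_cast; ring, hB]
    field_simp
    push_cast
    ring
  have hvert : VerticalIntegrable (mellin f) c := by
    unfold VerticalIntegrable
    simp only [heq]
    exact ((integrable_inv_mul_add_mul_I hc0 (sub_pos.2 hc)).const_mul _).sub
      ((integrable_inv_mul_add_mul_I hc0 (by linarith)).const_mul _)
  have hfeq : ∀ t : ℝ, 0 < t →
      f t = ((A * (min t 1) ^ (-α) + B + C * min t 1 : ℝ) : ℂ) := fun t ht => by
    by_cases h1 : t ≤ 1
    · have hm : t ∈ Set.Ioc (0 : ℝ) 1 := ⟨ht, h1⟩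
      simp only [hf, Set.indicator_of_mem hm, min_eq_left h1, smul_eq_mul]
      push_cast
      rw [ofReal_cpow ht.le]
      push_cast
      rw [cpow_one]
      ring
    · have hm : t ∉ Set.Ioc (0 : ℝ) 1 := fun h => h1 h.2
      simp only [hf, Set.indicator_of_notMem hm, min_eq_right (not_le.1 h1).le, smul_eq_mul]
      rw [one_rpow]
      have : A * 1 + B + C * 1 = 0 := by linarith
      rw [this]
      simp
  have hcont : ContinuousAt f v := by
    have h2 : f =ᶠ[nhds v] fun t : ℝ => ((A * (min t 1) ^ (-α) + B + C * min t 1 : ℝ) : ℂ) := by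
      filter_upwards [lt_mem_nhds hv] with t ht using hfeq t ht
    refine ContinuousAt.congr ?_ h2.symm
    refine continuous_ofReal.continuousAt.comp ?_
    have h3 : ContinuousAt (fun t : ℝ => min t 1) v := by fun_prop
    exact ((continuousAt_const.mul (h3.rpow_const (Or.inl (lt_min hv one_pos).ne'))).add
      continuousAt_const).add (continuousAt_const.mul h3)
  have hinv := mellinInv_mellin_eq c f hv (hmel c (by simp)).1 hvert hcont
  rw [hfeq v hv, mellinInv] at hinv
  simp only [heq, smul_eq_mul] at hinv
  rw [show (2 * π * (A * (min v 1) ^ (-α) + B + C * min v 1)) =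
    2 * π * ((A * (min v 1) ^ (-α) + B + C * min v 1)) by ring, ofReal_mul, ← hinv]
  rw [real_smul, ← mul_assoc]
  have hpi : ((2 * π : ℝ) : ℂ) * ((1 / (2 * π) : ℝ) : ℂ) = 1 := by
    rw [← ofReal_mul, mul_one_div_cancel (by positivity), ofReal_one]
  rw [hpi, one_mul]

/-- The smoothed main term attached to a simple pole at `α`. -/
noncomputable def smoothMain (α x : ℝ) : ℝ := x ^ (1 + α) / (α * (α + 1)) - x / α + 1 / (α + 1)

/-- The Perron kernel of the first Riesz mean. -/
noncomputable def rieszKernel (x : ℝ) (s : ℂ) : ℂ := (x : ℂ) ^ (1 + s) * (s * (s + 1))⁻¹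

lemma ofReal_inv_cpow_neg (hx : 0 < x) (s : ℂ) :
    (x : ℂ) * ((x⁻¹ : ℝ) : ℂ) ^ (-s) = (x : ℂ) ^ (1 + s) := by
  have hx' : (x : ℂ) ≠ 0 := mod_cast hx.ne'
  rw [cpow_add _ _ hx', cpow_one, ofReal_inv, inv_cpow, cpow_neg, inv_inv]
  rw [arg_ofReal_of_nonneg hx.le]
  exact pi_ne_zero.symm

lemma integral_rieszKernel_div {α c x : ℝ} (hα : 0 < α) (hc : α < c) (hx : 1 ≤ x) :
    ∫ y : ℝ, rieszKernel x (c + y * I) / (c + y * I - α) = ((2 * π * smoothMain α x : ℝ) : ℂ) := by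
  have hx0 : 0 < x := by linarith
  have h := mellinInv_truncated (A := 1 / (α * (α + 1))) (B := -1 / α) (C := 1 / (α + 1)) hα.le hc
    (by field_simp; ring) (inv_pos.2 hx0)
  rw [min_eq_left (inv_le_one_of_one_le₀ hx)] at h
  have h1 : ((2 * π * smoothMain α x : ℝ) : ℂ) = x * ((2 * π *
      (1 / (α * (α + 1)) * x⁻¹ ^ (-α) + -1 / α + 1 / (α + 1) * x⁻¹) : ℝ) : ℂ) := by
    rw [← ofReal_mul]
    congr 1
    rw [smoothMain, inv_rpow hx0.le, rpow_neg hx0.le, inv_inv, rpow_add hx0, rpow_one]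
    field_simp
    ring
  rw [h1, ← h, ← MeasureTheory.integral_const_mul]
  refine MeasureTheory.integral_congr_ae (.of_forall fun y => ?_)
  have e1 := ofReal_add_mul_I_ne_zero (hα.trans hc) y
  have e2 := ofReal_add_mul_I_ne_zero (sub_pos.2 hc) y
  have e3 := ofReal_add_mul_I_ne_zero (by linarith : 0 < c + 1) y
  have e4 : (α : ℂ) ≠ 0 := mod_cast hα.ne'
  have e5 : (α : ℂ) + 1 ≠ 0 := mod_cast (by linarith : α + 1 ≠ 0)
  simp only
  rw [rieszKernel, ← ofReal_inv_cpow_neg hx0, mul_div_assoc, mul_assoc]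
  congr 2
  rw [show (c : ℂ) + y * I - α = ((c - α : ℝ) : ℂ) + y * I by push_cast; ring,
      show (c : ℂ) + y * I + 1 = ((c + 1 : ℝ) : ℂ) + y * I by push_cast; ring]
  push_cast at *
  field_simp
  ring

lemma integrable_rieszKernel {c x : ℝ} (hc : 0 < c) (hx : 0 < x) :
    Integrable fun y : ℝ => rieszKernel x (c + y * I) := by
  have h := integrable_inv_mul_add_mul_I hc (by linarith : 0 < c + 1)
  refine (h.norm.const_mul (x ^ (1 + c))).mono' ?_ (.of_forall fun y => ?_)
  · unfold rieszKernel
    have hx' : (x : ℂ) ≠ 0 := mod_cast hx.ne'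
    refine Continuous.aestronglyMeasurable (Continuous.mul ?_ (Continuous.inv₀ (by fun_prop)
      fun y => ?_))
    · exact Continuous.const_cpow (by fun_prop) (Or.inl hx')
    · have := ofReal_add_mul_I_ne_zero (by linarith : 0 < c + 1) y
      refine mul_ne_zero (ofReal_add_mul_I_ne_zero hc y) ?_
      convert this using 1
      push_cast
      ring
  · rw [rieszKernel, norm_mul, norm_cpow_eq_rpow_re_of_pos hx]
    refine le_of_eq ?_
    congr 2
    · simp
    · push_cast
      ring

lemma integral_rieszKernel_mul_cpow {c x u : ℝ} (hc : 0 < c) (hx : 0 < x) (hu : 0 < u) :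
    ∫ y : ℝ, rieszKernel x (c + y * I) * (u : ℂ) ^ (-((c : ℂ) + y * I)) =
      ((2 * π * max (x - u) 0 : ℝ) : ℂ) := by
  have h := mellinInv_truncated (A := 0) (B := 1) (C := -1) le_rfl hc (by norm_num) (div_pos hu hx)
  have h1 : ((2 * π * max (x - u) 0 : ℝ) : ℂ) = x * ((2 * π *
      (0 * (min (u / x) 1) ^ (-(0 : ℝ)) + 1 + -1 * min (u / x) 1) : ℝ) : ℂ) := by
    rw [← ofReal_mul]
    congr 1
    rcases le_total u x with h2 | h2
    · rw [max_eq_left (by linarith), min_eq_left (by rwa [div_le_one hx])]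
      field_simp
      ring
    · rw [max_eq_right (by linarith), min_eq_right (by rwa [one_le_div hx])]
      ring
  rw [h1, ← h, ← MeasureTheory.integral_const_mul]
  refine MeasureTheory.integral_congr_ae (.of_forall fun y => ?_)
  simp only
  rw [rieszKernel, ← ofReal_inv_cpow_neg hx, div_eq_mul_inv, mul_comm u, ofReal_mul,
    mul_cpow_ofReal_nonneg (inv_pos.2 hx).le hu.le]
  push_cast
  rw [show (c : ℂ) + 1 + y * I = c + y * I + 1 by ring]
  ring

/-- The first Riesz mean of the weights. -/
noncomputable def rieszMean (r : ℕ) (x : ℝ) : ℝ := ∑' n : ℕ, (weight r n : ℝ) * max (x - n) 0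

lemma norm_rieszKernel_mul_weight (r : ℕ) (c x y : ℝ) (n : ℕ) :
    ‖rieszKernel x (c + y * I) * ((weight r n : ℂ) * (n : ℂ) ^ (-((c : ℂ) + y * I)))‖ =
      (weight r n : ℝ) * (n : ℝ) ^ (-c) * ‖rieszKernel x (c + y * I)‖ := by
  rw [norm_mul, norm_weight_mul_cpow, mul_comm]
  simp

theorem integral_rieszKernel_mul_weightSeries (hr : r = 0 ∨ r = 4) {c x : ℝ}
    (hc : 1 / 4 < c) (hx : 0 < x) :
    Integrable (fun y : ℝ => rieszKernel x (c + y * I) * weightSeries r (c + y * I)) ∧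
    ∫ y : ℝ, rieszKernel x (c + y * I) * weightSeries r (c + y * I) =
      ((2 * π * rieszMean r x : ℝ) : ℂ) := by
  have hc0 : 0 < c := by linarith
  set F : ℕ → ℝ → ℂ := fun n y =>
    rieszKernel x (c + y * I) * ((weight r n : ℂ) * (n : ℂ) ^ (-((c : ℂ) + y * I))) with hF
  have hker := integrable_rieszKernel hc0 hx
  have hsumm := summable_weight_mul_rpow hr hc
  have hnorm : ∀ n y, ‖F n y‖ = (weight r n : ℝ) * (n : ℝ) ^ (-c) * ‖rieszKernel x (c + y * I)‖ :=
    fun n y => norm_rieszKernel_mul_weight r c x y n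
  have hFint : ∀ n, Integrable (F n) := fun n => by
    refine (hker.norm.const_mul ((weight r n : ℝ) * (n : ℝ) ^ (-c))).mono' ?_
      (.of_forall fun y => (hnorm n y).le)
    refine hker.aestronglyMeasurable.mul ?_
    rcases eq_or_ne n 0 with rfl | hn
    · simp only [weight_zero]
      simpa using aestronglyMeasurable_const
    · refine Continuous.aestronglyMeasurable (continuous_const.mul
        (Continuous.const_cpow (by fun_prop) (Or.inl (mod_cast hn))))
  have hFsum : Summable fun n => ∫ y, ‖F n y‖ := by
    simp only [hnorm, MeasureTheory.integral_const_mul]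
    exact hsumm.mul_right _
  have htsum : ∀ y : ℝ, ∑' n, F n y = rieszKernel x (c + y * I) * weightSeries r (c + y * I) :=
    fun y => by rw [weightSeries, ← tsum_mul_left]
  have hval : ∀ n, ∫ y, F n y = ((2 * π * ((weight r n : ℝ) * max (x - n) 0) : ℝ) : ℂ) :=
    fun n => by
      rcases eq_or_ne n 0 with rfl | hn
      · simp [hF, weight_zero]
      have h1 := integral_rieszKernel_mul_cpow hc0 hx (mod_cast Nat.pos_of_ne_zero hn : (0 : ℝ) < n)
      rw [show 2 * π * ((weight r n : ℝ) * max (x - n) 0) =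
        (weight r n : ℝ) * (2 * π * max (x - n) 0) by ring, ofReal_mul, ← h1,
        ← MeasureTheory.integral_const_mul]
      refine MeasureTheory.integral_congr_ae (.of_forall fun y => ?_)
      simp only [hF]
      push_cast
      ring
  have h := hasSum_integral_of_summable_integral_norm hFint hFsum
  constructor
  · simp only [← htsum]
    have hb : ∀ y, Summable fun n => ‖F n y‖ := fun y => by
      simp only [hnorm]; exact hsumm.mul_right _
    refine (hker.norm.const_mul (∑' n : ℕ, (weight r n : ℝ) * (n : ℝ) ^ (-c))).mono' ?_
      (.of_forall fun y => ?_)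
    · refine aestronglyMeasurable_of_tendsto_ae atTop
        (f := fun (N : ℕ) y => ∑ n ∈ range N, F n y) (fun N => ?_) (.of_forall fun y => ?_)
      · exact aestronglyMeasurable_fun_sum _ fun n _ => (hFint n).aestronglyMeasurable
      · exact (hb y).of_norm.hasSum.tendsto_sum_nat
    · refine (norm_tsum_le_tsum_norm (hb y)).trans (le_of_eq ?_)
      simp only [hnorm]
      rw [tsum_mul_right]
  · simp only [← htsum]
    rw [← h.tsum_eq]
    simp only [hval]
    rw [← ofReal_tsum, tsum_mul_left, rieszMean]

lemma charModEight_ne_one {i : ℕ} (h0 : i ≠ 0) (h4 : i < 4) : charModEight i ≠ 1 := fun h => by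
  have hu : ∀ n : ℕ, n = 3 ∨ n = 5 → (1 : DirichletCharacter ℂ 8) (n : ZMod 8) = 1 := fun n hn => by
    refine MulChar.one_apply ?_
    rw [ZMod.isUnit_iff_coprime]
    rcases hn with rfl | rfl <;> norm_num
  have key : ∀ n : ℕ, n = 3 ∨ n = 5 → charFamily 4 ⟨i, h4⟩ n = 1 := fun n hn => by
    rw [charFamily, h, hu n hn]
  have k3 := key 3 (Or.inl rfl)
  have k5 := key 5 (Or.inr rfl)
  rw [charFamily_natCast, Int.cast_eq_one] at k3 k5
  interval_cases i
  · exact h0 rfl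
  · simp at k3
  · simp at k3
  · simp at k5

/-- Multiplying a product of shifted `L`-functions by a linear factor makes it entire. -/
lemma exists_differentiable_prod_LFunction (hr : r ≤ 4) (κ : ℕ) :
    ∃ g : ℂ → ℂ, Differentiable ℂ g ∧ ∀ s : ℂ, (κ : ℂ) * s ≠ 1 →
      g s = (κ * s - 1) * ∏ i, (charFamily r i).LFunction (κ * s) := by
  rcases r with _ | k
  · exact ⟨fun s => κ * s - 1, by fun_prop, fun s _ => by simp⟩
  · refine ⟨fun s => LFunctionTrivChar₁ 8 (κ * s) *
      ∏ i : Fin k, (charFamily (k + 1) i.succ).LFunction (κ * s), ?_, fun s hs => ?_⟩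
    · refine ((DirichletCharacter.differentiable_LFunctionTrivChar₁ 8).comp (by fun_prop)).mul ?_
      refine Differentiable.fun_finsetProd fun i _ => ?_
      refine Differentiable.comp (fun s => differentiableAt_LFunction _ s (Or.inr ?_)) (by fun_prop)
      exact charModEight_ne_one (by simp) (by have := i.2; simp; omega)
    · beta_reduce
      rw [Fin.prod_univ_succ, LFunctionTrivChar₁, Function.update_of_ne hs]
      have h0 : charFamily (k + 1) 0 = 1 := charModEight_zero
      rw [h0, DirichletCharacter.LFunctionTrivChar]
      ring

/-- The product of `L`-functions in the factorisation of `weightSeries`. -/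
noncomputable def mainProd (r : ℕ) (s : ℂ) : ℂ :=
  (charModEight 0).LFunction ((4 : ℕ) * s) * ((∏ i, (charFamily 2 i).LFunction ((6 : ℕ) * s)) *
    ∏ i, (charFamily r i).LFunction ((7 : ℕ) * s))

lemma exists_differentiable_mainProd (hr : r ≤ 4) :
    ∃ g : ℂ → ℂ, Differentiable ℂ g ∧ ∀ s : ℂ, s ≠ 1 / 4 → s ≠ 1 / 6 → s ≠ 1 / 7 →
      g s = (s - 1 / 4) * (s - 1 / 6) * (s - 1 / 7) * mainProd r s := by
  obtain ⟨g₄, d₄, e₄⟩ := exists_differentiable_prod_LFunction (r := 1) (by norm_num) 4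
  obtain ⟨g₆, d₆, e₆⟩ := exists_differentiable_prod_LFunction (r := 2) (by norm_num) 6
  obtain ⟨g₇, d₇, e₇⟩ := exists_differentiable_prod_LFunction hr 7
  refine ⟨fun s => (1 / 168) * (g₄ s * (g₆ s * g₇ s)), by fun_prop, fun s h4 h6 h7 => ?_⟩
  have aux : ∀ (κ : ℕ), κ ≠ 0 → s ≠ 1 / κ → (κ : ℂ) * s ≠ 1 := fun κ hκ h h' => by
    have : (κ : ℂ) ≠ 0 := mod_cast hκ
    apply h
    field_simp
    rw [mul_comm, h']
  beta_reduce
  rw [e₄ s (aux 4 (by norm_num) (by simpa using h4)), e₆ s (aux 6 (by norm_num) (by simpa using h6)),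
    e₇ s (aux 7 (by norm_num) (by simpa using h7)), mainProd]
  rw [univ_unique, prod_singleton]
  change (1 / 168) * ((((4 : ℕ) : ℂ) * s - 1) * (charModEight 0).LFunction (((4 : ℕ) : ℂ) * s) *
    ((((6 : ℕ) : ℂ) * s - 1) * _ * ((((7 : ℕ) : ℂ) * s - 1) * _))) = _
  push_cast
  ring

lemma exists_norm_correctionFactor_le_div : ∃ C : ℝ, 0 < C ∧ ∀ r : ℕ, r = 0 ∨ r = 4 →
    ∀ s : ℂ, 1 / 8 < s.re → s.re ≤ 2 / 5 → ‖correctionFactor r s‖ ≤ C / (8 * s.re - 1) := by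
  obtain ⟨C, hC, h⟩ := exists_norm_correctionFactor_le
  have h1 : ∀ᶠ s : ℝ in nhdsWithin 1 (Set.Ioi 1), (s - 1) * ∑' n : ℕ, 1 / (n : ℝ) ^ s < 2 :=
    tendsto_sub_mul_tsum_nat_rpow.eventually_lt_const (by norm_num)
  obtain ⟨δ, hδ, hs⟩ := mem_nhdsGT_iff_exists_Ioc_subset.1 h1
  have hδ1 : 1 < δ := hδ
  have hZ0 : ∀ u : ℝ, 0 ≤ ∑' n : ℕ, 1 / (n : ℝ) ^ u := fun u => tsum_nonneg fun n => by positivity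
  refine ⟨C * (2 + 3 * ∑' n : ℕ, 1 / (n : ℝ) ^ δ), by have := hZ0 δ; positivity,
    fun r hr s hs1 hs2 => ?_⟩
  have h2 := h r hr s.re hs1 s le_rfl
  have hpos : 0 < 8 * s.re - 1 := by linarith
  refine h2.trans ?_
  rw [mul_div_assoc]
  refine mul_le_mul_of_nonneg_left ?_ hC.le
  rw [le_div_iff₀ hpos]
  rcases le_total (8 * s.re) δ with h3 | h3
  · have := hs ⟨(by linarith : 1 < 8 * s.re), h3⟩
    simp only [Set.mem_ofPred_eq] at this
    have := hZ0 δ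
    linarith
  · have h4 : ∑' n : ℕ, 1 / (n : ℝ) ^ (8 * s.re) ≤ ∑' n : ℕ, 1 / (n : ℝ) ^ δ := by
      refine Summable.tsum_le_tsum (fun n => ?_) (summable_one_div_nat_rpow.2 (by linarith))
        (summable_one_div_nat_rpow.2 hδ1)
      rcases Nat.eq_zero_or_pos n with rfl | hn
      · rw [Nat.cast_zero, zero_rpow (by linarith), zero_rpow (by linarith)]
      · have hn1 : (1 : ℝ) ≤ n := mod_cast hn
        exact one_div_le_one_div_of_le (by positivity) (rpow_le_rpow_of_exponent_le hn1 h3)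
    have := hZ0 δ
    nlinarith [hZ0 (8 * s.re)]

/-- The part of `weightSeries` to the right of `1 / 8` that is left after removing its poles. -/
structure IsRegularPart (r : ℕ) (r₄ r₆ r₇ : ℂ) (G : ℂ → ℂ) : Prop where
  differentiableOn : DifferentiableOn ℂ G {s | 1 / 8 < s.re}
  eq : ∀ s : ℂ, 1 / 8 < s.re → s ≠ 1 / 4 → s ≠ 1 / 6 → s ≠ 1 / 7 →
    mainProd r s * correctionFactor r s =
      r₄ / (s - 1 / 4) + r₆ / (s - 1 / 6) + r₇ / (s - 1 / 7) + G s

lemma norm_sub_ge_of_re {s α : ℂ} {δ : ℝ} (h : δ ≤ |s.re - α.re|) : δ ≤ ‖s - α‖ :=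
  h.trans (by simpa using abs_re_le_norm (s - α))

lemma inv_norm_sub_le_of_re {s α : ℂ} (h : 1 / 100 ≤ |s.re - α.re|) : ‖(s - α)⁻¹‖ ≤ 100 := by
  rw [norm_inv]
  have := norm_sub_ge_of_re h
  calc _ ≤ (1 / 100 : ℝ)⁻¹ := inv_anti₀ (by norm_num) this
    _ = 100 := by norm_num

theorem exists_isRegularPart (hr : r = 0 ∨ r = 4) : ∃ r₄ r₆ r₇ : ℂ, ∃ G : ℂ → ℂ,
    IsRegularPart r r₄ r₆ r₇ G ∧ ∃ C : ℝ, 0 < C ∧ ∀ s : ℂ, 1 / 8 < s.re →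
      s.re ≤ 1 / 8 + 1 / 200 → |s.im| ≤ 1 → ‖G s‖ ≤ C / (8 * s.re - 1) := by
  obtain ⟨g, hg, hgs⟩ := exists_differentiable_mainProd (r := r) (by omega)
  obtain ⟨K, hK, hKs⟩ := exists_norm_correctionFactor_le_div
  set P : ℂ → ℂ := fun s => g s * correctionFactor r s with hP
  have hU : IsOpen {s : ℂ | 1 / 8 < s.re} := isOpen_lt continuous_const continuous_re
  have hPd : DifferentiableOn ℂ P {s | 1 / 8 < s.re} :=
    hg.differentiableOn.mul (differentiableOn_correctionFactor hr)
  have hd : ∀ α : ℂ, 1 / 8 < α.re → DifferentiableOn ℂ (dslope P α) {s | 1 / 8 < s.re} :=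
    fun α hα => (differentiableOn_dslope (hU.mem_nhds hα)).2 hPd
  set G : ℂ → ℂ := fun s => 112 * dslope P (1 / 4) s - 504 * dslope P (1 / 6) s
    + 392 * dslope P (1 / 7) s with hG
  have heq : ∀ s : ℂ, s ≠ 1 / 4 → s ≠ 1 / 6 → s ≠ 1 / 7 →
      mainProd r s * correctionFactor r s = 112 * P (1 / 4) / (s - 1 / 4) +
        -504 * P (1 / 6) / (s - 1 / 6) + 392 * P (1 / 7) / (s - 1 / 7) + G s := fun s h4 h6 h7 => by
    simp only [hG]
    rw [dslope_of_ne _ h4, dslope_of_ne _ h6, dslope_of_ne _ h7]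
    simp only [slope, vsub_eq_sub, smul_eq_mul]
    have hPs : P s = (s - 1 / 4) * (s - 1 / 6) * (s - 1 / 7) *
        (mainProd r s * correctionFactor r s) := by
      simp only [hP]
      rw [hgs s h4 h6 h7]
      ring
    have n4 := sub_ne_zero.2 h4
    have n6 := sub_ne_zero.2 h6
    have n7 := sub_ne_zero.2 h7
    rw [hPs]
    generalize mainProd r s * correctionFactor r s = w
    have e6 : s - 1 / 6 = (s - 1 / 4) + 1 / 12 := by ring
    have e7 : s - 1 / 7 = (s - 1 / 4) + 3 / 28 := by ring
    simp only [div_eq_mul_inv]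
    simp only [mul_sub]
    have i4 : (s - 1 * 4⁻¹)⁻¹ * (s - 1 * 4⁻¹) = 1 := inv_mul_cancel₀ (by simpa using n4)
    have i6 : (s - 1 * 6⁻¹)⁻¹ * (s - 1 * 6⁻¹) = 1 := inv_mul_cancel₀ (by simpa using n6)
    have i7 : (s - 1 * 7⁻¹)⁻¹ * (s - 1 * 7⁻¹) = 1 := inv_mul_cancel₀ (by simpa using n7)
    linear_combination (-112 * (s - 1 / 6) * (s - 1 / 7) * w) * i4 +
      (504 * (s - 1 / 4) * (s - 1 / 7) * w) * i6 + (-392 * (s - 1 / 4) * (s - 1 / 6) * w) * i7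
  refine ⟨112 * P (1 / 4), -504 * P (1 / 6), 392 * P (1 / 7), G,
    ⟨?_, fun s _ h4 h6 h7 => heq s h4 h6 h7⟩, ?_⟩
  · have h4 := hd (1 / 4) (by norm_num)
    have h6 := hd (1 / 6) (by norm_num)
    have h7 := hd (1 / 7) (by norm_num)
    exact ((h4.const_mul 112).sub (h6.const_mul 504)).add (h7.const_mul 392)
  have hcomp : IsCompact (Set.Icc (1 / 8 : ℝ) (1 / 8 + 1 / 200) ×ℂ Set.Icc (-1 : ℝ) 1) :=
    isCompact_Icc.reProdIm isCompact_Icc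
  obtain ⟨B, hB⟩ := hcomp.exists_bound_of_continuousOn hg.continuous.continuousOn
  set R : ℝ := 112 * ‖P (1 / 4)‖ + 504 * ‖P (1 / 6)‖ + 392 * ‖P (1 / 7)‖ with hR
  refine ⟨1000000 * (|B| * K) + 100 * R + 1, by positivity, fun s h1 h2 h3 => ?_⟩
  have hpos : 0 < 8 * s.re - 1 := by linarith
  have hle1 : 8 * s.re - 1 ≤ 1 := by linarith
  have r4 : (1 / 4 : ℂ).re = 1 / 4 := by norm_num
  have r6 : (1 / 6 : ℂ).re = 1 / 6 := by norm_num
  have r7 : (1 / 7 : ℂ).re = 1 / 7 := by norm_num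
  have b4 : ‖(s - 1 / 4)⁻¹‖ ≤ 100 := inv_norm_sub_le_of_re (by
    rw [r4, abs_of_nonpos (by linarith)]; linarith)
  have b6 : ‖(s - 1 / 6)⁻¹‖ ≤ 100 := inv_norm_sub_le_of_re (by
    rw [r6, abs_of_nonpos (by linarith)]; linarith)
  have b7 : ‖(s - 1 / 7)⁻¹‖ ≤ 100 := inv_norm_sub_le_of_re (by
    rw [r7, abs_of_nonpos (by linarith)]; linarith)
  have ne : ∀ a : ℝ, s.re < a → s ≠ (a : ℂ) := fun a ha h => by
    rw [h, ofReal_re] at ha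
    exact lt_irrefl _ ha
  have n4 : s ≠ 1 / 4 := by simpa using ne (1 / 4) (by linarith)
  have n6 : s ≠ 1 / 6 := by simpa using ne (1 / 6) (by linarith)
  have n7 : s ≠ 1 / 7 := by simpa using ne (1 / 7) (by linarith)
  have hgB : ‖g s‖ ≤ |B| := (hB s (by
    rw [mem_reProdIm]
    exact ⟨⟨h1.le, h2⟩, abs_le.1 h3⟩)).trans (le_abs_self B)
  have hGs : G s = g s * (s - 1 / 4)⁻¹ * (s - 1 / 6)⁻¹ * (s - 1 / 7)⁻¹ * correctionFactor r s -
      (112 * P (1 / 4) * (s - 1 / 4)⁻¹ + -504 * P (1 / 6) * (s - 1 / 6)⁻¹ +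
        392 * P (1 / 7) * (s - 1 / 7)⁻¹) := by
    have h5 := heq s n4 n6 n7
    have h6 : g s * (s - 1 / 4)⁻¹ * (s - 1 / 6)⁻¹ * (s - 1 / 7)⁻¹ = mainProd r s := by
      rw [hgs s n4 n6 n7]
      have m4 := sub_ne_zero.2 n4
      have m6 := sub_ne_zero.2 n6
      have m7 := sub_ne_zero.2 n7
      generalize s - 1 / 4 = a at *
      generalize s - 1 / 6 = b at *
      generalize s - 1 / 7 = c at *
      field_simp
    rw [h6, h5]
    ring
  rw [hGs]
  have hK1 := hKs r hr s h1 (by linarith)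
  have hm : ‖g s * (s - 1 / 4)⁻¹ * (s - 1 / 6)⁻¹ * (s - 1 / 7)⁻¹ * correctionFactor r s‖ ≤
      |B| * 100 * 100 * 100 * (K / (8 * s.re - 1)) := by
    simp only [norm_mul]
    gcongr
  have hp : ‖112 * P (1 / 4) * (s - 1 / 4)⁻¹ + -504 * P (1 / 6) * (s - 1 / 6)⁻¹ +
        392 * P (1 / 7) * (s - 1 / 7)⁻¹‖ ≤ 100 * R := by
    refine (norm_add₃_le).trans ?_
    simp only [norm_mul, norm_neg, norm_ofNat]
    have := mul_le_mul_of_nonneg_left b4 (norm_nonneg (P (1 / 4)))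
    have := mul_le_mul_of_nonneg_left b6 (norm_nonneg (P (1 / 6)))
    have := mul_le_mul_of_nonneg_left b7 (norm_nonneg (P (1 / 7)))
    rw [hR]
    linarith
  refine (norm_sub_le _ _).trans ((add_le_add hm hp).trans ?_)
  rw [le_div_iff₀ hpos, add_mul]
  have e1 : |B| * 100 * 100 * 100 * (K / (8 * s.re - 1)) * (8 * s.re - 1) =
    1000000 * (|B| * K) := by field_simp; ring
  have e2 : 100 * R * (8 * s.re - 1) ≤ 100 * R := mul_le_of_le_one_right (by positivity) hle1
  rw [e1]
  linarith

lemma norm_LFunction_natCast_mul_le_rpow (h4 : 4 ≤ κ)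
    (h7 : κ ≤ 7) {a : ℝ} (hs : 1 / 8 ≤ s.re) (hs' : s.re ≤ 2 / 5) (ht : 1 ≤ |s.im|)
    (ha : 1 - κ * s.re ≤ a) (ha0 : 0 ≤ a) :
    ‖χ.LFunction (κ * s)‖ ≤ 2000000 * |s.im| ^ (a + 1 / 28) := by
  have hκ4 : (4 : ℝ) ≤ κ := mod_cast h4
  have hκ7 : (κ : ℝ) ≤ 7 := mod_cast h7
  have hre : ((κ : ℂ) * s).re = κ * s.re := re_natCast_mul κ s
  have him : ((κ : ℂ) * s).im = κ * s.im := im_natCast_mul κ s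
  set t := |s.im| with htdef
  have habs : |((κ : ℂ) * s).im| = κ * t := by rw [him, abs_mul, abs_of_nonneg (by linarith)]
  have hκt : 1 ≤ κ * t := by nlinarith
  have h := norm_LFunction_le χ (s := κ * s) (by rw [hre]; nlinarith) (by rw [hre]; nlinarith)
    (by rw [habs]; exact hκt)
  rw [habs, hre] at h
  set e := max (1 - κ * s.re) 0 with he
  have he1 : e ≤ 1 := max_le (by nlinarith) (by norm_num)
  have hea : e ≤ a := max_le ha ha0
  have he0 : 0 ≤ e := le_max_right _ _
  have ht0 : 0 < t := by linarith
  have k1 : (κ * t) ^ e ≤ 7 * t ^ a := by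
    rw [mul_rpow (by linarith) ht0.le]
    refine mul_le_mul ?_ (rpow_le_rpow_of_exponent_le ht hea) (by positivity) (by norm_num)
    calc (κ : ℝ) ^ e ≤ (κ : ℝ) ^ (1 : ℝ) := rpow_le_rpow_of_exponent_le (by linarith) he1
      _ ≤ 7 := by rwa [rpow_one]
  have k2 : 1 + log (κ * t) ≤ 35 * t ^ (1 / 28 : ℝ) := by
    rw [log_mul (by linarith) ht0.ne']
    have l1 : log κ ≤ 6 := by
      have := log_le_sub_one_of_pos (by linarith : (0 : ℝ) < κ)
      linarith
    have l2 := log_le_rpow_div ht0.le (by norm_num : (0 : ℝ) < 1 / 28)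
    have l3 := one_le_rpow ht (by norm_num : (0 : ℝ) ≤ 1 / 28)
    rw [div_eq_mul_inv, show (1 / 28 : ℝ)⁻¹ = 28 by norm_num] at l2
    linarith
  have k0 : 0 ≤ 1 + log (κ * t) := by have := log_nonneg hκt; linarith
  refine h.trans ?_
  calc _ ≤ 5000 * (7 * t ^ a) * (35 * t ^ (1 / 28 : ℝ)) := by gcongr
    _ = 1225000 * t ^ (a + 1 / 28) := by rw [rpow_add ht0]; ring
    _ ≤ _ := by
        have : 0 < t ^ (a + 1 / 28) := by positivity
        linarith

lemma norm_mainProd_le (hr : r = 0 ∨ r = 4) (hs : 1 / 8 ≤ s.re)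
    (hs' : s.re ≤ 2 / 5) (ht : 1 ≤ |s.im|) :
    ‖mainProd r s‖ ≤ 2000000 ^ 7 * |s.im| ^ (7 / 4 : ℝ) := by
  set t := |s.im| with htdef
  have ht0 : 0 < t := by linarith
  have b4 := norm_LFunction_natCast_mul_le_rpow (charModEight 0) (κ := 4) (a := 1 / 2)
    (by norm_num) (by norm_num) hs hs' ht (by push_cast; linarith) (by norm_num)
  have b6 : ∀ i, ‖(charFamily 2 i).LFunction ((6 : ℕ) * s)‖ ≤
    2000000 * t ^ (1 / 4 + 1 / 28 : ℝ) := fun i =>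
    norm_LFunction_natCast_mul_le_rpow _ (κ := 6) (by norm_num) (by norm_num) hs hs' ht
      (by push_cast; linarith) (by norm_num)
  have b7 : ∀ i, ‖(charFamily r i).LFunction ((7 : ℕ) * s)‖ ≤
    2000000 * t ^ (1 / 8 + 1 / 28 : ℝ) := fun i =>
    norm_LFunction_natCast_mul_le_rpow _ (κ := 7) (by norm_num) (by norm_num) hs hs' ht
      (by push_cast; linarith) (by norm_num)
  have p6 : ‖∏ i, (charFamily 2 i).LFunction ((6 : ℕ) * s)‖ ≤
      (2000000 * t ^ (1 / 4 + 1 / 28 : ℝ)) ^ 2 := by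
    rw [norm_prod]
    refine (prod_le_prod (fun i _ => norm_nonneg _) fun i _ => b6 i).trans ?_
    simp
  have p7 : ‖∏ i, (charFamily r i).LFunction ((7 : ℕ) * s)‖ ≤
      (2000000 * t ^ (1 / 8 + 1 / 28 : ℝ)) ^ 4 := by
    rw [norm_prod]
    refine (prod_le_prod (fun i _ => norm_nonneg _) fun i _ => b7 i).trans ?_
    simp only [prod_const, card_univ, Fintype.card_fin]
    refine pow_le_pow_right₀ ?_ (by omega)
    have := one_le_rpow ht (by norm_num : (0 : ℝ) ≤ 1 / 8 + 1 / 28)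
    linarith
  rw [mainProd, norm_mul, norm_mul]
  calc _ ≤ 2000000 * t ^ (1 / 2 + 1 / 28 : ℝ) * ((2000000 * t ^ (1 / 4 + 1 / 28 : ℝ)) ^ 2 *
        (2000000 * t ^ (1 / 8 + 1 / 28 : ℝ)) ^ 4) := by gcongr
    _ = 2000000 ^ 7 * (t ^ (1 / 2 + 1 / 28 : ℝ) * ((t ^ (1 / 4 + 1 / 28 : ℝ)) ^ 2 *
        (t ^ (1 / 8 + 1 / 28 : ℝ)) ^ 4)) := by ring
    _ = _ := by
        rw [← rpow_mul_natCast ht0.le, ← rpow_mul_natCast ht0.le, ← rpow_add ht0, ← rpow_add ht0]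
        norm_num

lemma ne_ofReal_of_im_ne_zero (h : s.im ≠ 0) (a : ℝ) : s ≠ (a : ℂ) := fun h' => by
  rw [h', ofReal_im] at h
  exact h rfl

lemma norm_inv_sub_ofReal_le (ht : 1 ≤ |s.im|) (a : ℝ) : ‖(s - (a : ℂ))⁻¹‖ ≤ 1 := by
  rw [norm_inv]
  refine inv_le_one_of_one_le₀ (ht.trans ?_)
  simpa using abs_im_le_norm (s - a)

lemma IsRegularPart.eq_sub {r₄ r₆ r₇ : ℂ} (h : IsRegularPart r r₄ r₆ r₇ G) (hs : 1 / 8 < s.re) (ht : s.im ≠ 0) :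
    G s = mainProd r s * correctionFactor r s - (r₄ * (s - (1 / 4 : ℝ))⁻¹ +
      r₆ * (s - (1 / 6 : ℝ))⁻¹ + r₇ * (s - (1 / 7 : ℝ))⁻¹) := by
  have h1 := h.eq s hs (by simpa using ne_ofReal_of_im_ne_zero ht (1 / 4))
    (by simpa using ne_ofReal_of_im_ne_zero ht (1 / 6))
    (by simpa using ne_ofReal_of_im_ne_zero ht (1 / 7))
  rw [h1]
  push_cast
  ring

lemma IsRegularPart.norm_le {r₄ r₆ r₇ : ℂ} (h : IsRegularPart r r₄ r₆ r₇ G) (hs : 1 / 8 < s.re) (ht : 1 ≤ |s.im|) :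
    ‖G s‖ ≤ ‖mainProd r s‖ * ‖correctionFactor r s‖ + (‖r₄‖ + ‖r₆‖ + ‖r₇‖) := by
  rw [h.eq_sub hs (abs_pos.1 (by linarith)), ← norm_mul]
  refine (norm_sub_le _ _).trans (add_le_add le_rfl (norm_add₃_le.trans ?_))
  simp only [norm_mul]
  have := norm_inv_sub_ofReal_le ht
  gcongr <;> exact mul_le_of_le_one_right (norm_nonneg _) (this _)

theorem IsRegularPart.exists_norm_le_rpow (hr : r = 0 ∨ r = 4) {r₄ r₆ r₇ : ℂ}
    (h : IsRegularPart r r₄ r₆ r₇ G) {σ₀ : ℝ} (hσ₀ : 1 / 8 < σ₀) :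
    ∃ C : ℝ, 0 < C ∧ ∀ s : ℂ, σ₀ ≤ s.re → s.re ≤ 2 / 5 → 1 ≤ |s.im| →
      ‖G s‖ ≤ C * |s.im| ^ (7 / 4 : ℝ) := by
  obtain ⟨K, hK, hKs⟩ := exists_norm_correctionFactor_le_div
  have h0 : 0 < 8 * σ₀ - 1 := by linarith
  refine ⟨2000000 ^ 7 * (K / (8 * σ₀ - 1)) + (‖r₄‖ + ‖r₆‖ + ‖r₇‖), by positivity,
    fun s h1 h2 ht => ?_⟩
  have k1 := hKs r hr s (by linarith) h2
  have k2 : K / (8 * s.re - 1) ≤ K / (8 * σ₀ - 1) := by gcongr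
  refine (h.norm_le (by linarith) ht).trans ?_
  have k3 := norm_mainProd_le hr (by linarith) h2 ht
  have k4 := one_le_rpow ht (by norm_num : (0 : ℝ) ≤ 7 / 4)
  rw [add_mul]
  refine add_le_add ?_ (le_mul_of_one_le_right (by positivity) k4)
  calc _ ≤ 2000000 ^ 7 * |s.im| ^ (7 / 4 : ℝ) * (K / (8 * σ₀ - 1)) := by
        gcongr
        exact k1.trans k2
    _ = _ := by ring

lemma continuousOn_vertical (h : DifferentiableOn ℂ G {s | 1 / 8 < s.re})
    (hσ : 1 / 8 < σ) : Continuous fun t : ℝ => G (σ + t * I) := by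
  refine h.continuousOn.comp_continuous (by fun_prop) fun t => ?_
  simpa using hσ

theorem IsRegularPart.exists_integral_norm_le (hr : r = 0 ∨ r = 4) {r₄ r₆ r₇ : ℂ} (h : IsRegularPart r r₄ r₆ r₇ G) :
    ∃ C : ℝ, 0 < C ∧ ∀ (J : ℕ) (σ a b : ℝ), 1 / 8 < σ → σ ≤ 1 / 8 + 1 / 200 →
      DyadicInterval J a b → ∫ t in a..b, ‖G (σ + t * I)‖ ≤ C / (8 * σ - 1) * (J + 1) * 2 ^ J := by
  obtain ⟨K, hK, hKs⟩ := exists_norm_correctionFactor_le_div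
  obtain ⟨A, hA, hAs⟩ := exists_integral_norm_prod_LFunction_le (Fin 2) (Fin r) (by simp)
    (by rw [Fintype.card_fin]; omega)
  set R := ‖r₄‖ + ‖r₆‖ + ‖r₇‖ with hR
  refine ⟨K * A + R, by positivity, fun J σ a b h1 h2 hd => ?_⟩
  have hpos : 0 < 8 * σ - 1 := by linarith
  have hre : ∀ t : ℝ, ((σ : ℂ) + t * I).re = σ := fun t => by simp
  have him : ∀ t : ℝ, ((σ : ℂ) + t * I).im = t := fun t => by simp
  have hb : ∀ t ∈ Set.Icc a b, ‖G (σ + t * I)‖ ≤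
      K / (8 * σ - 1) * ‖mainProd r (σ + t * I)‖ + R := fun t ht => by
    have ht1 : 1 ≤ |((σ : ℂ) + t * I).im| := by
      rw [him]
      exact (one_le_pow₀ (by norm_num)).trans (hd.inDyadic t ht).1
    refine (h.norm_le (by rw [hre]; exact h1) ht1).trans (add_le_add ?_ le_rfl)
    rw [mul_comm]
    have := hKs r hr (σ + t * I) (by rw [hre]; exact h1) (by rw [hre]; linarith)
    rw [hre] at this
    gcongr
  have hc : ContinuousOn (fun t : ℝ => mainProd r (σ + t * I)) (Set.Icc a b) := by
    unfold mainProd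
    refine (continuousOn_LFunction_natCast_mul _ (by norm_num) σ hd).mul
      ((continuousOn_finsetProd _ fun i _ => continuousOn_LFunction_natCast_mul _ (by norm_num) σ
        hd).mul (continuousOn_finsetProd _ fun i _ =>
          continuousOn_LFunction_natCast_mul _ (by norm_num) σ hd))
  rw [← Set.uIcc_of_le hd.le] at hc
  have hi : IntervalIntegrable (fun t : ℝ => K / (8 * σ - 1) * ‖mainProd r (σ + t * I)‖)
      MeasureTheory.volume a b := (hc.norm.const_mul _).intervalIntegrable
  have hmono := integral_mono_on hd.le
    (continuousOn_vertical h.differentiableOn h1).norm.continuousOn.intervalIntegrable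
    (hi.add intervalIntegrable_const) hb
  refine hmono.trans ?_
  rw [integral_add hi intervalIntegrable_const,
    integral_const_mul, integral_const, hd.length, smul_eq_mul]
  have hA' := hAs (charModEight 0) (charFamily 2) (charFamily r) J σ a b h1.le h2 hd
  have hA2 : ∫ t in a..b, ‖mainProd r (σ + t * I)‖ ≤ A * (J + 1) * 2 ^ J := hA'
  have hle1 : 8 * σ - 1 ≤ 1 := by linarith
  have hRR : R ≤ R / (8 * σ - 1) := le_div_self (by positivity) hpos hle1
  have hJ : (1 : ℝ) ≤ J + 1 := by have := J.cast_nonneg (α := ℝ); linarith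
  calc _ ≤ K / (8 * σ - 1) * (A * (J + 1) * 2 ^ J) + (2 ^ J * (R / (8 * σ - 1))) * (J + 1) := by
        refine add_le_add (by gcongr) ?_
        refine le_trans ?_ (le_mul_of_one_le_right (by positivity) hJ)
        gcongr
    _ = _ := by ring

/-- The Perron kernel of a difference of first Riesz means. -/
noncomputable def rieszDiff (x h : ℝ) (s : ℂ) : ℂ := rieszKernel (x + h) s - rieszKernel x s

lemma norm_rieszKernel_le (hx : 0 < x) (s : ℂ) :
    ‖rieszKernel x s‖ = x ^ (1 + s.re) * ‖(s * (s + 1))⁻¹‖ := by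
  rw [rieszKernel, norm_mul, norm_cpow_eq_rpow_re_of_pos hx]
  simp

lemma abs_im_sq_le_norm_mul (s : ℂ) : |s.im| ^ 2 ≤ ‖s * (s + 1)‖ := by
  rw [norm_mul, sq]
  have h1 := abs_im_le_norm s
  have h2 : |s.im| ≤ ‖s + 1‖ := by simpa using abs_im_le_norm (s + 1)
  gcongr

lemma norm_rieszDiff_le_sq {x h : ℝ} (hx : 0 < x) (hh : 0 < h) (hs : 0 ≤ s.re)
    (ht : s.im ≠ 0) : ‖rieszDiff x h s‖ ≤ 2 * (x + h) ^ (1 + s.re) / |s.im| ^ 2 := by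
  have ht0 : 0 < |s.im| := abs_pos.2 ht
  have hinv : ‖(s * (s + 1))⁻¹‖ ≤ (|s.im| ^ 2)⁻¹ := by
    rw [norm_inv]
    exact inv_anti₀ (by positivity) (abs_im_sq_le_norm_mul s)
  have hmono : x ^ (1 + s.re) ≤ (x + h) ^ (1 + s.re) :=
    rpow_le_rpow hx.le (by linarith) (by linarith)
  refine (norm_sub_le _ _).trans ?_
  rw [norm_rieszKernel_le hx, norm_rieszKernel_le (by linarith)]
  calc _ ≤ (x + h) ^ (1 + s.re) * (|s.im| ^ 2)⁻¹ + (x + h) ^ (1 + s.re) * (|s.im| ^ 2)⁻¹ := by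
        gcongr
    _ = _ := by ring

lemma norm_ofReal_cpow_sub_le {x h : ℝ} (hx : 0 < x) (hh : 0 < h) (hs : 0 ≤ s.re) :
    ‖((x + h : ℝ) : ℂ) ^ (1 + s) - (x : ℂ) ^ (1 + s)‖ ≤ ‖1 + s‖ * (x + h) ^ s.re * h := by
  have hs1 : 1 + s ≠ 0 := fun h => by
    have := congrArg re h
    simp at this
    linarith
  have hd : ∀ u ∈ Set.Icc x (x + h), HasDerivWithinAt (fun u : ℝ => (u : ℂ) ^ (1 + s))
      ((1 + s) * (u : ℂ) ^ s) (Set.Icc x (x + h)) u := fun u hu => by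
    have hu0 : 0 < u := hx.trans_le hu.1
    have h1 := (hasDerivAt_ofReal_cpow_const hu0.ne' hs1).hasDerivWithinAt (s := Set.Icc x (x + h))
    rwa [add_sub_cancel_left] at h1
  have hb : ∀ u ∈ Set.Icc x (x + h), ‖(1 + s) * (u : ℂ) ^ s‖ ≤ ‖1 + s‖ * (x + h) ^ s.re :=
    fun u hu => by
      rw [norm_mul, norm_cpow_eq_rpow_re_of_pos (hx.trans_le hu.1)]
      exact mul_le_mul_of_nonneg_left (rpow_le_rpow (hx.le.trans hu.1) hu.2 hs) (norm_nonneg _)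
  have := (convex_Icc x (x + h)).norm_image_sub_le_of_norm_hasDerivWithin_le hd hb
    (Set.left_mem_Icc.2 (by linarith)) (Set.right_mem_Icc.2 (by linarith))
  rwa [add_sub_cancel_left, norm_of_nonneg hh.le] at this

lemma norm_rieszDiff_le {x h : ℝ} (hx : 0 < x) (hh : 0 < h) (hs : 0 < s.re) :
    ‖rieszDiff x h s‖ ≤ h * (x + h) ^ s.re / ‖s‖ := by
  have hs1 : 0 < ‖1 + s‖ := norm_pos_iff.2 fun h => by
    have := congrArg re h
    simp at this
    linarith
  have hs0 : 0 < ‖s‖ := norm_pos_iff.2 fun h => by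
    rw [h, zero_re] at hs
    exact lt_irrefl _ hs
  rw [rieszDiff, rieszKernel, rieszKernel, ← sub_mul, norm_mul, norm_inv, norm_mul, add_comm s 1]
  rw [le_div_iff₀ hs0]
  have := norm_ofReal_cpow_sub_le hx hh hs.le
  calc _ = ‖((x + h : ℝ) : ℂ) ^ (1 + s) - (x : ℂ) ^ (1 + s)‖ * ‖1 + s‖⁻¹ := by field_simp
    _ ≤ ‖1 + s‖ * (x + h) ^ s.re * h * ‖1 + s‖⁻¹ := by gcongr
    _ = _ := by field_simp

lemma differentiableOn_rieszKernel (hx : 0 < x) :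
    DifferentiableOn ℂ (rieszKernel x) {s | 0 < s.re} := by
  have hx' : (x : ℂ) ≠ 0 := mod_cast hx.ne'
  intro s hs
  have hs : 0 < s.re := hs
  have h0 : s * (s + 1) ≠ 0 := mul_ne_zero (fun h => by rw [h] at hs; simp at hs) fun h => by
      have := congrArg re h
      simp at this
      linarith
  unfold rieszKernel
  refine DifferentiableAt.differentiableWithinAt ?_
  refine DifferentiableAt.mul ?_ (DifferentiableAt.inv (by fun_prop) h0)
  exact DifferentiableAt.const_cpow (by fun_prop) (Or.inl hx')

/-- Moving a vertical line of integration to the left. -/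
lemma norm_integral_le_of_shift {f : ℂ → ℂ} {σ c B C : ℝ} (hσ : σ ≤ c)
    (hf : DifferentiableOn ℂ f {s | σ ≤ s.re})
    (hitg : Integrable fun t : ℝ => f (c + t * I))
    (hdec : ∀ s : ℂ, σ ≤ s.re → s.re ≤ c → 1 ≤ |s.im| → ‖f s‖ ≤ C * |s.im| ^ (-(1 / 4) : ℝ))
    (hB : ∀ M : ℕ, ‖∫ t in (-(2 ^ M : ℝ))..(2 ^ M : ℝ), f (σ + t * I)‖ ≤ B) :
    ‖∫ t : ℝ, f (c + t * I)‖ ≤ B := by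
  have hT : Tendsto (fun M : ℕ => (2 ^ M : ℝ)) atTop atTop :=
    tendsto_pow_atTop_atTop_of_one_lt (by norm_num)
  have hlim := (intervalIntegral_tendsto_integral hitg (tendsto_neg_atTop_atBot.comp hT) hT).norm
  have hlim2 : Tendsto (fun M : ℕ => B + 2 * (C * (2 ^ M : ℝ) ^ (-(1 / 4) : ℝ) * (c - σ)))
      atTop (nhds (B + 2 * (C * 0 * (c - σ)))) := by
    have := (tendsto_rpow_neg_atTop (by norm_num : (0 : ℝ) < 1 / 4)).comp hT
    exact (((this.const_mul C).mul_const _).const_mul 2).const_add B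
  rw [show B + 2 * (C * 0 * (c - σ)) = B by ring] at hlim2
  refine le_of_tendsto_of_tendsto' hlim hlim2 fun M => ?_
  set T : ℝ := 2 ^ M with hTdef
  have hT1 : 1 ≤ T := one_le_pow₀ (by norm_num)
  have hrect := integral_boundary_rect_eq_zero_of_differentiableOn f (σ + (-T : ℝ) * I)
    (c + (T : ℝ) * I) (hf.mono fun s hs => by
      have := (mem_reProdIm.1 hs).1
      simp only [add_re, ofReal_re, mul_re, I_re, mul_zero,
        ofReal_im, I_im, mul_one, sub_self, add_zero] at this
      rw [Set.uIcc_of_le hσ] at this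
      exact this.1)
  simp only [add_re, ofReal_re, mul_re, I_re, mul_zero,
        ofReal_im, I_im, mul_one, sub_self, add_zero, add_im,
        mul_im, zero_add] at hrect
  have hhor : ∀ τ : ℝ, |τ| = T → ‖∫ x in σ..c, f (x + τ * I)‖ ≤
      C * T ^ (-(1 / 4) : ℝ) * (c - σ) := fun τ hτ => by
    have := intervalIntegral.norm_integral_le_of_norm_le_const (a := σ) (b := c)
      (f := fun x : ℝ => f (x + τ * I)) (C := C * T ^ (-(1 / 4) : ℝ)) fun x hx => by
        rw [Set.uIoc_of_le hσ] at hx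
        have h1 := hdec (x + τ * I) (by simpa using hx.1.le) (by simpa using hx.2)
          (by simpa [hτ] using hT1)
        simpa [hτ] using h1
    rwa [abs_of_nonneg (by linarith)] at this
  have h1 := hhor (-T) (by rw [abs_neg, abs_of_pos (by linarith)])
  have h2 := hhor T (abs_of_pos (by linarith))
  have h3 : I • ∫ t in (-T)..T, f (c + t * I) = I • (∫ t in (-T)..T, f (σ + t * I)) +
      ((∫ x in σ..c, f (x + T * I)) - ∫ x in σ..c, f (x + (-T : ℝ) * I)) := by
    linear_combination hrect
  have h4 := congrArg norm h3
  rw [norm_smul, norm_I, one_mul] at h4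
  change ‖∫ t in (-T)..T, f (c + t * I)‖ ≤ _
  rw [h4]
  refine (norm_add_le _ _).trans (add_le_add ?_ ((norm_sub_le _ _).trans (by linarith)))
  rw [norm_smul, norm_I, one_mul]
  exact hB M

lemma sum_range_add_one_mul_min_le (N M : ℕ) :
    ∑ J ∈ range M, ((J : ℝ) + 1) * min 1 ((2 : ℝ) ^ N / 2 ^ J) ≤ 4 * (N + 1) ^ 2 := by
  have hmono : ∑ J ∈ range M, ((J : ℝ) + 1) * min 1 ((2 : ℝ) ^ N / 2 ^ J) ≤
      ∑ J ∈ range (N + M), ((J : ℝ) + 1) * min 1 ((2 : ℝ) ^ N / 2 ^ J) :=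
    sum_le_sum_of_subset_of_nonneg (range_mono (by omega)) fun J _ _ => by positivity
  refine hmono.trans ?_
  rw [sum_range_add]
  have h1 : ∑ J ∈ range N, ((J : ℝ) + 1) * min 1 ((2 : ℝ) ^ N / 2 ^ J) ≤ N * (N + 1) := by
    refine (sum_le_card_nsmul _ _ ((N : ℝ) + 1) fun J hJ => ?_).trans (by simp [mul_add])
    have hJN : (J : ℝ) ≤ N := mod_cast (mem_range.1 hJ).le
    exact (mul_le_of_le_one_right (by positivity) (min_le_left _ _)).trans (by linarith)
  have h2 : ∑ i ∈ range M, (((N + i : ℕ) : ℝ) + 1) * min 1 ((2 : ℝ) ^ N / 2 ^ (N + i)) ≤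
      (N + 1) * (4 - 2 * (M + 2) / 2 ^ M) := by
    induction M with
    | zero => norm_num
    | succ k ih =>
      have ih' := ih (sum_le_sum_of_subset_of_nonneg (range_mono (by omega))
        fun J _ _ => by positivity)
      rw [sum_range_succ]
      have h3 : min 1 ((2 : ℝ) ^ N / 2 ^ (N + k)) ≤ 1 / 2 ^ k :=
        (min_le_right _ _).trans (le_of_eq (by rw [pow_add]; field_simp))
      have h4 : (((N + k : ℕ) : ℝ) + 1) ≤ (N + 1) * (k + 1) := by
        push_cast
        nlinarith [N.cast_nonneg (α := ℝ), k.cast_nonneg (α := ℝ),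
          mul_nonneg (N.cast_nonneg (α := ℝ)) (k.cast_nonneg (α := ℝ))]
      have h5 : (((N + k : ℕ) : ℝ) + 1) * min 1 ((2 : ℝ) ^ N / 2 ^ (N + k)) ≤
          (N + 1) * (k + 1) * (1 / 2 ^ k) := by gcongr
      refine (add_le_add ih' h5).trans (le_of_eq ?_)
      push_cast
      rw [pow_succ]
      field_simp
      ring
  have h6 : (N + 1 : ℝ) * (4 - 2 * (M + 2) / 2 ^ M) ≤ (N + 1) * 4 := by
    have : (0 : ℝ) ≤ 2 * (M + 2) / 2 ^ M := by positivity
    gcongr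
    linarith
  have := N.cast_nonneg (α := ℝ)
  nlinarith

lemma norm_rieszDiff_le_dyadic {x h σ t : ℝ} (hx : 0 < x) (hh : 0 < h) (hσ : 0 < σ) {J N : ℕ}
    (hN : 2 * (x + h) ≤ 2 ^ N * h) (ht : InDyadic J t) :
    ‖rieszDiff x h (σ + t * I)‖ ≤ h * (x + h) ^ σ * (min 1 ((2 : ℝ) ^ N / 2 ^ J) / 2 ^ J) := by
  have hre : ((σ : ℂ) + t * I).re = σ := by simp
  have him : ((σ : ℂ) + t * I).im = t := by simp
  have hJ : (0 : ℝ) < 2 ^ J := by positivity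
  have b1 := norm_rieszDiff_le hx hh (s := σ + t * I) (by rw [hre]; exact hσ)
  have b2 := norm_rieszDiff_le_sq hx hh (s := σ + t * I) (by rw [hre]; exact hσ.le)
    (by rw [him]; exact ht.ne_zero)
  rw [hre] at b1 b2
  rw [him] at b2
  have hnorm : (2 : ℝ) ^ J ≤ ‖(σ : ℂ) + t * I‖ :=
    ht.1.trans (by simpa using abs_im_le_norm ((σ : ℂ) + t * I))
  rw [← min_div_div_right hJ.le, mul_min_of_nonneg _ _ (by positivity)]
  refine le_min (b1.trans ?_) (b2.trans ?_)
  · rw [mul_one_div]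
    gcongr
  · rw [rpow_add (by linarith), rpow_one]
    have h2 : ((2 : ℝ) ^ J) ^ 2 ≤ |t| ^ 2 := pow_le_pow_left₀ hJ.le ht.1 2
    calc 2 * ((x + h) * (x + h) ^ σ) / |t| ^ 2 ≤ 2 * ((x + h) * (x + h) ^ σ) / ((2 : ℝ) ^ J) ^ 2 := by
          gcongr
      _ = (2 * (x + h)) * (x + h) ^ σ / ((2 : ℝ) ^ J) ^ 2 := by ring
      _ ≤ (2 ^ N * h) * (x + h) ^ σ / ((2 : ℝ) ^ J) ^ 2 := by gcongr
      _ = _ := by field_simp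

lemma dyadicInterval_pow (J : ℕ) : DyadicInterval J (2 ^ J) (2 ^ (J + 1)) where
  length := by rw [pow_succ]; ring
  inDyadic t ht := by
    have h0 : (0 : ℝ) < 2 ^ J := by positivity
    rw [pow_succ] at ht
    rw [InDyadic, abs_of_pos (h0.trans_le ht.1)]
    exact ⟨ht.1, by linarith [ht.2]⟩

lemma dyadicInterval_neg_pow (J : ℕ) : DyadicInterval J (-(2 ^ (J + 1))) (-(2 ^ J)) where
  length := by rw [pow_succ]; ring
  inDyadic t ht := by
    have h0 : (0 : ℝ) < 2 ^ J := by positivity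
    rw [pow_succ] at ht
    rw [InDyadic, abs_of_neg (by linarith [ht.2])]
    exact ⟨by linarith [ht.2], by linarith [ht.1]⟩

lemma norm_integral_rieszDiff_mul_le {x h σ A : ℝ} (hx : 0 < x) (hh : 0 < h)
    (hσ : 1 / 8 < σ) (hA : 0 < A) (hN : 2 * (x + h) ≤ 2 ^ N * h)
    (hG : DifferentiableOn ℂ G {s | 1 / 8 < s.re})
    (hlow : ∀ t : ℝ, |t| ≤ 1 → ‖G (σ + t * I)‖ ≤ A)
    (hdy : ∀ (J : ℕ) (a b : ℝ), DyadicInterval J a b →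
      ∫ t in a..b, ‖G (σ + t * I)‖ ≤ A * (J + 1) * 2 ^ J) (M : ℕ) :
    ‖∫ t in (-(2 ^ M : ℝ))..(2 ^ M : ℝ), rieszDiff x h (σ + t * I) * G (σ + t * I)‖ ≤
      24 * A * (h * (x + h) ^ σ) * (N + 1) ^ 2 := by
  set f : ℝ → ℝ := fun t => ‖rieszDiff x h (σ + t * I) * G (σ + t * I)‖ with hf
  set Q := h * (x + h) ^ σ with hQ
  have hQ0 : 0 < Q := by positivity
  have hGc := continuousOn_vertical hG hσ
  have hk : DifferentiableOn ℂ (rieszDiff x h) {s | 1 / 8 < s.re} :=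
    ((differentiableOn_rieszKernel (by linarith)).sub (differentiableOn_rieszKernel hx)).mono
      fun s (hs : 1 / 8 < s.re) => show 0 < s.re by linarith
  have hkc := continuousOn_vertical hk hσ
  have hfc : Continuous f := (hkc.mul hGc).norm
  have hcell : ∀ (J : ℕ) (a b : ℝ), DyadicInterval J a b →
      ∫ t in a..b, f t ≤ A * Q * ((J + 1) * min 1 ((2 : ℝ) ^ N / 2 ^ J)) := fun J a b hd => by
    have hb : ∀ t ∈ Set.Icc a b, f t ≤ Q * (min 1 ((2 : ℝ) ^ N / 2 ^ J) / 2 ^ J) *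
        ‖G (σ + t * I)‖ := fun t ht => by
      simp only [hf, norm_mul]
      have := norm_rieszDiff_le_dyadic hx hh (by linarith : 0 < σ) hN (hd.inDyadic t ht)
      gcongr
    have hi : IntervalIntegrable (fun t : ℝ => Q * (min 1 ((2 : ℝ) ^ N / 2 ^ J) / 2 ^ J) *
        ‖G (σ + t * I)‖) MeasureTheory.volume a b :=
      (continuous_const.mul hGc.norm).intervalIntegrable a b
    have hm := integral_mono_on hd.le (hfc.intervalIntegrable a b) hi hb
    rw [integral_const_mul] at hm
    refine hm.trans ?_
    calc _ ≤ Q * (min 1 ((2 : ℝ) ^ N / 2 ^ J) / 2 ^ J) * (A * (J + 1) * 2 ^ J) := by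
          have := hdy J a b hd
          gcongr
      _ = _ := by field_simp
  have hind : ∀ M : ℕ, ∫ t in (-(2 ^ M : ℝ))..(2 ^ M : ℝ), f t ≤ 16 * A * Q +
      2 * (A * Q) * ∑ J ∈ range M, ((J : ℝ) + 1) * min 1 ((2 : ℝ) ^ N / 2 ^ J) := fun M => by
    induction M with
    | zero =>
      have hb : ∀ t ∈ Set.Icc (-1 : ℝ) 1, f t ≤ 8 * Q * A := fun t ht => by
        simp only [hf, norm_mul]
        have h1 := hlow t (abs_le.2 ht)
        have hre : ((σ : ℂ) + t * I).re = σ := by simp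
        have h2 := norm_rieszDiff_le hx hh (s := σ + t * I) (by rw [hre]; linarith)
        rw [hre] at h2
        have h3 : 1 / 8 ≤ ‖(σ : ℂ) + t * I‖ := by
          have := abs_re_le_norm ((σ : ℂ) + t * I)
          rw [hre, abs_of_pos (by linarith)] at this
          linarith
        have h4 : h * (x + h) ^ σ / ‖(σ : ℂ) + t * I‖ ≤ 8 * Q := by
          rw [div_le_iff₀ (by linarith)]
          nlinarith
        exact mul_le_mul (h2.trans h4) h1 (norm_nonneg _) (by positivity)
      have hi : IntervalIntegrable (fun _ : ℝ => 8 * Q * A) MeasureTheory.volume (-1) 1 :=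
        continuous_const.intervalIntegrable _ _
      have hm := integral_mono_on (by norm_num : (-1 : ℝ) ≤ 1) (hfc.intervalIntegrable _ _) hi hb
      rw [integral_const, smul_eq_mul] at hm
      simp only [pow_zero, range_zero, sum_empty, mul_zero, add_zero]
      linarith
    | succ M ih =>
      rw [sum_range_succ]
      have c1 := hcell M _ _ (dyadicInterval_pow M)
      have c2 := hcell M _ _ (dyadicInterval_neg_pow M)
      have hi : ∀ a b, IntervalIntegrable f MeasureTheory.volume a b :=
        fun a b => hfc.intervalIntegrable a b
      rw [← integral_add_adjacent_intervals (hi _ (-(2 ^ M))) (hi _ _),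
        ← integral_add_adjacent_intervals (hi (-(2 ^ M)) (2 ^ M)) (hi _ _)]
      linarith
  have hle : (-(2 ^ M : ℝ)) ≤ 2 ^ M := by
    have : (0 : ℝ) < 2 ^ M := by positivity
    linarith
  refine (norm_integral_le_integral_norm hle).trans ((hind M).trans ?_)
  have h1 := sum_range_add_one_mul_min_le N M
  have h2 : (1 : ℝ) ≤ (N + 1) ^ 2 := one_le_pow₀ (by have := N.cast_nonneg (α := ℝ); linarith)
  have h3 : 0 < A * Q := by positivity
  nlinarith [mul_le_mul_of_nonneg_left h1 h3.le, mul_le_mul_of_nonneg_left h2 h3.le]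

theorem IsRegularPart.exists_norm_integral_rieszDiff_le (hr : r = 0 ∨ r = 4)
    {r₄ r₆ r₇ : ℂ} (hG : IsRegularPart r r₄ r₆ r₇ G)
    (hlow : ∃ C : ℝ, 0 < C ∧ ∀ s : ℂ, 1 / 8 < s.re →
      s.re ≤ 1 / 8 + 1 / 200 → |s.im| ≤ 1 → ‖G s‖ ≤ C / (8 * s.re - 1))
    (hitg : ∀ x : ℝ, 0 < x → Integrable fun t : ℝ =>
      rieszKernel x ((2 / 5 : ℝ) + t * I) * G ((2 / 5 : ℝ) + t * I)) :
    ∃ C : ℝ, 0 < C ∧ ∀ (N : ℕ) (x h σ : ℝ), 0 < x → 0 < h → 1 / 8 < σ → σ ≤ 1 / 8 + 1 / 200 →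
      2 * (x + h) ≤ 2 ^ N * h →
      ‖∫ t : ℝ, rieszDiff x h ((2 / 5 : ℝ) + t * I) * G ((2 / 5 : ℝ) + t * I)‖ ≤
        C / (8 * σ - 1) * (h * (x + h) ^ σ) * (N + 1) ^ 2 := by
  obtain ⟨C₁, hC₁, h₁⟩ := hlow
  obtain ⟨C₂, hC₂, h₂⟩ := hG.exists_integral_norm_le hr
  refine ⟨24 * (C₁ + C₂), by positivity, fun N x h σ hx hh hσ hσ' hN => ?_⟩
  have hpos : 0 < 8 * σ - 1 := by linarith
  obtain ⟨B, hB, hBs⟩ := hG.exists_norm_le_rpow hr hσ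
  have hre : ∀ t : ℝ, ((σ : ℂ) + t * I).re = σ := fun t => by simp
  have him : ∀ t : ℝ, ((σ : ℂ) + t * I).im = t := fun t => by simp
  have hk : DifferentiableOn ℂ (rieszDiff x h) {s | 1 / 8 < s.re} :=
    ((differentiableOn_rieszKernel (by linarith)).sub (differentiableOn_rieszKernel hx)).mono
      fun s (hs : 1 / 8 < s.re) => show 0 < s.re by linarith
  have hleft := norm_integral_rieszDiff_mul_le hx hh hσ (A := (C₁ + C₂) / (8 * σ - 1))
    (by positivity) hN hG.differentiableOn (fun t ht => by
      have := h₁ (σ + t * I) (by rw [hre]; exact hσ) (by rw [hre]; exact hσ') (by rw [him]; exact ht)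
      rw [hre] at this
      refine this.trans ?_
      gcongr
      linarith) (fun J a b hd => (h₂ J σ a b hσ hσ' hd).trans (by gcongr; linarith))
  have hshift := norm_integral_le_of_shift (f := fun s => rieszDiff x h s * G s) (σ := σ)
    (c := 2 / 5) (C := 2 * max 1 (x + h) ^ (2 : ℝ) * B) (by linarith)
    ((hk.mul hG.differentiableOn).mono fun s (hs : σ ≤ s.re) => show 1 / 8 < s.re by linarith)
    (by
      have := (hitg (x + h) (by linarith)).sub (hitg x hx)
      refine this.congr (.of_forall fun t => ?_)
      simp only [Pi.sub_apply, rieszDiff]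
      ring)
    (fun s hs1 hs2 ht => by
      have b1 := norm_rieszDiff_le_sq hx hh (s := s) (by linarith) (abs_pos.1 (by linarith))
      have b2 := hBs s hs1 hs2 ht
      have b3 : (x + h) ^ (1 + s.re) ≤ max 1 (x + h) ^ (2 : ℝ) :=
        (rpow_le_rpow (by linarith) (le_max_right _ _) (by linarith)).trans
          (rpow_le_rpow_of_exponent_le (le_max_left _ _) (by linarith))
      have ht0 : 0 < |s.im| := by linarith
      rw [norm_mul]
      calc _ ≤ 2 * max 1 (x + h) ^ (2 : ℝ) / |s.im| ^ 2 * (B * |s.im| ^ (7 / 4 : ℝ)) := by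
            refine mul_le_mul (b1.trans ?_) b2 (norm_nonneg _) (by positivity)
            gcongr
        _ = 2 * max 1 (x + h) ^ (2 : ℝ) * B * (|s.im| ^ (7 / 4 : ℝ) / |s.im| ^ (2 : ℝ)) := by
            rw [rpow_two, rpow_two]
            ring
        _ = _ := by
            rw [← rpow_sub ht0]
            norm_num)
    hleft
  refine hshift.trans (le_of_eq ?_)
  ring

/-- The summatory function of `weight r`. -/
noncomputable def weightSum (r : ℕ) (x : ℝ) : ℝ := ∑ n ∈ range (⌊x⌋₊ + 1), (weight r n : ℝ)

lemma rieszMean_eq_sum (r : ℕ) (h : x ≤ M + 1) :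
    rieszMean r x = ∑ n ∈ range (M + 1), (weight r n : ℝ) * max (x - n) 0 := by
  refine tsum_eq_sum fun n hn => ?_
  rw [mem_range, not_lt] at hn
  have : ((M + 1 : ℕ) : ℝ) ≤ n := mod_cast hn
  push_cast at this
  rw [max_eq_right (by linarith), mul_zero]

lemma rieszMean_sub_le (r : ℕ) {x h : ℝ} (hh : 0 < h) :
    rieszMean r (x + h) - rieszMean r x ≤ h * weightSum r (x + h) := by
  have h1 := (Nat.lt_floor_add_one (x + h)).le
  rw [rieszMean_eq_sum r h1, rieszMean_eq_sum r (by linarith : x ≤ ⌊x + h⌋₊ + 1), weightSum,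
    ← sum_sub_distrib, mul_sum]
  refine sum_le_sum fun n _ => ?_
  rw [← mul_sub, mul_comm h]
  refine mul_le_mul_of_nonneg_left ?_ (Nat.cast_nonneg _)
  rw [sub_le_iff_le_add]
  exact max_le (by linarith [le_max_left (x - n) 0]) (by linarith [le_max_right (x - n) 0])

lemma mul_weightSum_le (r : ℕ) {x h : ℝ} (hx : 0 ≤ x) (hh : 0 < h) :
    h * weightSum r x ≤ rieszMean r (x + h) - rieszMean r x := by
  have h1 := (Nat.lt_floor_add_one (x + h)).le
  rw [rieszMean_eq_sum r h1, rieszMean_eq_sum r (by linarith : x ≤ ⌊x + h⌋₊ + 1), weightSum,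
    ← sum_sub_distrib, mul_sum]
  have hmono : ⌊x⌋₊ ≤ ⌊x + h⌋₊ := Nat.floor_mono (by linarith)
  refine (sum_le_sum fun n hn => ?_).trans (sum_le_sum_of_subset_of_nonneg
    (range_mono (Nat.add_le_add_right hmono 1)) fun n _ _ => ?_)
  · rw [mem_range, Nat.lt_succ_iff, Nat.le_floor_iff hx] at hn
    rw [max_eq_left (by linarith), max_eq_left (by linarith)]
    linarith
  · rw [← mul_sub]
    exact mul_nonneg (Nat.cast_nonneg _) (sub_nonneg.2 (max_le_max (by linarith) le_rfl))

lemma hasDerivAt_smoothMain {α x : ℝ} (hα : 0 < α) (hx : 0 < x) :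
    HasDerivAt (smoothMain α) ((x ^ α - 1) / α) x := by
  have h1 : HasDerivAt (fun x : ℝ => x ^ (1 + α)) ((1 + α) * x ^ (1 + α - 1)) x :=
    hasDerivAt_rpow_const (Or.inl hx.ne')
  have h2 := ((h1.div_const (α * (α + 1))).sub ((hasDerivAt_id x).div_const α)).add_const
    (1 / (α + 1))
  refine h2.congr_deriv ?_
  rw [add_sub_cancel_left]
  field_simp
  ring

lemma abs_smoothMain_sub_le {α x h z : ℝ} (hα : 0 < α) (hα' : α ≤ 1) (hx : 0 < x) (hh : 0 < h)
    (hz : x ≤ z) (hz' : z ≤ x + h) :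
    |smoothMain α (x + h) - smoothMain α x - h * ((z ^ α - 1) / α)| ≤ h * (h * x ^ (α - 1)) := by
  obtain ⟨ξ, hξ, he⟩ := exists_hasDerivAt_eq_slope (smoothMain α) (fun x => (x ^ α - 1) / α)
    (by linarith : x < x + h)
    (fun y hy => (hasDerivAt_smoothMain hα (hx.trans_le hy.1)).continuousAt.continuousWithinAt)
    (fun y hy => hasDerivAt_smoothMain hα (hx.trans hy.1))
  rw [add_sub_cancel_left, eq_div_iff hh.ne'] at he
  have hb : ∀ y, x ≤ y → y ≤ x + h → x ^ α ≤ y ^ α ∧ y ^ α ≤ x ^ α + α * (h * x ^ (α - 1)) :=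
    fun y h1 h2 => by
    refine ⟨rpow_le_rpow hx.le h1 hα.le, (rpow_le_rpow (hx.le.trans h1) h2 hα.le).trans ?_⟩
    have h3 : (1 + h / x) ^ α ≤ 1 + α * (h / x) :=
      rpow_one_add_le_one_add_mul_self (by linarith [div_pos hh hx]) hα.le hα'
    have h4 : x + h = x * (1 + h / x) := by field_simp
    rw [h4, mul_rpow hx.le (by positivity), rpow_sub_one hx.ne']
    calc x ^ α * (1 + h / x) ^ α ≤ x ^ α * (1 + α * (h / x)) := by gcongr
      _ = _ := by field_simp
  obtain ⟨a1, a2⟩ := hb ξ hξ.1.le hξ.2.le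
  obtain ⟨b1, b2⟩ := hb z hz hz'
  rw [← he, mul_comm _ h, ← mul_sub, abs_mul, abs_of_pos hh, ← sub_div, abs_div, abs_of_pos hα]
  refine mul_le_mul_of_nonneg_left ?_ hh.le
  rw [div_le_iff₀ hα, abs_le]
  constructor <;> nlinarith

lemma integrable_rieszKernel_div {α c x : ℝ} (hα : α < c) (hc : 0 < c) (hx : 0 < x) :
    Integrable fun y : ℝ => rieszKernel x (c + y * I) / (c + y * I - α) := by
  have hker := integrable_rieszKernel hc hx
  have hb : ∀ y : ℝ, c - α ≤ ‖(c : ℂ) + y * I - α‖ := fun y => by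
    have := abs_re_le_norm ((c : ℂ) + y * I - α)
    simp only [sub_re, add_re, ofReal_re, mul_re, I_re,
      mul_zero, ofReal_im, I_im, mul_one, sub_self, add_zero] at this
    exact (le_abs_self _).trans this
  have h0 : 0 < c - α := by linarith
  refine (hker.norm.const_mul (c - α)⁻¹).mono' ?_ (.of_forall fun y => ?_)
  · simp only [div_eq_mul_inv]
    refine hker.aestronglyMeasurable.mul (Continuous.inv₀ (by fun_prop) fun y => ?_).aestronglyMeasurable
    exact norm_pos_iff.1 (h0.trans_le (hb y))
  · rw [norm_div, div_eq_mul_inv, mul_comm]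
    have := hb y
    gcongr

lemma IsRegularPart.integrable_and_integral (hr : r = 0 ∨ r = 4) {r₄ r₆ r₇ : ℂ} (hG : IsRegularPart r r₄ r₆ r₇ G) (hx : 0 < x) :
    Integrable (fun t : ℝ => rieszKernel x ((2 / 5 : ℝ) + t * I) * G ((2 / 5 : ℝ) + t * I)) ∧
    (1 ≤ x → ∫ t : ℝ, rieszKernel x ((2 / 5 : ℝ) + t * I) * G ((2 / 5 : ℝ) + t * I) =
      2 * π * ((rieszMean r x : ℝ) - (r₄ * (smoothMain (1 / 4) x : ℝ) +
        r₆ * (smoothMain (1 / 6) x : ℝ) + r₇ * (smoothMain (1 / 7) x : ℝ)))) := by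
  have hre : ∀ t : ℝ, (((2 / 5 : ℝ) : ℂ) + t * I).re = 2 / 5 := fun t => by simp
  have hne : ∀ (t α : ℝ), α < 2 / 5 → ((2 / 5 : ℝ) : ℂ) + t * I ≠ (α : ℂ) := fun t α hα h => by
    have := congrArg re h
    rw [hre, ofReal_re] at this
    linarith
  obtain ⟨i0, e0⟩ := integral_rieszKernel_mul_weightSeries hr (by norm_num : (1 / 4 : ℝ) < 2 / 5) hx
  have i4 := (integrable_rieszKernel_div (by norm_num : (1 / 4 : ℝ) < 2 / 5) (by norm_num) hx).const_mul r₄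
  have i6 := (integrable_rieszKernel_div (by norm_num : (1 / 6 : ℝ) < 2 / 5) (by norm_num) hx).const_mul r₆
  have i7 := (integrable_rieszKernel_div (by norm_num : (1 / 7 : ℝ) < 2 / 5) (by norm_num) hx).const_mul r₇
  have hfun : (fun t : ℝ => rieszKernel x ((2 / 5 : ℝ) + t * I) * G ((2 / 5 : ℝ) + t * I)) =
      fun t : ℝ => rieszKernel x ((2 / 5 : ℝ) + t * I) * weightSeries r ((2 / 5 : ℝ) + t * I) -
        (r₄ * (rieszKernel x ((2 / 5 : ℝ) + t * I) / ((2 / 5 : ℝ) + t * I - (1 / 4 : ℝ))) +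
        r₆ * (rieszKernel x ((2 / 5 : ℝ) + t * I) / ((2 / 5 : ℝ) + t * I - (1 / 6 : ℝ))) +
        r₇ * (rieszKernel x ((2 / 5 : ℝ) + t * I) / ((2 / 5 : ℝ) + t * I - (1 / 7 : ℝ)))) := by
    funext t
    have n4 := hne t (1 / 4) (by norm_num)
    have n6 := hne t (1 / 6) (by norm_num)
    have n7 := hne t (1 / 7) (by norm_num)
    have h1 := weightSeries_eq hr (s := (2 / 5 : ℝ) + t * I) (by rw [hre]; norm_num)
    have h2 := hG.eq ((2 / 5 : ℝ) + t * I) (by rw [hre]; norm_num)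
      (by push_cast at n4 ⊢; exact n4) (by push_cast at n6 ⊢; exact n6)
      (by push_cast at n7 ⊢; exact n7)
    rw [mainProd, ← h1] at h2
    rw [h2]
    push_cast
    ring
  rw [hfun]
  refine ⟨i0.sub ((i4.add i6).add i7), fun hx1 => ?_⟩
  refine (MeasureTheory.integral_sub i0 ((i4.add i6).add i7)).trans ?_
  rw [integral_add' (i4.add i6) i7, integral_add' i4 i6, e0]
  simp only [MeasureTheory.integral_const_mul]
  rw [integral_rieszKernel_div (by norm_num) (by norm_num) hx1,
    integral_rieszKernel_div (by norm_num) (by norm_num) hx1,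
    integral_rieszKernel_div (by norm_num) (by norm_num) hx1]
  push_cast
  ring

theorem exists_abs_rieszMean_sub_le (hr : r = 0 ∨ r = 4) :
    ∃ r₄ r₆ r₇ C : ℝ, 0 < C ∧ ∀ (N : ℕ) (x h σ : ℝ), 1 ≤ x → 0 < h → 1 / 8 < σ →
      σ ≤ 1 / 8 + 1 / 200 → 2 * (x + h) ≤ 2 ^ N * h →
      |rieszMean r (x + h) - rieszMean r x -
        (r₄ * (smoothMain (1 / 4) (x + h) - smoothMain (1 / 4) x) +
        r₆ * (smoothMain (1 / 6) (x + h) - smoothMain (1 / 6) x) +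
        r₇ * (smoothMain (1 / 7) (x + h) - smoothMain (1 / 7) x))| ≤
        C / (8 * σ - 1) * (h * (x + h) ^ σ) * (N + 1) ^ 2 := by
  obtain ⟨r₄, r₆, r₇, G, hG, hlow⟩ := exists_isRegularPart hr
  have hi := fun (x : ℝ) (hx : 0 < x) => hG.integrable_and_integral hr hx
  obtain ⟨C, hC, hb⟩ := hG.exists_norm_integral_rieszDiff_le hr hlow fun x hx => (hi x hx).1
  refine ⟨r₄.re, r₆.re, r₇.re, C, hC, fun N x h σ hx hh hσ hσ' hN => ?_⟩
  have hx0 : 0 < x := by linarith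
  obtain ⟨i1, e1⟩ := hi x hx0
  obtain ⟨i2, e2⟩ := hi (x + h) (by linarith)
  have hm := hb N x h σ hx0 hh hσ hσ' hN
  have he : ∫ t : ℝ, rieszDiff x h ((2 / 5 : ℝ) + t * I) * G ((2 / 5 : ℝ) + t * I) =
      2 * π * (((rieszMean r (x + h) : ℝ) : ℂ) - (rieszMean r x : ℝ) -
        (r₄ * ((smoothMain (1 / 4) (x + h) - smoothMain (1 / 4) x : ℝ) : ℂ) +
        r₆ * ((smoothMain (1 / 6) (x + h) - smoothMain (1 / 6) x : ℝ) : ℂ) +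
        r₇ * ((smoothMain (1 / 7) (x + h) - smoothMain (1 / 7) x : ℝ) : ℂ))) := by
    simp only [rieszDiff, sub_mul]
    rw [MeasureTheory.integral_sub i2 i1, e1 hx, e2 (by linarith)]
    push_cast
    ring
  rw [he] at hm
  refine le_trans ?_ hm
  rw [norm_mul]
  have hpi : (1 : ℝ) ≤ ‖(2 * π : ℂ)‖ := by
    rw [norm_mul, norm_real, norm_eq_abs, abs_of_pos pi_pos]
    simp only [norm_ofNat]
    linarith [pi_gt_three]
  refine le_trans ?_ (le_mul_of_one_le_left (norm_nonneg _) hpi)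
  refine le_trans (le_of_eq ?_) (abs_re_le_norm _)
  simp only [sub_re, add_re, re_mul_ofReal, ofReal_re]

lemma two_pow_ceil_ge {Z : ℝ} (hZ : 1 ≤ Z) : Z ^ (1 / 2 : ℝ) ≤ (2 : ℝ) ^ ⌈log Z⌉₊ := by
  have hl : 1 / 2 ≤ log 2 := by linarith [log_two_gt_d9]
  have h0 : 0 ≤ log Z := log_nonneg hZ
  calc Z ^ (1 / 2 : ℝ) ≤ (2 : ℝ) ^ log Z := by
        rw [rpow_def_of_pos (by linarith), rpow_def_of_pos (by norm_num)]
        apply exp_le_exp.2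
        nlinarith
    _ ≤ (2 : ℝ) ^ (⌈log Z⌉₊ : ℝ) := rpow_le_rpow_of_exponent_le (by norm_num) (Nat.le_ceil _)
    _ = _ := rpow_natCast _ _

set_option maxHeartbeats 1000000 in
lemma error_term_le {C Z x h : ℝ} (hC : 0 < C) (hL : 200 ≤ log Z) (hZ : 1 ≤ Z)
    (hh : h = Z ^ (7 / 8 : ℝ)) (hx : 0 ≤ x + h) (hx' : x + h ≤ 2 * Z) :
    C / (8 * (1 / 8 + 1 / log Z) - 1) * (h * (x + h) ^ (1 / 8 + 1 / log Z)) *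
      ((⌈log Z⌉₊ : ℝ) + 1) ^ 2 ≤ h * (4 * C * (Z ^ (1 / 8 : ℝ) * log Z ^ 8)) := by
  set L := log Z with hLd
  have hZ0 : 0 < Z := by linarith
  have hL0 : 0 < L := by linarith
  have hh0 : 0 < h := by rw [hh]; positivity
  have h1 : 8 * (1 / 8 + 1 / L) - 1 = 8 / L := by ring
  have hσ : 1 / 8 + 1 / L ≤ 1 := by
    have : 1 / L ≤ 1 / 200 := one_div_le_one_div_of_le (by norm_num) hL
    linarith
  have h2 : (x + h) ^ (1 / 8 + 1 / L) ≤ 6 * Z ^ (1 / 8 : ℝ) := by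
    calc (x + h) ^ (1 / 8 + 1 / L) ≤ (2 * Z) ^ (1 / 8 + 1 / L) :=
          rpow_le_rpow hx hx' (by positivity)
      _ = 2 ^ (1 / 8 + 1 / L) * (Z ^ (1 / 8 : ℝ) * exp 1) := by
          rw [mul_rpow (by norm_num) hZ0.le, rpow_add hZ0, rpow_def_of_pos hZ0 (1 / L),
            ← hLd, mul_one_div_cancel hL0.ne']
      _ ≤ 2 ^ (1 : ℝ) * (Z ^ (1 / 8 : ℝ) * 3) := by
          have := exp_one_lt_three.le
          gcongr
          norm_num
      _ = _ := by rw [rpow_one]; ring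
  have h3 : ((⌈L⌉₊ : ℝ) + 1) ^ 2 ≤ 4 * L ^ 2 := by
    have := (Nat.ceil_lt_add_one hL0.le).le
    nlinarith [(Nat.cast_nonneg ⌈L⌉₊ : (0 : ℝ) ≤ _)]
  have h4 : L ^ 3 ≤ L ^ 8 := pow_le_pow_right₀ (by linarith) (by norm_num)
  rw [h1]
  calc _ ≤ C / (8 / L) * (h * (6 * Z ^ (1 / 8 : ℝ))) * (4 * L ^ 2) := by gcongr
    _ = h * (3 * C * (Z ^ (1 / 8 : ℝ) * L ^ 3)) := by field_simp; ring
    _ ≤ h * (4 * C * (Z ^ (1 / 8 : ℝ) * L ^ 8)) := by gcongr; norm_num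

lemma mul_rpow_sub_one_le {α Z x : ℝ} (hα : α ≤ 1 / 4) (hα0 : 0 < α) (hZ : 1 ≤ Z)
    (hx : Z / 2 ≤ x) : Z ^ (7 / 8 : ℝ) * x ^ (α - 1) ≤ 2 * Z ^ (1 / 8 : ℝ) := by
  have hZ0 : 0 < Z := by linarith
  have h1 : x ^ (α - 1) ≤ 2 * Z ^ (-(3 / 4) : ℝ) := by
    calc x ^ (α - 1) ≤ (Z / 2) ^ (α - 1) :=
          rpow_le_rpow_of_nonpos (by positivity) hx (by linarith)
      _ = Z ^ (α - 1) * 2 ^ (1 - α) := by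
          rw [div_rpow hZ0.le (by norm_num), div_eq_mul_inv, ← rpow_neg (by norm_num), neg_sub]
      _ ≤ Z ^ (-(3 / 4) : ℝ) * 2 ^ (1 : ℝ) :=
          mul_le_mul (rpow_le_rpow_of_exponent_le hZ (by linarith))
            (rpow_le_rpow_of_exponent_le (by norm_num) (by linarith)) (by positivity)
            (by positivity)
      _ = _ := by rw [rpow_one]; ring
  calc _ ≤ Z ^ (7 / 8 : ℝ) * (2 * Z ^ (-(3 / 4) : ℝ)) := by gcongr
    _ = 2 * (Z ^ (7 / 8 : ℝ) * Z ^ (-(3 / 4) : ℝ)) := by ring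
    _ = _ := by rw [← rpow_add hZ0]; norm_num

set_option maxHeartbeats 1000000 in
theorem exists_abs_weightSum_sub_le (hr : r = 0 ∨ r = 4) : ∃ c₄ c₆ c₇ C Z₀ : ℝ, ∀ Z : ℝ, Z₀ ≤ Z →
      |weightSum r Z - (c₄ * Z ^ (1 / 4 : ℝ) + c₆ * Z ^ (1 / 6 : ℝ) + c₇ * Z ^ (1 / 7 : ℝ))| ≤
        C * (Z ^ (1 / 8 : ℝ) * log Z ^ 8) := by
  obtain ⟨r₄, r₆, r₇, C, hC, hb⟩ := exists_abs_rieszMean_sub_le hr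
  set K := |r₄| + |r₆| + |r₇| with hK
  refine ⟨4 * r₄, 6 * r₆, 7 * r₇, 4 * C + 2 * K + 7 * K, exp 200, fun Z hZ => ?_⟩
  have hZ1 : 1 ≤ Z := (one_le_exp (by norm_num)).trans hZ
  have hZ0 : 0 < Z := by linarith
  have hL : 200 ≤ log Z := (le_log_iff_exp_le hZ0).2 hZ
  set E := Z ^ (1 / 8 : ℝ) * log Z ^ 8 with hE
  have hL8 : 1 ≤ log Z ^ 8 := one_le_pow₀ (by linarith)
  have hZ8 : 1 ≤ Z ^ (1 / 8 : ℝ) := one_le_rpow hZ1 (by norm_num)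
  have hZE : Z ^ (1 / 8 : ℝ) ≤ E := le_mul_of_one_le_right (by linarith) hL8
  have hE1 : 1 ≤ E := hZ8.trans hZE
  have hbig : 4 ≤ Z ^ (1 / 8 : ℝ) := by
    rw [rpow_def_of_pos hZ0]
    have := add_one_le_exp (log Z * (1 / 8))
    linarith
  set h := Z ^ (7 / 8 : ℝ) with hh
  have hh0 : 0 < h := by positivity
  have hhZ : h * Z ^ (1 / 8 : ℝ) = Z := by
    rw [hh, ← rpow_add hZ0]
    norm_num
  have hhle : 4 * h ≤ Z := by nlinarith
  have hσ : 1 / 8 < 1 / 8 + 1 / log Z := by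
    have : 0 < 1 / log Z := by positivity
    linarith
  have hσ' : 1 / 8 + 1 / log Z ≤ 1 / 8 + 1 / 200 := by
    have := one_div_le_one_div_of_le (by norm_num) hL
    linarith
  have hN : ∀ x, x + h ≤ 2 * Z → 2 * (x + h) ≤ 2 ^ ⌈log Z⌉₊ * h := fun x hx => by
    have h1 := two_pow_ceil_ge hZ1
    have h2 : 4 * Z ^ (1 / 8 : ℝ) ≤ Z ^ (1 / 2 : ℝ) := by
      have h3 : Z ^ (1 / 2 : ℝ) = Z ^ (1 / 8 : ℝ) * Z ^ (1 / 8 : ℝ) * (Z ^ (1 / 8 : ℝ) *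
          Z ^ (1 / 8 : ℝ)) := by
        rw [← rpow_add hZ0, ← rpow_add hZ0]
        norm_num
      rw [h3]
      nlinarith [mul_le_mul hbig hZ8 (by norm_num) (by positivity)]
    nlinarith
  have key : ∀ x, Z / 2 ≤ x → x ≤ Z → Z ≤ x + h →
      |rieszMean r (x + h) - rieszMean r x - h * (4 * r₄ * Z ^ (1 / 4 : ℝ) +
        6 * r₆ * Z ^ (1 / 6 : ℝ) + 7 * r₇ * Z ^ (1 / 7 : ℝ))| ≤
        h * ((4 * C + 2 * K + 7 * K) * E) := fun x hx1 hx2 hx3 => by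
    have hx0 : 0 < x := by linarith
    have hexp1 : (1 : ℝ) ≤ x := by
      have := add_one_le_exp (200 : ℝ)
      linarith
    have m := (hb ⌈log Z⌉₊ x h _ hexp1 hh0 hσ hσ' (hN x (by linarith))).trans
      (error_term_le hC hL hZ1 hh (by linarith) (by linarith))
    have hs : ∀ α : ℝ, 0 < α → α ≤ 1 / 4 → ∀ ρ : ℝ,
        |ρ * (smoothMain α (x + h) - smoothMain α x - h * ((Z ^ α - 1) / α))| ≤
          |ρ| * (h * (2 * E)) := fun α h1 h2 ρ => by
      rw [abs_mul]
      refine mul_le_mul_of_nonneg_left ((abs_smoothMain_sub_le h1 (by linarith) hx0 hh0 hx2 hx3).trans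
        (mul_le_mul_of_nonneg_left ?_ hh0.le)) (abs_nonneg _)
      exact (mul_rpow_sub_one_le h2 h1 hZ1 hx1).trans (by linarith)
    have s4 := hs (1 / 4) (by norm_num) le_rfl r₄
    have s6 := hs (1 / 6) (by norm_num) (by norm_num) r₆
    have s7 := hs (1 / 7) (by norm_num) (by norm_num) r₇
    have hc : |4 * r₄ + 6 * r₆ + 7 * r₇| ≤ 7 * K := by
      rw [hK, abs_le]
      constructor <;> linarith [neg_abs_le r₄, neg_abs_le r₆, neg_abs_le r₇, le_abs_self r₄,
        le_abs_self r₆, le_abs_self r₇, abs_nonneg r₄, abs_nonneg r₆]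
    have hc' : |h * (4 * r₄ + 6 * r₆ + 7 * r₇)| ≤ h * (7 * K * E) := by
      rw [abs_mul, abs_of_pos hh0]
      refine mul_le_mul_of_nonneg_left (hc.trans (le_mul_of_one_le_right ?_ hE1)) hh0.le
      positivity
    rw [abs_le] at m s4 s6 s7 hc' ⊢
    have hexpand : h * ((4 * C + 2 * K + 7 * K) * E) = h * (4 * C * E) + (|r₄| * (h * (2 * E)) +
        |r₆| * (h * (2 * E)) + |r₇| * (h * (2 * E))) + h * (7 * K * E) := by rw [hK]; ring
    rw [hexpand]
    constructor <;> linarith [m.1, m.2, s4.1, s4.2, s6.1, s6.2, s7.1, s7.2, hc'.1, hc'.2]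
  have up := mul_weightSum_le r hZ0.le hh0
  have lo := rieszMean_sub_le r (x := Z - h) hh0
  rw [sub_add_cancel] at lo
  have k1 := key Z (by linarith) le_rfl (by linarith)
  have k2 := key (Z - h) (by linarith) (by linarith) (by linarith)
  rw [sub_add_cancel] at k2
  rw [abs_le] at k1 k2 ⊢
  constructor
  · refine le_of_mul_le_mul_left ?_ hh0
    rw [mul_neg, mul_sub]
    linarith [k2.1]
  · refine le_of_mul_le_mul_left ?_ hh0
    rw [mul_sub]
    linarith [k1.2]

end LFunctionMoments

section FieldCounting

open Finset hiding ext
open Ideal hiding ext sum_mem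
open IntermediateField hiding ext
open NumberField
open Subgroup hiding ext Normal inclusion
open Module hiding restrictScalars
open Real (div_rpow log log_le_log log_le_rpow_div log_nonneg log_pos log_rpow mul_rpow norm_eq_abs norm_of_nonneg one_le_rpow rpow_add rpow_le_rpow_of_exponent_le rpow_natCast rpow_natCast_mul rpow_nonneg rpow_two)
open Function
open Filter (Tendsto atTop eventually_ge_atTop eventually_gt_atTop)
open AlgEquiv (mul_apply restrictNormalHom restrictNormalHom_surjective)
open MonoidHom (mem_ker range_eq_top range_eq_map)
local notation "Ω" => AlgebraicClosure ℚ
local notation "C₈" => Multiplicative (ZMod 8)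

section Inertia

variable {S : Type*} [CommRing S] [IsDedekindDomain S] {G : Type*} [Group G] [MulSemiringAction G S]
  {P : Ideal S}

lemma eq_one_of_pow_eq_one_of_sub_one_mem {η : S} {m : ℕ} (h : η ^ m = 1) (hη : η - 1 ∈ P)
    (hm : (m : S) ∉ P) : η = 1 := by
  by_contra hne
  have h1 : (∑ i ∈ range m, η ^ i) = 0 := by
    have h2 := geom_sum_mul η m
    rw [h, sub_self] at h2
    exact (mul_eq_zero.1 h2).resolve_right (sub_ne_zero.2 hne)
  apply hm
  have h3 : (m : S) = -∑ i ∈ range m, (η ^ i - 1) := by simp [sum_sub_distrib, h1]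
  rw [h3]
  refine neg_mem (sum_mem fun i _ => ?_)
  exact mem_of_dvd _ (sub_one_dvd_pow_sub_one η i) hη

lemma smul_eq_of_mem_inertia_of_pow_eq_one {σ : G} (hσ : σ ∈ P.inertia G) {ζ : S} {m : ℕ}
    (h : ζ ^ m = 1) (hm : (m : S) ∉ P) : σ • ζ = ζ := by
  have hm0 : m ≠ 0 := by
    rintro rfl
    simp at hm
  have hu : ζ ^ (m - 1) * ζ = 1 := by
    rw [← pow_succ, Nat.sub_add_cancel (Nat.one_le_iff_ne_zero.2 hm0), h]
  have h1 : (σ • ζ) * ζ ^ (m - 1) = 1 := by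
    refine eq_one_of_pow_eq_one_of_sub_one_mem (P := P) (m := m) ?_ ?_ hm
    · rw [mul_pow, ← pow_mul, mul_comm (m - 1), pow_mul, h, one_pow, mul_one, ← smul_pow', h,
        smul_one]
    · have h2 := P.mul_mem_left (ζ ^ (m - 1)) (hσ ζ)
      rwa [mul_sub, hu, mul_comm] at h2
  calc σ • ζ = ((σ • ζ) * ζ ^ (m - 1)) * ζ := by rw [mul_assoc, hu, mul_one]
    _ = ζ := by rw [h1, one_mul]

omit [IsDedekindDomain S] in
lemma smul_mem_of_mem_inertia {σ : G} (hσ : σ ∈ P.inertia G) {x : S} (hx : x ∈ P) : σ • x ∈ P := by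
  simpa using P.add_mem (hσ x) hx

omit [IsDedekindDomain S] in
lemma smul_mem_pow_of_forall {σ : G} (hσ : ∀ x ∈ P, σ • x ∈ P) (k : ℕ) {x : S}
    (hx : x ∈ P ^ k) : σ • x ∈ P ^ k :=
  ((pow_right_mono (J := P.comap (MulSemiringAction.toRingHom G S σ)) (fun x hx => hσ x hx)
    k).trans (le_comap_pow _ _)) hx

/-- An element of the inertia group fixing a uniformizer to second order acts trivially on the
graded ring of the `P`-adic filtration. -/
lemma smul_sub_mem_pow_succ {σ : G} (hσ : σ ∈ P.inertia G) [P.IsPrime] (hP : P ≠ ⊥) {π : S}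
    (h1 : π ∈ P) (h2 : π ∉ P ^ 2) (h3 : σ • π - π ∈ P ^ 2) (k : ℕ) {x : S} (hx : x ∈ P ^ k) :
    σ • x - x ∈ P ^ (k + 1) := by
  have key : ∀ x ∈ P, σ • x - x ∈ P ^ 2 := by
    intro x hx
    obtain ⟨d, e, he, rfl⟩ := exists_mul_add_mem_pow_succ hP (i := 1) π x (by simpa using h1)
      (by simpa using h2) (by simpa using hx)
    have h4 : σ • (π * d + e) - (π * d + e) =
        (σ • π - π) * (σ • d) + π * (σ • d - d) + (σ • e - e) := by
      rw [smul_add, smul_mul']; ring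
    rw [h4]
    refine add_mem (add_mem (mul_mem_right _ _ h3) ?_) (sub_mem ?_ he)
    · rw [pow_two]
      exact Ideal.mul_mem_mul h1 (hσ d)
    · exact smul_mem_pow_of_forall (fun x hx => smul_mem_of_mem_inertia hσ hx) 2 he
  induction k generalizing x with
  | zero => simpa using hσ x
  | succ k ih =>
    rw [pow_succ] at hx
    refine Submodule.mul_induction_on hx (fun a ha b hb => ?_) (fun a b ha hb => ?_)
    · have h4 : σ • (a * b) - a * b = (σ • a - a) * (σ • b) + a * (σ • b - b) := by
        rw [smul_mul']; ring
      rw [h4]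
      refine add_mem ?_ ?_
      · rw [pow_succ _ (k + 1)]
        exact Ideal.mul_mem_mul (ih ha) (smul_mem_of_mem_inertia hσ hb)
      · rw [add_assoc, pow_add]
        exact Ideal.mul_mem_mul ha (key b hb)
    · have h4 : σ • (a + b) - (a + b) = (σ • a - a) + (σ • b - b) := by rw [smul_add]; ring
      rw [h4]
      exact add_mem ha hb

lemma smul_eq_of_tame {σ : G} (hσ : σ ∈ P.inertia G) [P.IsPrime] (hP : P ≠ ⊥) {n : ℕ}
    (hn : σ ^ n = 1) (hnP : (n : S) ∉ P) {π : S} (h1 : π ∈ P) (h2 : π ∉ P ^ 2)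
    (h3 : σ • π - π ∈ P ^ 2) (x : S) : σ • x = x := by
  have key : ∀ k : ℕ, σ • x - x ∈ P ^ k := by
    intro k
    induction k with
    | zero => simp
    | succ k ih =>
      obtain ⟨y, hy⟩ : ∃ y, y = σ • x - x := ⟨_, rfl⟩
      rw [← hy] at ih ⊢
      have h4 : ∀ i : ℕ, σ ^ i • y - y ∈ P ^ (k + 1) := by
        intro i
        induction i with
        | zero => simp
        | succ i ihi =>
          have h5 : σ ^ (i + 1) • y - y = σ • (σ ^ i • y - y) + (σ • y - y) := by
            rw [pow_succ', mul_smul, smul_sub]; abel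
          rw [h5]
          exact add_mem (smul_mem_pow_of_forall (fun x hx => smul_mem_of_mem_inertia hσ hx) _ ihi)
            (smul_sub_mem_pow_succ hσ hP h1 h2 h3 k ih)
      have h6 : ∀ i : ℕ, σ ^ i • x - x - i * y ∈ P ^ (k + 1) := by
        intro i
        induction i with
        | zero => simp
        | succ i ihi =>
          have h5 : σ ^ (i + 1) • x - x - ((i + 1 : ℕ) : S) * y =
              (σ ^ i • x - x - i * y) + (σ ^ i • y - y) := by
            rw [pow_succ, mul_smul]
            have : σ • x = x + y := by rw [hy]; ring
            rw [this, smul_add]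
            push_cast
            ring
          rw [h5]
          exact add_mem ihi (h4 i)
      have h7 := h6 n
      rw [hn, one_smul, sub_self, zero_sub, neg_mem_iff] at h7
      rw [mul_comm] at h7
      exact (IsPrime.mem_pow_mul P h7).resolve_right hnP
  have h8 : σ • x - x ∈ (⨅ k : ℕ, P ^ k) := by simpa [Ideal.mem_iInf] using key
  rw [iInf_pow_eq_bot_of_isDomain P (IsPrime.ne_top inferInstance)] at h8
  simpa [sub_eq_zero] using h8

/-- In an abelian group of automorphisms, a tame inertia group has order at most `p - 1`. -/
lemma exists_pow_sub_one_of_mem_inertia [P.IsPrime] (hP : P ≠ ⊥) {p : ℕ} (hp : 1 ≤ p) {φ : G}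
    (hφ : ∀ x : S, φ • x - x ^ p ∈ P) {π : S} (h1 : π ∈ P) (h2 : π ∉ P ^ 2)
    {σ : G} (hσ : σ ∈ P.inertia G) (hc : φ * σ = σ * φ) :
    ∃ u : S, σ • π - π * u ∈ P ^ 2 ∧ u ^ (p - 1) - 1 ∈ P := by
  have hIσ : ∀ x ∈ P, σ • x ∈ P := fun x hx => smul_mem_of_mem_inertia hσ hx
  have hIφ : ∀ x ∈ P, φ • x ∈ P := fun x hx => by
    simpa using P.add_mem (hφ x) (pow_mem_of_mem P hx p hp)
  have hIφ' : ∀ x, φ • x ∈ P → x ∈ P := fun x hx =>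
    IsPrime.mem_of_pow_mem inferInstance p (by simpa using P.sub_mem hx (hφ x))
  have hrep : ∀ x ∈ P, ∃ d, x - π * d ∈ P ^ 2 := by
    intro x hx
    obtain ⟨d, e, he, rfl⟩ := exists_mul_add_mem_pow_succ hP (i := 1) π x (by simpa using h1)
      (by simpa using h2) (by simpa using hx)
    exact ⟨d, by simpa using he⟩
  have hmul : ∀ x ∈ P, ∀ y ∈ P, x * y ∈ P ^ 2 := fun x hx y hy => by
    rw [pow_two]; exact Ideal.mul_mem_mul hx hy
  have hcan : ∀ x y : S, x * y ∈ P ^ 2 → x ∉ P ^ 2 → y ∈ P := by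
    intro x y hxy hx
    by_contra hy
    exact (IsPrime.mem_pow_mul P hxy).elim hx hy
  have hinv : ∀ τ : G, (∀ x ∈ P, τ • x ∈ P) → (∀ x, τ • x ∈ P → x ∈ P) → τ • π ∉ P ^ 2 := by
    intro τ hτ hτ' h
    have hle : ∀ x ∈ P, τ⁻¹ • x ∈ P := fun x hx => hτ' _ (by simpa using hx)
    exact h2 (by simpa using smul_mem_pow_of_forall hle 2 h)
  obtain ⟨u, hu⟩ := hrep _ (hIσ π h1)
  obtain ⟨v, hv⟩ := hrep _ (hIφ π h1)
  have hφ2 := hinv φ hIφ hIφ'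
  have hσ2 := hinv σ hIσ fun x hx => by simpa using P.sub_mem hx (hσ x)
  refine ⟨u, hu, ?_⟩
  have e1 : φ • (σ • π) - (φ • π) * u ^ p ∈ P ^ 2 := by
    have h5 : φ • (σ • π) - (φ • π) * u ^ p = φ • (σ • π - π * u) + (φ • π) * (φ • u - u ^ p) := by
      rw [smul_sub, smul_mul']; ring
    rw [h5]
    exact add_mem (smul_mem_pow_of_forall hIφ 2 hu) (hmul _ (hIφ π h1) _ (hφ u))
  have e2 : σ • (φ • π) - (φ • π) * u ∈ P ^ 2 := by
    have h5 : σ • (φ • π) - (φ • π) * u =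
        σ • (φ • π - π * v) + (σ • π) * (σ • v - v) + (σ • π - π * u) * v - (φ • π - π * v) * u := by
      rw [smul_sub, smul_mul']; ring
    rw [h5]
    exact sub_mem (add_mem (add_mem (smul_mem_pow_of_forall hIσ 2 hv)
      (hmul _ (hIσ π h1) _ (hσ v))) (mul_mem_right _ _ hu)) (mul_mem_right _ _ hv)
  have e3 : φ • π * (u * (u ^ (p - 1) - 1)) ∈ P ^ 2 := by
    have h5 : u * u ^ (p - 1) = u ^ p := by rw [← pow_succ', Nat.sub_add_cancel hp]
    have h6 : φ • π * (u * (u ^ (p - 1) - 1)) =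
        (σ • (φ • π) - (φ • π) * u) - (φ • (σ • π) - (φ • π) * u ^ p) := by
      rw [← mul_smul, ← mul_smul, hc, mul_sub, h5]; ring
    rw [h6]
    exact sub_mem e2 e1
  refine (IsPrime.mem_or_mem inferInstance (hcan _ _ e3 hφ2)).resolve_left fun hu' => hσ2 ?_
  simpa using add_mem hu (hmul _ h1 _ hu')

lemma card_inertia_le [P.IsPrime] [FaithfulSMul G S] (hP : P ≠ ⊥) {p : ℕ} (hp : 2 ≤ p) {φ : G}
    (hφ : ∀ x : S, φ • x - x ^ p ∈ P) (hc : ∀ σ τ : G, σ * τ = τ * σ) {n : ℕ}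
    (hn : ∀ σ ∈ P.inertia G, σ ^ n = 1) (hnP : (n : S) ∉ P) :
    Nat.card (P.inertia G) ≤ p - 1 := by
  obtain ⟨π, h1, h2⟩ : ∃ π ∈ P, π ∉ P ^ 2 := by
    simpa using exists_mem_pow_notMem_pow_succ P hP (IsPrime.ne_top inferInstance) 1
  choose! u hu1 hu2 using fun (σ : G) (hσ : σ ∈ P.inertia G) =>
    exists_pow_sub_one_of_mem_inertia hP (by omega) hφ h1 h2 hσ (hc φ σ)
  have hp0 : 0 < p - 1 := by omega
  let f : P.inertia G → Polynomial.nthRootsFinset (p - 1) (1 : S ⧸ P) := fun σ =>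
    ⟨Ideal.Quotient.mk P (u σ), by
      rw [Polynomial.mem_nthRootsFinset hp0]
      have := Quotient.eq_zero_iff_mem.2 (hu2 σ σ.2)
      rwa [map_sub, map_pow, map_one, sub_eq_zero] at this⟩
  have hf : Injective f := by
    intro σ τ h
    have h3 : u σ - u τ ∈ P := Ideal.Quotient.eq.1 (Subtype.ext_iff.1 h)
    have hmem : ((σ : G) * (τ : G)⁻¹) ∈ P.inertia G := mul_mem σ.2 (inv_mem τ.2)
    have h4 : (σ : G) • π - (τ : G) • π ∈ P ^ 2 := by
      have h5 : (σ : G) • π - (τ : G) • π = ((σ : G) • π - π * u σ) - ((τ : G) • π - π * u τ)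
          + π * (u σ - u τ) := by ring
      rw [h5]
      refine add_mem (sub_mem (hu1 σ σ.2) (hu1 τ τ.2)) ?_
      rw [pow_two]
      exact Ideal.mul_mem_mul h1 h3
    have h6 : ((τ : G)⁻¹ * σ) • π - π ∈ P ^ 2 := by
      have h7 : ((τ : G)⁻¹ * σ) • π - π = (τ : G)⁻¹ • ((σ : G) • π - (τ : G) • π) := by
        rw [smul_sub, mul_smul, inv_smul_smul (τ : G) π]
      rw [h7]
      exact smul_mem_pow_of_forall (fun x hx => smul_mem_of_mem_inertia (inv_mem τ.2) hx) 2 h4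
    rw [hc] at hmem
    have h8 : ((τ : G)⁻¹ * σ) = 1 := FaithfulSMul.eq_of_smul_eq_smul (α := S) fun x => by
      rw [one_smul]
      exact smul_eq_of_tame hmem hP (hn _ hmem) hnP h1 h2 h6 x
    exact Subtype.ext (inv_mul_eq_one.1 h8).symm
  have h9 := Nat.card_le_card_of_injective f hf
  refine h9.trans ?_
  rw [Nat.card_eq_fintype_card, Fintype.card_coe, Polynomial.nthRootsFinset_def]
  exact (Multiset.toFinset_card_le _).trans (Polynomial.card_nthRoots _ _)

end Inertia

section NumberFieldInertia

open NumberField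

variable {M : Type*} [Field M] [NumberField M]

lemma RingOfIntegers.coe_algEquiv_smul (σ : Gal(M/ℚ)) (x : 𝓞 M) :
    ((σ • x : 𝓞 M) : M) = σ (x : M) := rfl

instance RingOfIntegers.faithfulSMul_algEquiv : FaithfulSMul Gal(M/ℚ) (𝓞 M) := ⟨by
  intro σ τ h
  ext x
  obtain ⟨a, b, hb, rfl⟩ := IsFractionRing.div_surjective (A := 𝓞 M) x
  have ha := congrArg (algebraMap (𝓞 M) M) (h a)
  have hb := congrArg (algebraMap (𝓞 M) M) (h b)
  rw [map_div₀, map_div₀]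
  exact congrArg₂ (· / ·) ha hb⟩

variable {p : ℕ} {P : Ideal (𝓞 M)} [P.IsPrime] [hPp : P.LiesOver (span {(p : ℤ)})]

include hPp in
omit [NumberField M] [P.IsPrime] in
lemma natCast_mem_iff_of_liesOver {n : ℕ} : (n : 𝓞 M) ∈ P ↔ p ∣ n := by
  have h := mem_of_liesOver P (span {(p : ℤ)}) (n : ℤ)
  rw [mem_span_singleton, Int.natCast_dvd_natCast] at h
  rw [h]
  simp

include hPp in
omit [P.IsPrime] in
lemma ne_bot_of_liesOver_span (hp : p ≠ 0) : P ≠ ⊥ := by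
  rintro rfl
  have := (natCast_mem_iff_of_liesOver (p := p) (P := (⊥ : Ideal (𝓞 M)))).2 dvd_rfl
  exact hp (by simpa using this)

include hPp in
lemma exists_frobenius [IsGalois ℚ M] (hp : p.Prime) :
    ∃ φ : Gal(M/ℚ), ∀ x : 𝓞 M, φ • x - x ^ p ∈ P := by
  have : P.IsMaximal := IsPrime.isMaximal inferInstance (ne_bot_of_liesOver_span hp.ne_zero)
  have : Finite (𝓞 M ⧸ P) := Ring.HasFiniteQuotients.finiteQuotient
    (ne_bot_of_liesOver_span hp.ne_zero)
  obtain ⟨φ, hφ⟩ := IsArithFrobAt.exists_of_isInvariant ℤ Gal(M/ℚ) P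
  refine ⟨φ, fun x => ?_⟩
  have h1 : Nat.card (ℤ ⧸ P.under ℤ) = p := by
    rw [← hPp.over]
    rw [Nat.card_congr (Int.quotientSpanNatEquivZMod p).toEquiv, Nat.card_zmod]
  have := hφ x
  rwa [h1] at this

include hPp in
lemma card_inertia_eq_ramificationIdx [IsGalois ℚ M] (hp : p.Prime) :
    Nat.card (P.inertia Gal(M/ℚ)) = P.ramificationIdx ℤ := by
  have : (span {(p : ℤ)}).IsPrime :=
    (span_singleton_prime (mod_cast hp.ne_zero)).2 (Nat.prime_iff_prime_int.1 hp)
  have : (span {(p : ℤ)}).IsMaximal := IsPrime.isMaximal this (by simpa using hp.ne_zero)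
  rw [card_inertia_eq_ramificationIdxIn (R := ℤ) (span {(p:ℤ)}) P,
    ramificationIdxIn_eq_ramificationIdx (span {(p:ℤ)}) P Gal(M/ℚ)]

include hPp in
lemma le_ramificationIdx_of_mem_pow (hp : p ≠ 0) {k : ℕ} (h : (p : 𝓞 M) ∈ P ^ k) :
    k ≤ P.ramificationIdx ℤ := by
  have h1 : (span {(p : ℤ)}).map (algebraMap ℤ (𝓞 M)) = span {(p : 𝓞 M)} := by
    rw [map_span, Set.image_singleton]; simp
  have h0 : (span {(p : ℤ)}).map (algebraMap ℤ (𝓞 M)) ≠ ⊥ := by rw [h1]; simpa using hp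
  rw [IsDedekindDomain.ramificationIdx_eq_multiplicity (span {(p : ℤ)}) P h0]
  refine FiniteMultiplicity.le_multiplicity_of_pow_dvd ?_ ?_
  · refine FiniteMultiplicity.of_prime_left (prime_of_isPrime
      (ne_bot_of_liesOver_span hp) inferInstance) h0
  · rw [h1, dvd_span_singleton]
    exact h

include hPp in
omit [NumberField M] in
lemma one_sub_mem_of_pow_eq_one (hp : p.Prime) {ζ : 𝓞 M} (hζ : ζ ^ p = 1) : 1 - ζ ∈ P := by
  have : Fact p.Prime := ⟨hp⟩
  have : CharP (𝓞 M ⧸ P) p := by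
    refine CharP.mk fun n => ?_
    rw [← map_natCast (Ideal.Quotient.mk P), Quotient.eq_zero_iff_mem,
      natCast_mem_iff_of_liesOver (p := p)]
  refine IsPrime.mem_of_pow_mem inferInstance p ?_
  rw [← Quotient.eq_zero_iff_mem, map_pow, map_sub, sub_pow_char, ← map_pow, ← map_pow, hζ]
  simp

omit [NumberField M] [P.IsPrime] in
lemma natCast_mem_pow_of_one_sub_mem (hp : 1 ≤ p) {ζ : 𝓞 M} (hζ : IsPrimitiveRoot ζ p) {k : ℕ}
    (h : 1 - ζ ∈ P ^ k) : (p : 𝓞 M) ∈ P ^ (k * (p - 1)) := by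
  obtain ⟨n, rfl⟩ : ∃ n, p = n + 1 := ⟨p - 1, by omega⟩
  have h1 := hζ.prod_one_sub_pow_eq_order
  push_cast
  rw [← h1, pow_mul]
  have h2 := prod_mem_prod (s := range n) (I := fun _ => P ^ k)
    (x := fun i => 1 - ζ ^ (i + 1)) fun i _ =>
      mem_of_dvd _ (by simpa using sub_dvd_pow_sub_pow 1 ζ (i + 1)) h
  simpa using h2

include hPp in
/-- An abelian field containing the `p`-th roots of unity which is tamely ramified at `p` has
inertia group isomorphic to the Galois group of the field of `p`-th roots of unity. -/
lemma inertia_of_tame [IsGalois ℚ M] (hp : p.Prime) (hc : ∀ σ τ : Gal(M/ℚ), σ * τ = τ * σ) {n : ℕ}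
    (hn : ∀ σ ∈ P.inertia Gal(M/ℚ), σ ^ n = 1) (hnp : ¬ p ∣ n) {ζ : M} (hζ : IsPrimitiveRoot ζ p) :
    Nat.card (P.inertia Gal(M/ℚ)) ≤ p - 1 ∧
    (∀ σ ∈ P.inertia Gal(M/ℚ), σ ζ = ζ → σ = 1) ∧
    ∀ τ : Gal(M/ℚ), ∃ σ ∈ P.inertia Gal(M/ℚ), σ ζ = τ ζ := by
  have : NeZero p := ⟨hp.ne_zero⟩
  obtain ⟨φ, hφ⟩ := exists_frobenius (P := P) hp
  have hP : P ≠ ⊥ := ne_bot_of_liesOver_span hp.ne_zero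
  have hnP : (n : 𝓞 M) ∉ P := fun h => hnp (natCast_mem_iff_of_liesOver.1 h)
  have hle := card_inertia_le hP hp.two_le hφ hc hn hnP
  set z : 𝓞 M := hζ.toInteger with hz
  have hzp : IsPrimitiveRoot z p := hζ.toInteger_isPrimitiveRoot
  have hzc : (z : M) = ζ := rfl
  have h1 : 1 - z ∈ P := one_sub_mem_of_pow_eq_one hp hzp.pow_eq_one
  have hp1 : 1 ≤ p - 1 := by have := hp.two_le; omega
  have hge : p - 1 ≤ Nat.card (P.inertia Gal(M/ℚ)) := by
    rw [card_inertia_eq_ramificationIdx hp]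
    refine le_ramificationIdx_of_mem_pow hp.ne_zero ?_
    simpa using natCast_mem_pow_of_one_sub_mem hp.one_lt.le hzp (k := 1) (by simpa using h1)
  have h2 : 1 - z ∉ P ^ 2 := by
    intro h
    have h3 := le_ramificationIdx_of_mem_pow hp.ne_zero
      (natCast_mem_pow_of_one_sub_mem hp.one_lt.le hzp h)
    rw [← card_inertia_eq_ramificationIdx hp] at h3
    omega
  have hinj : ∀ σ ∈ P.inertia Gal(M/ℚ), σ ζ = ζ → σ = 1 := by
    intro σ hσ h
    refine FaithfulSMul.eq_of_smul_eq_smul (α := 𝓞 M) fun x => ?_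
    rw [one_smul]
    refine smul_eq_of_tame hσ hP (hn _ hσ) hnP h1 h2 ?_ x
    have : σ • (1 - z) = 1 - z := by
      apply RingOfIntegers.ext
      rw [RingOfIntegers.coe_algEquiv_smul]
      simp [hzc, h]
    simp [this]
  refine ⟨hle, hinj, fun τ => ?_⟩
  let f : P.inertia Gal(M/ℚ) → primitiveRoots p M := fun σ =>
    ⟨(σ : Gal(M/ℚ)) ζ, (mem_primitiveRoots hp.pos).2 (hζ.map_of_injective (σ : Gal(M/ℚ)).injective)⟩
  have hf : Injective f := by
    intro σ σ' h
    have h3 : (σ : Gal(M/ℚ)) ζ = (σ' : Gal(M/ℚ)) ζ := congrArg Subtype.val h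
    have h4 := hinj ((σ' : Gal(M/ℚ))⁻¹ * σ) (mul_mem (inv_mem σ'.2) σ.2) (by
      rw [mul_apply, h3, ← mul_apply, inv_mul_cancel]; rfl)
    exact Subtype.ext (inv_mul_eq_one.1 h4).symm
  have hsurj : Surjective f := by
    refine ((Nat.bijective_iff_injective_and_card f).2 ⟨hf, ?_⟩).2
    rw [Nat.card_eq_fintype_card (α := primitiveRoots p M), Fintype.card_coe, hζ.card_primitiveRoots,
      Nat.totient_prime hp]
    omega
  obtain ⟨σ, hσ⟩ := hsurj ⟨τ ζ, (mem_primitiveRoots hp.pos).2 (hζ.map_of_injective τ.injective)⟩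
  exact ⟨σ, σ.2, congrArg Subtype.val hσ⟩

end NumberFieldInertia

section NumberFieldInertia

open NumberField

variable {M : Type*} [Field M] [NumberField M]

variable {p : ℕ} {P : Ideal (𝓞 M)} [P.IsPrime] [hPp : P.LiesOver (span {(p : ℤ)})]

include hPp in
lemma ramificationIdx_under_fixedField_inertia [IsGalois ℚ M] (hp : p.Prime) :
    (P.under (𝓞 (fixedField (P.inertia Gal(M/ℚ))))).ramificationIdx ℤ = 1 := by
  set H := P.inertia Gal(M/ℚ) with hH
  set E := fixedField H with hE
  have hP : P ≠ ⊥ := ne_bot_of_liesOver_span hp.ne_zero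
  have : P.IsMaximal := IsPrime.isMaximal inferInstance hP
  have : IsGaloisGroup H E M := IsGaloisGroup.subgroup Gal(M/ℚ) ℚ M H
  have : IsGaloisGroup H (𝓞 E) (𝓞 M) := .of_isFractionRing _ _ _ E M
  have h1 := ramificationIdx_tower (R := ℤ) (P.under (𝓞 E)) P
  have : (P.under (𝓞 E)).IsMaximal := inferInstance
  have h2 : Nat.card (P.inertia H) = P.ramificationIdx (𝓞 E) := by
    rw [card_inertia_eq_ramificationIdxIn (R := 𝓞 E) (P.under (𝓞 E)) P,
      ramificationIdxIn_eq_ramificationIdx (P.under (𝓞 E)) P H]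
  have h3 : P.inertia H = ⊤ := by
    ext σ
    simp only [Subgroup.mem_top, iff_true]
    exact coe_mem_inertia.1 σ.2
  rw [h3, card_top, hH, card_inertia_eq_ramificationIdx hp (P := P)] at h2
  rw [← h2] at h1
  exact (right_eq_mul₀ (ramificationIdx_pos P ℤ).ne').1 h1

include hPp in
/-- If the inertia group at `p` fixes a square root of an integer `d`, then `d` is not exactly
divisible by `p`. -/
lemma not_squarefree_dvd_of_inertia_fixes [IsGalois ℚ M] (hp : p.Prime) {α : M} {d : ℤ}
    (hα : α ^ 2 = d) (hfix : ∀ σ ∈ P.inertia Gal(M/ℚ), σ α = α) (hd : Squarefree d) :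
    ¬ (p : ℤ) ∣ d := by
  rintro ⟨d', rfl⟩
  have hd' : ¬ (p : ℤ) ∣ d' := by
    rintro ⟨c, rfl⟩
    have := hd p ⟨c, by ring⟩
    rw [Int.isUnit_iff] at this
    have := hp.two_le
    omega
  set E := fixedField (P.inertia Gal(M/ℚ)) with hE
  set Q := P.under (𝓞 E) with hQ
  have hQp : Q.LiesOver (span {(p : ℤ)}) := ⟨by rw [hPp.over, hQ, under_under]⟩
  let β : E := ⟨α, fun σ => hfix σ σ.2⟩
  have hβ : β ^ 2 = ((p * d' : ℤ) : E) := Subtype.ext (by simpa [β] using hα)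
  have hitg : IsIntegral ℤ β := by
    refine IsIntegral.of_pow (n := 2) two_pos ?_
    rw [hβ]
    exact isIntegral_algebraMap
  let b : 𝓞 E := ⟨β, hitg⟩
  have hb : b ^ 2 = ((p * d' : ℤ) : 𝓞 E) := by
    apply RingOfIntegers.ext
    change algebraMap (𝓞 E) E (b ^ 2) = algebraMap (𝓞 E) E _
    rw [map_pow, map_intCast, ← hβ]
    rfl
  have hint_mem : ∀ n : ℤ, ((n : 𝓞 E) ∈ Q ↔ (p : ℤ) ∣ n) := by
    intro n
    have h := mem_of_liesOver Q (span {(p : ℤ)}) n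
    rw [mem_span_singleton] at h
    rw [h]
    simp
  have h1 : b ∈ Q := IsPrime.mem_of_pow_mem inferInstance 2 (by
    rw [hb, hint_mem]
    exact dvd_mul_right _ _)
  have h2 : (p : 𝓞 E) ∈ Q ^ 2 := by
    have h3 : ((p : ℤ) : 𝓞 E) * (d' : 𝓞 E) ∈ Q ^ 2 := by
      have := Ideal.pow_mem_pow h1 2
      rw [hb] at this
      simpa using this
    have := (IsPrime.mem_pow_mul Q h3).resolve_right fun h => hd' ((hint_mem _).1 h)
    simpa using this
  have h4 := le_ramificationIdx_of_mem_pow hp.ne_zero h2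
  rw [ramificationIdx_under_fixedField_inertia hp] at h4
  omega

end NumberFieldInertia

/-- In a finite abelian Galois group, an element outside an index `2` subgroup is detected by the
square root of a squarefree integer. -/
lemma exists_sqrt_of_hom {M : Type*} [Field M] [NumberField M] [IsGalois ℚ M]
    (hc : ∀ σ τ : Gal(M/ℚ), σ * τ = τ * σ) (φ : Gal(M/ℚ) →* ℤˣ) {x : Gal(M/ℚ)} (hx : φ x ≠ 1) :
    ∃ (α : M) (d : ℤ), α ^ 2 = d ∧ Squarefree d ∧ (∀ σ, φ σ = 1 → σ α = α) ∧ x α ≠ α := by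
  obtain ⟨β, hβ1, hβ2⟩ : ∃ β : M, (∀ σ, φ σ = 1 → σ β = β) ∧ x β ≠ β := by
    by_contra! h
    apply hx
    have h1 : x ∈ (fixedField φ.ker).fixingSubgroup := by
      rw [IntermediateField.mem_fixingSubgroup_iff]
      exact fun β hβ => h β fun σ hσ => hβ ⟨σ, hσ⟩
    rwa [fixingSubgroup_fixedField] at h1
  have hx2 : ∀ τ, φ (τ * τ) = 1 := fun τ => by rw [map_mul, Int.units_mul_self]
  set α := β - x β with hα
  have hα0 : α ≠ 0 := sub_ne_zero.2 hβ2.symm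
  have hfix : ∀ σ, φ σ = 1 → σ α = α := fun σ hσ => by
    rw [hα, map_sub, hβ1 σ hσ, ← mul_apply, hc, mul_apply, hβ1 σ hσ]
  have hxα : x α = -α := by
    rw [hα, map_sub, ← mul_apply, hβ1 _ (hx2 x)]
    ring
  have hsq : ∀ σ : Gal(M/ℚ), σ (α ^ 2) = α ^ 2 := by
    intro σ
    rcases Int.units_eq_one_or (φ σ) with h | h
    · rw [map_pow, hfix σ h]
    · have hx' := (Int.units_eq_one_or (φ x)).resolve_left hx
      have h1 := hfix (x * σ) (by rw [map_mul, h, hx']; simp)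
      have h2 : σ α = -α := by
        have h3 := congrArg x h1
        rw [mul_apply, ← mul_apply x, hxα] at h3
        have h4 := hfix (x * x) (hx2 x)
        have h5 : (x * x) (σ α) = σ α := by rw [← mul_apply, hc, mul_apply, h4]
        rw [← h5, h3]
      rw [map_pow, h2]
      ring
  obtain ⟨r, hr⟩ := (IsGalois.mem_bot_iff_fixed (F := ℚ) (α ^ 2)).2 hsq
  have hr' : (r : M) = α ^ 2 := by rw [← hr]; rfl
  have hr0 : r ≠ 0 := by
    rintro rfl
    exact hα0 (by simpa using hr'.symm)
  have hden : (r.den : M) ≠ 0 := mod_cast r.den_nz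
  have hnum : ((r.num * r.den : ℤ) : M) = (α * r.den) ^ 2 := by
    rw [mul_pow, ← hr', Rat.cast_def r]
    push_cast
    field_simp
  obtain ⟨a, b, hab, ha⟩ := Nat.sq_mul_squarefree (r.num * r.den).natAbs
  have hm0 : r.num * r.den ≠ 0 := mul_ne_zero (Rat.num_ne_zero.2 hr0) (mod_cast r.den_nz)
  have hb0 : b ≠ 0 := by
    rintro rfl
    simp at hab
    omega
  have hb0' : (b : M) ≠ 0 := mod_cast hb0
  refine ⟨α * r.den / b, (r.num * r.den).sign * a, ?_, ?_, ?_, ?_⟩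
  · rw [div_pow, ← hnum, div_eq_iff (pow_ne_zero _ hb0')]
    have h1 : (r.num * r.den) = (r.num * r.den).sign * a * b ^ 2 := by
      conv_lhs => rw [← Int.sign_mul_natAbs (r.num * r.den), ← hab]
      push_cast
      ring
    exact_mod_cast h1
  · rw [← Int.squarefree_natAbs, Int.natAbs_mul, Int.natAbs_sign_of_ne_zero hm0, one_mul,
      Int.natAbs_natCast]
    exact ha
  · intro σ hσ
    simp [hfix σ hσ]
  · rw [map_div₀, map_mul, hxα, map_natCast, map_natCast]
    intro h
    have h1 : (α * r.den / b) ≠ 0 := div_ne_zero (mul_ne_zero hα0 hden) hb0'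
    rw [neg_mul, neg_div] at h
    exact h1 (self_eq_neg.1 h.symm)

section AbelianGroups

variable {G : Type*} [CommGroup G]

lemma card_sup_le [Finite G] (H K : Subgroup G) :
    Nat.card (H ⊔ K : Subgroup G) ≤ Nat.card H * Nat.card K := by
  rw [← Nat.card_prod]
  refine Nat.card_le_card_of_surjective
    (fun x : H × K => (⟨x.1 * x.2, mul_mem_sup x.1.2 x.2.2⟩ : (H ⊔ K : Subgroup G))) ?_
  rintro ⟨x, hx⟩
  obtain ⟨y, hy, z, hz, rfl⟩ := Subgroup.mem_sup.1 hx
  exact ⟨(⟨y, hy⟩, ⟨z, hz⟩), rfl⟩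

lemma card_finset_sup_le [Finite G] {ι : Type*} (s : Finset ι) (I : ι → Subgroup G) :
    Nat.card (s.sup I : Subgroup G) ≤ ∏ i ∈ s, Nat.card (I i) := by
  induction s using Finset.induction_on with
  | empty => simp
  | insert i s hi ih =>
    rw [sup_insert, prod_insert hi]
    exact (card_sup_le _ _).trans (Nat.mul_le_mul_left _ ih)

lemma card_le_of_forall_exists_mul_sq [Finite G] (H : Subgroup G) (c g : G) (hc : c ^ 2 = 1)
    (h8 : ∀ x : G, x ^ 8 ∈ H)
    (h : ∀ x : G, ∃ k ∈ zpowers c ⊔ zpowers g ⊔ H, ∃ y, x = k * y ^ 2) :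
    Nat.card G ≤ 16 * Nat.card H := by
  have hcard : ∀ (x : G) (n : ℕ), 0 < n → x ^ n ∈ H → ∀ y ∈ zpowers x,
      ∃ (a : Fin n), ∃ k ∈ H, y = x ^ (a : ℕ) * k := by
    rintro x n hn hx y ⟨j, rfl⟩
    refine ⟨⟨(j % n).toNat, ?_⟩, (x ^ n) ^ (j / n), Subgroup.zpow_mem _ hx _, ?_⟩
    · have := Int.emod_lt_of_pos j (b := n) (by omega)
      have := Int.emod_nonneg j (b := n) (by omega)
      omega
    · dsimp only
      rw [← zpow_natCast, Int.toNat_of_nonneg (Int.emod_nonneg j (by omega)), ← zpow_natCast,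
        ← zpow_mul, ← zpow_add, Int.emod_add_mul_ediv]
  have htop : ∀ x : G, ∃ k ∈ zpowers c ⊔ zpowers g ⊔ H, x = k := by
    intro x
    obtain ⟨k1, hk1, y1, rfl⟩ := h x
    obtain ⟨k2, hk2, y2, rfl⟩ := h y1
    obtain ⟨k3, hk3, y3, rfl⟩ := h y2
    refine ⟨_, ?_, rfl⟩
    have h1 : k1 * (k2 * (k3 * y3 ^ 2) ^ 2) ^ 2 = k1 * k2 ^ 2 * k3 ^ 4 * y3 ^ 8 := by
      simp only [mul_pow, ← pow_mul, mul_assoc, Nat.reduceMul]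
    rw [h1]
    exact mul_mem (mul_mem (mul_mem hk1 (pow_mem hk2 _)) (pow_mem hk3 _))
      (Subgroup.mem_sup_right (h8 _))
  have : Nat.card (Fin 2 × Fin 8 × H) = 16 * Nat.card H := by simp [Nat.card_prod, ← mul_assoc]
  rw [← this]
  refine Nat.card_le_card_of_surjective
    (fun x : Fin 2 × Fin 8 × H => c ^ (x.1 : ℕ) * g ^ (x.2.1 : ℕ) * (x.2.2 : G)) fun x => ?_
  obtain ⟨k, hk, rfl⟩ := htop x
  obtain ⟨y, hy, z, hz, rfl⟩ := Subgroup.mem_sup.1 hk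
  obtain ⟨u, hu, v, hv, rfl⟩ := Subgroup.mem_sup.1 hy
  obtain ⟨a, k1, hk1, rfl⟩ := hcard c 2 (by omega) (by rw [hc]; exact one_mem _) u hu
  obtain ⟨b, k2, hk2, rfl⟩ := hcard g 8 (by omega) (h8 g) v hv
  refine ⟨(a, b, ⟨k1 * k2 * z, mul_mem (mul_mem hk1 hk2) hz⟩), ?_⟩
  dsimp only
  simp only [mul_assoc, mul_left_comm]

instance hasEnoughRootsOfUnity_int_two : HasEnoughRootsOfUnity ℤ 2 where
  prim := ⟨-1, IsPrimitiveRoot.mk_of_lt _ two_pos (by norm_num) fun l h0 h2 => by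
    obtain rfl : l = 1 := by omega
    norm_num⟩
  cyc := inferInstance

lemma exists_mem_mul_sq_of_forall_hom [Finite G] (H : Subgroup G) (z : G)
    (h : ∀ φ : G →* ℤˣ, (∀ x ∈ H, φ x = 1) → φ z = 1) : ∃ x ∈ H, ∃ y, z = x * y ^ 2 := by
  set K := H ⊔ (powMonoidHom 2 : G →* G).range with hK
  suffices hz : z ∈ K by
    obtain ⟨x, hx, w, ⟨y, rfl⟩, rfl⟩ := Subgroup.mem_sup.1 hz
    exact ⟨x, hx, y, rfl⟩
  by_contra hz
  have hexp : Monoid.exponent (G ⧸ K) ∣ 2 := by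
    refine Monoid.exponent_dvd_of_forall_pow_eq_one fun x => ?_
    induction x using QuotientGroup.induction_on with
    | H x =>
      rw [← QuotientGroup.mk_pow, QuotientGroup.eq_one_iff]
      exact Subgroup.mem_sup_right ⟨x, rfl⟩
  have := HasEnoughRootsOfUnity.of_dvd ℤ hexp
  obtain ⟨φ, hφ⟩ := CommGroup.exists_apply_ne_one_of_hasEnoughRootsOfUnity (G ⧸ K) ℤ
    (a := (QuotientGroup.mk z : G ⧸ K)) (by rwa [Ne, QuotientGroup.eq_one_iff])
  refine hφ (h (φ.comp (QuotientGroup.mk' K)) fun x hx => ?_)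
  rw [MonoidHom.comp_apply, QuotientGroup.mk'_apply,
    (QuotientGroup.eq_one_iff x).2 (Subgroup.mem_sup_left hx), map_one]

end AbelianGroups

section RootsOfUnity

variable {M : Type*} [Field M] [CharZero M]

lemma algEquiv_pow_apply_primitiveRoot {n k : ℕ} [NeZero n] (hk : ∀ u : (ZMod n)ˣ, u ^ k = 1)
    {ω : M} (hω : IsPrimitiveRoot ω n) (σ : Gal(M/ℚ)) : (σ ^ k) ω = ω := by
  have h := IsPrimitiveRoot.autToPow_spec ℚ hω (σ ^ k)
  rw [map_pow, hk] at h
  rw [← h]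
  rcases Nat.lt_or_ge 1 n with h1 | h1
  · have : Fact (1 < n) := ⟨h1⟩
    rw [Units.val_one, ZMod.val_one, pow_one]
  · obtain rfl : n = 1 := le_antisymm h1 (NeZero.pos n)
    simp [IsPrimitiveRoot.one_right_iff.1 hω]

lemma algEquiv_apply_of_forall_pow {ζ : M} (h0 : ζ ≠ 0) (σ : Gal(M/ℚ)) (A : Set ℕ)
    (h : ∀ a ∈ A, σ (ζ ^ a) = ζ ^ a) (hA : ∀ q : ℕ, q.Prime → ∃ a ∈ A, ¬ q ∣ a) : σ ζ = ζ := by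
  have h1 : ∀ a ∈ A, orderOf (σ ζ / ζ) ∣ a := fun a ha => by
    rw [orderOf_dvd_iff_pow_eq_one, div_pow, ← map_pow, h a ha, div_self (pow_ne_zero _ h0)]
  have h2 : orderOf (σ ζ / ζ) = 1 := by
    by_contra h2
    obtain ⟨q, hq, hqd⟩ := Nat.exists_prime_and_dvd h2
    obtain ⟨a, ha, hqa⟩ := hA q hq
    exact hqa (hqd.trans (h1 a ha))
  rw [orderOf_eq_one_iff, div_eq_one_iff_eq h0] at h2
  exact h2

end RootsOfUnity

lemma exists_algEquiv_complexConj {M : Type*} [Field M] [NumberField M] [IsGalois ℚ M] :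
    ∃ c : Gal(M/ℚ), c ^ 2 = 1 ∧ ∀ ω : M, ω ^ 2 = -1 → c ω ≠ ω := by
  obtain ⟨φ⟩ : Nonempty (M →+* ℂ) := inferInstance
  obtain ⟨σ, hσ⟩ := ComplexEmbedding.exists_comp_symm_eq_of_comp_eq (k := ℚ) φ
    ((starRingEnd ℂ).comp φ) (RingHom.ext_rat _ _)
  have h1 : ∀ x, φ (σ.symm x) = starRingEnd ℂ (φ x) := fun x => RingHom.congr_fun hσ x
  refine ⟨σ.symm, ?_, fun ω hω h => ?_⟩
  · ext x
    apply φ.injective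
    rw [pow_two, mul_apply, h1, h1]
    simp
  · have h2 := h1 ω
    rw [h] at h2
    have h3 : (φ ω) ^ 2 = -1 := by rw [← map_pow, hω]; simp
    have h4 := Complex.conj_eq_iff_real.1 h2.symm
    obtain ⟨r, hr⟩ := h4
    rw [hr] at h3
    have h5 : r ^ 2 = -1 := mod_cast h3
    nlinarith [sq_nonneg r]

section KroneckerWeber

open NumberField IntermediateField

variable {M : Type*} [Field M] [NumberField M]

lemma inertia_apply_eq_of_pow_eq_one {p : ℕ} {P : Ideal (𝓞 M)} [P.IsPrime]
    [P.LiesOver (span {(p : ℤ)})] {σ : Gal(M/ℚ)} (hσ : σ ∈ P.inertia Gal(M/ℚ)) {ω : M}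
    {k : ℕ} (h : ω ^ k = 1) (hk : ¬ p ∣ k) : σ ω = ω := by
  have hk0 : k ≠ 0 := fun h0 => hk (h0 ▸ dvd_zero p)
  have hitg : IsIntegral ℤ ω := IsIntegral.of_pow (Nat.pos_of_ne_zero hk0) (h ▸ isIntegral_one)
  have h1 : (⟨ω, hitg⟩ : 𝓞 M) ^ k = 1 := RingOfIntegers.ext h
  have := smul_eq_of_mem_inertia_of_pow_eq_one hσ h1
    (fun h => hk ((natCast_mem_iff_of_liesOver (P := P)).1 h))
  exact congrArg (algebraMap (𝓞 M) M) this

lemma algEquiv_pow_apply_of_apply_eq {σ : M ≃ₐ[ℚ] M} {x : M} (h : σ x = x) (n : ℕ) :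
    (σ ^ n) x = x := by
  have : σ ∈ MulAction.stabilizer (M ≃ₐ[ℚ] M) x := h
  exact pow_mem this n

lemma ZMod.units_thirtyTwo_pow_eight (u : (ZMod 32)ˣ) : u ^ 8 = 1 := by
  have h1 := ZMod.val_coe_unit_coprime u
  have h2 : (u : ZMod 32) = ((u : ZMod 32).val : ZMod 32) := (ZMod.natCast_zmod_val _).symm
  set a := (u : ZMod 32).val
  have h3 : Odd a := by
    rw [show (32 : ℕ) = 2 ^ 5 by norm_num] at h1
    exact Nat.coprime_two_right.1 (Nat.Coprime.coprime_dvd_right (by norm_num) h1)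
  obtain ⟨k, hk⟩ := h3
  obtain ⟨t, ht⟩ := (Nat.even_mul_succ_self k).two_dvd
  have h4 : a ^ 8 = 32 * (t + 12 * t ^ 2 + 64 * t ^ 3 + 128 * t ^ 4) + 1 := by
    have : a ^ 2 = 8 * t + 1 := by rw [hk]; nlinarith
    rw [show a ^ 8 = (a ^ 2) ^ 4 by ring, this]; ring
  ext
  rw [Units.val_pow_eq_pow_val, h2, ← Nat.cast_pow, h4]
  push_cast
  rw [show (32 : ZMod 32) = 0 from rfl]
  simp

lemma Squarefree.eq_of_forall_odd_prime_not_dvd {d : ℤ} (hd : Squarefree d)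
    (h : ∀ q : ℕ, q.Prime → q ≠ 2 → ¬ (q : ℤ) ∣ d) : d = 1 ∨ d = -1 ∨ d = 2 ∨ d = -2 := by
  have h1 := Nat.prod_primeFactors_of_squarefree (Int.squarefree_natAbs.2 hd)
  have h2 : d.natAbs.primeFactors ⊆ {2} := by
    intro q hq
    rw [mem_singleton]
    by_contra hq2
    exact h q (Nat.prime_of_mem_primeFactors hq) hq2
      (Int.natCast_dvd.2 (Nat.dvd_of_mem_primeFactors hq))
  rcases subset_singleton_iff.1 h2 with h3 | h3
  · rw [h3, prod_empty] at h1; omega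
  · rw [h3, prod_singleton] at h1; omega

lemma exists_primesOver_family : ∃ P : ℕ → Ideal (𝓞 M), ∀ q, q.Prime →
    (P q).IsPrime ∧ (P q).LiesOver (span {(q : ℤ)}) := by
  have (q : ℕ) : ∃ P : Ideal (𝓞 M), q.Prime → P.IsPrime ∧ P.LiesOver (span {(q : ℤ)}) := by
    by_cases hq : q.Prime
    · have : (span {(q : ℤ)}).IsPrime := (span_singleton_prime
        (mod_cast hq.ne_zero)).2 (Nat.prime_iff_prime_int.1 hq)
      obtain ⟨⟨P, h1, h2⟩⟩ := (span {(q : ℤ)}).nonempty_primesOver (S := 𝓞 M)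
      exact ⟨P, fun _ => ⟨h1, h2⟩⟩
    · exact ⟨⊥, fun h => absurd h hq⟩
  choose P hP using this
  exact ⟨P, hP⟩

set_option maxHeartbeats 1000000 in
theorem card_gal_le_of_inertia [IsGalois ℚ M] (hc : ∀ σ τ : Gal(M/ℚ), σ * τ = τ * σ)
    {S : Finset ℕ} (hS : ∀ p ∈ S, p.Prime ∧ p ≠ 2) {ζ : M}
    (hζ : IsPrimitiveRoot ζ (32 * ∏ p ∈ S, p))
    (h2 : ∀ (σ : Gal(M/ℚ)) (k : ℕ), 8 ∣ k → (σ ^ k) ζ = ζ → σ ^ k = 1)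
    (h3 : ∀ q : ℕ, q.Prime → q ≠ 2 → q ∉ S → ∀ P : Ideal (𝓞 M), P.IsPrime →
      P.LiesOver (span {(q : ℤ)}) → ∀ σ ∈ P.inertia Gal(M/ℚ), σ = 1) :
    Nat.card Gal(M/ℚ) ≤ 16 * ∏ p ∈ S, (p - 1) := by
  let : CommGroup Gal(M/ℚ) := { (inferInstance : Group Gal(M/ℚ)) with mul_comm := hc }
  obtain ⟨P, hP⟩ := exists_primesOver_family (M := M)
  set m := ∏ p ∈ S, p with hm
  have hm0 : 0 < m := prod_pos fun p hp => (hS p hp).1.pos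
  set r : ℕ → ℕ := fun p => ∏ q ∈ S.erase p, q with hr
  have hmr : ∀ p ∈ S, m = p * r p := fun p hp => (mul_prod_erase S _ hp).symm
  have hpr : ∀ p ∈ S, ¬ p ∣ 32 * r p := by
    intro p hp h
    rcases (hS p hp).1.dvd_mul.1 h with h | h
    · rw [show 32 = 2 ^ 5 by norm_num] at h
      exact (hS p hp).2 ((Nat.prime_dvd_prime_iff_eq (hS p hp).1 Nat.prime_two).1
        ((hS p hp).1.dvd_of_dvd_pow h))
    · obtain ⟨q, hq, hpq⟩ := ((hS p hp).1.prime.dvd_finsetProd_iff _).1 h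
      rw [mem_erase] at hq
      exact hq.1 ((Nat.prime_dvd_prime_iff_eq (hS p hp).1 (hS q hq.2).1).1 hpq).symm
  have hζ0 : ζ ≠ 0 := hζ.ne_zero (by positivity)
  have hζp : ∀ p ∈ S, IsPrimitiveRoot (ζ ^ (32 * r p)) p := fun p hp =>
    hζ.pow (by positivity) (by rw [hmr p hp]; ring)
  have hζ32 : IsPrimitiveRoot (ζ ^ m) 32 := hζ.pow (by positivity) (by ring)
  have hpow : ∀ p ∈ S, ∀ σ ∈ (P p).inertia Gal(M/ℚ), σ ^ (8 * (p - 1)) = 1 := by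
    intro p hp σ hσ
    obtain ⟨_, _⟩ := hP p (hS p hp).1
    have : Fact p.Prime := ⟨(hS p hp).1⟩
    refine h2 σ _ (dvd_mul_right _ _) (algEquiv_apply_of_forall_pow hζ0 _ {p, 32 * r p} ?_ ?_)
    · rintro a (rfl | rfl)
      · refine algEquiv_pow_apply_of_apply_eq ?_ _
        refine inertia_apply_eq_of_pow_eq_one (k := 32 * r a) hσ ?_ (hpr a hp)
        rw [← pow_mul, show a * (32 * r a) = 32 * (a * r a) by ring, ← hmr a hp, hζ.pow_eq_one]
      · rw [mul_comm, pow_mul]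
        refine algEquiv_pow_apply_of_apply_eq ?_ _
        exact algEquiv_pow_apply_primitiveRoot (ZMod.units_pow_card_sub_one_eq_one p) (hζp p hp) σ
    · intro q hq
      by_cases hqp : q ∣ p
      · obtain rfl := (Nat.prime_dvd_prime_iff_eq hq (hS p hp).1).1 hqp
        exact ⟨_, Or.inr rfl, hpr q hp⟩
      · exact ⟨_, Or.inl rfl, hqp⟩
  have htame := fun p (hp : p ∈ S) => by
    obtain ⟨_, _⟩ := hP p (hS p hp).1
    refine inertia_of_tame (P := P p) (hS p hp).1 hc (hpow p hp) ?_ (hζp p hp)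
    intro h
    rcases (hS p hp).1.dvd_mul.1 h with h | h
    · rw [show 8 = 2 ^ 3 by norm_num] at h
      exact (hS p hp).2 ((Nat.prime_dvd_prime_iff_eq (hS p hp).1 Nat.prime_two).1
        ((hS p hp).1.dvd_of_dvd_pow h))
    · have := (hS p hp).1.two_le
      exact absurd (Nat.le_of_dvd (by omega) h) (by omega)
  set H : Subgroup Gal(M/ℚ) := S.sup fun p => (P p).inertia Gal(M/ℚ) with hH
  have hIH : ∀ p ∈ S, (P p).inertia Gal(M/ℚ) ≤ H := fun p hp =>
    le_sup (f := fun p => (P p).inertia Gal(M/ℚ)) hp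
  have h8 : ∀ g : Gal(M/ℚ), g ^ 8 ∈ H := by
    intro g
    have : ∀ p, ∃ f : Gal(M/ℚ), p ∈ S → f ∈ (P p).inertia Gal(M/ℚ) ∧
        f (ζ ^ (32 * r p)) = g (ζ ^ (32 * r p)) := fun p => by
      by_cases hp : p ∈ S
      · obtain ⟨f, hf1, hf2⟩ := (htame p hp).2.2 g
        exact ⟨f, fun _ => ⟨hf1, hf2⟩⟩
      · exact ⟨1, fun h => absurd h hp⟩
    choose f hf using this
    set h := ∏ p ∈ S, f p with hh
    have hhH : h ∈ H := Subgroup.prod_mem _ fun p hp => hIH p hp (hf p hp).1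
    have hhp : ∀ p ∈ S, h (ζ ^ (32 * r p)) = g (ζ ^ (32 * r p)) := by
      intro p hp
      have h4 : ∏ q ∈ S.erase p, f q ∈ MulAction.stabilizer Gal(M/ℚ) (ζ ^ (32 * r p)) := by
        refine Subgroup.prod_mem _ fun q hq => ?_
        rw [mem_erase] at hq
        obtain ⟨_, _⟩ := hP q (hS q hq.2).1
        exact inertia_apply_eq_of_pow_eq_one (hf q hq.2).1 (hζp p hp).pow_eq_one
          (fun h => hq.1 ((Nat.prime_dvd_prime_iff_eq (hS q hq.2).1 (hS p hp).1).1 h))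
      have h4 : (∏ q ∈ S.erase p, f q) (ζ ^ (32 * r p)) = ζ ^ (32 * r p) := h4
      rw [hh, ← mul_prod_erase S _ hp, mul_apply, h4, (hf p hp).2]
    have h5 : (h⁻¹ * g) ^ 8 = 1 := by
      refine h2 _ 8 dvd_rfl (algEquiv_apply_of_forall_pow hζ0 _
        (insert m ((fun p => 32 * r p) '' S)) ?_ ?_)
      · rintro a (rfl | ⟨p, hp, rfl⟩)
        · exact algEquiv_pow_apply_primitiveRoot ZMod.units_thirtyTwo_pow_eight hζ32 _
        · refine algEquiv_pow_apply_of_apply_eq ?_ _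
          rw [mul_apply, ← hhp p hp, ← mul_apply, inv_mul_cancel]
          rfl
      · intro q hq
        by_cases hqm : q ∣ m
        · obtain ⟨p, hp, hqp⟩ := (hq.prime.dvd_finsetProd_iff _).1 hqm
          obtain rfl := (Nat.prime_dvd_prime_iff_eq hq (hS p hp).1).1 hqp
          exact ⟨_, Or.inr ⟨q, hp, rfl⟩, hpr q hp⟩
        · exact ⟨_, Or.inl rfl, hqm⟩
    rw [mul_pow, inv_pow, inv_mul_eq_one] at h5
    exact h5 ▸ pow_mem hhH 8
  set w := ζ ^ (4 * m) with hw
  have hw8 : IsPrimitiveRoot w 8 := hζ.pow (by positivity) (by ring)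
  have hw4 : w ^ 4 = -1 := by
    have h1 : w ^ 4 * w ^ 4 = 1 := by rw [← pow_add, hw8.pow_eq_one]
    rcases mul_self_eq_one_iff.1 h1 with h | h
    · exact absurd h (hw8.pow_ne_one_of_pos_of_lt (by norm_num) (by norm_num))
    · exact h
  set i := w ^ 2 with hi
  set s := w + w ^ 7 with hs
  have hi2 : i ^ 2 = -1 := by rw [hi, ← hw4]; ring
  have hs2 : s ^ 2 = 2 := by
    have : s ^ 2 = w ^ 2 + 2 * (w ^ 4) ^ 2 + (w ^ 4) ^ 3 * w ^ 2 := by rw [hs]; ring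
    rw [this, hw4]; ring
  have key : ∀ z : Gal(M/ℚ), z i = i → z s = s → ∃ x ∈ H, ∃ y, z = x * y ^ 2 := by
    intro z hzi hzs
    refine exists_mem_mul_sq_of_forall_hom H z fun φ hφ => ?_
    by_contra hne
    obtain ⟨α, d, hα, hd, hfix, hzα⟩ := exists_sqrt_of_hom hc φ hne
    have hd' := hd.eq_of_forall_odd_prime_not_dvd fun q hq hq2 => by
      obtain ⟨_, _⟩ := hP q hq
      refine not_squarefree_dvd_of_inertia_fixes (P := P q) hq hα (fun σ hσ => ?_) hd
      by_cases hqS : q ∈ S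
      · exact hfix σ (hφ σ (hIH q hqS hσ))
      · rw [h3 q hq hq2 hqS _ inferInstance inferInstance σ hσ]; rfl
    have aux : ∀ j : M, z j = j → α ^ 2 ≠ j ^ 2 := by
      intro j hj h
      rcases sq_eq_sq_iff_eq_or_eq_neg.1 h with rfl | rfl
      · exact hzα hj
      · exact hzα (by rw [map_neg, hj])
    rcases hd' with rfl | rfl | rfl | rfl
    · exact aux 1 (map_one z) (by rw [hα]; simp)
    · exact aux i hzi (by rw [hα, hi2]; simp)
    · exact aux s hzs (by rw [hα, hs2]; simp)
    · exact aux (i * s) (by rw [map_mul, hzi, hzs]) (by rw [hα, mul_pow, hs2, hi2]; simp)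
  have hneg : ∀ (σ : Gal(M/ℚ)) (j : M) (e : ℤ), j ^ 2 = e → σ j = j ∨ σ j = -j := by
    intro σ j e hj
    refine sq_eq_sq_iff_eq_or_eq_neg.1 ?_
    rw [← map_pow, hj, map_intCast]
  obtain ⟨c, hc2, hci⟩ := exists_algEquiv_complexConj (M := M)
  have hci : c i = -i := (hneg c i (-1) (by simpa using hi2)).resolve_left (hci i hi2)
  obtain ⟨g, hg⟩ : ∃ g : Gal(M/ℚ), ∀ x : Gal(M/ℚ), x i = i → ∃ b : ℕ,
      (x * g ^ b) i = i ∧ (x * g ^ b) s = s := by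
    by_cases h : ∃ g : Gal(M/ℚ), g i = i ∧ g s = -s
    · obtain ⟨g, hgi, hgs⟩ := h
      refine ⟨g, fun x hx => ?_⟩
      rcases hneg x s 2 (by simpa using hs2) with hxs | hxs
      · exact ⟨0, by simpa using hx, by simpa using hxs⟩
      · refine ⟨1, ?_, ?_⟩
        · rw [pow_one, mul_apply, hgi, hx]
        · rw [pow_one, mul_apply, hgs, map_neg, hxs, neg_neg]
    · push Not at h
      refine ⟨1, fun x hx => ⟨0, by simpa using hx, ?_⟩⟩
      simpa using (hneg x s 2 (by simpa using hs2)).resolve_right (h x hx)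
  have hle := card_le_of_forall_exists_mul_sq H c g hc2 h8 fun x => by
    obtain ⟨a, ha⟩ : ∃ a : ℕ, (x * c ^ a) i = i := by
      rcases hneg x i (-1) (by simpa using hi2) with h | h
      · exact ⟨0, by simpa using h⟩
      · exact ⟨1, by rw [pow_one, mul_apply, hci, map_neg, h, neg_neg]⟩
    obtain ⟨b, hb1, hb2⟩ := hg _ ha
    obtain ⟨k, hk, y, hy⟩ := key _ hb1 hb2
    refine ⟨(c ^ a)⁻¹ * (g ^ b)⁻¹ * k, ?_, y, ?_⟩
    · exact mul_mem (Subgroup.mem_sup_left (mul_mem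
        (Subgroup.mem_sup_left (inv_mem (pow_mem (mem_zpowers c) _)))
        (Subgroup.mem_sup_right (inv_mem (pow_mem (mem_zpowers g) _)))))
        (Subgroup.mem_sup_right hk)
    · rw [mul_assoc, ← hy, mul_comm x, mul_assoc]
      simp [mul_comm]
  refine hle.trans (Nat.mul_le_mul_left _ ((card_finset_sup_le _ _).trans ?_))
  exact prod_le_prod' fun p hp => (htame p hp).1

end KroneckerWeber

section Discriminants

open NumberField Polynomial

lemma natCast_mem_differentIdeal_of_pow_eq_one {F E : Type*} [Field F] [NumberField F] [Field E]
    [NumberField E] [Algebra F E] {ζ : E} {m : ℕ} (hm : m ≠ 0) (h1 : ζ ^ m = 1)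
    (htop : adjoin F {ζ} = ⊤) : (m : 𝓞 E) ∈ differentIdeal (𝓞 F) (𝓞 E) := by
  have hitg : IsIntegral ℤ ζ := IsIntegral.of_pow (Nat.pos_of_ne_zero hm) (h1 ▸ isIntegral_one)
  set z : 𝓞 E := ⟨ζ, hitg⟩ with hz
  have hz1 : z ^ m = 1 := RingOfIntegers.ext h1
  have halg : Algebra.adjoin F {algebraMap (𝓞 E) E z} = ⊤ := by
    have : IsIntegral F ζ := hitg.tower_top
    change Algebra.adjoin F {ζ} = ⊤
    rw [← adjoin_simple_toSubalgebra_of_isAlgebraic this.isAlgebraic, htop, top_toSubalgebra]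
  have h2 := aeval_derivative_mem_differentIdeal (𝓞 F) F E z halg
  have hz2 : IsIntegral (𝓞 F) z := Algebra.IsIntegral.isIntegral z
  obtain ⟨g, hg⟩ : minpoly (𝓞 F) z ∣ X ^ m - 1 := minpoly.isIntegrallyClosed_dvd hz2 (by simp [hz1])
  have h3 := congrArg (fun f => aeval z (derivative f)) hg
  simp only [derivative_mul, map_add, map_mul, minpoly.aeval, zero_mul, add_zero, derivative_sub,
    derivative_X_pow, derivative_one, sub_zero, map_natCast, aeval_X_pow] at h3
  have h4 : (m : 𝓞 E) = (m : 𝓞 E) * z ^ (m - 1) * z := by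
    rw [mul_assoc, pow_sub_one_mul hm, hz1, mul_one]
  rw [h4, h3]
  exact mul_mem_right _ _ (mul_mem_right _ _ h2)

lemma padicValNat_discr_of_adjoin_eq_top {F E : Type*} [Field F] [NumberField F] [Field E]
    [NumberField E] [Algebra F E] {ζ : E} {m : ℕ} (h1 : ζ ^ m = 1)
    (htop : adjoin F {ζ} = ⊤) {p : ℕ} (hp : p.Prime) (hpm : ¬ p ∣ m) :
    padicValNat p (discr E).natAbs = finrank F E * padicValNat p (discr F).natAbs := by
  have : Fact p.Prime := ⟨hp⟩
  have hm : m ≠ 0 := fun h => hpm (h ▸ dvd_zero p)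
  have h2 := natCast_mem_differentIdeal_of_pow_eq_one hm h1 htop
  have h3 : absNorm (differentIdeal (𝓞 F) (𝓞 E)) ∣ m ^ finrank ℤ (𝓞 E) := by
    have := absNorm_dvd_norm_of_mem h2
    have h4 : Algebra.norm ℤ (m : 𝓞 E) = (m : ℤ) ^ finrank ℤ (𝓞 E) := by
      rw [← Algebra.norm_algebraMap]; simp
    rw [h4] at this
    exact_mod_cast this
  have h4 : ¬ p ∣ absNorm (differentIdeal (𝓞 F) (𝓞 E)) := fun h =>
    hpm (hp.dvd_of_dvd_pow (h.trans h3))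
  rw [natAbs_discr_eq_absNorm_differentIdeal_mul_natAbs_discr_pow F (𝓞 F) E (𝓞 E),
    padicValNat.mul, padicValNat.pow, padicValNat.eq_zero_of_not_dvd h4, zero_add]
  · rintro h
    exact h4 (h ▸ dvd_zero p)
  · exact pow_ne_zero _ (Int.natAbs_ne_zero.2 (discr_ne_zero F))

end Discriminants

section TotalRamification

open NumberField

lemma Ideal.ramificationIdx_le_finrank_of_isDomain {R S : Type*} [CommRing R] [CommRing S] [Algebra R S]
    [IsDomain R] [Module.Finite R S] [Flat R S] (Q : Ideal S) [Q.IsPrime] :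
    Q.ramificationIdx R ≤ finrank R S := by
  have : Finite ((Q.under R).primesOver S) := Algebra.QuasiFinite.finite_primesOver _
  let := Fintype.ofFinite ((Q.under R).primesOver S)
  rw [← sum_ramification_inertia_eq_finrank (Q.under R)]
  refine le_trans ?_ (single_le_sum
    (f := fun q : (Q.under R).primesOver S => q.1.ramificationIdx R * q.1.inertiaDeg R)
    (fun _ _ => Nat.zero_le _) (mem_univ ⟨Q, inferInstance, inferInstance⟩))
  exact Nat.le_mul_of_pos_right _ (inertiaDeg_pos _ _)

lemma dvd_absNorm_of_liesOver {K : Type*} [Field K] [NumberField K] {p : ℕ} (I : Ideal (𝓞 K))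
    [I.IsPrime] [I.LiesOver (span {(p : ℤ)})] : p ∣ absNorm I := by
  rw [← natCast_mem_iff_of_liesOver (P := I)]
  exact absNorm_mem I

lemma padicValNat_discr_add_one_of_le_cyclotomic {F E : Type*} [Field F] [NumberField F] [Field E]
    [NumberField E] [Algebra F E] {p : ℕ} (hp : p.Prime)
    [IsCyclotomicExtension {p} ℚ E] :
    padicValNat p (discr F).natAbs + 1 = finrank ℚ F := by
  have : Fact p.Prime := ⟨hp⟩
  have h3 := hp.two_le
  obtain ⟨P', hP'⟩ := exists_primesOver_family (M := E)
  obtain ⟨_, _⟩ := hP' p hp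
  set Q := P' p
  set P := Q.under (𝓞 F)
  have : P.LiesOver (span {(p : ℤ)}) := LiesOver.tower_bot Q P _
  have hQ0 : Q ≠ ⊥ := ne_bot_of_liesOver_span hp.ne_zero
  have hP0 : P ≠ ⊥ := ne_bot_of_liesOver_span hp.ne_zero
  have : (span {(p : ℤ)}).IsPrime :=
    (span_singleton_prime (mod_cast hp.ne_zero)).2 (Nat.prime_iff_prime_int.1 hp)
  have : (span {(p : ℤ)}).IsMaximal := IsPrime.isMaximal this (by simpa using hp.ne_zero)
  have : P.IsMaximal := IsPrime.isMaximal inferInstance hP0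
  have hdE : (discr E).natAbs = p ^ (p - 2) := by
    rw [IsCyclotomicExtension.Rat.discr_prime p E, Int.natAbs_mul, Int.natAbs_pow, Int.natAbs_pow]
    simp
  have hE : finrank ℚ E = p - 1 := by
    rw [IsCyclotomicExtension.finrank E (Polynomial.cyclotomic.irreducible_rat hp.pos),
      Nat.totient_prime hp]
  have htower := ramificationIdx_tower (R := ℤ) P Q
  rw [IsCyclotomicExtension.Rat.ramificationIdx_eq_of_prime p E Q] at htower
  have hF1 : P.ramificationIdx ℤ ≤ finrank ℚ F := by
    rw [← RingOfIntegers.rank]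
    exact ramificationIdx_le_finrank_of_isDomain P
  have hE1 : Q.ramificationIdx (𝓞 F) ≤ finrank F E := by
    rw [IsFractionRing.finrank_eq (𝓞 F) F (𝓞 E) E]
    exact ramificationIdx_le_finrank_of_isDomain Q
  have hFE := finrank_mul_finrank ℚ F E
  have hpos : 0 < Q.ramificationIdx (𝓞 F) := Nat.pos_of_ne_zero fun h => by rw [h] at htower; omega
  have hpos1 : 0 < P.ramificationIdx ℤ := Nat.pos_of_ne_zero fun h => by rw [h] at htower; omega
  have hF2 : P.ramificationIdx ℤ = finrank ℚ F := by
    refine le_antisymm hF1 ?_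
    by_contra! h
    have := Nat.mul_lt_mul_of_lt_of_le h hE1 finrank_pos
    omega
  have hE2 : Q.ramificationIdx (𝓞 F) = finrank F E := by
    rw [hE, htower, hF2] at hFE
    exact (Nat.eq_of_mul_eq_mul_left finrank_pos hFE).symm
  have hmap1 : (span {(p : ℤ)}).map (algebraMap ℤ (𝓞 F)) ≠ ⊥ := by
    rw [Ne, Ideal.map_eq_bot_iff_of_injective (FaithfulSMul.algebraMap_injective _ _)]
    simpa using hp.ne_zero
  have hmap2 : P.map (algebraMap (𝓞 F) (𝓞 E)) ≠ ⊥ := by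
    rwa [Ne, Ideal.map_eq_bot_iff_of_injective (FaithfulSMul.algebraMap_injective _ _)]
  have hd1 := pow_sub_one_dvd_differentIdeal ℤ (p := span {(p : ℤ)}) P
    (P.ramificationIdx ℤ) (by simpa using hp.ne_zero) (by
      rw [IsDedekindDomain.ramificationIdx_eq_multiplicity (span {(p : ℤ)}) P hmap1]
      exact pow_multiplicity_dvd _ _)
  have hd2 := pow_sub_one_dvd_differentIdeal (𝓞 F) (p := P) Q (Q.ramificationIdx (𝓞 F)) hP0 (by
      rw [IsDedekindDomain.ramificationIdx_eq_multiplicity P Q hmap2]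
      exact pow_multiplicity_dvd _ _)
  have hn1 := absNorm_dvd_absNorm_of_le (dvd_iff_le.1 hd1)
  have hn2 := absNorm_dvd_absNorm_of_le (dvd_iff_le.1 hd2)
  rw [map_pow] at hn1 hn2
  rw [absNorm_differentIdeal F] at hn1
  have hv := natAbs_discr_eq_absNorm_differentIdeal_mul_natAbs_discr_pow F (𝓞 F) E (𝓞 E)
  have hd0 : (discr F).natAbs ≠ 0 := Int.natAbs_ne_zero.2 (discr_ne_zero F)
  have hD0 : absNorm (differentIdeal (𝓞 F) (𝓞 E)) ≠ 0 := by
    intro h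
    rw [h, zero_mul, hdE] at hv
    exact pow_ne_zero _ hp.ne_zero hv
  have hv1 := (padicValNat_dvd_iff_le hd0).1 
    ((pow_dvd_pow_of_dvd (dvd_absNorm_of_liesOver (p := p) P) _).trans hn1)
  have hv2 := (padicValNat_dvd_iff_le hD0).1 
    ((pow_dvd_pow_of_dvd (dvd_absNorm_of_liesOver (p := p) Q) _).trans hn2)
  have hv3 := congrArg (padicValNat p) hv
  rw [hdE, padicValNat.prime_pow, padicValNat.mul hD0 (pow_ne_zero _ hd0), padicValNat.pow]
    at hv3
  rw [hF2] at hv1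
  rw [hE2] at hv2
  have hpe : 0 < finrank ℚ F := finrank_pos
  have hpf : 0 < finrank F E := finrank_pos
  rw [hE] at hFE
  obtain ⟨e, he⟩ : ∃ e, finrank ℚ F = e + 1 := ⟨_, (Nat.succ_pred_eq_of_pos hpe).symm⟩
  obtain ⟨f, hf⟩ : ∃ f, finrank F E = f + 1 := ⟨_, (Nat.succ_pred_eq_of_pos hpf).symm⟩
  rw [he] at hv1 hFE ⊢
  rw [hf] at hv2 hv3 hFE
  rw [Nat.add_sub_cancel] at hv1 hv2
  set v := padicValNat p (discr F).natAbs
  have h4 : p - 1 = p - 2 + 1 := by omega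
  rw [← hFE, hv3] at h4
  have h5 : (f + 1) * v ≤ (f + 1) * e := by nlinarith
  have := Nat.le_of_mul_le_mul_left h5 (Nat.succ_pos f)
  omega

end TotalRamification

section CyclotomicCharacter


instance isAlgClosure_rat : IsAlgClosure ℚ Ω :=
  ⟨inferInstance, Subsingleton.elim (AlgebraicClosure.instAlgebra ℚ) DivisionRing.toRatAlgebra ▸
    AlgebraicClosure.isAlgebraic ℚ⟩

/-- A primitive `N`-th root of unity in the algebraic closure of `ℚ`. -/
noncomputable def cycRoot (N : ℕ) [NeZero N] : Ω :=
  (HasEnoughRootsOfUnity.exists_primitiveRoot Ω N).choose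

theorem isPrimitiveRoot_cycRoot (N : ℕ) [NeZero N] : IsPrimitiveRoot (cycRoot N) N :=
  (HasEnoughRootsOfUnity.exists_primitiveRoot Ω N).choose_spec

theorem cycRoot_pow_eq_pow_iff {N : ℕ} [NeZero N] {a b : ℕ} :
    cycRoot N ^ a = cycRoot N ^ b ↔ (a : ZMod N) = b := by
  have hζ := isPrimitiveRoot_cycRoot N
  have h : IsOfFinOrder (cycRoot N) :=
    isOfFinOrder_iff_pow_eq_one.2 ⟨N, NeZero.pos N, hζ.pow_eq_one⟩
  rw [h.pow_eq_pow_iff_modEq, ← hζ.eq_orderOf, ZMod.natCast_eq_natCast_iff]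

theorem cycRoot_pow_eq_self_iff {N : ℕ} [NeZero N] {a : ℕ} :
    cycRoot N ^ a = cycRoot N ↔ (a : ZMod N) = 1 := by
  simpa using cycRoot_pow_eq_pow_iff (N := N) (a := a) (b := 1)

/-- The mod `N` cyclotomic character of the absolute Galois group of `ℚ`. -/
noncomputable def cycChar (N : ℕ) [NeZero N] : Gal(Ω/ℚ) →* (ZMod N)ˣ :=
  (isPrimitiveRoot_cycRoot N).autToPow ℚ

/-- The `N`-th cyclotomic field inside the algebraic closure of `ℚ`. -/
noncomputable abbrev cycField (N : ℕ) [NeZero N] : IntermediateField ℚ Ω := adjoin ℚ {cycRoot N}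

theorem apply_eq_pow_cycChar {N : ℕ} [NeZero N] (σ : Gal(Ω/ℚ))
    {ω : Ω} (h : ω ^ N = 1) : σ ω = ω ^ (cycChar N σ : ZMod N).val := by
  obtain ⟨k, -, rfl⟩ := (isPrimitiveRoot_cycRoot N).eq_pow_of_pow_eq_one h
  rw [map_pow, ← (isPrimitiveRoot_cycRoot N).autToPow_spec ℚ σ, ← pow_mul, ← pow_mul, mul_comm]
  rfl

theorem mem_ker_cycChar {N : ℕ} [NeZero N] {σ : Gal(Ω/ℚ)} :
    σ ∈ (cycChar N).ker ↔ σ (cycRoot N) = cycRoot N := by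
  rw [mem_ker, apply_eq_pow_cycChar σ (isPrimitiveRoot_cycRoot N).pow_eq_one,
    cycRoot_pow_eq_self_iff, ZMod.natCast_zmod_val, Units.val_eq_one]

theorem ker_cycChar_le_of_dvd {n N : ℕ} [NeZero n] [NeZero N] (h : n ∣ N) :
    (cycChar N).ker ≤ (cycChar n).ker := by
  intro σ hσ
  rw [mem_ker_cycChar] at hσ ⊢
  obtain ⟨k, -, hk⟩ := (isPrimitiveRoot_cycRoot N).eq_pow_of_pow_eq_one
    (((isPrimitiveRoot_cycRoot n).pow_eq_one_iff_dvd N).2 h)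
  rw [← hk, map_pow, hσ]

theorem fixingSubgroup_cycField (N : ℕ) [NeZero N] :
    (cycField N).fixingSubgroup = (cycChar N).ker := by
  ext σ
  rw [mem_ker_cycChar, IntermediateField.mem_fixingSubgroup_iff]
  refine ⟨fun h ↦ h _ (mem_adjoin_simple_self ℚ _), fun h x hx ↦ ?_⟩
  have : cycField N ≤ fixedField (zpowers σ) := by
    rw [adjoin_le_iff, Set.singleton_subset_iff]
    rintro ⟨τ, k, rfl⟩
    exact (MulAction.stabilizer _ (cycRoot N)).zpow_mem (x := σ) h k
  exact this hx ⟨σ, mem_zpowers σ⟩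

theorem unitsMap_cycChar {n N : ℕ} [NeZero n] [NeZero N] (h : n ∣ N)
    (σ : Gal(Ω/ℚ)) : ZMod.unitsMap h (cycChar N σ) = cycChar n σ := by
  have hζ := isPrimitiveRoot_cycRoot n
  have h1 := apply_eq_pow_cycChar (N := N) σ ((hζ.pow_eq_one_iff_dvd N).2 h)
  rw [apply_eq_pow_cycChar σ hζ.pow_eq_one, cycRoot_pow_eq_pow_iff] at h1
  refine Units.ext ?_
  rw [ZMod.unitsMap_val]
  simpa [ZMod.natCast_val] using h1.symm

theorem cycChar_surjective (N : ℕ) [NeZero N] : Surjective (cycChar N) := by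
  intro u
  have hζ := isPrimitiveRoot_cycRoot N
  have hξ : IsPrimitiveRoot (cycRoot N ^ (u : ZMod N).val) N :=
    hζ.pow_of_coprime _ (ZMod.val_coe_unit_coprime u)
  have hconj : IsConjRoot ℚ (cycRoot N) (cycRoot N ^ (u : ZMod N).val) := by
    rw [IsConjRoot, ← Polynomial.cyclotomic_eq_minpoly_rat hζ (NeZero.pos N),
      ← Polynomial.cyclotomic_eq_minpoly_rat hξ (NeZero.pos N)]
  obtain ⟨σ, hσ⟩ := isConjRoot_iff_exists_algEquiv.1 hconj.symm
  refine ⟨σ, ?_⟩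
  change σ _ = _ at hσ
  rw [apply_eq_pow_cycChar σ hζ.pow_eq_one, cycRoot_pow_eq_pow_iff] at hσ
  exact Units.ext (by simpa using hσ)

variable {ι : Type} [Fintype ι] {m : ι → ℕ} [∀ i, NeZero (m i)]

theorem exists_forall_cycChar_eq (hm : Pairwise (onFun Nat.Coprime m))
    (u : Π i, (ZMod (m i))ˣ) : ∃ σ, ∀ i, cycChar (m i) σ = u i := by
  have : NeZero (∏ i, m i) := ⟨prod_ne_zero_iff.2 fun i _ ↦ NeZero.ne _⟩
  obtain ⟨σ, hσ⟩ := cycChar_surjective (∏ i, m i)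
    ((Units.mapEquiv (ZMod.prodEquivPi m hm).toMulEquiv).symm (MulEquiv.piUnits.symm u))
  refine ⟨σ, fun i ↦ ?_⟩
  have hi : m i ∣ ∏ i, m i := dvd_prod_of_mem m (mem_univ i)
  rw [← unitsMap_cycChar hi, hσ]
  refine Units.ext ?_
  rw [ZMod.unitsMap_val]
  have := ZMod.prodEquivPi_apply m hm ((ZMod.prodEquivPi m hm).symm fun i ↦ (u i : ZMod (m i))) i
  rw [RingEquiv.apply_symm_apply] at this
  exact this.symm

theorem mem_ker_cycChar_prod (hm : Pairwise (onFun Nat.Coprime m))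
    [NeZero (∏ i, m i)] {σ : Gal(Ω/ℚ)} (h : ∀ i, σ ∈ (cycChar (m i)).ker) :
    σ ∈ (cycChar (∏ i, m i)).ker := by
  rw [mem_ker]
  refine Units.ext ((ZMod.prodEquivPi m hm).injective (funext fun i ↦ ?_))
  have hi : m i ∣ ∏ i, m i := dvd_prod_of_mem m (mem_univ i)
  rw [ZMod.prodEquivPi_apply, Units.val_one, map_one]
  have := mem_ker.1 (h i)
  rw [← unitsMap_cycChar hi] at this
  simpa [ZMod.unitsMap_val] using congrArg Units.val this

end CyclotomicCharacter

section CharField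


theorem IntermediateField.eq_of_fixingSubgroup_eq {L F : IntermediateField ℚ Ω}
    (h : L.fixingSubgroup = F.fixingSubgroup) : L = F := by
  rw [← InfiniteGalois.fixedField_fixingSubgroup L, h, InfiniteGalois.fixedField_fixingSubgroup]

variable {A : Type*} [Group A]

/-- The fixed field of the kernel of a homomorphism from the absolute Galois group of `ℚ`. -/
noncomputable def charField (θ : Gal(Ω/ℚ) →* A) : IntermediateField ℚ Ω := fixedField θ.ker

variable {θ : Gal(Ω/ℚ) →* A} {N : ℕ} [NeZero N]

theorem isClosed_ker_of_ker_cycChar_le (hθ : (cycChar N).ker ≤ θ.ker) :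
    IsClosed (θ.ker : Set Gal(Ω/ℚ)) := by
  have hfin : FiniteDimensional ℚ (cycField N) :=
    adjoin.finiteDimensional (Algebra.IsIntegral.isIntegral _)
  refine isClosed_of_isOpen _ (isOpen_mono hθ ?_)
  rw [← fixingSubgroup_cycField]
  exact fixingSubgroup_isOpen _

theorem fixingSubgroup_charField (hθ : (cycChar N).ker ≤ θ.ker) :
    (charField θ).fixingSubgroup = θ.ker :=
  InfiniteGalois.fixingSubgroup_fixedField ⟨θ.ker, isClosed_ker_of_ker_cycChar_le hθ⟩

theorem charField_le_cycField (hθ : (cycChar N).ker ≤ θ.ker) : charField θ ≤ cycField N := by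
  rw [← InfiniteGalois.fixedField_fixingSubgroup (cycField N), fixingSubgroup_cycField]
  intro x hx σ
  exact hx ⟨σ, hθ σ.2⟩

instance finiteDimensional_cycField : FiniteDimensional ℚ (cycField N) :=
  adjoin.finiteDimensional (Algebra.IsIntegral.isIntegral _)

theorem finiteDimensional_charField (hθ : (cycChar N).ker ≤ θ.ker) :
    FiniteDimensional ℚ (charField θ) :=
  (InfiniteGalois.isOpen_iff_finite _).1 <| by
    change IsOpen ((charField θ).fixingSubgroup : Set Gal(Ω/ℚ))
    rw [fixingSubgroup_charField hθ]
    refine isOpen_mono hθ ?_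
    rw [← fixingSubgroup_cycField]
    exact fixingSubgroup_isOpen _

theorem isGalois_charField (hθ : (cycChar N).ker ≤ θ.ker) : IsGalois ℚ (charField θ) := by
  refine (InfiniteGalois.normal_iff_isGalois (charField θ)).1 ?_
  rw [fixingSubgroup_charField hθ]
  infer_instance

theorem nonempty_gal_charField_mulEquiv (hθ : (cycChar N).ker ≤ θ.ker) :
    Nonempty (Gal(charField θ/ℚ) ≃* θ.range) := by
  let H : ClosedSubgroup Gal(Ω/ℚ) := ⟨θ.ker, isClosed_ker_of_ker_cycChar_le hθ⟩
  have : H.Normal := θ.normal_ker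
  exact ⟨(InfiniteGalois.normalAutEquivQuotient H).symm.trans
    (QuotientGroup.quotientKerEquivRange θ)⟩

theorem finrank_charField (hθ : (cycChar N).ker ≤ θ.ker) :
    finrank ℚ (charField θ) = Nat.card θ.range := by
  have := isGalois_charField hθ
  have := finiteDimensional_charField hθ
  rw [← IsGalois.card_aut_eq_finrank]
  exact Nat.card_congr (nonempty_gal_charField_mulEquiv hθ).some.toEquiv

theorem charField_sup_cycField_eq {B : Type*} [Group B] {θ' : Gal(Ω/ℚ) →* B} {N' : ℕ} [NeZero N']
    (hθ : (cycChar N).ker ≤ θ.ker) (hθ' : (cycChar N').ker ≤ θ'.ker) {m : ℕ} [NeZero m]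
    (h : ∀ σ ∈ (cycChar m).ker, θ σ = 1 ↔ θ' σ = 1) :
    charField θ ⊔ cycField m = charField θ' ⊔ cycField m := by
  refine eq_of_fixingSubgroup_eq ?_
  rw [fixingSubgroup_sup, fixingSubgroup_sup, fixingSubgroup_charField hθ,
    fixingSubgroup_charField hθ', fixingSubgroup_cycField]
  ext σ
  simp only [Subgroup.mem_inf]
  exact and_congr_left fun hσ ↦ h σ hσ

theorem charField_injective_ker {B : Type*} [Group B] {θ' : Gal(Ω/ℚ) →* B} {N' : ℕ} [NeZero N']
    (hθ : (cycChar N).ker ≤ θ.ker) (hθ' : (cycChar N').ker ≤ θ'.ker)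
    (h : charField θ = charField θ') : θ.ker = θ'.ker := by
  rw [← fixingSubgroup_charField hθ, h, fixingSubgroup_charField hθ']

theorem absDisc_eq_natAbs_discr (L : IntermediateField ℚ Ω)
    [FiniteDimensional ℚ L] [NumberField L] : absDisc L = (discr L).natAbs := by
  rw [absDisc, dif_pos ‹_›]

theorem absDisc_ne_zero (L : IntermediateField ℚ Ω) [FiniteDimensional ℚ L] : absDisc L ≠ 0 := by
  have : NumberField L := ⟨⟩
  rw [absDisc_eq_natAbs_discr]
  exact Int.natAbs_ne_zero.2 (discr_ne_zero L)

theorem absDisc_bot : absDisc ⊥ = 1 := by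
  have : NumberField (⊥ : IntermediateField ℚ Ω) := ⟨⟩
  rw [absDisc_eq_natAbs_discr, discr_eq_discr_of_algEquiv _ (botEquiv ℚ _), discr_rat]
  rfl

theorem padicValNat_absDisc_sup_cycField (L : IntermediateField ℚ Ω)
    [FiniteDimensional ℚ L] {m : ℕ} [NeZero m] {ℓ : ℕ} (hℓ : ℓ.Prime) (hm : ¬ ℓ ∣ m) :
    padicValNat ℓ (absDisc (L ⊔ cycField m)) * finrank ℚ L = padicValNat ℓ (absDisc L) *
        finrank ℚ (L ⊔ cycField m : IntermediateField ℚ Ω) := by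
  let E : IntermediateField L Ω := adjoin L {cycRoot m}
  have h0 : restrictScalars ℚ E = L ⊔ cycField m := restrictScalars_adjoin_eq_sup _ _ _
  have hitg : IsIntegral L (cycRoot m) := Algebra.IsIntegral.isIntegral _
  have hfE : FiniteDimensional L E := adjoin.finiteDimensional (Algebra.IsIntegral.isIntegral _)
  have hfE' : FiniteDimensional ℚ E := FiniteDimensional.trans ℚ L E
  have hfE'' : FiniteDimensional ℚ (restrictScalars ℚ E) := hfE'
  have : NumberField L := ⟨⟩
  have : NumberField E := ⟨⟩
  have : NumberField (restrictScalars ℚ E) := ⟨⟩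
  have h1 : absDisc (L ⊔ cycField m) = (discr E).natAbs := by
    rw [← h0]
    exact absDisc_eq_natAbs_discr (restrictScalars ℚ E)
  have h2 : finrank ℚ (L ⊔ cycField m : IntermediateField ℚ Ω) = finrank ℚ L * finrank L E := by
    rw [← h0]
    exact (finrank_mul_finrank ℚ L E).symm
  have htop : adjoin L {AdjoinSimple.gen L (cycRoot m)} = ⊤ :=
    adjoin_eq_top_of_algebra _ _ (adjoin.powerBasis hitg).adjoin_gen_eq_top
  have h3 := padicValNat_discr_of_adjoin_eq_top (F := L) (E := E)
    (ζ := AdjoinSimple.gen L (cycRoot m)) (m := m)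
    (Subtype.ext (isPrimitiveRoot_cycRoot m).pow_eq_one) htop hℓ hm
  rw [h1, h2, h3, absDisc_eq_natAbs_discr]
  ring

theorem padicValNat_absDisc_mul_finrank {L F : IntermediateField ℚ Ω}
    [FiniteDimensional ℚ L] [FiniteDimensional ℚ F] {m : ℕ} [NeZero m] {ℓ : ℕ}
    (hℓ : ℓ.Prime) (hm : ¬ ℓ ∣ m) (h : L ⊔ cycField m = F ⊔ cycField m) :
    padicValNat ℓ (absDisc L) * finrank ℚ F = padicValNat ℓ (absDisc F) * finrank ℚ L := by
  have h1 := padicValNat_absDisc_sup_cycField L hℓ hm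
  have h2 := padicValNat_absDisc_sup_cycField F hℓ hm
  rw [h] at h1
  have hpos : 0 < finrank ℚ (F ⊔ cycField m : IntermediateField ℚ Ω) := finrank_pos
  refine Nat.eq_of_mul_eq_mul_right hpos ?_
  rw [mul_right_comm, ← h1, mul_right_comm (padicValNat ℓ (absDisc F)), ← h2]
  ring

theorem padicValNat_absDisc_charField_add_one {p : ℕ} [NeZero p] (hp : p.Prime)
    (hθ : (cycChar p).ker ≤ θ.ker) :
    padicValNat p (absDisc (charField θ)) + 1 = Nat.card θ.range := by
  have := finiteDimensional_charField hθ
  rw [← finrank_charField hθ]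
  let i : charField θ →ₐ[ℚ] cycField p := inclusion (charField_le_cycField hθ)
  let _ : Algebra (charField θ) (cycField p) := i.toRingHom.toAlgebra
  have : NumberField (charField θ) := ⟨⟩
  have : NumberField (cycField p) := ⟨⟩
  have : IsCyclotomicExtension {p} ℚ (cycField p) :=
    (isPrimitiveRoot_cycRoot p).intermediateField_adjoin_isCyclotomicExtension ℚ
  rw [absDisc_eq_natAbs_discr]
  exact padicValNat_discr_add_one_of_le_cyclotomic (E := cycField p) hp

end CharField

section ConductorBound


theorem eq_one_of_mem_inertia_of_not_dvd_discr {M : Type*} [Field M] [NumberField M]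
    [IsGalois ℚ M] {q : ℕ} (hq : q.Prime) (h : ¬ q ∣ (discr M).natAbs) (P : Ideal (𝓞 M))
    [P.IsPrime] [P.LiesOver (span {(q : ℤ)})] {σ : Gal(M/ℚ)}
    (hσ : σ ∈ P.inertia Gal(M/ℚ)) : σ = 1 := by
  have h1 := (not_dvd_discr_iff_forall_mem M (𝓞 M) (Nat.prime_iff_prime_int.1 hq)).1
    (by rwa [← Int.natCast_dvd] at h) P inferInstance
    (by simpa using (natCast_mem_iff_of_liesOver (P := P) (p := q)).2 dvd_rfl)
  have h2 := card_inertia_eq_ramificationIdx (P := P) hq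
  rw [ramificationIdx_eq_one_of_isUnramifiedAt] at h2
  have := (Nat.card_eq_one_iff_unique.1 h2).1
  exact congrArg Subtype.val (Subsingleton.elim (⟨σ, hσ⟩ : P.inertia Gal(M/ℚ)) 1)

theorem Nat.totient_prod_of_prime {S : Finset ℕ} (hS : ∀ p ∈ S, p.Prime) :
    Nat.totient (∏ p ∈ S, p) = ∏ p ∈ S, (p - 1) := by
  induction S using Finset.induction_on with
  | empty => simp
  | insert p S hp ih =>
    rw [prod_insert hp, prod_insert hp, Nat.totient_mul,
      Nat.totient_prime (hS p (mem_insert_self p S)),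
      ih fun q hq ↦ hS q (mem_insert_of_mem hq)]
    refine Nat.Coprime.prod_right fun q hq ↦ (Nat.coprime_primes
      (hS p (mem_insert_self p S)) (hS q (mem_insert_of_mem hq))).2 ?_
    rintro rfl
    exact hp hq

theorem finrank_cycField (N : ℕ) [NeZero N] : finrank ℚ (cycField N) = N.totient := by
  have h : charField (cycChar N) = cycField N := eq_of_fixingSubgroup_eq
      (by rw [fixingSubgroup_charField le_rfl, fixingSubgroup_cycField])
  rw [← h, finrank_charField le_rfl, range_eq_top.2 (cycChar_surjective N),
    card_top, Nat.card_eq_fintype_card, ZMod.card_units_eq_totient]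

set_option maxHeartbeats 1000000 in
theorem le_cycField_of_forall_not_dvd_absDisc {L : IntermediateField ℚ Ω}
    [FiniteDimensional ℚ L] [IsGalois ℚ L] (hc : ∀ σ τ : Gal(L/ℚ), σ * τ = τ * σ)
    (h8 : ∀ σ : Gal(L/ℚ), σ ^ 8 = 1) {S : Finset ℕ} (hS : ∀ p ∈ S, p.Prime ∧ p ≠ 2)
    (hd : ∀ q : ℕ, q.Prime → q ≠ 2 → q ∉ S → ¬ q ∣ absDisc L)
    [NeZero (32 * ∏ p ∈ S, p)] : L ≤ cycField (32 * ∏ p ∈ S, p) := by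
  set N := 32 * ∏ p ∈ S, p with hN
  let M : IntermediateField ℚ Ω := L ⊔ cycField N
  have hLM : L ≤ M := le_sup_left
  have hKM : cycField N ≤ M := le_sup_right
  have hM : FiniteDimensional ℚ M := finiteDimensional_sup L (cycField N)
  have hfix : M.fixingSubgroup = L.fixingSubgroup ⊓ (cycChar N).ker := by
    rw [fixingSubgroup_sup, fixingSubgroup_cycField]
  have hnL : @Normal ℚ L _ _ L.algebra' := ‹IsGalois ℚ L›.to_normal
  have hfL : L.fixingSubgroup = (restrictNormalHom L).ker := (restrictNormalHom_ker L).symm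
  have hgal : IsGalois ℚ M := by
    refine (InfiniteGalois.normal_iff_isGalois M).1 ?_
    rw [hfix, hfL]
    infer_instance
  have hnM : @Normal ℚ M _ _ M.algebra' := hgal.to_normal
  have hfM : M.fixingSubgroup = (restrictNormalHom M).ker := (restrictNormalHom_ker M).symm
  have hker : ∀ σ, (restrictNormalHom (F := ℚ) (K₁ := Ω) M) σ = 1 ↔
      (restrictNormalHom L) σ = 1 ∧ cycChar N σ = 1 := by
    intro σ
    rw [← mem_ker, ← hfM, hfix, Subgroup.mem_inf, hfL, mem_ker, mem_ker]
  have hsurj := restrictNormalHom_surjective (F := ℚ) (K₁ := M) Ω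
  have : NumberField M := ⟨⟩
  have hζ := isPrimitiveRoot_cycRoot N
  let ζ : M := ⟨cycRoot N, hKM (mem_adjoin_simple_self ℚ _)⟩
  have hζM : IsPrimitiveRoot ζ N := IsPrimitiveRoot.of_map_of_injective
    (f := algebraMap M Ω) hζ (algebraMap M Ω).injective
  have hcard : Nat.card Gal(M/ℚ) ≤ 16 * ∏ p ∈ S, (p - 1) := by
    refine card_gal_le_of_inertia ?_ hS hζM ?_ ?_
    · intro σ τ
      obtain ⟨σ, rfl⟩ := hsurj σ
      obtain ⟨τ, rfl⟩ := hsurj τ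
      rw [← mul_inv_eq_one, ← map_mul, ← map_mul, ← map_inv, ← map_mul, hker]
      simp only [map_mul, map_inv, mul_inv_eq_one]
      exact ⟨hc _ _, mul_comm _ _⟩
    · intro σ k hk hσ
      obtain ⟨σ, rfl⟩ := hsurj σ
      rw [← map_pow] at hσ ⊢
      rw [hker]
      constructor
      · obtain ⟨j, rfl⟩ := hk
        rw [map_pow, pow_mul, h8, one_pow]
      · rw [← mem_ker, mem_ker_cycChar]
        have := AlgEquiv.restrictNormal_commutes (σ ^ k) M ζ
        exact this.symm.trans (congrArg (algebraMap M Ω) hσ)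
    · intro q hq hq2 hqS P hP hPq σ hσ
      have hqN : ¬ q ∣ N := by
        rw [hN, hq.dvd_mul, Prime.dvd_finsetProd_iff hq.prime]
        rintro (h | ⟨p, hp, h⟩)
        · exact hq2 ((Nat.prime_dvd_prime_iff_eq hq Nat.prime_two).1 (hq.dvd_of_dvd_pow (n := 5) h))
        · exact hqS ((Nat.prime_dvd_prime_iff_eq hq (hS p hp).1).1 h ▸ hp)
      refine eq_one_of_mem_inertia_of_not_dvd_discr hq ?_ P hσ
      have h1 := padicValNat_absDisc_sup_cycField L hq hqN
      rw [padicValNat.eq_zero_of_not_dvd (hd q hq hq2 hqS), zero_mul, mul_eq_zero,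
        or_iff_left finrank_pos.ne'] at h1
      rw [← absDisc_eq_natAbs_discr]
      have : Fact q.Prime := ⟨hq⟩
      rcases padicValNat.eq_zero_iff.1 h1 with h | h | h
      · exact absurd h hq.ne_one
      · exact absurd h (absDisc_ne_zero M)
      · exact h
  have hfin : finrank ℚ (cycField N) = 16 * ∏ p ∈ S, (p - 1) := by
    rw [finrank_cycField, hN, Nat.totient_mul, Nat.totient_prod_of_prime fun p hp ↦ (hS p hp).1]
    · rfl
    · refine Nat.Coprime.prod_right fun p hp ↦ ?_
      exact Nat.Coprime.pow_left (m := 2) 5 <| (Nat.coprime_primes Nat.prime_two (hS p hp).1).2 (hS p hp).2.symm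
  rw [IsGalois.card_aut_eq_finrank, ← hfin] at hcard
  exact hLM.trans (eq_of_le_of_finrank_le hKM hcard).ge

theorem exists_character_of_le_cycField {L : IntermediateField ℚ Ω}
    [FiniteDimensional ℚ L] [IsGalois ℚ L] {N : ℕ} [NeZero N] (hL : L ≤ cycField N)
    {A : Type*} [Group A] (e : Gal(L/ℚ) ≃* A) :
    ∃ θ : Gal(Ω/ℚ) →* A, Surjective θ ∧ (cycChar N).ker ≤ θ.ker ∧ charField θ = L := by
  have hnL : @Normal ℚ L _ _ L.algebra' := ‹IsGalois ℚ L›.to_normal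
  have hfL : L.fixingSubgroup = (restrictNormalHom L).ker := (restrictNormalHom_ker L).symm
  let θ := e.toMonoidHom.comp (restrictNormalHom (K₁ := Ω) L)
  have hθ : θ.ker = L.fixingSubgroup := by
    rw [hfL]
    ext σ
    simp [θ, mem_ker]
  refine ⟨θ, e.surjective.comp (restrictNormalHom_surjective _), ?_, ?_⟩
  · rw [hθ, ← fixingSubgroup_cycField]
    exact fixingSubgroup_antitone hL
  · rw [charField, hθ, InfiniteGalois.fixedField_fixingSubgroup]

end ConductorBound

section TupleChar

theorem padicValNat_prod_pow {ι : Type*} [Fintype ι] {b : ι → ℕ} (hb : ∀ i, (b i).Prime)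
    (hinj : Injective b) (e : ι → ℕ) (i : ι) :
    padicValNat (b i) (∏ j, b j ^ e j) = e i := by
  have : Fact (b i).Prime := ⟨hb i⟩
  rw [← mul_prod_erase _ _ (mem_univ i), padicValNat.mul (pow_ne_zero _ (hb i).ne_zero)
    (prod_ne_zero_iff.2 fun j _ ↦ pow_ne_zero _ (hb j).ne_zero), padicValNat.prime_pow,
    padicValNat.eq_zero_of_not_dvd, add_zero]
  rw [Prime.dvd_finsetProd_iff (hb i).prime]
  rintro ⟨j, hj, h⟩
  exact ne_of_mem_erase hj
    (hinj ((Nat.prime_dvd_prime_iff_eq (hb i) (hb j)).1 ((hb i).dvd_of_dvd_pow h)).symm)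

variable {A : Type*} [CommGroup A] {ι : Type} [Fintype ι] {m : ι → ℕ} [∀ i, NeZero (m i)]

/-- The Galois character attached to a family of characters of the groups `(ZMod (m i))ˣ`. -/
noncomputable def tupleChar (t : Π i, (ZMod (m i))ˣ →* A) : Gal(Ω/ℚ) →* A :=
  ∏ i, (t i).comp (cycChar (m i))

theorem tupleChar_apply (t : Π i, (ZMod (m i))ˣ →* A) (σ : Gal(Ω/ℚ)) :
    tupleChar t σ = ∏ i, t i (cycChar (m i) σ) := by
  simp [tupleChar, MonoidHom.finsetProd_apply]

theorem tupleChar_apply_of_forall_ne (t : Π i, (ZMod (m i))ˣ →* A)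
    {σ : Gal(Ω/ℚ)} (i : ι) (h : ∀ j, j ≠ i → cycChar (m j) σ = 1) :
    tupleChar t σ = t i (cycChar (m i) σ) := by
  rw [tupleChar_apply]
  exact prod_eq_single i (fun j _ hj ↦ by rw [h j hj, map_one]) (by simp)

theorem ker_cycChar_prod_le_ker_tupleChar [NeZero (∏ i, m i)] (t : Π i, (ZMod (m i))ˣ →* A) :
    (cycChar (∏ i, m i)).ker ≤ (tupleChar t).ker := by
  intro σ hσ
  rw [mem_ker, tupleChar_apply]
  refine prod_eq_one fun i _ ↦ ?_
  rw [mem_ker.1 (ker_cycChar_le_of_dvd (dvd_prod_of_mem m (mem_univ i)) hσ), map_one]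

theorem tupleChar_injective (hm : Pairwise (onFun Nat.Coprime m)) :
    Injective (tupleChar (A := A) (m := m)) := by
  intro t t' h
  refine funext fun i ↦ MonoidHom.ext fun u ↦ ?_
  obtain ⟨σ, hσ⟩ := exists_forall_cycChar_eq hm (Pi.mulSingle i u)
  have h1 : ∀ j, j ≠ i → cycChar (m j) σ = 1 := fun j hj ↦ by rw [hσ, Pi.mulSingle_eq_of_ne hj]
  have h2 := DFunLike.congr_fun h σ
  rwa [tupleChar_apply_of_forall_ne t i h1, tupleChar_apply_of_forall_ne t' i h1, hσ,
    Pi.mulSingle_eq_same] at h2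

theorem exists_tupleChar_eq (hm : Pairwise (onFun Nat.Coprime m)) [NeZero (∏ i, m i)]
    {θ : Gal(Ω/ℚ) →* A} (hθ : (cycChar (∏ i, m i)).ker ≤ θ.ker) :
    ∃ t : Π i, (ZMod (m i))ˣ →* A, tupleChar t = θ := by
  let f : Gal(Ω/ℚ) →* Π i, (ZMod (m i))ˣ :=
    MonoidHom.mk' (fun σ i ↦ cycChar (m i) σ) fun σ τ ↦ funext fun i ↦ map_mul _ _ _
  have hf : Surjective f := fun u ↦ by
    obtain ⟨σ, hσ⟩ := exists_forall_cycChar_eq hm u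
    exact ⟨σ, funext hσ⟩
  have hker : f.ker ≤ θ.ker := fun σ hσ ↦
    hθ (mem_ker_cycChar_prod hm fun i ↦ congrFun (mem_ker.1 hσ) i)
  let φ := f.liftOfSurjective hf ⟨θ, hker⟩
  have hφ : ∀ σ, φ (f σ) = θ σ := fun σ ↦
    f.liftOfRightInverse_comp_apply _ (rightInverse_surjInv hf) ⟨θ, hker⟩ σ
  refine ⟨fun i ↦ φ.comp (MonoidHom.mulSingle (fun i ↦ (ZMod (m i))ˣ) i), MonoidHom.ext fun σ ↦ ?_⟩
  rw [tupleChar_apply, ← hφ, ← univ_prod_mulSingle (f σ), map_prod]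
  rfl

theorem padicValNat_absDisc_tupleChar (t : Π i, (ZMod (m i))ˣ →* A) {ℓ : ℕ} (hℓ : ℓ.Prime)
    (i : ι) (h : ∀ j, j ≠ i → ¬ ℓ ∣ m j) :
    padicValNat ℓ (absDisc (charField (tupleChar t))) * Nat.card (t i).range =
      padicValNat ℓ (absDisc (charField ((t i).comp (cycChar (m i))))) *
        Nat.card (tupleChar t).range := by
  have hN : NeZero (∏ i, m i) := ⟨prod_ne_zero_iff.2 fun i _ ↦ NeZero.ne _⟩
  have hE : NeZero (∏ j ∈ univ.erase i, m j) := ⟨prod_ne_zero_iff.2 fun i _ ↦ NeZero.ne _⟩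
  have h1 := ker_cycChar_prod_le_ker_tupleChar t
  have h2 : (cycChar (m i)).ker ≤ ((t i).comp (cycChar (m i))).ker := fun σ hσ ↦ by
    rw [mem_ker, MonoidHom.comp_apply, mem_ker.1 hσ, map_one]
  have := finiteDimensional_charField h1
  have := finiteDimensional_charField h2
  have h3 : Nat.card (t i).range = finrank ℚ (charField ((t i).comp (cycChar (m i)))) := by
    rw [finrank_charField h2, MonoidHom.range_comp, range_eq_top.2 (cycChar_surjective _),
      range_eq_map]
  rw [h3, ← finrank_charField h1]
  refine padicValNat_absDisc_mul_finrank (m := ∏ j ∈ univ.erase i, m j) hℓ ?_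
    (charField_sup_cycField_eq h1 h2 fun σ hσ ↦ ?_)
  · rw [Prime.dvd_finsetProd_iff hℓ.prime]
    rintro ⟨j, hj, h'⟩
    exact h j (ne_of_mem_erase hj) h'
  · rw [tupleChar_apply_of_forall_ne t i fun j hj ↦ mem_ker.1 (ker_cycChar_le_of_dvd
      (dvd_prod_of_mem m (mem_erase.2 ⟨hj, mem_univ j⟩)) hσ)]
    rfl

theorem padicValNat_absDisc_tupleChar_eq_zero (t : Π i, (ZMod (m i))ˣ →* A) {ℓ : ℕ}
    (hℓ : ℓ.Prime) (h : ∀ j, ¬ ℓ ∣ m j) :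
    padicValNat ℓ (absDisc (charField (tupleChar t))) = 0 := by
  have hN : NeZero (∏ i, m i) := ⟨prod_ne_zero_iff.2 fun i _ ↦ NeZero.ne _⟩
  have h1 := ker_cycChar_prod_le_ker_tupleChar t
  have := finiteDimensional_charField h1
  have hle := charField_le_cycField h1
  have h2 := padicValNat_absDisc_mul_finrank (L := charField (tupleChar t)) (F := ⊥)
    (m := ∏ i, m i) hℓ ?_ ?_
  · rwa [absDisc_bot, padicValNat_one_right, zero_mul, IntermediateField.finrank_bot, mul_one] at h2
  · rw [Prime.dvd_finsetProd_iff hℓ.prime]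
    rintro ⟨j, hj, h'⟩
    exact h j h'
  · rw [bot_sup_eq, sup_eq_right.2 hle]

/-- The exponent of `q` in the discriminant of a cyclic octic field whose defining character
has `χ` as its component of conductor `n`, a power of `q`. -/
noncomputable def discExp (q : ℕ) {n : ℕ} [NeZero n] (χ : (ZMod n)ˣ →* A) : ℕ :=
  8 * padicValNat q (absDisc (charField (χ.comp (cycChar n)))) / Nat.card χ.range

theorem discExp_of_prime {p : ℕ} [NeZero p] (hp : p.Prime) (χ : (ZMod p)ˣ →* A) :
    discExp p χ = 8 * (Nat.card χ.range - 1) / Nat.card χ.range := by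
  have h2 : (cycChar p).ker ≤ (χ.comp (cycChar p)).ker := fun σ hσ ↦ by
    rw [mem_ker, MonoidHom.comp_apply, mem_ker.1 hσ, map_one]
  have h := padicValNat_absDisc_charField_add_one hp h2
  rw [MonoidHom.range_comp, range_eq_top.2 (cycChar_surjective _), ← range_eq_map] at h
  rw [discExp, ← h, Nat.add_sub_cancel]

theorem discExp_one (q n : ℕ) [NeZero n] : discExp q (1 : (ZMod n)ˣ →* A) = 0 := by
  have h : charField ((1 : (ZMod n)ˣ →* A).comp (cycChar n)) = ⊥ := by
    rw [MonoidHom.one_comp, charField, MonoidHom.ker_one, InfiniteGalois.fixedField_bot]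
  rw [discExp, h, absDisc_bot, padicValNat_one_right, mul_zero, Nat.zero_div]

theorem absDisc_charField_tupleChar {b : ι → ℕ} (hb : ∀ i, (b i).Prime)
    (hinj : Injective b) (hbm : ∀ i, ∀ ℓ : ℕ, ℓ.Prime → ℓ ∣ m i → ℓ = b i)
    (t : Π i, (ZMod (m i))ˣ →* A) (ht : Nat.card (tupleChar t).range = 8) :
    absDisc (charField (tupleChar t)) = ∏ i, b i ^ discExp (b i) (t i) := by
  have hN : NeZero (∏ i, m i) := ⟨prod_ne_zero_iff.2 fun i _ ↦ NeZero.ne _⟩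
  have := finiteDimensional_charField (ker_cycChar_prod_le_ker_tupleChar t)
  refine (Nat.eq_iff_prime_padicValNat_eq _ _ (absDisc_ne_zero _)
    (prod_ne_zero_iff.2 fun j _ ↦ pow_ne_zero _ (hb j).ne_zero)).2 fun ℓ hℓ ↦ ?_
  by_cases h : ∃ i, b i = ℓ
  · obtain ⟨i, rfl⟩ := h
    rw [padicValNat_prod_pow hb hinj, discExp]
    have h1 := padicValNat_absDisc_tupleChar t hℓ i fun j hj h ↦ hj (hinj (hbm j _ hℓ h)).symm
    rw [ht] at h1
    rw [mul_comm 8, ← h1, Nat.mul_div_cancel _ Nat.card_pos]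
  · rw [padicValNat_absDisc_tupleChar_eq_zero t hℓ fun j hj ↦ h ⟨j, (hbm j ℓ hℓ hj).symm⟩,
      padicValNat.eq_zero_of_not_dvd]
    rw [Prime.dvd_finsetProd_iff hℓ.prime]
    rintro ⟨j, hj, h'⟩
    exact h ⟨j, ((Nat.prime_dvd_prime_iff_eq hℓ (hb j)).1 (hℓ.dvd_of_dvd_pow h')).symm⟩

end TupleChar

section CountCharacters

theorem charField_mulEquiv_comp {A B : Type*} [Group A] [Group B] (α : A ≃* B)
    (θ : Gal(Ω/ℚ) →* A) : charField (α.toMonoidHom.comp θ) = charField θ := by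
  have : (α.toMonoidHom.comp θ).ker = θ.ker := by
    ext σ
    simp [mem_ker]
  rw [charField, this, charField]

theorem exists_mulEquiv_comp_eq_of_ker_eq {G A B : Type*} [Group G] [Group A] [Group B]
    {f : G →* A} {g : G →* B} (hf : Surjective f) (hg : Surjective g)
    (h : f.ker = g.ker) : ∃ α : A ≃* B, α.toMonoidHom.comp f = g := by
  refine ⟨(QuotientGroup.quotientKerEquivOfSurjective f hf).symm.trans
    ((QuotientGroup.quotientMulEquivOfEq h).trans
      (QuotientGroup.quotientKerEquivOfSurjective g hg)), MonoidHom.ext fun x ↦ ?_⟩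
  have : (QuotientGroup.quotientKerEquivOfSurjective f hf).symm (f x) = (x : G ⧸ f.ker) :=
    (MulEquiv.symm_apply_eq _).2 rfl
  simp only [MonoidHom.comp_apply, MulEquiv.toMonoidHom_eq_coe, MonoidHom.coe_coe,
    MulEquiv.trans_apply, this]
  rfl

theorem card_mulAut_zmod_eight : Nat.card (MulAut C₈) = 4 := by
  rw [Nat.card_congr (IsCyclic.mulAutMulEquiv C₈).toEquiv,
    Nat.card_congr Multiplicative.toAdd, Nat.card_zmod, Nat.card_eq_fintype_card,
    ZMod.card_units_eq_totient]
  rfl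

theorem card_surjective_characters {N : ℕ} [NeZero N] {X : ℝ}
    (h : ∀ L : IntermediateField ℚ Ω, FiniteDimensional ℚ L → IsGalois ℚ L →
      Nonempty ((L ≃ₐ[ℚ] L) ≃* C₈) → (absDisc L : ℝ) ≤ X →
      L ≤ cycField N) :
    Nat.card {θ : Gal(Ω/ℚ) →* C₈ //
      Surjective θ ∧ (cycChar N).ker ≤ θ.ker ∧ (absDisc (charField θ) : ℝ) ≤ X} =
    4 * galoisCount C₈ X := by
  have key : ∀ L : {L : IntermediateField ℚ Ω // FiniteDimensional ℚ L ∧ IsGalois ℚ L ∧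
        Nonempty ((L ≃ₐ[ℚ] L) ≃* C₈) ∧ (absDisc L : ℝ) ≤ X},
      ∃ θ : Gal(Ω/ℚ) →* C₈, Surjective θ ∧ (cycChar N).ker ≤ θ.ker ∧ charField θ = L := by
    rintro ⟨L, h1, h2, h3, h4⟩
    exact exists_character_of_le_cycField (h L h1 h2 h3 h4) h3.some
  choose θ hθs hθk hθL using key
  rw [galoisCount, mul_comm, ← card_mulAut_zmod_eight, ← Nat.card_prod]
  symm
  have hker : ∀ L (α : MulAut C₈),
      charField ((MulEquiv.toMonoidHom α).comp (θ L)) = L := fun L α ↦ by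
    rw [charField_mulEquiv_comp, hθL]
  refine Nat.card_congr (Equiv.ofBijective (fun q ↦
    ⟨(MulEquiv.toMonoidHom q.2).comp (θ q.1), q.2.surjective.comp (hθs q.1), ?_, ?_⟩) ⟨?_, ?_⟩)
  · refine (hθk q.1).trans fun σ hσ ↦ ?_
    rw [mem_ker, MonoidHom.comp_apply, mem_ker.1 hσ, map_one]
  · rw [hker]
    exact q.1.2.2.2.2
  · rintro ⟨L, α⟩ ⟨L', α'⟩ hq
    have hq' := congrArg Subtype.val hq
    have hL := congrArg charField hq'
    simp only [hker] at hL
    obtain rfl := Subtype.ext hL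
    refine Prod.ext rfl (MulEquiv.ext fun x ↦ ?_)
    obtain ⟨σ, rfl⟩ := hθs L x
    exact DFunLike.congr_fun hq' σ
  · rintro ⟨φ, h1, h2, h3⟩
    let L := charField φ
    have hgal : Nonempty ((L ≃ₐ[ℚ] L) ≃* C₈) := by
      obtain ⟨e⟩ := nonempty_gal_charField_mulEquiv h2
      exact ⟨e.trans ((MulEquiv.subgroupCongr (range_eq_top.2 h1)).trans Subgroup.topEquiv)⟩
    let L' : {L : IntermediateField ℚ Ω // FiniteDimensional ℚ L ∧ IsGalois ℚ L ∧
        Nonempty ((L ≃ₐ[ℚ] L) ≃* C₈) ∧ (absDisc L : ℝ) ≤ X} :=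
      ⟨L, finiteDimensional_charField h2, isGalois_charField h2, hgal, h3⟩
    obtain ⟨α, hα⟩ := exists_mulEquiv_comp_eq_of_ker_eq (hθs L') h1
      (charField_injective_ker (hθk L') h2 (hθL L'))
    exact ⟨⟨L', α⟩, Subtype.ext hα⟩

end CountCharacters

section LocalCount

theorem discExp_eq_of_generator {p : ℕ} [NeZero p] (hp : p.Prime) {g : (ZMod p)ˣ}
    (hg : ∀ x, x ∈ zpowers g) (χ : (ZMod p)ˣ →* C₈) :
    discExp p χ = 8 * (orderOf (χ g) - 1) / orderOf (χ g) := by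
  rw [discExp_of_prime hp, range_eq_map, ← (eq_top_iff' _).2 hg,
    MonoidHom.map_zpowers, Nat.card_zpowers]

/-- The discriminant exponent attached to the value of a tame character at a generator. -/
def tameExp (y : ZMod 8) : ℕ :=
  if y = 0 then 0 else if y = 4 then 4 else if y = 2 then 6 else if y = 6 then 6 else 7

theorem eight_mul_addOrderOf_sub_one_div (y : ZMod 8) :
    8 * (addOrderOf y - 1) / addOrderOf y = tameExp y := by
  rw [← ZMod.natCast_zmod_val y, ZMod.addOrderOf_coe _ (by norm_num)]
  fin_cases y <;> rfl

theorem card_zmod_eight_tameExp {r k p : ℕ} (hk : (r = 0 ∧ k = 4) ∨ (r = 4 ∧ k = 8))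
    (hp2 : p % 2 = 1) (e : ℕ) :
    Nat.card {y : ZMod 8 // (p - 1) • y = 0 ∧ k • y = 0 ∧ tameExp y = e} = localWeight r p e := by
  have h8 : ∀ y : ZMod 8, (p - 1) • y = (p % 8 - 1) • y := fun y ↦ by
    have : p - 1 = p % 8 - 1 + 8 * (p / 8) := by omega
    rw [this, add_nsmul, mul_nsmul', nsmul_eq_mul 8]
    simp [show (8 : ZMod 8) = 0 from rfl]
  simp only [h8]
  have h4 : p % 4 = p % 8 % 4 := by omega
  have hp : p ≠ 2 := by omega
  have h0 : p % 8 = 1 ∨ p % 8 = 3 ∨ p % 8 = 5 ∨ p % 8 = 7 := by omega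
  have he : e = 0 ∨ e = 4 ∨ e = 6 ∨ e = 7 ∨ (e ≠ 0 ∧ e ≠ 4 ∧ e ≠ 6 ∧ e ≠ 7) := by omega
  rw [localWeight, h4, if_neg hp, Nat.card_eq_fintype_card, Fintype.card_subtype]
  rcases he with rfl | rfl | rfl | rfl | ⟨e0, e4, e6, e7⟩
  case inr.inr.inr.inr =>
    rw [if_neg e0, if_neg e4, if_neg e6, if_neg e7, card_eq_zero, filter_eq_empty_iff]
    rintro y - ⟨-, -, rfl⟩
    unfold tameExp at e0 e4 e6 e7
    split_ifs at e0 e4 e6 e7 <;> simp_all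
  all_goals
    rcases hk with ⟨rfl, rfl⟩ | ⟨rfl, rfl⟩ <;> rcases h0 with h | h | h | h <;> rw [h] <;> rfl

theorem card_characters_discExp_eq {r k p : ℕ} (hk : (r = 0 ∧ k = 4) ∨ (r = 4 ∧ k = 8))
    [NeZero p] (hp : p.Prime) (hp2 : p ≠ 2) (e : ℕ) :
    Nat.card {χ : (ZMod p)ˣ →* C₈ // χ ^ k = 1 ∧ discExp p χ = e} = localWeight r p e := by
  rw [← card_zmod_eight_tameExp hk ((hp.eq_two_or_odd).resolve_left hp2)]
  have : Fact p.Prime := ⟨hp⟩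
  obtain ⟨g, hg⟩ := IsCyclic.exists_generator (α := (ZMod p)ˣ)
  have hord : orderOf g = p - 1 := by
    rw [orderOf_eq_card_of_forall_mem_zpowers hg, Nat.card_eq_fintype_card, ZMod.card_units]
  have hpow : ∀ χ : (ZMod p)ˣ →* C₈, χ ^ k = 1 ↔ k • (χ g).toAdd = 0 := fun χ ↦ by
    rw [MonoidHom.eq_iff_eq_on_generator hg]
    exact Iff.rfl
  have hexp : ∀ χ : (ZMod p)ˣ →* C₈, discExp p χ = tameExp (χ g).toAdd := fun χ ↦ by
    rw [discExp_eq_of_generator hp hg, ← eight_mul_addOrderOf_sub_one_div, ← orderOf_ofAdd_eq_addOrderOf,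
      ofAdd_toAdd]
  refine Nat.card_congr (Equiv.ofBijective
    (fun χ ↦ ⟨(χ.1 g).toAdd, ?_, (hpow _).1 χ.2.1, by rw [← hexp, χ.2.2]⟩) ⟨?_, ?_⟩)
  · rw [← toAdd_pow, ← map_pow, ← hord, pow_orderOf_eq_one, map_one, toAdd_one]
  · intro χ χ' h
    exact Subtype.ext ((MonoidHom.eq_iff_eq_on_generator hg _ _).2 (congrArg Subtype.val h))
  · rintro ⟨y, h1, h2, h3⟩
    have h0 : orderOf (Multiplicative.ofAdd y) ∣ orderOf g := by
      rw [hord, orderOf_ofAdd_eq_addOrderOf]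
      exact addOrderOf_dvd_of_nsmul_eq_zero h1
    have hg' := monoidHomOfForallMemZpowers_apply_gen hg h0
    refine ⟨⟨monoidHomOfForallMemZpowers hg h0, ?_, ?_⟩, Subtype.ext ?_⟩
    · rw [hpow, hg']
      exact h2
    · rw [hexp, hg']
      exact h3
    · exact congrArg Multiplicative.toAdd hg'

end LocalCount

section TupleCount

theorem factorization_prod_pow_coe {S : Finset ℕ} (hS : ∀ p ∈ S, p.Prime) (d : S → ℕ) (q : S) :
    (∏ p : S, (p : ℕ) ^ d p).factorization q = d q := by
  rw [Nat.factorization_prod fun (p : S) _ ↦ pow_ne_zero _ (hS p p.2).ne_zero, sum_apply',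
    sum_eq_single q (fun p _ hpq ↦ ?_) fun h ↦ absurd (mem_univ q) h,
    (hS q q.2).factorization_pow, Finsupp.single_eq_same]
  rw [(hS p p.2).factorization_pow, Finsupp.single_eq_of_ne]
  exact fun h ↦ hpq (Subtype.ext h.symm)

theorem prod_pow_coe_eq_iff {S : Finset ℕ} (hS : ∀ p ∈ S, p.Prime) {n : ℕ} (hn : n ≠ 0)
    (hnS : n.primeFactors ⊆ S) (d : S → ℕ) :
    ∏ p : S, (p : ℕ) ^ d p = n ↔ ∀ p : S, d p = n.factorization p := by
  refine ⟨fun h p ↦ by rw [← h, factorization_prod_pow_coe hS], fun h ↦ ?_⟩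
  simp only [h]
  rw [prod_coe_sort S fun p ↦ p ^ n.factorization p]
  exact (Finsupp.prod_of_support_subset _ hnS _ fun _ _ ↦ pow_zero _).symm.trans
    (Nat.prod_factorization_pow_eq_self hn)

theorem card_pi_prod_pow_eq {S : Finset ℕ} (hS : ∀ p ∈ S, p.Prime) {T : S → Type}
    (P : ∀ p, T p → Prop) (d : ∀ p, T p → ℕ) (w : ℕ → ℕ → ℕ) (hw0 : ∀ p, w p 0 = 1)
    (hw : ∀ p e, Nat.card {x : T p // P p x ∧ d p x = e} = w p e) {n : ℕ} (hn : n ≠ 0)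
    (hnS : n.primeFactors ⊆ S) :
    Nat.card {s : ∀ p, T p // (∀ p, P p (s p)) ∧ ∏ p : S, (p : ℕ) ^ d p (s p) = n} =
      n.factorization.prod w := by
  simp only [prod_pow_coe_eq_iff hS hn hnS, ← forall_and]
  rw [Nat.card_congr (Equiv.subtypePiEquivPi (p := fun p x ↦ P p x ∧ d p x = n.factorization p)),
    Nat.card_pi]
  simp only [hw]
  rw [prod_coe_sort S fun p ↦ w p (n.factorization p)]
  exact (Finsupp.prod_of_support_subset _ hnS _ fun p _ ↦ hw0 p).symm

/-- The odd primes up to `X`. -/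
noncomputable def oddPrimesLE (X : ℝ) : Finset ℕ :=
  (range (⌊X⌋₊ + 1)).filter fun p ↦ p.Prime ∧ p ≠ 2

theorem mem_oddPrimesLE {X : ℝ} {p : ℕ} : p ∈ oddPrimesLE X ↔ p ≤ ⌊X⌋₊ ∧ p.Prime ∧ p ≠ 2 := by
  rw [oddPrimesLE, mem_filter, mem_range, Nat.lt_succ_iff]

theorem card_pi_prod_pow_eq_weight {X : ℝ} {r : ℕ} {T : oddPrimesLE X → Type}
    (P : ∀ p, T p → Prop) (d : ∀ p, T p → ℕ)
    (hw : ∀ p e, Nat.card {x : T p // P p x ∧ d p x = e} = localWeight r p e) {n : ℕ}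
    (hn : n ≤ ⌊X⌋₊) :
    Nat.card {s : ∀ p, T p // (∀ p, P p (s p)) ∧ ∏ p : oddPrimesLE X, (p : ℕ) ^ d p (s p) = n} =
      weight r n := by
  have hS : ∀ p ∈ oddPrimesLE X, p.Prime := fun p hp ↦ (mem_oddPrimesLE.1 hp).2.1
  rcases eq_or_ne n 0 with rfl | h0
  · rw [weight_zero, Nat.card_eq_zero]
    exact .inl ⟨fun s ↦ prod_ne_zero_iff.2
      (fun (p : oddPrimesLE X) _ ↦ pow_ne_zero _ (hS p p.2).ne_zero) s.2.2⟩
  rw [weight, if_neg h0]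
  by_cases h2 : 2 ∣ n
  · have : n.factorization.prod (localWeight r) = 0 := by
      refine prod_eq_zero (i := 2) ?_ ?_
      · rw [Nat.support_factorization]
        exact Nat.mem_primeFactors.2 ⟨Nat.prime_two, h2, h0⟩
      · rw [localWeight, if_neg (Nat.prime_two.factorization_pos_of_dvd h0 h2).ne', if_pos rfl]
    rw [this, Nat.card_eq_zero]
    refine .inl ⟨fun s ↦ ?_⟩
    rw [← s.2.2] at h2
    obtain ⟨p, -, hp⟩ := (Nat.prime_two.prime.dvd_finsetProd_iff _).1 h2
    have hp' := mem_oddPrimesLE.1 p.2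
    exact hp'.2.2 ((Nat.prime_dvd_prime_iff_eq Nat.prime_two hp'.2.1).1
      (Nat.prime_two.dvd_of_dvd_pow hp)).symm
  · refine card_pi_prod_pow_eq hS P d (localWeight r) (fun p ↦ localWeight_zero ..) hw h0 fun p hp ↦ ?_
    have hp' := Nat.mem_primeFactors.1 hp
    refine mem_oddPrimesLE.2 ⟨(Nat.le_of_dvd (Nat.pos_of_ne_zero h0) hp'.2.1).trans hn, hp'.1, ?_⟩
    rintro rfl
    exact h2 hp'.2.1

theorem card_pi_prod_pow_le {X Y : ℝ} {r : ℕ} {T : oddPrimesLE X → Type} [∀ p, Finite (T p)]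
    (P : ∀ p, T p → Prop) (d : ∀ p, T p → ℕ)
    (hw : ∀ p e, Nat.card {x : T p // P p x ∧ d p x = e} = localWeight r p e)
    (hY : 0 ≤ Y) (hYX : Y ≤ X) :
    (Nat.card {s : ∀ p, T p // (∀ p, P p (s p)) ∧ ((∏ p : oddPrimesLE X, (p : ℕ) ^ d p (s p) : ℕ) : ℝ) ≤ Y} : ℝ) =
      weightSum r Y := by
  have e : {s : ∀ p, T p // (∀ p, P p (s p)) ∧ ((∏ p : oddPrimesLE X, (p : ℕ) ^ d p (s p) : ℕ) : ℝ) ≤ Y} ≃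
      Σ n : range (⌊Y⌋₊ + 1),
        {s : ∀ p, T p // (∀ p, P p (s p)) ∧ ∏ p : oddPrimesLE X, (p : ℕ) ^ d p (s p) = n} :=
    { toFun := fun s ↦ ⟨⟨_, mem_range.2 (Nat.lt_succ_of_le (Nat.le_floor s.2.2))⟩,
        ⟨s.1, s.2.1, rfl⟩⟩
      invFun := fun s ↦ ⟨s.2.1, s.2.2.1, by
        rw [s.2.2.2]
        exact (Nat.le_floor_iff hY).1 (Nat.lt_succ_iff.1 (mem_range.1 s.1.2))⟩
      left_inv := fun s ↦ rfl
      right_inv := by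
        rintro ⟨⟨n, hn⟩, s, hs, h⟩
        dsimp only at h
        subst h
        rfl }
  rw [Nat.card_congr e, Nat.card_sigma, weightSum, Nat.cast_sum, ← sum_coe_sort (range _)]
  refine sum_congr rfl fun n _ ↦ ?_
  rw [card_pi_prod_pow_eq_weight P d hw]
  exact (Nat.lt_succ_iff.1 (mem_range.1 n.2)).trans (Nat.floor_le_floor hYX)

theorem card_pi_option_prod_pow_le {X : ℝ} (hX : 0 ≤ X) {r : ℕ}
    {T : Option (oddPrimesLE X) → Type} [∀ o, Finite (T o)]
    (P : ∀ o, T o → Prop) (d : ∀ o, T o → ℕ)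
    (hw : ∀ p e, Nat.card {x : T (some p) // P (some p) x ∧ d (some p) x = e} =
      localWeight r p e) [Fintype {x : T none // P none x}] :
    (Nat.card {t : ∀ o, T o // (∀ o, P o (t o)) ∧
      ((∏ o : Option (oddPrimesLE X), (o.elim 2 (↑) : ℕ) ^ d o (t o) : ℕ) : ℝ) ≤ X} : ℝ) =
      ∑ x : {x : T none // P none x}, weightSum r (X / 2 ^ d none x) := by
  have e : {t : ∀ o, T o // (∀ o, P o (t o)) ∧
      ((∏ o : Option (oddPrimesLE X), (o.elim 2 (↑) : ℕ) ^ d o (t o) : ℕ) : ℝ) ≤ X} ≃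
      Σ x : {x : T none // P none x}, {s : ∀ p, T (some p) // (∀ p, P (some p) (s p)) ∧
        ((∏ p : oddPrimesLE X, (p : ℕ) ^ d (some p) (s p) : ℕ) : ℝ) ≤ X / 2 ^ d none x} :=
    { toFun := fun t ↦ ⟨⟨t.1 none, t.2.1 none⟩, ⟨fun p ↦ t.1 (some p), fun p ↦ t.2.1 (some p), by
        have := t.2.2
        rw [Fintype.prod_option, Nat.cast_mul] at this
        rw [le_div_iff₀' (by positivity)]
        simpa using this⟩⟩
      invFun := fun s ↦ ⟨fun o ↦ o.rec s.1.1 s.2.1, fun o ↦ by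
          cases o
          exacts [s.1.2, s.2.2.1 _], by
        have := s.2.2.2
        rw [le_div_iff₀' (by positivity)] at this
        rw [Fintype.prod_option, Nat.cast_mul]
        simpa using this⟩
      left_inv := fun t ↦ Subtype.ext <| funext fun o ↦ by cases o <;> rfl
      right_inv := fun s ↦ rfl }
  rw [Nat.card_congr e, Nat.card_sigma, Nat.cast_sum]
  refine sum_congr rfl fun x _ ↦ ?_
  exact card_pi_prod_pow_le (fun p ↦ P (some p)) (fun p ↦ d (some p)) hw (by positivity)
    (div_le_self hX (one_le_pow₀ one_le_two))

end TupleCount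

section GlobalCount

noncomputable instance fintypeUnitsCharacters (n : ℕ) [NeZero n] : Fintype ((ZMod n)ˣ →* C₈) :=
  have := DFunLike.finite ((ZMod n)ˣ →* C₈)
  Fintype.ofFinite _

theorem surjective_tupleChar_iff {ι : Type} [Fintype ι] {m : ι → ℕ} [∀ i, NeZero (m i)]
    (hm : Pairwise (onFun Nat.Coprime m))
    (t : Π i, (ZMod (m i))ˣ →* C₈) :
    Surjective (tupleChar t) ↔ ¬ ∀ i, t i ^ 4 = 1 := by
  constructor
  · intro h ht
    obtain ⟨σ, hσ⟩ := h (Multiplicative.ofAdd 1)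
    have h4 : tupleChar t σ ^ 4 = 1 := by
      rw [tupleChar_apply, ← prod_pow]
      exact prod_eq_one fun i _ ↦ DFunLike.congr_fun (ht i) _
    rw [hσ] at h4
    exact absurd (congrArg Multiplicative.toAdd h4) (by decide : (4 : ℕ) • (1 : ZMod 8) ≠ 0)
  · intro h
    obtain ⟨i, hi⟩ := not_forall.1 h
    obtain ⟨u, hu⟩ : ∃ u, t i u ^ 4 ≠ 1 := by
      by_contra! h'
      exact hi (MonoidHom.ext h')
    obtain ⟨σ, hσ⟩ := exists_forall_cycChar_eq hm (Pi.mulSingle i u)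
    have hσu : tupleChar t σ = t i u := by
      rw [tupleChar_apply_of_forall_ne t i fun j hj ↦ by rw [hσ, Pi.mulSingle_eq_of_ne hj], hσ,
        Pi.mulSingle_eq_same]
    have key : ∀ y : ZMod 8, (4 : ℕ) • y ≠ 0 → ∀ z : ZMod 8, (z * y).val • y = z := by decide
    refine fun z ↦ ⟨σ ^ (z.toAdd * (t i u).toAdd).val, ?_⟩
    rw [map_pow, hσu]
    exact key _ hu z.toAdd

variable {X : ℝ}

/-- The moduli of the local characters of the cyclic octic fields of discriminant at most `X`. -/
def localModulus (o : Option (oddPrimesLE X)) : ℕ := o.elim 32 (↑)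

/-- The residue characteristics of the moduli `localModulus`. -/
def localPrime (o : Option (oddPrimesLE X)) : ℕ := o.elim 2 (↑)

instance neZero_localModulus (o : Option (oddPrimesLE X)) : NeZero (localModulus o) := by
  refine ⟨?_⟩
  cases o with
  | none => exact (by norm_num : (32 : ℕ) ≠ 0)
  | some p => exact (mem_oddPrimesLE.1 p.2).2.1.ne_zero

theorem prime_localPrime (o : Option (oddPrimesLE X)) : (localPrime o).Prime := by
  cases o with
  | none => exact Nat.prime_two
  | some p => exact (mem_oddPrimesLE.1 p.2).2.1

theorem localPrime_injective : Injective (localPrime (X := X)) := by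
  rintro (_ | p) (_ | q) h
  · rfl
  · exact absurd h.symm (mem_oddPrimesLE.1 q.2).2.2
  · exact absurd h (mem_oddPrimesLE.1 p.2).2.2
  · exact congrArg some (Subtype.ext h)

theorem eq_localPrime (o : Option (oddPrimesLE X)) (ℓ : ℕ) (hℓ : ℓ.Prime)
    (h : ℓ ∣ localModulus o) : ℓ = localPrime o := by
  cases o with
  | none =>
    exact (Nat.prime_dvd_prime_iff_eq hℓ Nat.prime_two).1
      (hℓ.dvd_of_dvd_pow (show ℓ ∣ 2 ^ 5 from h))
  | some p => exact (Nat.prime_dvd_prime_iff_eq hℓ (mem_oddPrimesLE.1 p.2).2.1).1 h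

theorem pairwise_coprime_localModulus :
    Pairwise (onFun Nat.Coprime (localModulus (X := X))) := fun o o' h ↦
  Nat.Coprime.symm <| Nat.coprime_of_dvd fun ℓ hℓ h1 h2 ↦ h <| localPrime_injective <|
    (eq_localPrime o ℓ hℓ h2).symm.trans (eq_localPrime o' ℓ hℓ h1)

theorem prod_localModulus :
    ∏ o : Option (oddPrimesLE X), localModulus o = 32 * ∏ p ∈ oddPrimesLE X, p := by
  rw [Fintype.prod_option, ← prod_coe_sort (oddPrimesLE X) fun p ↦ p]
  rfl

theorem le_cycField_of_absDisc_le [NeZero (∏ o : Option (oddPrimesLE X), localModulus o)]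
    (L : IntermediateField ℚ Ω) (hf : FiniteDimensional ℚ L)
    (hg : IsGalois ℚ L) (e : Nonempty ((L ≃ₐ[ℚ] L) ≃* C₈))
    (hX : (absDisc L : ℝ) ≤ X) :
    L ≤ cycField (∏ o : Option (oddPrimesLE X), localModulus o) := by
  obtain ⟨e⟩ := e
  have h0 : NeZero (32 * ∏ p ∈ oddPrimesLE X, p) := ⟨prod_localModulus (X := X) ▸ NeZero.ne _⟩
  have hcyc : cycField (∏ o : Option (oddPrimesLE X), localModulus o) =
      cycField (32 * ∏ p ∈ oddPrimesLE X, p) := by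
    congr 1
    exact prod_localModulus
  rw [hcyc]
  refine le_cycField_of_forall_not_dvd_absDisc (fun σ τ ↦ e.injective ?_)
    (fun σ ↦ e.injective ?_) (fun p hp ↦ (mem_oddPrimesLE.1 hp).2) fun q hq hq2 hqS hqd ↦ hqS ?_
  · rw [map_mul, map_mul, mul_comm]
  · rw [map_pow, map_one]
    exact (by decide : ∀ y : ZMod 8, (8 : ℕ) • y = 0) _
  · exact mem_oddPrimesLE.2
      ⟨(Nat.le_of_dvd (Nat.pos_of_ne_zero (absDisc_ne_zero L)) hqd).trans (Nat.le_floor hX),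
        hq, hq2⟩

/-- The product of the local contributions of a family of characters to the discriminant. -/
noncomputable def tupleDisc
    (t : Π o : Option (oddPrimesLE X), (ZMod (localModulus o))ˣ →* C₈) : ℕ :=
  ∏ o, localPrime o ^ discExp (localPrime o) (t o)

theorem absDisc_charField_of_surjective
    (t : Π o : Option (oddPrimesLE X), (ZMod (localModulus o))ˣ →* C₈)
    (ht : Surjective (tupleChar t)) :
    absDisc (charField (tupleChar t)) = tupleDisc t := by
  refine absDisc_charField_tupleChar prime_localPrime localPrime_injective eq_localPrime t ?_
  rw [range_eq_top.2 ht, card_top, Nat.card_congr Multiplicative.toAdd, Nat.card_zmod]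

theorem card_surjective_tuples (X : ℝ) : Nat.card {t : Π o : Option (oddPrimesLE X),
      (ZMod (localModulus o))ˣ →* C₈ // ¬ (∀ o, t o ^ 4 = 1) ∧ (tupleDisc t : ℝ) ≤ X} =
    4 * galoisCount C₈ X := by
  have : NeZero (∏ o : Option (oddPrimesLE X), localModulus o) :=
    ⟨prod_ne_zero_iff.2 fun i _ ↦ NeZero.ne _⟩
  rw [← card_surjective_characters le_cycField_of_absDisc_le]
  have hs := surjective_tupleChar_iff (pairwise_coprime_localModulus (X := X))
  refine Nat.card_congr (Equiv.ofBijective (fun t ↦ ⟨tupleChar t.1, (hs _).2 t.2.1,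
    ker_cycChar_prod_le_ker_tupleChar _, ?_⟩) ⟨fun t t' h ↦ ?_, ?_⟩)
  · rw [absDisc_charField_of_surjective _ ((hs _).2 t.2.1)]
    exact t.2.2
  · exact Subtype.ext (tupleChar_injective pairwise_coprime_localModulus (congrArg Subtype.val h))
  · rintro ⟨θ, h1, h2, h3⟩
    obtain ⟨t, rfl⟩ := exists_tupleChar_eq pairwise_coprime_localModulus h2
    rw [absDisc_charField_of_surjective _ h1] at h3
    exact ⟨⟨t, (hs t).1 h1, h3⟩, rfl⟩

theorem card_tuples_eq {r k : ℕ} (hk : (r = 0 ∧ k = 4) ∨ (r = 4 ∧ k = 8)) (hX : 0 ≤ X) :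
    (Nat.card {t : Π o : Option (oddPrimesLE X), (ZMod (localModulus o))ˣ →* C₈ //
        (∀ o, t o ^ k = 1) ∧ (tupleDisc t : ℝ) ≤ X} : ℝ) =
    ∑ χ : {χ : (ZMod 32)ˣ →* C₈ // χ ^ k = 1}, weightSum r (X / 2 ^ discExp 2 χ.1) :=
  card_pi_option_prod_pow_le hX (fun _ χ ↦ χ ^ k = 1) (fun o χ ↦ discExp (localPrime o) χ)
    fun p e ↦ @card_characters_discExp_eq r k p hk (neZero_localModulus (some p))
      (mem_oddPrimesLE.1 p.2).2.1 (mem_oddPrimesLE.1 p.2).2.2 e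

theorem four_mul_galoisCount_eq (hX : 0 ≤ X) : 4 * (galoisCount C₈ X : ℝ) =
      ∑ χ : {χ : (ZMod 32)ˣ →* C₈ // χ ^ 8 = 1}, weightSum 4 (X / 2 ^ discExp 2 χ.1) -
      ∑ χ : {χ : (ZMod 32)ˣ →* C₈ // χ ^ 4 = 1}, weightSum 0 (X / 2 ^ discExp 2 χ.1) := by
  rw [← card_tuples_eq (.inl ⟨rfl, rfl⟩) hX, ← card_tuples_eq (.inr ⟨rfl, rfl⟩) hX, eq_sub_iff_add_eq]
  have h := card_surjective_tuples X
  have h8 : ∀ t : Π o : Option (oddPrimesLE X),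
      (ZMod (localModulus o))ˣ →* C₈, ∀ o, t o ^ 8 = 1 := fun t o ↦
    MonoidHom.ext fun u ↦ (by decide : ∀ y : ZMod 8, (8 : ℕ) • y = 0) _
  have := Set.ncard_sdiff_add_ncard_of_subset (s := {t : Π o : Option (oddPrimesLE X),
      (ZMod (localModulus o))ˣ →* C₈ | (∀ o, t o ^ 4 = 1) ∧ (tupleDisc t : ℝ) ≤ X})
    (t := {t | (∀ o, t o ^ 8 = 1) ∧ (tupleDisc t : ℝ) ≤ X})
    (fun t ht ↦ ⟨h8 t, ht.2⟩) (Set.toFinite _)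
  rw [← Nat.card_coe_set_eq, ← Nat.card_coe_set_eq, ← Nat.card_coe_set_eq] at this
  have h' : ∀ t : Π o : Option (oddPrimesLE X), (ZMod (localModulus o))ˣ →* C₈,
      t ∈ {t | (∀ o, t o ^ 8 = 1) ∧ (tupleDisc t : ℝ) ≤ X} \
        {t | (∀ o, t o ^ 4 = 1) ∧ (tupleDisc t : ℝ) ≤ X} ↔
      ¬ (∀ o, t o ^ 4 = 1) ∧ (tupleDisc t : ℝ) ≤ X := fun t ↦ by
    have := h8 t
    simp only [Set.mem_sdiff, Set.mem_ofPred_eq]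
    tauto
  rw [Nat.card_congr (Equiv.subtypeEquivRight h'), h] at this
  exact_mod_cast this

end GlobalCount

section Assembly

/-- The error term of the asymptotic expansion. -/
noncomputable def rootError (X : ℝ) : ℝ := X ^ ((1 : ℝ) / 8) * log X ^ 8

/-- The function `f` agrees with `c₄ X ^ (1/4) + c₆ X ^ (1/6) + c₇ X ^ (1/7)` up to
`O(X ^ (1/8) (log X) ^ 8)`. -/
def HasRootExpansion (f : ℝ → ℝ) (c₄ c₆ c₇ : ℝ) : Prop :=
  (fun X : ℝ ↦ f X - c₄ * X ^ ((1 : ℝ) / 4) - c₆ * X ^ ((1 : ℝ) / 6) - c₇ * X ^ ((1 : ℝ) / 7))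
    =O[atTop] rootError

theorem HasRootExpansion.sub {f g : ℝ → ℝ} {a b c a' b' c' : ℝ} (hf : HasRootExpansion f a b c)
    (hg : HasRootExpansion g a' b' c') :
    HasRootExpansion (fun X ↦ f X - g X) (a - a') (b - b') (c - c') :=
  (Asymptotics.IsBigO.sub hf hg).congr_left fun X ↦ by ring

theorem HasRootExpansion.const_mul {f : ℝ → ℝ} {a b c : ℝ} (hf : HasRootExpansion f a b c)
    (k : ℝ) : HasRootExpansion (fun X ↦ k * f X) (k * a) (k * b) (k * c) :=
  (Asymptotics.IsBigO.const_mul_left hf k).congr_left fun X ↦ by ring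

theorem HasRootExpansion.sum {ι : Type*} (s : Finset ι) {f : ι → ℝ → ℝ} {a b c : ι → ℝ}
    (hf : ∀ i ∈ s, HasRootExpansion (f i) (a i) (b i) (c i)) :
    HasRootExpansion (fun X ↦ ∑ i ∈ s, f i X) (∑ i ∈ s, a i) (∑ i ∈ s, b i) (∑ i ∈ s, c i) :=
  (Asymptotics.IsBigO.sum hf).congr_left fun X ↦ by
    simp only [Finset.sum_apply, sum_sub_distrib, sum_mul]

theorem HasRootExpansion.congr {f g : ℝ → ℝ} {a b c : ℝ} (hf : HasRootExpansion f a b c)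
    (h : f =ᶠ[atTop] g) : HasRootExpansion g a b c :=
  Asymptotics.IsBigO.congr' hf (h.mono fun X hX ↦ by simp only [hX]) .rfl

theorem rootError_div_isBigO {k : ℝ} (hk : 1 ≤ k) :
    (fun X ↦ rootError (X / k)) =O[atTop] rootError := by
  refine .of_bound 1 ?_
  filter_upwards [eventually_ge_atTop k] with X hX
  have h1 : 1 ≤ X / k := (one_le_div (by linarith)).2 hX
  have h2 : X / k ≤ X := div_le_self (by linarith) hk
  have h0 : 0 ≤ X ^ ((1 : ℝ) / 8) := rpow_nonneg (by linarith) _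
  have h3 : 0 ≤ log (X / k) := log_nonneg h1
  have h4 : log (X / k) ≤ log X := log_le_log (by linarith) h2
  rw [one_mul, rootError, rootError, norm_of_nonneg (by positivity),
    norm_of_nonneg (mul_nonneg h0 (by positivity))]
  gcongr

theorem HasRootExpansion.div {f : ℝ → ℝ} {a b c : ℝ} (hf : HasRootExpansion f a b c) {k : ℝ}
    (hk : 1 ≤ k) :
    HasRootExpansion (fun X ↦ f (X / k)) (a / k ^ ((1 : ℝ) / 4)) (b / k ^ ((1 : ℝ) / 6))
      (c / k ^ ((1 : ℝ) / 7)) := by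
  have h := (Asymptotics.IsBigO.comp_tendsto hf
    (Filter.tendsto_id.atTop_div_const (by linarith : 0 < k))).trans (rootError_div_isBigO hk)
  refine h.congr' ?_ .rfl
  filter_upwards [eventually_ge_atTop 0] with X hX
  have hk0 : 0 ≤ k := by linarith
  simp only [comp, id, div_rpow hX hk0]
  ring

theorem exists_hasRootExpansion_weightSum {r : ℕ} (hr : r = 0 ∨ r = 4) :
    ∃ c₄ c₆ c₇ : ℝ, HasRootExpansion (weightSum r) c₄ c₆ c₇ := by
  obtain ⟨a, b, c, C, Z, h⟩ := exists_abs_weightSum_sub_le hr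
  refine ⟨a, b, c, .of_bound C ?_⟩
  filter_upwards [eventually_ge_atTop Z, eventually_ge_atTop 1] with X hX h1
  have h0 : 0 ≤ rootError X :=
    mul_nonneg (rpow_nonneg (by linarith) _) (pow_nonneg (log_nonneg h1) _)
  rw [norm_of_nonneg h0, norm_eq_abs]
  refine le_of_eq_of_le (congrArg _ ?_) (h X hX)
  ring

theorem four_mul_galoisCount_eq_sum_filter {X : ℝ} (hX : 0 ≤ X) : 4 * (galoisCount C₈ X : ℝ) =
      ∑ χ : (ZMod 32)ˣ →* C₈ with χ ^ 8 = 1, weightSum 4 (X / 2 ^ discExp 2 χ) -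
      ∑ χ : (ZMod 32)ˣ →* C₈ with χ ^ 4 = 1, weightSum 0 (X / 2 ^ discExp 2 χ) := by
  rw [four_mul_galoisCount_eq hX]
  congr 1 <;> exact (sum_subtype _ (fun _ ↦ mem_filter_univ _)
    fun χ ↦ weightSum _ (X / 2 ^ discExp 2 χ)).symm

theorem exists_hasRootExpansion_galoisCount : ∃ c₄ c₆ c₇ : ℝ, HasRootExpansion
    (fun X ↦ (galoisCount C₈ X : ℝ)) c₄ c₆ c₇ := by
  obtain ⟨a, b, c, h⟩ := exists_hasRootExpansion_weightSum (.inr rfl)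
  obtain ⟨a', b', c', h'⟩ := exists_hasRootExpansion_weightSum (.inl rfl)
  have key := ((HasRootExpansion.sum {χ : (ZMod 32)ˣ →* C₈ | χ ^ 8 = 1} fun χ _ ↦
      h.div (one_le_pow₀ one_le_two (n := discExp 2 χ))).sub
    (HasRootExpansion.sum {χ : (ZMod 32)ˣ →* C₈ | χ ^ 4 = 1} fun χ _ ↦
      h'.div (one_le_pow₀ one_le_two (n := discExp 2 χ)))).const_mul (1 / 4)
  refine ⟨_, _, _, key.congr ?_⟩
  filter_upwards [eventually_ge_atTop 0] with X hX
  rw [← four_mul_galoisCount_eq_sum_filter hX]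
  ring

theorem weight_zero_le_weight_four (n : ℕ) : weight 0 n ≤ weight 4 n := by
  unfold weight
  split_ifs
  · exact le_rfl
  · refine prod_le_prod' fun p _ ↦ ?_
    unfold localWeight
    split_ifs <;> omega

theorem weightSum_zero_le_weightSum_four (X : ℝ) : weightSum 0 X ≤ weightSum 4 X :=
  sum_le_sum fun n _ ↦ Nat.cast_le.2 (weight_zero_le_weight_four n)

theorem weightSum_nonneg (r : ℕ) (X : ℝ) : 0 ≤ weightSum r X :=
  sum_nonneg fun _ _ ↦ Nat.cast_nonneg _

theorem weightSum_sub_le_four_mul_galoisCount {X : ℝ} (hX : 0 ≤ X) :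
    weightSum 4 X - weightSum 0 X ≤ 4 * (galoisCount C₈ X : ℝ) := by
  rw [four_mul_galoisCount_eq_sum_filter hX]
  have h1 : ∑ χ : (ZMod 32)ˣ →* C₈ with χ ^ 4 = 1, weightSum 4 (X / 2 ^ discExp 2 χ) ≤
      ∑ χ : (ZMod 32)ˣ →* C₈ with χ ^ 8 = 1, weightSum 4 (X / 2 ^ discExp 2 χ) := by
    refine sum_le_sum_of_subset_of_nonneg (fun χ hχ ↦ ?_) fun _ _ _ ↦ weightSum_nonneg _ _
    rw [mem_filter] at hχ ⊢
    exact ⟨hχ.1, by rw [pow_mul χ 4 2, hχ.2, one_pow]⟩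
  refine le_trans ?_ (sub_le_sub_right h1 _)
  rw [← sum_sub_distrib]
  have h2 := single_le_sum (s := {χ : (ZMod 32)ˣ →* C₈ | χ ^ 4 = 1})
    (f := fun χ ↦ weightSum 4 (X / 2 ^ discExp 2 χ) - weightSum 0 (X / 2 ^ discExp 2 χ))
    (fun χ _ ↦ sub_nonneg.2 (weightSum_zero_le_weightSum_four _)) (a := 1) (by simp)
  simpa [discExp_one] using h2

theorem primeCounting_sub_two_le (n : ℕ) :
    (n.primeCounting : ℝ) - 2 ≤ weightSum 4 (17 ^ 7 * n ^ 4) - weightSum 0 (17 ^ 7 * n ^ 4) := by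
  have hfl : ⌊(17 : ℝ) ^ 7 * n ^ 4⌋₊ = 17 ^ 7 * n ^ 4 := by
    rw [show (17 : ℝ) ^ 7 * n ^ 4 = ((17 ^ 7 * n ^ 4 : ℕ) : ℝ) by push_cast; ring,
      Nat.floor_natCast]
  rw [weightSum, weightSum, hfl, ← sum_sub_distrib]
  obtain ⟨Q, hQ, hQmem⟩ : ∃ Q : Finset ℕ, n.primeCounting = Q.card ∧ ∀ p, p ∈ Q ↔ p ≤ n ∧ p.Prime :=
    ⟨_, Nat.count_eq_card_filter_range _ _, fun p ↦ by simp⟩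
  let P : Finset ℕ := (Q.erase 2).erase 17
  have hmem : ∀ p ∈ P, p ≠ 17 ∧ p ≠ 2 ∧ p ≤ n ∧ p.Prime := fun p hp ↦ by
    simpa only [P, mem_erase, hQmem] using hp
  have hP : n.primeCounting ≤ P.card + 2 := by
    have h1 : Q.card - 1 ≤ (Q.erase 2).card := pred_card_le_card_erase
    have h2 : (Q.erase 2).card - 1 ≤ P.card := pred_card_le_card_erase
    omega
  have hinj : Injective fun p : ℕ ↦ 17 ^ 7 * p ^ 4 := fun p q h ↦
    Nat.pow_left_injective (by norm_num : (4 : ℕ) ≠ 0) (Nat.eq_of_mul_eq_mul_left (by norm_num) h)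
  calc (n.primeCounting : ℝ) - 2 ≤ P.card := by
        have : (n.primeCounting : ℝ) ≤ P.card + 2 := mod_cast hP
        linarith
    _ = ∑ m ∈ P.map ⟨_, hinj⟩, (1 : ℝ) := by simp
    _ ≤ ∑ m ∈ P.map ⟨_, hinj⟩, ((weight 4 m : ℝ) - weight 0 m) := by
        refine sum_le_sum fun m hm ↦ ?_
        obtain ⟨p, hp, rfl⟩ := Finset.mem_map.1 hm
        obtain ⟨h17, h2, hp⟩ := hmem p hp
        have hcop : (17 ^ 7).Coprime (p ^ 4) := Nat.Coprime.pow _ _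
          ((Nat.coprime_primes (by norm_num) hp.2).2 h17.symm)
        have h17p : Nat.Prime 17 := by norm_num
        dsimp only [Embedding.coeFn_mk]
        rw [weight_mul_of_coprime _ hcop, weight_mul_of_coprime _ hcop, weight_prime_pow _ h17p,
          weight_prime_pow _ h17p, weight_prime_pow _ hp.2, weight_prime_pow _ hp.2]
        simp [localWeight, h2]
    _ ≤ _ := by
        refine sum_le_sum_of_subset_of_nonneg (fun m hm ↦ ?_) fun m _ _ ↦
          sub_nonneg.2 (Nat.cast_le.2 (weight_zero_le_weight_four m))
        obtain ⟨p, hp, rfl⟩ := Finset.mem_map.1 hm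
        exact mem_range.2 (Nat.lt_succ_of_le (Nat.mul_le_mul_left _
          (Nat.pow_le_pow_left (hmem p hp).2.2.1 4)))

end Assembly

section Positivity

theorem rootError_isBigO_rpow : rootError =O[atTop] fun X : ℝ ↦ X ^ ((1 : ℝ) / 6) := by
  have h := (Asymptotics.isBigO_refl (fun X : ℝ ↦ X ^ ((1 : ℝ) / 8)) atTop).mul
    (isLittleO_log_rpow_rpow_atTop 8 (by norm_num : (0 : ℝ) < 1 / 24)).isBigO
  refine h.congr' ?_ ?_
  · exact .of_forall fun X ↦ by simp only [rootError, ← rpow_natCast]; norm_num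
  · filter_upwards [eventually_gt_atTop 0] with X hX
    rw [← rpow_add hX]
    norm_num

theorem HasRootExpansion.sub_isBigO_rpow {f : ℝ → ℝ} {a b c : ℝ} (hf : HasRootExpansion f a b c) :
    (fun X ↦ f X - a * X ^ ((1 : ℝ) / 4)) =O[atTop] fun X : ℝ ↦ X ^ ((1 : ℝ) / 6) := by
  have h7 : (fun X : ℝ ↦ X ^ ((1 : ℝ) / 7)) =O[atTop] fun X : ℝ ↦ X ^ ((1 : ℝ) / 6) := by
    refine .of_bound 1 ?_
    filter_upwards [eventually_ge_atTop 1] with X hX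
    rw [one_mul, norm_of_nonneg (by positivity), norm_of_nonneg (by positivity)]
    exact rpow_le_rpow_of_exponent_le hX (by norm_num)
  exact (((hf.trans rootError_isBigO_rpow).add
    ((Asymptotics.isBigO_refl _ _).const_mul_left b)).add (h7.const_mul_left c)).congr_left
    fun X ↦ by ring

theorem not_eventually_primeCounting_sub_two_le (K : ℝ) :
    ¬ ∀ᶠ n : ℕ in atTop, (n.primeCounting : ℝ) - 2 ≤ K * (n : ℝ) ^ ((2 : ℝ) / 3) := by
  intro h
  have hl := (isLittleO_log_rpow_atTop (by norm_num : (0 : ℝ) < 1 / 6)).comp_tendsto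
    tendsto_natCast_atTop_atTop |>.def one_pos
  have ht := (tendsto_rpow_atTop (by norm_num : (0 : ℝ) < 1 / 6)).comp tendsto_natCast_atTop_atTop
  obtain ⟨n, hn, hn2, hlt, hl⟩ := (h.and ((eventually_ge_atTop 2).and
    ((ht.eventually_gt_atTop ((4 + |K|) / log 2)).and hl))).exists
  have hn2' : (2 : ℝ) ≤ n := mod_cast hn2
  have hn0 : (0 : ℝ) < n := by linarith
  have hlog : 0 < log n := log_pos (by linarith)
  have h1 : (1 : ℝ) ≤ (n : ℝ) ^ ((2 : ℝ) / 3) := one_le_rpow (by linarith) (by norm_num)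
  have hge := Chebyshev.pi_ge n
  rw [div_le_iff₀ hlog] at hge
  have hlog1 : log (n + 1) ≤ 2 * log n := by
    rw [← log_rpow hn0]
    refine log_le_log (by linarith) ?_
    rw [rpow_two]
    nlinarith
  have hy : 0 < (n : ℝ) ^ ((1 : ℝ) / 6) := by positivity
  simp only [comp, norm_of_nonneg hlog.le, norm_of_nonneg hy.le, one_mul,
    div_lt_iff₀ (log_pos one_lt_two)] at hl hlt
  have hn' : n * log 2 = (n : ℝ) ^ ((2 : ℝ) / 3) * (n : ℝ) ^ ((1 : ℝ) / 6) *
      ((n : ℝ) ^ ((1 : ℝ) / 6) * log 2) := by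
    rw [← mul_assoc, ← rpow_add hn0, ← rpow_add hn0]
    norm_num
  have hle : (n.primeCounting : ℝ) + 2 ≤ (4 + |K|) * (n : ℝ) ^ ((2 : ℝ) / 3) := by
    nlinarith [le_abs_self K]
  have h2 : n * log 2 ≤ (4 + |K|) * (n : ℝ) ^ ((2 : ℝ) / 3) * (n : ℝ) ^ ((1 : ℝ) / 6) :=
    (by linarith : n * log 2 ≤ (n.primeCounting + 2) * log n).trans (by gcongr)
  linarith [mul_lt_mul_of_pos_left hlt (by positivity :
    0 < (n : ℝ) ^ ((2 : ℝ) / 3) * (n : ℝ) ^ ((1 : ℝ) / 6))]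

theorem HasRootExpansion.galoisCount_pos {a b c : ℝ} (h : HasRootExpansion
    (fun X ↦ (galoisCount C₈ X : ℝ)) a b c) : 0 < a := by
  by_contra! ha
  obtain ⟨K, hK⟩ := h.sub_isBigO_rpow.bound
  have ht : Tendsto (fun n : ℕ ↦ (17 : ℝ) ^ 7 * n ^ 4) atTop atTop :=
    ((Filter.tendsto_pow_atTop (by norm_num : (4 : ℕ) ≠ 0)).comp
      tendsto_natCast_atTop_atTop).const_mul_atTop (by norm_num)
  refine not_eventually_primeCounting_sub_two_le (4 * K * ((17 : ℝ) ^ 7) ^ ((1 : ℝ) / 6)) ?_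
  filter_upwards [ht.eventually hK] with n hn
  have h0 : 0 ≤ (17 : ℝ) ^ 7 * n ^ 4 := by positivity
  have h1 := (primeCounting_sub_two_le n).trans (weightSum_sub_le_four_mul_galoisCount h0)
  have h2 : a * ((17 : ℝ) ^ 7 * n ^ 4) ^ ((1 : ℝ) / 4) ≤ 0 :=
    mul_nonpos_of_nonpos_of_nonneg ha (rpow_nonneg h0 _)
  have h3 := (le_abs_self _).trans hn
  rw [norm_of_nonneg (rpow_nonneg h0 _)] at h3
  have h4 : ((17 : ℝ) ^ 7 * n ^ 4) ^ ((1 : ℝ) / 6) =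
      ((17 : ℝ) ^ 7) ^ ((1 : ℝ) / 6) * (n : ℝ) ^ ((2 : ℝ) / 3) := by
    rw [mul_rpow (by positivity) (by positivity), ← rpow_natCast_mul (Nat.cast_nonneg n) 4 (1 / 6)]
    congr 2
    norm_num
  rw [h4] at h3
  rw [mul_assoc, mul_assoc]
  exact h1.trans (mul_le_mul_of_nonneg_left ((le_sub_self_iff _).2 h2 |>.trans h3) (by norm_num))

end Positivity

end FieldCounting

/-- asymptotic count of C₈-extensions of ℚ with square-root saving error. -/
theorem count_C8_fields : ∃ c₄ c₆ c₇ : ℝ, 0 < c₄ ∧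
      (fun X : ℝ => (galoisCount (Multiplicative (ZMod 8)) X : ℝ)
          - c₄ * X ^ ((1:ℝ)/4) - c₆ * X ^ ((1:ℝ)/6) - c₇ * X ^ ((1:ℝ)/7))
        =O[Filter.atTop] fun X : ℝ => X ^ ((1:ℝ)/8) * Real.log X ^ 8 := by
  obtain ⟨a, b, c, h⟩ := exists_hasRootExpansion_galoisCount
  exact ⟨a, b, c, h.galoisCount_pos, h⟩
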